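/- Let (Ω,σ) be a bounded one-sided NTA pair of mixed dimension in ℝ^n with n ≥ 3, let a > 0 satisfy a·σ(∂Ω) ≥ diam(Ω)^{n−2}, let G_R be a Robin Green function for the Laplacian on (Ω,σ) with parameter a, and let G_D be a Dirichlet Green function for the Laplacian on Ω. Let C₀ ≥ 1. Then there is a constant C > 1, depending only on C₀ and the geometric constants (but not on a), such that for all X, Y ∈ Ω with X ≠ Y and all points Q_X, Q_Y ∈ ∂Ω with |Q_X − X| = δ(X) and |Q_Y − Y| = δ(Y): if a^{−1} ≤ C₀ δ(X)^{2−n} σ(B(Q_X, δ(X))) and a^{−1} ≤ C₀ δ(Y)^{2−n} σ(B(Q_Y, δ(Y))), then G_D(X,Y) ≤ G_R(X,Y) ≤ C·G_D(X,Y). -/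

import Mathlib

open MeasureTheory Metric Set
open scoped RealInnerProductSpace ENNReal NNReal Topology

noncomputable section

/-- The (second-order) Laplacian-based notion of harmonicity: `u` is `C²` near each point of `S`
and its Laplacian (the sum of pure second derivatives) vanishes on `S`. -/
def IsHarmonicOn {n : ℕ} (u : EuclideanSpace ℝ (Fin n) → ℝ)
    (S : Set (EuclideanSpace ℝ (Fin n))) : Prop :=
  ∀ x ∈ S, ContDiffAt ℝ 2 u x ∧
    ∑ i : Fin n, iteratedFDeriv ℝ 2 u x ![EuclideanSpace.single i (1 : ℝ),
      EuclideanSpace.single i (1 : ℝ)] = 0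

/-- One-sided NTA conditions (C1) interior corkscrew and (C2) Harnack chains, with constant `M`. -/
structure IsOneSidedNTA {n : ℕ} (M : ℝ) (Ω : Set (EuclideanSpace ℝ (Fin n))) : Prop where
  isOpen : IsOpen Ω
  M_gt_one : 1 < M
  corkscrew : ∀ Q ∈ frontier Ω, ∀ r : ℝ, 0 < r → r < Metric.diam Ω / 10 →
    ∃ A ∈ Ω ∩ ball Q r, r / M ≤ infDist A (frontier Ω)
  harnack : ∀ r ε : ℝ, ∀ k : ℕ, 0 < r → r < Metric.diam Ω / 10 → 0 < ε → 1 ≤ k →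
    ∀ x ∈ Ω, ∀ y ∈ Ω, dist x y = r → ε ≤ infDist x (frontier Ω) →
      ε ≤ infDist y (frontier Ω) → r ≤ 2 ^ k * ε →
      ∃ (c : ℕ → EuclideanSpace ℝ (Fin n)) (ρ : ℕ → ℝ),
        c 1 = x ∧ c ⌈M * (k : ℝ)⌉₊ = y ∧
        ∀ i : ℕ, 1 ≤ i → i ≤ ⌈M * (k : ℝ)⌉₊ →
          0 < ρ i ∧ ρ i ≤ infDist (c i) (frontier Ω) / 10 ∧ ball (c i) (ρ i) ⊆ Ω ∧
          (i < ⌈M * (k : ℝ)⌉₊ → c (i + 1) ∈ ball (c i) (ρ i))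

/-- A bounded one-sided NTA pair of mixed dimension, with geometric constants `M, Cσ, d, cd`. -/
structure IsMixedPair {n : ℕ} (M Cσ d cd : ℝ) (Ω : Set (EuclideanSpace ℝ (Fin n)))
    (σ : Measure (EuclideanSpace ℝ (Fin n))) : Prop where
  nta : IsOneSidedNTA M Ω
  bounded : Bornology.IsBounded Ω
  nonempty : Ω.Nonempty
  supp_pos : ∀ Q ∈ frontier Ω, ∀ r : ℝ, 0 < r → 0 < σ (ball Q r)
  null_outside : σ (frontier Ω)ᶜ = 0
  finite : σ (frontier Ω) ≠ ⊤
  Cσ_pos : 0 < Cσ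
  doubling : ∀ Q ∈ frontier Ω, ∀ r : ℝ, 0 < r → r < Metric.diam Ω →
    (σ (ball Q (2 * r))).toReal ≤ Cσ * (σ (ball Q r)).toReal
  d_gt : (n : ℝ) - 2 < d
  cd_pos : 0 < cd
  lower_dim : ∀ Q ∈ frontier Ω, ∀ r s : ℝ, 0 < s → s < r → r < Metric.diam Ω →
    cd * (r / s) ^ d * (σ (ball Q s)).toReal ≤ (σ (ball Q r)).toReal

/-- A Robin Green function for the Laplacian on `(Ω, σ)` with parameter `a`. -/
structure IsRobinGreen {n : ℕ} (Ω : Set (EuclideanSpace ℝ (Fin n)))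
    (σ : Measure (EuclideanSpace ℝ (Fin n))) (a : ℝ)
    (G : EuclideanSpace ℝ (Fin n) → EuclideanSpace ℝ (Fin n) → ℝ) : Prop where
  symm : ∀ X ∈ Ω, ∀ Y ∈ Ω, X ≠ Y → G X Y = G Y X
  nonneg : ∀ Y ∈ Ω, ∀ X ∈ closure Ω \ {Y}, 0 ≤ G X Y
  contOn : ∀ Y ∈ Ω, ContinuousOn (fun X => G X Y) (closure Ω \ {Y})
  harmonic : ∀ Y ∈ Ω, IsHarmonicOn (fun X => G X Y) (Ω \ {Y})
  grad_L2 : ∀ Y ∈ Ω, ∀ r : ℝ, 0 < r →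
    IntegrableOn (fun X => ‖gradient (fun Z => G Z Y) X‖ ^ 2) (Ω \ ball Y r) volume
  grad_L1 : ∀ Y ∈ Ω, IntegrableOn (fun X => ‖gradient (fun Z => G Z Y) X‖) Ω volume
  weak : ∀ Y ∈ Ω, ∀ φ : EuclideanSpace ℝ (Fin n) → ℝ,
    ContDiff ℝ (⊤ : ℕ∞) φ → HasCompactSupport φ →
    (∫ X in Ω, ⟪gradient (fun Z => G Z Y) X, gradient φ X⟫) +
      a * ∫ P in frontier Ω, G P Y * φ P ∂σ = φ Y

/-- A Dirichlet Green function for the Laplacian on `Ω`. -/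
structure IsDirichletGreen {n : ℕ} (Ω : Set (EuclideanSpace ℝ (Fin n)))
    (G : EuclideanSpace ℝ (Fin n) → EuclideanSpace ℝ (Fin n) → ℝ) : Prop where
  nonneg : ∀ Y ∈ Ω, ∀ X ∈ closure Ω \ {Y}, 0 ≤ G X Y
  contOn : ∀ Y ∈ Ω, ContinuousOn (fun X => G X Y) (closure Ω \ {Y})
  boundary_zero : ∀ Y ∈ Ω, ∀ Q ∈ frontier Ω, G Q Y = 0
  harmonic : ∀ Y ∈ Ω, IsHarmonicOn (fun X => G X Y) (Ω \ {Y})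
  grad_L2 : ∀ Y ∈ Ω, ∀ r : ℝ, 0 < r →
    IntegrableOn (fun X => ‖gradient (fun Z => G Z Y) X‖ ^ 2) (Ω \ ball Y r) volume
  grad_L1 : ∀ Y ∈ Ω, IntegrableOn (fun X => ‖gradient (fun Z => G Z Y) X‖) Ω volume
  weak : ∀ Y ∈ Ω, ∀ φ : EuclideanSpace ℝ (Fin n) → ℝ,
    ContDiff ℝ (⊤ : ℕ∞) φ → HasCompactSupport φ → tsupport φ ⊆ Ω →
    (∫ X in Ω, ⟪gradient (fun Z => G Z Y) X, gradient φ X⟫) = φ Y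

/-- A solution with pole at `Y` and vanishing Robin condition (parameter `a`). -/
structure IsRobinPoleSolution {n : ℕ} (Ω : Set (EuclideanSpace ℝ (Fin n)))
    (σ : Measure (EuclideanSpace ℝ (Fin n))) (a : ℝ) (Y : EuclideanSpace ℝ (Fin n))
    (u : EuclideanSpace ℝ (Fin n) → ℝ) : Prop where
  contOn : ContinuousOn u (closure Ω \ {Y})
  harmonic : IsHarmonicOn u (Ω \ {Y})
  grad_L2 : ∀ r : ℝ, 0 < r → IntegrableOn (fun X => ‖gradient u X‖ ^ 2) (Ω \ ball Y r) volume
  weak : ∀ φ : EuclideanSpace ℝ (Fin n) → ℝ,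
    ContDiff ℝ (⊤ : ℕ∞) φ → HasCompactSupport φ → Y ∉ tsupport φ →
    (∫ X in Ω, ⟪gradient u X, gradient φ X⟫) + a * ∫ P in frontier Ω, u P * φ P ∂σ = 0

/-- A nonnegative weak solution of the homogeneous Robin problem in `B(Q, ρ)` (parameter `a`). -/
structure IsRobinLocalSolution {n : ℕ} (Ω : Set (EuclideanSpace ℝ (Fin n)))
    (σ : Measure (EuclideanSpace ℝ (Fin n))) (a : ℝ) (Q : EuclideanSpace ℝ (Fin n)) (ρ : ℝ)
    (u : EuclideanSpace ℝ (Fin n) → ℝ) : Prop where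
  nonneg : ∀ X ∈ closure Ω ∩ ball Q ρ, 0 ≤ u X
  contOn : ContinuousOn u (closure Ω ∩ ball Q ρ)
  harmonic : IsHarmonicOn u (Ω ∩ ball Q ρ)
  grad_L2 : ∀ ρ' : ℝ, ρ' < ρ →
    IntegrableOn (fun X => ‖gradient u X‖ ^ 2) (Ω ∩ ball Q ρ') volume
  weak : ∀ φ : EuclideanSpace ℝ (Fin n) → ℝ,
    ContDiff ℝ (⊤ : ℕ∞) φ → HasCompactSupport φ → tsupport φ ⊆ ball Q ρ →
    (∫ X in Ω, ⟪gradient u X, gradient φ X⟫) + a * ∫ P in frontier Ω, u P * φ P ∂σ = 0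

/-- A flux solution: `u = 1` on `cl B(0,1)`, harmonic outside, homogeneous Robin condition. -/
structure IsFluxSolution {n : ℕ} (Ω : Set (EuclideanSpace ℝ (Fin n)))
    (σ : Measure (EuclideanSpace ℝ (Fin n))) (a : ℝ)
    (u : EuclideanSpace ℝ (Fin n) → ℝ) : Prop where
  contOn : ContinuousOn u (closure Ω)
  one_on_ball : ∀ X ∈ closedBall (0 : EuclideanSpace ℝ (Fin n)) 1, u X = 1
  harmonic : IsHarmonicOn u (Ω \ closedBall (0 : EuclideanSpace ℝ (Fin n)) 1)
  grad_L2 : IntegrableOn (fun X => ‖gradient u X‖ ^ 2)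
    (Ω \ closedBall (0 : EuclideanSpace ℝ (Fin n)) 1) volume
  weak : ∀ φ : EuclideanSpace ℝ (Fin n) → ℝ,
    ContDiff ℝ (⊤ : ℕ∞) φ → HasCompactSupport φ →
    tsupport φ ⊆ (closedBall (0 : EuclideanSpace ℝ (Fin n)) 1)ᶜ →
    (∫ X in Ω, ⟪gradient u X, gradient φ X⟫) + a * ∫ P in frontier Ω, u P * φ P ∂σ = 0

/-- A Dirichlet harmonic measure for `Ω`: a family of probability measures on `∂Ω` solving the
Dirichlet problem for continuous boundary data. -/
structure IsDirichletHM {n : ℕ} (Ω : Set (EuclideanSpace ℝ (Fin n)))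
    (ω : EuclideanSpace ℝ (Fin n) → Measure (EuclideanSpace ℝ (Fin n))) : Prop where
  prob : ∀ X ∈ Ω, IsProbabilityMeasure (ω X)
  supported : ∀ X ∈ Ω, (ω X) (frontier Ω)ᶜ = 0
  solves : ∀ f : EuclideanSpace ℝ (Fin n) → ℝ, ContinuousOn f (frontier Ω) →
    ∃ h : EuclideanSpace ℝ (Fin n) → ℝ,
      ContinuousOn h (closure Ω) ∧ IsHarmonicOn h Ω ∧
      (∀ X ∈ Ω, h X = ∫ y, f y ∂(ω X)) ∧ (∀ Q ∈ frontier Ω, h Q = f Q)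

end

abbrev EE (n : ℕ) := EuclideanSpace ℝ (Fin n)

section main

open ENNReal (ofReal ofReal_add ofReal_div_of_pos ofReal_inv_of_pos ofReal_le_ofReal ofReal_le_ofReal_iff ofReal_le_ofReal_iff' ofReal_lt_top ofReal_mul ofReal_ne_top ofReal_ofNat ofReal_one ofReal_pow ofReal_toReal ofReal_tsum_of_nonneg)
open Real (norm_of_nonneg norm_eq_abs smoothTransition rpow_natCast)

variable {n : ℕ} {M Cσ d cd a : ℝ} {Ω : Set (EE n)} {σ : Measure (EE n)} {Y : EE n} {u : EE n → ℝ}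

local notation "E" => EE n
local notation "SE" => Set (EE n)
local notation "ME" => Measure (EE n)
local notation "oE" => (0 : EE n)
local notation "CD" => ContDiff ℝ (⊤ : ℕ∞)
local notation "nm" => (n - 2)
local notation "pz" => (by positivity)
local notation "oz" => (by omega)
local notation "lz" => (by linarith)
local notation "nz" => (by norm_num)
local notation "sz" => (by simp)

noncomputable section

def psk (y : E) : ℝ := expNegInvGlue (1 - ‖y‖ ^ 2)
def etk (y : E) : ℝ := 2 * (((1 - ‖y‖ ^ 2)⁻¹) ^ 2 * expNegInvGlue (1 - ‖y‖ ^ 2))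

theorem nsq_contDiff : CD (fun y : E => 1 - ‖y‖ ^ 2) :=
  contDiff_const.sub (contDiff_norm_sq ℝ)

theorem psk_contDiff : CD (psk : E → ℝ) :=
  expNegInvGlue.contDiff.comp nsq_contDiff

theorem etk_contDiff : CD (etk : E → ℝ) := by
  have h := (expNegInvGlue.contDiff_polynomial_eval_inv_mul (n := (⊤ : ℕ∞)) (Polynomial.X ^ 2)).comp
    (nsq_contDiff (n := n))
  have h2 := contDiff_const (c := (2 : ℝ)) |>.mul h
  have h3 : (etk : E → ℝ) = fun y => 2 * ((fun x => Polynomial.eval x⁻¹ (Polynomial.X ^ 2) *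
      expNegInvGlue x) ∘ fun y : E => 1 - ‖y‖ ^ 2) y := by
    funext y; simp [etk, Function.comp]
  rw [h3]; exact h2

theorem psk_nonneg (y : E) : 0 ≤ psk y := expNegInvGlue.nonneg _
theorem etk_nonneg (y : E) : 0 ≤ etk y :=
  mul_nonneg zero_le_two (mul_nonneg (sq_nonneg _) (expNegInvGlue.nonneg _))
theorem psk_zero {y : E} (h : 1 ≤ ‖y‖) : psk y = 0 :=
  expNegInvGlue.zero_of_nonpos (by nlinarith)
theorem etk_zero {y : E} (h : 1 ≤ ‖y‖) : etk y = 0 := by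
  rw [etk, expNegInvGlue.zero_of_nonpos (by nlinarith)]; simp
theorem psk_pos {y : E} (h : ‖y‖ < 1) : 0 < psk y :=
  expNegInvGlue.pos_of_pos (by nlinarith [norm_nonneg y])
theorem etk_pos {y : E} (h : ‖y‖ < 1) : 0 < etk y := by
  have h1 : 0 < 1 - ‖y‖ ^ 2 := by nlinarith [norm_nonneg y]
  have := expNegInvGlue.pos_of_pos h1
  unfold etk; positivity
theorem psk_fderiv (y : E) :
    HasFDerivAt (psk : E → ℝ) (-(etk y) • innerSL ℝ y) y := by
  have h := expNegInvGlue.hasDerivAt_polynomial_eval_inv_mul 1 (1 - ‖y‖ ^ 2)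
  simp only [Polynomial.eval_one, one_mul, Polynomial.derivative_one, sub_zero, mul_one,
    Polynomial.eval_pow, Polynomial.eval_X] at h
  have h2 : HasFDerivAt (fun y : E => 1 - ‖y‖ ^ 2) (-(2 • innerSL ℝ y)) y := by
    simpa using (hasStrictFDerivAt_norm_sq y).hasFDerivAt.const_sub 1
  have h3 := h.comp_hasFDerivAt y h2
  refine (show HasFDerivAt psk _ y from h3).congr_fderiv ?_
  ext v
  simp [etk]; ring

theorem etk_tsupport : tsupport (etk : E → ℝ) ⊆ closedBall 0 1 :=
  closure_minimal (fun y hy => by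
    by_contra h; exact hy (etk_zero (by simpa using (not_le.1 (by simpa using h)).le))) isClosed_closedBall
theorem etk_compact : HasCompactSupport (etk : E → ℝ) :=
  (isCompact_closedBall _ _).of_isClosed_subset (isClosed_tsupport _) etk_tsupport
theorem etk_integrable : Integrable (etk : E → ℝ) :=
  etk_contDiff.continuous.integrable_of_hasCompactSupport etk_compact

variable (n) in
def ceta : ℝ := ∫ y : E, etk y

variable (n) in
theorem ceta_pos : 0 < ceta n := by
  refine (integral_pos_iff_support_of_nonneg etk_nonneg etk_integrable).2 ?_
  refine lt_of_lt_of_le (measure_ball_pos volume oE one_pos) (measure_mono fun y hy => ?_)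
  exact (etk_pos (by simpa using hy)).ne'

variable (n) in
theorem etk_bdd : ∃ B : ℝ, 0 < B ∧ ∀ y : E, etk y ≤ B := by
  obtain ⟨B, hB⟩ := etk_contDiff.continuous.bounded_above_of_compact_support (etk_compact (n := n))
  exact ⟨max B 1, by positivity, fun y => (le_abs_self _).trans ((hB y).trans (le_max_left _ _))⟩

variable (n) in
theorem etk_lower : ∃ b : ℝ, 0 < b ∧ ∀ y : E, ‖y‖ ≤ 1 / 2 → b ≤ etk y := by
  obtain ⟨y, hy, h⟩ := (isCompact_closedBall oE (1 / 2)).exists_isMinOn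
    ⟨0, by simp⟩ etk_contDiff.continuous.continuousOn
  refine ⟨etk y, etk_pos ?_, fun z hz => h (by simpa using hz)⟩
  have : ‖y‖ ≤ 1 / 2 := by simpa using hy
  linarith

variable (n) in
theorem psk_lower : ∃ b : ℝ, 0 < b ∧ ∀ y : E, ‖y‖ ≤ 1 / 2 → b ≤ psk y := by
  obtain ⟨y, hy, h⟩ := (isCompact_closedBall oE (1 / 2)).exists_isMinOn
    ⟨0, by simp⟩ psk_contDiff.continuous.continuousOn
  refine ⟨psk y, psk_pos ?_, fun z hz => h (by simpa using hz)⟩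
  have : ‖y‖ ≤ 1 / 2 := by simpa using hy
  linarith

variable (n) in
theorem etk_lip : ∃ L : ℝ≥0, LipschitzWith L (etk : E → ℝ) :=
  ContDiff.lipschitzWith_of_hasCompactSupport (𝕂 := ℝ) etk_compact etk_contDiff sz

theorem lint_aff (f : E → ℝ≥0∞) (x : E) {r : ℝ} (hr : 0 < r) :
    ∫⁻ y, f (x + r • y) = ofReal ((r ^ n)⁻¹) * ∫⁻ z, f z := by
  have h1 : ∫⁻ y : E, f (x + r • y) = ∫⁻ y, f (x + y) ∂(Measure.map (fun y : E => r • y) volume) :=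
    ((measurableEmbedding_const_smul₀ hr.ne').lintegral_map (fun y => f (x + y))).symm
  rw [h1, Measure.map_addHaar_smul _ hr.ne', lintegral_smul_measure, lintegral_add_left_eq_self,
    finrank_euclideanSpace_fin, abs_of_pos pz, smul_eq_mul]

theorem int_aff (f : E → ℝ) (x : E) {r : ℝ} (hr : 0 < r) :
    ∫ y, f (x + r • y) = (r ^ n)⁻¹ * ∫ z, f z := by
  rw [Measure.integral_comp_smul volume (fun y => f (x + y)) r, integral_add_left_eq_self,
    finrank_euclideanSpace_fin, abs_of_pos pz, smul_eq_mul]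

theorem integrable_aff (f : E → ℝ) (x : E) {r : ℝ} (hr : 0 < r) :
    Integrable (fun y => f (x + r • y)) ↔ Integrable f := by
  rw [integrable_comp_smul_iff volume (fun y => f (x + y)) hr.ne']
  exact ⟨fun h => by simpa using h.comp_add_left (-x), fun h => h.comp_add_left x⟩

theorem grad_meas (g : E → ℝ) : Measurable (gradient g) :=
  (InnerProductSpace.toDual ℝ E).symm.continuous.measurable.comp (measurable_fderiv ℝ g)

theorem grad_inner (g : E → ℝ) (x v : E) : ⟪gradient g x, v⟫ = fderiv ℝ g x v := by
  rw [gradient, InnerProductSpace.toDual_symm_apply]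

theorem grad_norm (g : E → ℝ) (x : E) : ‖gradient g x‖ = ‖fderiv ℝ g x‖ := by
  rw [gradient, LinearIsometryEquiv.norm_map]

structure Wk (U : SE) (Y : E) (κ : ℝ) (g : E → ℝ) : Prop where
  op : IsOpen U
  c1 : ∀ x ∈ U, x ≠ Y → ContDiffAt ℝ 1 g x
  l1 : IntegrableOn (fun z => ‖gradient g z‖) U
  wk : ∀ φ : E → ℝ, CD φ → HasCompactSupport φ → tsupport φ ⊆ U →
    ∫ z in U, ⟪gradient g z, gradient φ z⟫ = κ * φ Y

theorem line_null (hn : 2 ≤ n) (w : E) : volume {y : E | ∃ r : ℝ, y = r • w} = 0 := by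
  have : {y : E | ∃ r : ℝ, y = r • w} = (Submodule.span ℝ {w} : SE) := by
    ext y; simp [Submodule.mem_span_singleton, eq_comm]
  rw [this]
  refine Measure.addHaar_submodule _ _ fun h => ?_
  have h1 := finrank_span_le_card (R := ℝ) ({w} : SE)
  rw [h, finrank_top, finrank_euclideanSpace_fin] at h1
  simp at h1
  omega
end

theorem mvt_step3 {U : SE} {Y : E} {κ : ℝ} {g : E → ℝ}
    (h : Wk U Y κ g) {x : E} {r : ℝ} (hr : 0 < r) (hU : closedBall x r ⊆ U) :
    ∫ y, ⟪gradient g (x + r • y), y⟫ * etk y = -(κ * (r * (r ^ n)⁻¹ * psk (r⁻¹ • (Y - x)))) := by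
  have hsm : CD (fun z : E => r⁻¹ • (z - x)) :=
    by fun_prop
  have hsup : tsupport (fun z : E => psk (r⁻¹ • (z - x))) ⊆ closedBall x r := by
    refine closure_minimal (fun z hz => ?_) isClosed_closedBall
    by_contra hc
    refine hz (psk_zero ?_)
    rw [mem_closedBall, not_le, dist_eq_norm] at hc
    rw [norm_smul, norm_inv, norm_of_nonneg hr.le, ← div_eq_inv_mul, le_div_iff₀ hr]
    linarith
  have hw := h.wk (fun z => psk (r⁻¹ • (z - x))) (psk_contDiff.comp hsm)
    ((isCompact_closedBall x r).of_isClosed_subset (isClosed_tsupport _) hsup) (hsup.trans hU)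
  have hg : ∀ z, gradient (fun z : E => psk (r⁻¹ • (z - x))) z =
      -(r⁻¹ * etk (r⁻¹ • (z - x))) • (r⁻¹ • (z - x)) := by
    intro z
    have h1 : HasFDerivAt (fun z : E => r⁻¹ • (z - x)) (r⁻¹ • ContinuousLinearMap.id ℝ E) z := by
      exact ((hasFDerivAt_id z).sub_const x).const_smul r⁻¹
    have h2 := (psk_fderiv (r⁻¹ • (z - x))).comp z h1
    refine ext_inner_right ℝ fun v => ?_
    rw [grad_inner, show (fun z : E => psk (r⁻¹ • (z - x))) = psk ∘ (fun z : E => r⁻¹ • (z - x)) from rfl,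
      h2.fderiv]
    simp [inner_smul_left, inner_sub_left]; ring
  set F : E → ℝ := fun z => ⟪gradient g z, r⁻¹ • (z - x)⟫ * etk (r⁻¹ • (z - x)) with hF
  have e1 : ∀ z, ⟪gradient g z, gradient (fun z : E => psk (r⁻¹ • (z - x))) z⟫ = -r⁻¹ * F z := by
    intro z; rw [hg z, hF, inner_smul_right]; ring
  have e2 : ∫ z in U, F z = ∫ z, F z := by
    refine setIntegral_eq_integral_of_forall_compl_eq_zero fun z hz => ?_
    have : etk (r⁻¹ • (z - x)) = 0 := by
      refine etk_zero ?_
      have hc : r < dist z x := by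
        by_contra hc; exact hz (hU (by simpa using hc))
      rw [dist_eq_norm] at hc
      rw [norm_smul, norm_inv, norm_of_nonneg hr.le, ← div_eq_inv_mul, le_div_iff₀ hr]
      linarith
    simp [hF, this]
  simp_rw [e1, integral_const_mul, e2] at hw
  have e3 : ∀ y : E, ⟪gradient g (x + r • y), y⟫ * etk y = F (x + r • y) := by
    intro y
    have : r⁻¹ • (x + r • y - x) = y := by simp [smul_smul, inv_mul_cancel₀ hr.ne']
    simp only [hF, this]
  simp_rw [e3]
  rw [int_aff F x hr]
  have : ∫ z, F z = -(r * (κ * psk (r⁻¹ • (Y - x)))) := by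
    rw [← hw]; field_simp
  rw [this]; ring

theorem mvt_step2 {U : SE} {Y : E} {κ : ℝ} {g : E → ℝ}
    (h : Wk U Y κ g) {x : E} (hxY : x ≠ Y) {R : ℝ} (hR : 0 < R) (hU : closedBall x R ⊆ U) :
    Integrable (Function.uncurry fun (r : ℝ) (y : E) => ⟪gradient g (x + r • y), y⟫ * etk y)
      ((volume.restrict (Ioc 0 R)).prod volume) := by
  have hmg : Measurable fun p : ℝ × E => gradient g (x + p.1 • p.2) :=
    (grad_meas g).comp (by fun_prop)
  have hm : Measurable (Function.uncurry fun (r : ℝ) (y : E) => ⟪gradient g (x + r • y), y⟫ * etk y) :=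
    (hmg.inner measurable_snd).mul (etk_contDiff.continuous.measurable.comp measurable_snd)
  refine ⟨hm.aestronglyMeasurable, ?_⟩
  rw [hasFiniteIntegral_iff_enorm, lintegral_prod _ hm.enorm.aemeasurable]
  obtain ⟨B, hB0, hB⟩ := etk_bdd n
  have hpt : ∀ r : ℝ, ∀ y : E, ‖⟪gradient g (x + r • y), y⟫ * etk y‖ₑ ≤
      ofReal B * (ball oE 1).indicator (fun y => ‖gradient g (x + r • y)‖ₑ) y := by
    intro r y
    by_cases hy : ‖y‖ < 1
    · rw [indicator_of_mem (by simpa using hy), ← ofReal_norm, ← ofReal_norm, ← ofReal_mul hB0.le]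
      refine ofReal_le_ofReal ?_
      rw [norm_mul, norm_of_nonneg (etk_nonneg y), mul_comm]
      refine mul_le_mul (hB y) ?_ (norm_nonneg _) hB0.le
      refine (norm_inner_le_norm _ _).trans ?_
      exact mul_le_of_le_one_right (norm_nonneg _) hy.le
    · simp [etk_zero (not_lt.1 hy)]
  have hxU : x ∈ U := hU (mem_closedBall_self hR.le)
  obtain ⟨r₀, hr₀, K, hK⟩ : ∃ r₀ > 0, ∃ K : ℝ, ∀ z ∈ ball x r₀, ‖gradient g z‖ ≤ K := by
    have hc : ContinuousAt (fderiv ℝ g) x :=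
      ((h.c1 x hxU hxY).fderiv_right (m := 0) nz).continuousAt
    have := hc.norm.eventually (gt_mem_nhds (lt_add_one ‖fderiv ℝ g x‖))
    obtain ⟨r₀, h0, h1⟩ := Metric.eventually_nhds_iff_ball.1 this
    exact ⟨r₀, h0, _, fun z hz => by rw [grad_norm]; exact (h1 z hz).le⟩
  set J := ∫⁻ z in U, ‖gradient g z‖ₑ
  have hJ : J < ⊤ := by
    have := h.l1.2; rw [hasFiniteIntegral_iff_enorm] at this; simpa using this
  have hbd : ∀ r ∈ Ioc 0 R, ∫⁻ y, ‖⟪gradient g (x + r • y), y⟫ * etk y‖ₑ ≤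
      ofReal B * (ofReal K * volume (ball oE 1) + ofReal ((r₀ ^ n)⁻¹) * J) := by
    intro r hr
    refine (lintegral_mono (hpt r)).trans ?_
    rw [lintegral_const_mul' _ _ ofReal_ne_top, lintegral_indicator measurableSet_ball]
    gcongr
    by_cases hrr : r < r₀
    · refine le_trans ?_ le_self_add
      rw [← setLIntegral_const]
      refine setLIntegral_mono measurable_const fun y hy => ?_
      rw [← ofReal_norm]
      refine ofReal_le_ofReal (hK _ ?_)
      have hy1 : ‖y‖ < 1 := by simpa using hy
      simp only [mem_ball, dist_self_add_left, norm_smul, norm_of_nonneg hr.1.le]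
      nlinarith [hr.1, norm_nonneg y]
    · push Not at hrr
      refine le_trans ?_ le_add_self
      have hmi : Measurable ((ball x r).indicator fun z => ‖gradient g z‖ₑ) :=
        (grad_meas g).enorm.indicator measurableSet_ball
      calc ∫⁻ y in ball oE 1, ‖gradient g (x + r • y)‖ₑ
          = ∫⁻ y, (ball x r).indicator (fun z => ‖gradient g z‖ₑ) (x + r • y) := by
            rw [← lintegral_indicator measurableSet_ball]
            congr 1; ext y
            have : y ∈ ball oE 1 ↔ x + r • y ∈ ball x r := by
              simp [norm_smul, abs_of_pos hr.1, hr.1]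
            by_cases hy : y ∈ ball oE 1
            · rw [indicator_of_mem hy, indicator_of_mem (this.1 hy)]
            · rw [indicator_of_notMem hy, indicator_of_notMem (fun hh => hy (this.2 hh))]
        _ = ofReal ((r ^ n)⁻¹) * ∫⁻ z in ball x r, ‖gradient g z‖ₑ := by
            rw [lint_aff _ x hr.1, lintegral_indicator measurableSet_ball]
        _ ≤ _ := by
            gcongr
            refine lintegral_mono_set ?_
            exact (ball_subset_closedBall.trans (closedBall_subset_closedBall hr.2)).trans hU
  refine (setLIntegral_mono measurable_const hbd).trans_lt ?_
  rw [setLIntegral_const]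
  refine ENNReal.mul_lt_top (ENNReal.mul_lt_top ofReal_lt_top (ENNReal.add_lt_top.2 ⟨?_, ?_⟩)) sz
  · exact ENNReal.mul_lt_top ofReal_lt_top measure_ball_lt_top
  · exact ENNReal.mul_lt_top ofReal_lt_top hJ

theorem mvt (hn : 2 ≤ n) {U : SE} {Y : E} {κ : ℝ} {g : E → ℝ}
    (h : Wk U Y κ g) {x : E} (hxY : x ≠ Y) {R : ℝ} (hR : 0 < R) (hU : closedBall x R ⊆ U) :
    Integrable (fun y => g (x + R • y) * etk y) ∧
    IntegrableOn (fun r : ℝ => κ * (r * (r ^ n)⁻¹ * psk (r⁻¹ • (Y - x)))) (Ioc 0 R) ∧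
    ceta n * g x = (∫ y, g (x + R • y) * etk y) +
      ∫ r in Ioc 0 R, κ * (r * (r ^ n)⁻¹ * psk (r⁻¹ • (Y - x))) := by
  have h2 := mvt_step2 h hxY hR hU
  have h1 : ∀ᵐ y : E, ∫ r in Ioc 0 R, ⟪gradient g (x + r • y), y⟫ * etk y =
      (g (x + R • y) - g x) * etk y := by
    filter_upwards [measure_eq_zero_iff_ae_notMem.1 (line_null hn (Y - x))] with y hy
    by_cases hy1 : 1 ≤ ‖y‖
    · simp [etk_zero hy1]
    push Not at hy1
    rw [integral_mul_const]
    congr 1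
    have hin : ∀ r ∈ Icc 0 R, x + r • y ∈ U ∧ x + r • y ≠ Y := by
      intro r hr
      refine ⟨hU ?_, fun hc => hy ?_⟩
      · simp only [mem_closedBall, dist_self_add_left, norm_smul, norm_of_nonneg hr.1]
        nlinarith [hr.1, hr.2, norm_nonneg y]
      · have hr0 : r ≠ 0 := by rintro rfl; exact hxY (by simpa using hc)
        exact ⟨r⁻¹, by rw [← hc]; simp [smul_smul, hr0]⟩
    have hd : ∀ r ∈ Icc 0 R, HasDerivAt (fun r : ℝ => g (x + r • y)) (⟪gradient g (x + r • y), y⟫) r := by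
      intro r hr
      have e1 := ((h.c1 _ (hin r hr).1 (hin r hr).2).differentiableAt nz).hasFDerivAt
      have e2 : HasDerivAt (fun r : ℝ => x + r • y) y r := by
        simpa using ((hasDerivAt_id r).smul_const y).const_add x
      rw [grad_inner]
      exact e1.comp_hasDerivAt r e2
    have hcont : ContinuousOn (fun r : ℝ => ⟪gradient g (x + r • y), y⟫) (Icc 0 R) := by
      intro r hr
      simp_rw [grad_inner]
      have e1 : ContinuousAt (fderiv ℝ g) (x + r • y) :=
        ((h.c1 _ (hin r hr).1 (hin r hr).2).fderiv_right (m := 0) nz).continuousAt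
      have e3 : ContinuousAt (fun r : ℝ => x + r • y) r := by fun_prop
      have e4 : ContinuousAt (fun r : ℝ => fderiv ℝ g (x + r • y)) r :=
        ContinuousAt.comp (f := fun r : ℝ => x + r • y) e1 e3
      exact (e4.clm_apply continuousAt_const).continuousWithinAt
    have := intervalIntegral.integral_eq_sub_of_hasDerivAt (a := 0) (b := R)
      (f := fun r : ℝ => g (x + r • y)) (fun r hr => hd r (by rwa [uIcc_of_le hR.le] at hr))
      (ContinuousOn.intervalIntegrable (by rwa [uIcc_of_le hR.le]))
    rw [intervalIntegral.integral_of_le hR.le] at this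
    simpa using this
  have h3 : ∀ r ∈ Ioc 0 R, ∫ y, ⟪gradient g (x + r • y), y⟫ * etk y =
      -(κ * (r * (r ^ n)⁻¹ * psk (r⁻¹ • (Y - x)))) := fun r hr =>
    mvt_step3 h hr.1 ((closedBall_subset_closedBall hr.2).trans hU)
  have hsw := integral_integral_swap h2
  rw [setIntegral_congr_fun measurableSet_Ioc h3, integral_congr_ae h1] at hsw
  have hI : Integrable fun y => (g (x + R • y) - g x) * etk y :=
    (h2.integral_prod_right).congr h1
  have hI2 : Integrable (fun y => g (x + R • y) * etk y) := by
    refine (hI.add (etk_integrable.const_mul (g x))).congr (Filter.Eventually.of_forall fun y => ?_)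
    simp only [Pi.add_apply]; ring
  refine ⟨hI2, ?_, ?_⟩
  · have := h2.integral_prod_left
    have h5 := (this.congr ((ae_restrict_iff' measurableSet_Ioc).2 (Filter.Eventually.of_forall h3))).neg
    exact h5.congr (Filter.Eventually.of_forall fun r => by simp)
  · have : ∫ y, (g (x + R • y) - g x) * etk y = (∫ y, g (x + R • y) * etk y) - g x * ceta n := by
      simp_rw [sub_mul]
      rw [integral_sub hI2 (etk_integrable.const_mul _), integral_const_mul]; rfl
    rw [this, integral_neg] at hsw
    linarith

theorem pole_zero {w : E} {R : ℝ} (h : R ≤ ‖w‖) (κ : ℝ) :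
    ∫ r in Ioc 0 R, κ * (r * (r ^ n)⁻¹ * psk (r⁻¹ • w)) = 0 := by
  rw [setIntegral_congr_fun (g := fun _ => 0) measurableSet_Ioc]
  · simp
  intro r hr
  have : psk (r⁻¹ • w) = 0 := by
    refine psk_zero ?_
    rw [norm_smul, norm_inv, norm_of_nonneg hr.1.le, ← div_eq_inv_mul, le_div_iff₀ hr.1]
    linarith [hr.2]
  simp [this]

theorem pole_nonneg {w : E} {R κ : ℝ} (hκ : 0 ≤ κ) :
    0 ≤ ∫ r in Ioc 0 R, κ * (r * (r ^ n)⁻¹ * psk (r⁻¹ • w)) := by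
  refine setIntegral_nonneg measurableSet_Ioc fun r hr => ?_
  have := hr.1
  have := psk_nonneg (r⁻¹ • w)
  positivity

variable (n) in
theorem mv_low (hn : 2 ≤ n) : ∃ b : ℝ, 0 < b ∧ ∀ (U : SE) (Y : E) (κ : ℝ) (g : E → ℝ),
    Wk U Y κ g → 0 ≤ κ → (∀ z ∈ U, z ≠ Y → 0 ≤ g z) → ∀ (x : E) (R : ℝ), x ≠ Y → 0 < R →
    closedBall x R ⊆ U →
    ofReal b * ∫⁻ z in ball x (R / 2), ofReal (g z) ≤ ofReal (R ^ n * g x) := by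
  obtain ⟨b, hb, hbl⟩ := etk_lower n
  refine ⟨b * (ceta n)⁻¹, by have := ceta_pos n; positivity, ?_⟩
  intro U Y κ g h hκ hg x R hxY hR hU
  have hc := ceta_pos n
  obtain ⟨h1, -, h2⟩ := mvt hn h hxY hR hU
  have h3 := pole_nonneg (n := n) (w := Y - x) (R := R) hκ
  have hae : 0 ≤ᵐ[volume] fun y => g (x + R • y) * etk y := by
    have : {y : E | x + R • y = Y} ⊆ {R⁻¹ • (Y - x)} := by
      intro y hy; simp only [mem_setOf_eq] at hy; simp [← hy, smul_smul, hR.ne']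
    filter_upwards [measure_eq_zero_iff_ae_notMem.1 (measure_mono_null this (by
      haveI : Nonempty (Fin n) := ⟨⟨0, by omega⟩⟩
      simp))] with y hy
    by_cases h1 : ‖y‖ < 1
    · refine mul_nonneg (hg _ (hU ?_) hy) (etk_nonneg _)
      simp only [mem_closedBall, dist_self_add_left, norm_smul, norm_of_nonneg hR.le]
      nlinarith [norm_nonneg y]
    · simp [etk_zero (not_lt.1 h1)]
  have h4 : ∫⁻ y, ofReal (g (x + R • y) * etk y) ≤ ofReal (ceta n * g x) := by
    rw [← ofReal_integral_eq_lintegral_ofReal h1 hae]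
    exact ofReal_le_ofReal lz
  have h5 : ofReal b * ∫⁻ y, (ball x (R / 2)).indicator (fun z => ofReal (g z)) (x + R • y) ≤
      ∫⁻ y, ofReal (g (x + R • y) * etk y) := by
    rw [← lintegral_const_mul' _ _ ofReal_ne_top]
    refine lintegral_mono_ae ?_
    filter_upwards [hae] with y hy
    by_cases hm : x + R • y ∈ ball x (R / 2)
    · rw [indicator_of_mem hm, ← ofReal_mul hb.le]
      simp only [mem_ball, dist_self_add_left, norm_smul, norm_of_nonneg hR.le] at hm
      have hy2 : ‖y‖ ≤ 1 / 2 := by nlinarith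
      have h6 := hbl y hy2
      refine ofReal_le_ofReal ?_
      rw [mul_comm]
      refine mul_le_mul_of_nonneg_left h6 ?_
      exact nonneg_of_mul_nonneg_left hy (lt_of_lt_of_le hb h6)
    · simp [indicator_of_notMem hm]
  rw [lint_aff _ x hR, lintegral_indicator measurableSet_ball] at h5
  have h6 := h5.trans h4
  calc _ = ofReal ((ceta n)⁻¹ * R ^ n) * (ofReal b * (ofReal (R ^ n)⁻¹ *
        ∫⁻ z in ball x (R / 2), ofReal (g z))) := by
        rw [← mul_assoc, ← mul_assoc, ← ofReal_mul pz, ← ofReal_mul pz]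
        congr 2; field_simp
    _ ≤ ofReal ((ceta n)⁻¹ * R ^ n) * ofReal (ceta n * g x) := by gcongr
    _ = _ := by
        rw [← ofReal_mul pz]; congr 1; field_simp

variable (n) in
theorem mv_up (hn : 2 ≤ n) : ∃ B : ℝ, 0 < B ∧ ∀ (U : SE) (Y : E) (κ : ℝ) (g : E → ℝ),
    Wk U Y κ g → ∀ (x : E) (R : ℝ), x ≠ Y → 0 < R → (κ = 0 ∨ R ≤ dist Y x) →
    closedBall x R ⊆ U →
    ofReal (R ^ n * |g x|) ≤ ofReal B * ∫⁻ z in ball x R, ofReal |g z| := by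
  obtain ⟨B, hB, hBl⟩ := etk_bdd n
  refine ⟨B * (ceta n)⁻¹, by have := ceta_pos n; positivity, ?_⟩
  intro U Y κ g h x R hxY hR hY hU
  have hc := ceta_pos n
  obtain ⟨h1, -, h2⟩ := mvt hn h hxY hR hU
  have h3 : ∫ r in Ioc 0 R, κ * (r * (r ^ n)⁻¹ * psk (r⁻¹ • (Y - x))) = 0 := by
    rcases hY with rfl | hY
    · simp
    · exact pole_zero (by rwa [dist_eq_norm] at hY) κ
  rw [h3, add_zero] at h2
  have h4 : ofReal (ceta n * |g x|) ≤ ofReal B *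
      ∫⁻ y, (ball x R).indicator (fun z => ofReal |g z|) (x + R • y) := by
    have h5 : ofReal (ceta n * |g x|) ≤ ∫⁻ y, ‖g (x + R • y) * etk y‖ₑ := by
      have := enorm_integral_le_lintegral_enorm (μ := volume) (fun y => g (x + R • y) * etk y)
      rw [← h2, ← ofReal_norm, norm_mul, norm_of_nonneg hc.le] at this
      exact this
    refine h5.trans ?_
    rw [← lintegral_const_mul' _ _ ofReal_ne_top]
    refine lintegral_mono fun y => ?_
    by_cases hm : x + R • y ∈ ball x R
    · rw [indicator_of_mem hm, ← ofReal_mul hB.le, ← ofReal_norm, norm_mul, norm_of_nonneg (etk_nonneg _),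
        mul_comm, norm_eq_abs]
      exact ofReal_le_ofReal (mul_le_mul_of_nonneg_right (hBl y) (abs_nonneg _))
    · have : 1 ≤ ‖y‖ := by
        simp only [mem_ball, dist_self_add_left, norm_smul, norm_of_nonneg hR.le] at hm
        by_contra hc; push Not at hc; exact hm (by nlinarith)
      simp [etk_zero this]
  rw [lint_aff _ x hR, lintegral_indicator measurableSet_ball] at h4
  calc _ = ofReal ((ceta n)⁻¹ * R ^ n) * ofReal (ceta n * |g x|) := by
        rw [← ofReal_mul pz]; congr 1; field_simp
    _ ≤ ofReal ((ceta n)⁻¹ * R ^ n) * (ofReal B * (ofReal (R ^ n)⁻¹ *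
        ∫⁻ z in ball x R, ofReal |g z|)) := by gcongr
    _ = _ := by
        rw [← mul_assoc, ← mul_assoc, ← ofReal_mul pz, ← ofReal_mul pz]
        congr 2; field_simp

variable (n) in
theorem harn (hn : 2 ≤ n) : ∃ H : ℝ, 1 ≤ H ∧ ∀ (U : SE) (Y : E) (κ : ℝ) (g : E → ℝ),
    Wk U Y κ g → 0 ≤ κ → (∀ z ∈ U, z ≠ Y → 0 ≤ g z) → ∀ (x x' : E) (R ρ : ℝ), x ≠ Y → x' ≠ Y → 0 < R → 0 < ρ →
    (κ = 0 ∨ ρ ≤ dist Y x') → dist x' x + ρ ≤ R / 2 → closedBall x R ⊆ U → ρ ^ n * g x' ≤ H * (R ^ n * g x) := by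
  obtain ⟨b, hb, hlow⟩ := mv_low n hn
  obtain ⟨B, hB, hup⟩ := mv_up n hn
  refine ⟨max 1 (B / b), le_max_left _ _, ?_⟩
  intro U Y κ g h hκ hg x x' R ρ hx hx' hR hρ hY hd hU
  have hbb : ball x' ρ ⊆ ball x (R / 2) := ball_subset_ball' lz
  have hU' : closedBall x' ρ ⊆ U := (closedBall_subset_closedBall' lz).trans hU
  have h1 := hlow U Y κ g h hκ hg x R hx hR hU
  have h2 := hup U Y κ g h x' ρ hx' hρ hY hU'
  have gx : 0 ≤ g x := hg x (hU (mem_closedBall_self hR.le)) hx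
  have gx' : 0 ≤ g x' := hg x' (hU' (mem_closedBall_self hρ.le)) hx'
  have haeY : ∀ᵐ z : E, z ≠ Y := by
    haveI : Nonempty (Fin n) := ⟨⟨0, by omega⟩⟩
    exact measure_eq_zero_iff_ae_notMem.1 (show volume ({Y} : SE) = 0 by simp)
  have h3 : ∫⁻ z in ball x' ρ, ofReal |g z| ≤ ∫⁻ z in ball x (R / 2), ofReal (g z) := by
    refine le_trans (le_of_eq ?_) (lintegral_mono_set hbb)
    refine setLIntegral_congr_fun_ae measurableSet_ball ?_
    filter_upwards [haeY] with z hz hzb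
    rw [abs_of_nonneg (hg z (hU' (ball_subset_closedBall hzb)) hz)]
  have h4 : ofReal (ρ ^ n * g x') ≤ ofReal (B / b * (R ^ n * g x)) := by
    calc _ ≤ ofReal B * ∫⁻ z in ball x (R / 2), ofReal (g z) := by
          rw [abs_of_nonneg gx'] at h2; exact h2.trans (by gcongr)
      _ = ofReal (B / b) * (ofReal b * ∫⁻ z in ball x (R / 2), ofReal (g z)) := by
          rw [← mul_assoc, ← ofReal_mul pz, div_mul_cancel₀ _ hb.ne']
      _ ≤ _ := by
          rw [ofReal_mul pz]; gcongr
  have h5 := (ofReal_le_ofReal_iff pz).1 h4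
  refine h5.trans (mul_le_mul_of_nonneg_right (le_max_right _ _) pz)

theorem etk_supp {ρ : ℝ} (hρ : 0 < ρ) {z x : E} (h : etk (ρ⁻¹ • (z - x)) ≠ 0) : dist z x < ρ := by
  by_contra hc
  refine h (etk_zero ?_)
  rw [norm_smul, norm_inv, norm_of_nonneg hρ.le, ← div_eq_inv_mul, le_div_iff₀ hρ, ← dist_eq_norm]
  linarith

theorem mvt_conv (hn : 2 ≤ n) {U : SE} {Y : E} {κ : ℝ} {g : E → ℝ}
    (h : Wk U Y κ g) {x : E} (hxY : x ≠ Y) {ρ : ℝ} (hρ : 0 < ρ) (hY : κ = 0 ∨ ρ ≤ dist Y x)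
    (hU : closedBall x ρ ⊆ U) :
    Integrable (fun z => g z * etk (ρ⁻¹ • (z - x))) ∧
    ceta n * g x = (ρ ^ n)⁻¹ * ∫ z, g z * etk (ρ⁻¹ • (z - x)) := by
  obtain ⟨h1, -, h2⟩ := mvt hn h hxY hρ hU
  have h3 : ∫ r in Ioc 0 ρ, κ * (r * (r ^ n)⁻¹ * psk (r⁻¹ • (Y - x))) = 0 := by
    rcases hY with rfl | hY
    · simp
    · exact pole_zero (by rwa [dist_eq_norm] at hY) κ
  have e : (fun y => g (x + ρ • y) * etk y) =
      fun y => (fun z => g z * etk (ρ⁻¹ • (z - x))) (x + ρ • y) := by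
    funext y; simp [smul_smul, inv_mul_cancel₀ hρ.ne']
  rw [h3, add_zero] at h2
  rw [e] at h1 h2
  rw [int_aff (fun z => g z * etk (ρ⁻¹ • (z - x))) x hρ] at h2
  exact ⟨(integrable_aff _ x hρ).1 h1, h2⟩

variable (n) in
theorem grad_bd (hn : 2 ≤ n) : ∃ C : ℝ, 0 < C ∧ ∀ (U : SE) (Y : E) (κ : ℝ) (g : E → ℝ),
    Wk U Y κ g → 0 ≤ κ → (∀ z ∈ U, z ≠ Y → 0 ≤ g z) → ∀ (x : E) (R : ℝ), x ≠ Y → 0 < R →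
    (κ = 0 ∨ R ≤ dist Y x) → closedBall x R ⊆ U → R * ‖gradient g x‖ ≤ C * g x := by
  obtain ⟨b, hb, hlow⟩ := mv_low n hn
  obtain ⟨L, hL⟩ := etk_lip n
  have hc := ceta_pos n
  refine ⟨(L + 1) * 4 * 4 ^ n * b⁻¹ * (ceta n)⁻¹, by positivity, ?_⟩
  intro U Y κ g h hκ hg x R hx hR hY hU
  have gx : 0 ≤ g x := hg x (hU (mem_closedBall_self hR.le)) hx
  have h1 := hlow U Y κ g h hκ hg x R hx hR hU
  have haeY : ∀ᵐ z : E, z ≠ Y := by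
    haveI : Nonempty (Fin n) := ⟨⟨0, by omega⟩⟩
    exact measure_eq_zero_iff_ae_notMem.1 (show volume ({Y} : SE) = 0 by simp)
  set C' : ℝ := (L + 1) * 4 * 4 ^ n * b⁻¹ * (ceta n)⁻¹ * g x / R with hC'
  suffices hs : ‖fderiv ℝ g x‖ ≤ C' by
    rw [grad_norm]
    calc R * ‖fderiv ℝ g x‖ ≤ R * C' := by gcongr
      _ = _ := by rw [hC']; field_simp
  refine norm_fderiv_le_of_lip' ℝ pz ?_
  filter_upwards [ball_mem_nhds x (show 0 < R / 8 by positivity), isOpen_ne.mem_nhds hx] with x' hx' hxY'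
  rw [mem_ball] at hx'
  set ρ := R / 4 with hρ
  have hρ0 : 0 < ρ := by positivity
  have hY1 : κ = 0 ∨ ρ ≤ dist Y x := hY.imp id fun h => by rw [hρ]; linarith
  have hY2 : κ = 0 ∨ ρ ≤ dist Y x' := hY.imp id fun h => by
    rw [hρ]; have := dist_triangle Y x' x; linarith
  obtain ⟨i1, e1⟩ := mvt_conv hn h hx hρ0 hY1 ((closedBall_subset_closedBall (by rw [hρ]; linarith)).trans hU)
  obtain ⟨i2, e2⟩ := mvt_conv hn h hxY' hρ0 hY2
    ((closedBall_subset_closedBall' (by rw [hρ]; linarith)).trans hU)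
  have e3 : ceta n * (g x' - g x) = (ρ ^ n)⁻¹ *
      ∫ z, g z * (etk (ρ⁻¹ • (z - x')) - etk (ρ⁻¹ • (z - x))) := by
    simp_rw [mul_sub]; rw [integral_sub i2 i1, mul_sub, ← e1, ← e2]
  have e4 : ‖∫ z, g z * (etk (ρ⁻¹ • (z - x')) - etk (ρ⁻¹ • (z - x)))‖ₑ ≤
      ofReal ((L + 1) * (dist x' x / ρ)) * ∫⁻ z in ball x (R / 2), ofReal (g z) := by
    refine (enorm_integral_le_lintegral_enorm _).trans ?_
    rw [← lintegral_const_mul' _ _ ofReal_ne_top, ← lintegral_indicator measurableSet_ball]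
    refine lintegral_mono_ae ?_
    filter_upwards [haeY] with z hz
    by_cases hm : z ∈ ball x (R / 2)
    · rw [indicator_of_mem hm]
      have gz : 0 ≤ g z := hg z (hU (ball_subset_closedBall (ball_subset_ball lz hm))) hz
      rw [← ofReal_mul pz, ← ofReal_norm, norm_mul, norm_of_nonneg gz, mul_comm]
      refine ofReal_le_ofReal (mul_le_mul_of_nonneg_right ?_ gz)
      have := hL.dist_le_mul (ρ⁻¹ • (z - x')) (ρ⁻¹ • (z - x))
      rw [dist_eq_norm] at this
      refine this.trans ?_
      have e5 : dist (ρ⁻¹ • (z - x')) (ρ⁻¹ • (z - x)) = dist x' x / ρ := by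
        rw [dist_smul₀, dist_sub_left, norm_inv, norm_of_nonneg hρ0.le]; field_simp
      rw [e5]
      have : 0 ≤ dist x' x / ρ := by positivity
      nlinarith
    · have hz1 : etk (ρ⁻¹ • (z - x')) = 0 := by
        by_contra hcc
        have := etk_supp hρ0 hcc
        rw [mem_ball, not_lt] at hm
        have := dist_triangle z x' x
        rw [hρ] at *; linarith
      have hz2 : etk (ρ⁻¹ • (z - x)) = 0 := by
        by_contra hcc
        have := etk_supp hρ0 hcc
        rw [mem_ball, not_lt] at hm
        rw [hρ] at *; linarith
      simp [hz1, hz2]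
  have e6 : ∫⁻ z in ball x (R / 2), ofReal (g z) ≤ ofReal (b⁻¹ * (R ^ n * g x)) := by
    rw [ofReal_mul pz]
    calc _ = ofReal b⁻¹ * (ofReal b * ∫⁻ z in ball x (R / 2), ofReal (g z)) := by
          rw [← mul_assoc, ← ofReal_mul pz, inv_mul_cancel₀ hb.ne']; simp
      _ ≤ _ := by gcongr
  have e7 : ‖∫ z, g z * (etk (ρ⁻¹ • (z - x')) - etk (ρ⁻¹ • (z - x)))‖ ≤
      (L + 1) * (dist x' x / ρ) * (b⁻¹ * (R ^ n * g x)) := by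
    rw [← ofReal_norm] at e4
    have := e4.trans (mul_le_mul_right e6 _)
    rw [← ofReal_mul pz] at this
    exact (ofReal_le_ofReal_iff pz).1 this
  have e8 : ‖g x' - g x‖ = (ceta n)⁻¹ * ((ρ ^ n)⁻¹ *
      ‖∫ z, g z * (etk (ρ⁻¹ • (z - x')) - etk (ρ⁻¹ • (z - x)))‖) := by
    have : g x' - g x = (ceta n)⁻¹ * (ceta n * (g x' - g x)) := by field_simp
    rw [this, e3, norm_mul, norm_mul, norm_of_nonneg (by positivity : 0 ≤ (ceta n)⁻¹),
      norm_of_nonneg (by positivity : 0 ≤ (ρ ^ n)⁻¹)]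
  rw [e8]
  calc _ ≤ (ceta n)⁻¹ * ((ρ ^ n)⁻¹ * ((L + 1) * (dist x' x / ρ) * (b⁻¹ * (R ^ n * g x)))) := by gcongr
    _ = _ := by rw [hC', hρ, dist_eq_norm, div_pow]; field_simp

theorem smooth_rep (hn : 2 ≤ n) {U : SE} {Y : E} {g : E → ℝ}
    (h : Wk U Y 0 g) (hi : IntegrableOn g U) {τ : ℝ} (hτ : 0 < τ) :
    ∃ G : E → ℝ, CD G ∧ ∀ x, closedBall x τ ⊆ U → x ≠ Y → G x = g x := by
  have hc := ceta_pos n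
  have hsm : CD (fun z : E => etk (τ⁻¹ • z)) := etk_contDiff.comp (by fun_prop)
  have hcs : HasCompactSupport (fun z : E => etk (τ⁻¹ • z)) := by
    refine (isCompact_closedBall oE τ).of_isClosed_subset (isClosed_tsupport _)
      (closure_minimal (fun z hz => ?_) isClosed_closedBall)
    have := etk_supp (x := 0) (z := z) hτ (by simpa using hz)
    exact this.le
  have hli : LocallyIntegrable (U.indicator g) :=
    ((integrable_indicator_iff h.op.measurableSet).2 hi).locallyIntegrable
  refine ⟨fun x => (ceta n)⁻¹ * ((τ ^ n)⁻¹ * (convolution (U.indicator g) (fun z : E => etk (τ⁻¹ • z))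
    (ContinuousLinearMap.mul ℝ ℝ) volume) x), ?_, ?_⟩
  · exact contDiff_const.mul (contDiff_const.mul (hcs.contDiff_convolution_right _ hli hsm))
  · intro x hx hxY
    have h1 := (mvt_conv hn h hxY hτ (Or.inl rfl) hx).2
    have : (convolution (U.indicator g) (fun z : E => etk (τ⁻¹ • z))
      (ContinuousLinearMap.mul ℝ ℝ) volume) x = ∫ z, g z * etk (τ⁻¹ • (z - x)) := by
      rw [convolution_def]
      congr 1; ext z
      have e : etk (τ⁻¹ • (x - z)) = etk (τ⁻¹ • (z - x)) := by
        unfold etk; rw [norm_smul, norm_smul, norm_sub_rev]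
      rw [ContinuousLinearMap.mul_apply', e]
      by_cases hz : z ∈ U
      · rw [indicator_of_mem hz]
      · have : etk (τ⁻¹ • (z - x)) = 0 := by
          by_contra hcc; exact hz (hx (etk_supp hτ hcc).le)
        simp [this]
    show (ceta n)⁻¹ * ((τ ^ n)⁻¹ * _) = g x
    rw [this, ← h1]; field_simp

variable (n) in
theorem pole_lower (hn : 2 ≤ n) : ∃ c : ℝ, 0 < c ∧ ∀ (w : E) (R : ℝ), w ≠ 0 → 4 * ‖w‖ ≤ R →
    IntegrableOn (fun r : ℝ => 1 * (r * (r ^ n)⁻¹ * psk (r⁻¹ • w))) (Ioc 0 R) →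
    c * (‖w‖ ^ nm)⁻¹ ≤ ∫ r in Ioc 0 R, 1 * (r * (r ^ n)⁻¹ * psk (r⁻¹ • w)) := by
  obtain ⟨b, hb, hbl⟩ := psk_lower n
  refine ⟨2 * 2 * (4 ^ n)⁻¹ * b, by positivity, ?_⟩
  intro w R hw hR hi
  set ρ := ‖w‖ with hρ
  have hρ0 : 0 < ρ := norm_pos_iff.2 hw
  have hsub : Ioc (2 * ρ) (4 * ρ) ⊆ Ioc 0 R := fun r hr => ⟨by linarith [hr.1], by linarith [hr.2]⟩
  have h1 : ∫ r in Ioc (2 * ρ) (4 * ρ), 1 * (r * (r ^ n)⁻¹ * psk (r⁻¹ • w)) ≤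
      ∫ r in Ioc 0 R, 1 * (r * (r ^ n)⁻¹ * psk (r⁻¹ • w)) := by
    refine setIntegral_mono_set hi ?_ (Filter.Eventually.of_forall hsub)
    refine (ae_restrict_iff' measurableSet_Ioc).2 (Filter.Eventually.of_forall fun r hr => ?_)
    have := hr.1; have := psk_nonneg (r⁻¹ • w)
    simp only [Pi.zero_apply]; positivity
  refine le_trans ?_ h1
  have h2 : ∫ r in Ioc (2 * ρ) (4 * ρ), (2 * ρ * ((4 * ρ) ^ n)⁻¹ * b) ≤
      ∫ r in Ioc (2 * ρ) (4 * ρ), 1 * (r * (r ^ n)⁻¹ * psk (r⁻¹ • w)) := by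
    refine setIntegral_mono_on (integrableOn_const sz) (hi.mono_set hsub) measurableSet_Ioc fun r hr => ?_
    have hr0 : 0 < r := by linarith [hr.1]
    rw [one_mul]
    have := hr.1.le; have := hr.2
    have hpb : b ≤ psk (r⁻¹ • w) := by
      refine hbl _ ?_
      rw [norm_smul, norm_inv, norm_of_nonneg hr0.le, ← div_eq_inv_mul, div_le_iff₀ hr0]; linarith
    gcongr
  refine le_trans (le_of_eq ?_) h2
  have hpow : ρ ^ n = ρ ^ nm * ρ ^ 2 := by rw [← pow_add]; congr 1; omega
  simp only [integral_const, MeasurableSet.univ, measureReal_restrict_apply, univ_inter, Real.volume_real_Ioc, smul_eq_mul]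
  rw [max_eq_left lz, mul_pow, hpow]
  field_simp; ring

noncomputable abbrev dl (Ω : SE) (x : E) : ℝ := infDist x (frontier Ω)

theorem dl_ball {x : E} (hx : x ∈ Ω) : ball x (dl Ω x) ⊆ Ω := by
  intro y hy
  have hpos : 0 < dl Ω x := lt_of_le_of_lt dist_nonneg (mem_ball.1 hy)
  have hdis : ∀ z ∈ ball x (dl Ω x), z ∉ frontier Ω := fun z hz hzf => by
    have := infDist_le_dist_of_mem (x := x) hzf
    rw [mem_ball, dist_comm] at hz
    exact absurd this (not_le.2 hz)
  have hi : ∀ z ∈ ball x (dl Ω x), z ∈ closure Ω → z ∈ interior Ω := fun z hz hzc => by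
    by_contra hcc; exact hdis z hz ⟨hzc, hcc⟩
  refine interior_subset ((convex_ball x (dl Ω x)).isPreconnected.subset_left_of_subset_union isOpen_interior
    (isClosed_closure (s := Ω)).isOpen_compl ?_ ?_ ⟨x, mem_ball_self hpos, hi x (mem_ball_self hpos) (subset_closure hx)⟩ hy)
  · exact disjoint_compl_right.mono_left (interior_subset.trans subset_closure)
  · intro z hz
    by_cases hc : z ∈ closure Ω
    · exact Or.inl (hi z hz hc)
    · exact Or.inr hc

theorem dl_cball {x y : E} (hx : x ∈ Ω) {r : ℝ} (h : dist y x + r < dl Ω x) :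
    closedBall y r ⊆ Ω := (closedBall_subset_ball' (by rw [add_comm]; exact h)).trans (dl_ball hx)

theorem dl_lip (Ω : SE) (x y : E) : dl Ω x ≤ dl Ω y + dist x y := infDist_le_infDist_add_dist

theorem Wk.iint {U : SE} {Y : E} {κ : ℝ} {g : E → ℝ} (h : Wk U Y κ g) {φ : E → ℝ}
    (h1 : CD φ) (h2 : HasCompactSupport φ) :
    IntegrableOn (fun z => ⟪gradient g z, gradient φ z⟫) U := by
  obtain ⟨L, hL⟩ := h1.lipschitzWith_of_hasCompactSupport h2 sz
  refine Integrable.mono' (h.l1.mul_const (L : ℝ)) ((grad_meas g).inner (grad_meas φ)).aestronglyMeasurable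
    (Filter.Eventually.of_forall fun z => ?_)
  refine (norm_inner_le_norm _ _).trans ?_
  gcongr
  rw [grad_norm]
  exact norm_fderiv_le_of_lipschitz ℝ hL

theorem grad_tsupp {φ : E → ℝ} {z : E} (h : z ∉ tsupport φ) : gradient φ z = 0 := by
  rw [← norm_eq_zero, grad_norm, fderiv_of_notMem_tsupport ℝ h, norm_zero]

theorem Wk.restrict {U U' : SE} {Y Y' : E} {κ : ℝ} {g : E → ℝ} (h : Wk U Y κ g)
    (ho : IsOpen U') (hs : U' ⊆ U) (hY : Y ∉ U') : Wk U' Y' 0 g where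
  op := ho
  c1 x hx _ := h.c1 x (hs hx) fun e => hY (e ▸ hx)
  l1 := h.l1.mono_set hs
  wk φ h1 h2 h3 := by
    have := h.wk φ h1 h2 (h3.trans hs)
    rw [image_eq_zero_of_notMem_tsupport fun e => hY (h3 e), mul_zero] at this
    rw [zero_mul, ← this]
    refine (setIntegral_eq_of_subset_of_forall_diff_eq_zero h.op.measurableSet hs fun z hz => ?_).symm
    rw [grad_tsupp fun e => hz.2 (h3 e), inner_zero_right]

theorem grad_lin {f g : E → ℝ} {x : E} (hf : DifferentiableAt ℝ f x) (hg : DifferentiableAt ℝ g x)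
    (s t : ℝ) : gradient (fun z => s * f z + t * g z) x = s • gradient f x + t • gradient g x := by
  have : HasFDerivAt (fun z => s * f z + t * g z) (s • fderiv ℝ f x + t • fderiv ℝ g x) x :=
    (hf.hasFDerivAt.const_mul s).add (hg.hasFDerivAt.const_mul t)
  rw [gradient, this.fderiv]; simp [gradient]

theorem ae_neY (hn : 1 ≤ n) (Y : E) : ∀ᵐ z : E, z ≠ Y := by
  haveI : Nonempty (Fin n) := ⟨⟨0, by omega⟩⟩
  exact measure_eq_zero_iff_ae_notMem.1 (show volume ({Y} : SE) = 0 by simp)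

theorem Wk.lin (hn : 1 ≤ n) {U : SE} {Y : E} {κ κ' : ℝ} {f g : E → ℝ} (hf : Wk U Y κ f)
    (hg : Wk U Y κ' g) (s t : ℝ) : Wk U Y (s * κ + t * κ') (fun z => s * f z + t * g z) := by
  have hae : ∀ᵐ z ∂(volume.restrict U), gradient (fun z => s * f z + t * g z) z =
      s • gradient f z + t • gradient g z := by
    filter_upwards [ae_restrict_mem hf.op.measurableSet, ae_restrict_of_ae (ae_neY hn Y)] with z hz hzY
    exact grad_lin ((hf.c1 z hz hzY).differentiableAt sz) ((hg.c1 z hz hzY).differentiableAt sz) s t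
  refine ⟨hf.op, fun x hx hY => ?_, ?_, fun φ h1 h2 h3 => ?_⟩
  · exact (contDiffAt_const.mul (hf.c1 x hx hY)).add (contDiffAt_const.mul (hg.c1 x hx hY))
  · refine Integrable.mono' ((hf.l1.const_mul |s|).add (hg.l1.const_mul |t|))
      (grad_meas _).norm.aestronglyMeasurable ?_
    filter_upwards [hae] with z hz
    rw [hz, norm_norm]
    refine (norm_add_le _ _).trans (le_of_eq ?_)
    simp [norm_smul]
  · have e : ∫ z in U, ⟪gradient (fun z => s * f z + t * g z) z, gradient φ z⟫ =
        ∫ z in U, (s * ⟪gradient f z, gradient φ z⟫ + t * ⟪gradient g z, gradient φ z⟫) := by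
      refine integral_congr_ae ?_
      filter_upwards [hae] with z hz
      rw [hz, inner_add_left, real_inner_smul_left, real_inner_smul_left]
    rw [e, integral_add ((hf.iint h1 h2).const_mul s) ((hg.iint h1 h2).const_mul t), integral_const_mul,
      integral_const_mul, hf.wk φ h1 h2 h3, hg.wk φ h1 h2 h3]
    ring

theorem maxp (hn : 2 ≤ n) {W : SE} {Y : E} {g : E → ℝ} (hb : Bornology.IsBounded W)
    (h : Wk W Y 0 g) (hY : Y ∉ W) (hc : ContinuousOn g (closure W)) (hf : ∀ x ∈ frontier W, 0 ≤ g x) :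
    ∀ x ∈ closure W, 0 ≤ g x := by
  by_contra! hneg
  obtain ⟨x0, hx0, hx0n⟩ := hneg
  have hK : IsCompact (closure W) := hb.isCompact_closure
  obtain ⟨x1, hx1, hmin⟩ := hK.exists_isMinOn ⟨x0, hx0⟩ hc
  set m := g x1 with hm
  have hm0 : m < 0 := (hmin hx0).trans_lt hx0n
  have hK2 : IsCompact (closure W ∩ g ⁻¹' {m}) :=
    hK.of_isClosed_subset (hc.preimage_isClosed_of_isClosed isClosed_closure isClosed_singleton) inter_subset_left
  obtain ⟨x, hx, hmax⟩ := hK2.exists_isMaxOn ⟨x1, hx1, rfl⟩ continuous_norm.continuousOn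
  have hgx : g x = m := hx.2
  have hxW : x ∈ W := by
    by_contra hcc
    have : x ∈ frontier W := ⟨hx.1, by rwa [h.op.interior_eq]⟩
    linarith [hf x this]
  obtain ⟨R, hR, hRW⟩ := nhds_basis_closedBall.mem_iff.1 (h.op.mem_nhds hxW)
  obtain ⟨i1, -, e1⟩ := mvt hn h (fun e => hY (e ▸ hxW)) hR hRW
  simp only [zero_mul, integral_zero, add_zero] at e1
  have e2 : ∫ y, (g (x + R • y) - m) * etk y = 0 := by
    simp_rw [sub_mul]
    rw [integral_sub i1 (etk_integrable.const_mul m), integral_const_mul, ← e1, hgx]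
    simp [ceta, mul_comm]
  have hin : ∀ y : E, ‖y‖ < 1 → x + R • y ∈ closure W := fun y hy => subset_closure <| hRW <| by
    rw [mem_closedBall, dist_eq_norm, add_sub_cancel_left, norm_smul, norm_of_nonneg hR.le]; nlinarith
  have e3 : (fun y => (g (x + R • y) - m) * etk y) =ᵐ[volume] 0 := by
    refine (integral_eq_zero_iff_of_nonneg (fun y => ?_) ?_).1 e2
    · by_cases hy : ‖y‖ < 1
      · exact mul_nonneg (sub_nonneg.2 (hmin (hin y hy))) (etk_nonneg y)
      · simp [etk_zero (not_lt.1 hy)]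
    · simp_rw [sub_mul]; exact i1.sub (etk_integrable.const_mul m)
  have hopen : IsOpen {y : E | ‖y‖ < 1 ∧ ‖x‖ < ‖x + R • y‖} :=
    (isOpen_lt continuous_norm continuous_const).inter
      (isOpen_lt continuous_const (g := fun y : E => ‖x + R • y‖) (by fun_prop))
  have hne : {y : E | ‖y‖ < 1 ∧ ‖x‖ < ‖x + R • y‖}.Nonempty := by
    obtain ⟨e, he⟩ : ∃ e : E, ‖e‖ = 1 / 2 :=
      ⟨EuclideanSpace.single ⟨0, by omega⟩ (1 / 2), by simp⟩
    have key : ∀ e : E, ‖e‖ = 1 / 2 → 0 ≤ ⟪x, e⟫ → ‖x‖ < ‖x + R • e‖ := by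
      intro e he h0
      have : ‖x + R • e‖ ^ 2 = ‖x‖ ^ 2 + 2 * (R * ⟪x, e⟫) + R ^ 2 / 4 := by
        rw [norm_add_sq_real, real_inner_smul_right, norm_smul, he, norm_of_nonneg hR.le]; ring
      refine lt_of_pow_lt_pow_left₀ 2 (norm_nonneg _) ?_
      rw [this]; nlinarith [mul_nonneg hR.le h0]
    rcases le_total 0 ⟪x, e⟫ with h0 | h0
    · exact ⟨e, by rw [he]; norm_num, key e he h0⟩
    · refine ⟨-e, by rw [norm_neg, he]; norm_num, key (-e) (by rwa [norm_neg]) ?_⟩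
      rw [inner_neg_right]; linarith
  have hpos := hopen.measure_pos volume hne
  obtain ⟨y, hy, hy2⟩ : ∃ y ∈ {y : E | ‖y‖ < 1 ∧ ‖x‖ < ‖x + R • y‖}, (g (x + R • y) - m) * etk y = 0 := by
    by_contra! hcc
    refine hpos.ne' (measure_mono_null (fun y hy => ?_) e3)
    exact hcc y hy
  have : g (x + R • y) = m := by
    have := (mul_eq_zero.1 hy2).resolve_right (etk_pos hy.1).ne'
    linarith
  have := hmax (show x + R • y ∈ closure W ∩ g ⁻¹' {m} from ⟨hin y hy.1, this⟩)
  exact absurd hy.2 (not_lt.2 this)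

variable (n) in
theorem lemS (hn : 2 ≤ n) : ∃ c : ℝ, 0 < c ∧ c ≤ 1 ∧ ∀ (Ω : SE) (Y : E) (κ : ℝ) (u : E → ℝ),
    Wk Ω Y κ u → 0 ≤ κ → (∀ z ∈ Ω, z ≠ Y → 0 ≤ u z) → ∀ (p : ℕ → E) (N : ℕ),
    (∀ i, i ≤ N → p i ∈ Ω ∧ 0 < dl Ω (p i)) → (∀ i, i < N → dist (p (i + 1)) (p i) < dl Ω (p i) / 10) →
    p 0 ≠ Y → (κ = 0 ∨ dl Ω (p 0) / 40 ≤ dist Y (p 0)) →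
    ∀ z ∈ ball (p N) (dl Ω (p N) / 20), z ≠ Y → c ^ (N + 1) * u (p 0) ≤ u z := by
  obtain ⟨b, hb, hlow⟩ := mv_low n hn
  obtain ⟨H, hH, hharn⟩ := harn n hn
  set V := (volume (ball oE 1)).toReal with hV
  have hV0 : 0 < V := ENNReal.toReal_pos (measure_ball_pos _ _ one_pos).ne' measure_ball_lt_top.ne
  set c1 := b * (V * (1 / 10) ^ n) with hc1
  set c2 := (H * 20 ^ n)⁻¹ with hc2
  have hc10 : 0 < c1 := by positivity
  have hc20 : 0 < c2 := by positivity
  refine ⟨min 1 (min c1 c2), by positivity, min_le_left _ _, ?_⟩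
  intro Ω Y κ u h hκ hu p N hp hs h0 hY
  set c := min 1 (min c1 c2) with hc
  have hcpos : 0 < c := by positivity
  have hu0 : 0 ≤ u (p 0) := hu _ (hp 0 (Nat.zero_le _)).1 h0
  induction N with
  | zero =>
    intro z hz hzY
    have hδ := (hp 0 le_rfl).2
    rw [mem_ball] at hz
    have := hharn Ω Y κ u h hκ hu z (p 0) (dl Ω (p 0) / 2) (dl Ω (p 0) / 40) hzY h0 lz lz
      (hY.imp id fun h => by linarith) (by rw [dist_comm]; linarith) (dl_cball (hp 0 le_rfl).1 lz)
    have e1 : u (p 0) ≤ H * 20 ^ n * u z := by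
      have e : (dl Ω (p 0) / 2) ^ n = (dl Ω (p 0) / 40) ^ n * 20 ^ n := by rw [← mul_pow]; ring
      rw [e] at this
      have hq : 0 < (dl Ω (p 0) / 40) ^ n := by positivity
      nlinarith
    have e2 : c ≤ c2 := (min_le_right _ _).trans (min_le_right _ _)
    calc c ^ (0 + 1) * u (p 0) ≤ c2 * u (p 0) := by rw [zero_add, pow_one]; gcongr
      _ ≤ c2 * (H * 20 ^ n * u z) := by gcongr
      _ = u z := by rw [hc2]; field_simp
  | succ N ih =>
    have ih := ih (fun i hi => hp i oz) (fun i hi => hs i oz)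
    intro z hz hzY
    have hδ := (hp N oz).2
    have hd := hs N oz
    have hl := dl_lip Ω (p (N + 1)) (p N)
    rw [mem_ball] at hz
    have hzd : dist z (p N) < dl Ω (p N) * (155 / 1000) := by
      have := dist_triangle z (p (N + 1)) (p N); linarith
    set δ := dl Ω (p N) with hδd
    have hlo := hlow Ω Y κ u h hκ hu z (δ / 2) hzY lz
      (dl_cball (hp N oz).1 (by rw [← hδd]; linarith))
    have hlo2 : ofReal b * ∫⁻ w in ball (p N) (δ / 20), ofReal (c ^ (N + 1) * u (p 0)) ≤
        ofReal ((δ / 2) ^ n * u z) := by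
      refine le_trans ?_ hlo
      gcongr 1
      calc _ ≤ ∫⁻ w in ball (p N) (δ / 20), ofReal (u w) := by
            refine lintegral_mono_ae ?_
            filter_upwards [ae_restrict_mem measurableSet_ball, ae_restrict_of_ae (ae_neY oz Y)] with w hw hwY
            exact ofReal_le_ofReal (ih w hw hwY)
        _ ≤ _ := lintegral_mono_set (ball_subset_ball' (by rw [dist_comm]; linarith))
    rw [lintegral_const, Measure.restrict_apply_univ, Measure.addHaar_ball_of_pos _ _ pz, finrank_euclideanSpace_fin,
      ← ofReal_toReal (measure_ball_lt_top (μ := volume) (x := oE) (r := 1)).ne, ← hV,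
      ← ofReal_mul pz, ← ofReal_mul pz, ← ofReal_mul pz,
      ofReal_le_ofReal_iff'] at hlo2
    have huz : 0 ≤ u z := hu z (dl_ball (hp N oz).1 (by rw [mem_ball, ← hδd]; linarith)) hzY
    have e1 : c1 * (c ^ (N + 1) * u (p 0)) ≤ u z := by
      have hq : 0 < (δ / 2) ^ n := by positivity
      have e : (δ / 20) ^ n = (δ / 2) ^ n * (1 / 10) ^ n := by rw [← mul_pow]; ring
      rcases hlo2 with h1 | h1
      · rw [e] at h1
        refine le_of_mul_le_mul_left (le_trans (le_of_eq ?_) h1) hq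
        rw [hc1]; ring
      · refine le_trans ?_ huz
        refine le_of_mul_le_mul_left (le_trans (le_of_eq ?_) (h1.trans (le_of_eq (mul_zero ((δ / 2) ^ n)).symm))) hq
        rw [hc1, e]; ring
    calc c ^ (N + 1 + 1) * u (p 0) = c * (c ^ (N + 1) * u (p 0)) := by ring
      _ ≤ c1 * (c ^ (N + 1) * u (p 0)) := by gcongr; exact (min_le_right _ _).trans (min_le_left _ _)
      _ ≤ _ := e1

structure Pl (Ω : SE) (Y : E) (u : E → ℝ) : Prop where
  bd : Bornology.IsBounded Ω
  mem : Y ∈ Ω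
  nn : ∀ x ∈ closure Ω, x ≠ Y → 0 ≤ u x
  ct : ContinuousOn u (closure Ω \ {Y})
  wk : Wk Ω Y 1 u
  l2 : ∀ r : ℝ, 0 < r → IntegrableOn (fun x => ‖gradient u x‖ ^ 2) (Ω \ ball Y r)

theorem Pl.nn' {Y : E} {u : E → ℝ} (h : Pl Ω Y u) : ∀ z ∈ Ω, z ≠ Y → 0 ≤ u z :=
  fun z hz hY => h.nn z (subset_closure hz) hY

theorem Pl.robin {a : ℝ} {G : E → E → ℝ} (ho : IsOpen Ω)
    (hb : Bornology.IsBounded Ω) (h : IsRobinGreen Ω σ a G) {Y : E} (hY : Y ∈ Ω) : Pl Ω Y (fun x => G x Y) where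
  bd := hb
  mem := hY
  nn x hx hne := h.nonneg Y hY x ⟨hx, hne⟩
  ct := h.contOn Y hY
  l2 := h.grad_L2 Y hY
  wk := by
    refine ⟨ho, fun x hx hne => ((h.harmonic Y hY x ⟨hx, hne⟩).1).of_le nz, h.grad_L1 Y hY, fun φ h1 h2 h3 => ?_⟩
    have := h.weak Y hY φ h1 h2
    have e0 : ∫ P in frontier Ω, G P Y * φ P ∂σ = 0 := setIntegral_eq_zero_of_forall_eq_zero fun P hP => by
      have : φ P = 0 := image_eq_zero_of_notMem_tsupport fun e => hP.2 (by rw [ho.interior_eq]; exact h3 e)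
      rw [this, mul_zero]
    rw [e0, mul_zero, add_zero] at this
    rw [one_mul]; exact this

theorem Pl.diri {G : E → E → ℝ} (ho : IsOpen Ω)
    (hb : Bornology.IsBounded Ω) (h : IsDirichletGreen Ω G) {Y : E} (hY : Y ∈ Ω) : Pl Ω Y (fun x => G x Y) where
  bd := hb
  mem := hY
  nn x hx hne := h.nonneg Y hY x ⟨hx, hne⟩
  ct := h.contOn Y hY
  l2 := h.grad_L2 Y hY
  wk := ⟨ho, fun x hx hne => ((h.harmonic Y hY x ⟨hx, hne⟩).1).of_le nz, h.grad_L1 Y hY,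
    fun φ h1 h2 h3 => by rw [one_mul]; exact h.weak Y hY φ h1 h2 h3⟩

variable (n) in
theorem pl_low (hn : 2 ≤ n) : ∃ c : ℝ, 0 < c ∧ ∀ (Ω : SE) (Y : E) (u : E → ℝ), Pl Ω Y u →
    ∀ (x : E) (R : ℝ), x ≠ Y → 4 * dist x Y ≤ R → closedBall x R ⊆ Ω → c * (dist x Y ^ nm)⁻¹ ≤ u x := by
  obtain ⟨c, hc, hpl⟩ := pole_lower n hn
  have h0 := ceta_pos n
  refine ⟨c * (ceta n)⁻¹, by positivity, fun Ω Y u h x R hx hR hU => ?_⟩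
  have hR0 : 0 < R := lt_of_lt_of_le (by have := dist_pos.2 hx; linarith) hR
  obtain ⟨-, h2, h3⟩ := mvt hn h.wk hx hR0 hU
  have hn1 : ‖Y - x‖ = dist x Y := by rw [dist_comm, dist_eq_norm]
  have h4 := hpl (Y - x) R (sub_ne_zero.2 hx.symm) (by rw [hn1]; exact hR) h2
  have h5 : 0 ≤ ∫ y, u (x + R • y) * etk y := by
    refine integral_nonneg_of_ae ?_
    filter_upwards [ae_neY oz (R⁻¹ • (Y - x))] with y hy
    by_cases hy1 : ‖y‖ < 1
    · refine mul_nonneg (h.nn' _ (hU ?_) fun e => hy ?_) (etk_nonneg y)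
      · rw [mem_closedBall, dist_eq_norm, add_sub_cancel_left, norm_smul, norm_of_nonneg hR0.le]; nlinarith
      · rw [← e, add_sub_cancel_left, smul_smul, inv_mul_cancel₀ hR0.ne', one_smul]
    · simp [etk_zero (not_lt.1 hy1)]
  rw [hn1] at h4
  calc _ = (ceta n)⁻¹ * (c * (dist x Y ^ nm)⁻¹) := by ring
    _ ≤ (ceta n)⁻¹ * (ceta n * u x) := mul_le_mul_of_nonneg_left lz pz
    _ = u x := by field_simp

theorem loc_rep (hn : 2 ≤ n) {U : SE} {Y : E} {g : E → ℝ}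
    (h : Wk U Y 0 g) {x0 : E} (hx0 : x0 ∈ U) :
    ∃ ρ > 0, ∃ G : E → ℝ, CD G ∧ ∀ x ∈ ball x0 ρ, x ≠ Y → G x = g x := by
  obtain ⟨ρ', hρ', hU⟩ := isOpen_iff.1 h.op x0 hx0
  set ρ := ρ' / 8 with hρ
  have hρ0 : 0 < ρ := by positivity
  obtain ⟨x, hx, hxY⟩ : ∃ x ∈ ball x0 ρ, x ≠ Y := by
    by_contra! hc
    have h1 : volume (ball x0 ρ) ≤ volume ({Y} : SE) := measure_mono fun x hx => hc x hx
    haveI : Nonempty (Fin n) := ⟨⟨0, by omega⟩⟩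
    rw [measure_singleton] at h1
    exact (measure_ball_pos volume x0 hρ0).ne' (le_antisymm h1 bot_le)
  rw [mem_ball] at hx
  obtain ⟨i1, -⟩ := mvt_conv hn h hxY (show 0 < 4 * ρ by positivity) (Or.inl rfl)
    ((closedBall_subset_ball' lz).trans hU)
  obtain ⟨b, hb, hbl⟩ := etk_lower n
  have hlb : ∀ z ∈ ball x0 ρ, b ≤ etk ((4 * ρ)⁻¹ • (z - x)) := fun z hz => hbl _ <| by
    have : dist z x ≤ 2 * ρ := by
      have := dist_triangle_right z x x0; rw [mem_ball] at hz; linarith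
    rw [norm_smul, norm_inv, norm_of_nonneg pz, ← dist_eq_norm, ← div_eq_inv_mul,
      div_le_iff₀ pz]; linarith
  have hi : IntegrableOn g (ball x0 ρ) := by
    have hm : AEStronglyMeasurable (fun z => (g z * etk ((4 * ρ)⁻¹ • (z - x))) * (etk ((4 * ρ)⁻¹ • (z - x)))⁻¹)
        (volume.restrict (ball x0 ρ)) := by
      refine (i1.aestronglyMeasurable.mul ?_).restrict
      have : Continuous fun z : E => etk ((4 * ρ)⁻¹ • (z - x)) := etk_contDiff.continuous.comp (by fun_prop)
      exact this.measurable.inv.aestronglyMeasurable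
    have hm2 : AEStronglyMeasurable g (volume.restrict (ball x0 ρ)) := by
      refine hm.congr ?_
      filter_upwards [ae_restrict_mem measurableSet_ball] with z hz
      have := hlb z hz
      rw [mul_assoc, mul_inv_cancel₀ (hb.trans_le this).ne', mul_one]
    refine Integrable.mono' (i1.norm.const_mul b⁻¹).integrableOn hm2 ?_
    filter_upwards [ae_restrict_mem measurableSet_ball] with z hz
    have := hlb z hz
    rw [norm_mul, norm_of_nonneg (etk_nonneg _)]
    calc ‖g z‖ = b⁻¹ * (‖g z‖ * b) := by field_simp
      _ ≤ _ := by gcongr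
  have hW : Wk (ball x0 ρ) Y 0 g := by
    have hs : ball x0 ρ ⊆ U := (ball_subset_ball lz).trans hU
    refine ⟨isOpen_ball, fun z hz => h.c1 z (hs hz), h.l1.mono_set hs, fun φ h1 h2 h3 => ?_⟩
    rw [zero_mul, ← zero_mul (φ Y), ← h.wk φ h1 h2 (h3.trans hs)]
    refine (setIntegral_eq_of_subset_of_forall_diff_eq_zero h.op.measurableSet hs fun z hz => ?_).symm
    rw [grad_tsupp fun e => hz.2 (h3 e), inner_zero_right]
  obtain ⟨G, hG, hGe⟩ := smooth_rep hn hW hi (show 0 < ρ / 4 by positivity)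
  refine ⟨ρ / 2, by positivity, G, hG, fun z hz hzY => hGe z ?_ hzY⟩
  exact closedBall_subset_ball' (by rw [mem_ball] at hz; linarith)

theorem hfun (hn : 2 ≤ n) {Y : E} {u v : E → ℝ} (hu : Pl Ω Y u) (hv : Pl Ω Y v) :
    ∃ H : E → ℝ, ContinuousOn H (closure Ω) ∧ (∀ x ∈ Ω, ContDiffAt ℝ (⊤ : ℕ∞) H x) ∧ (∀ Y', Wk Ω Y' 0 H) ∧
      ∀ x, x ≠ Y → H x = u x - v x := by
  have hw := hu.wk.lin oz hv.wk 1 (-1)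
  set h := fun z => 1 * u z + -1 * v z with hh
  rw [show (1 : ℝ) * 1 + -1 * 1 = 0 by norm_num] at hw
  obtain ⟨ρ, hρ, G, hG, hGe⟩ := loc_rep hn hw hu.mem
  set H := Function.update h Y (G Y) with hH
  have hHh : ∀ x, x ≠ Y → H x = h x := fun x hx => Function.update_of_ne hx _ _
  have hHG : ∀ x ∈ ball Y ρ, H x = G x := fun x hx => by
    by_cases e : x = Y
    · rw [e, hH, Function.update_self]
    · rw [hHh x e, hGe x hx e]
  have hev : ∀ x, x ≠ Y → H =ᶠ[𝓝 x] h := fun x hx => by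
    filter_upwards [isOpen_ne.mem_nhds hx] with z hz using hHh z hz
  have hsm : ∀ x ∈ Ω, ContDiffAt ℝ (⊤ : ℕ∞) H x := by
    intro x hx
    by_cases e : x = Y
    · subst e
      refine hG.contDiffAt.congr_of_eventuallyEq ?_
      filter_upwards [ball_mem_nhds x hρ] with z hz using hHG z hz
    · obtain ⟨ρ', hρ', G', hG', hGe'⟩ := loc_rep hn hw hx
      refine hG'.contDiffAt.congr_of_eventuallyEq ?_
      filter_upwards [ball_mem_nhds x hρ', isOpen_ne.mem_nhds e] with z hz hzY
      rw [hHh z hzY, hGe' z hz hzY]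
  have hgr : ∀ᵐ z : E, gradient H z = gradient h z := by
    filter_upwards [ae_neY oz Y] with z hz
    rw [gradient, gradient, (hev z hz).fderiv_eq]
  refine ⟨H, ?_, hsm, fun Y' => ⟨hw.op, fun x hx _ => (hsm x hx).of_le sz, ?_, fun φ h1 h2 h3 => ?_⟩,
    fun x hx => by rw [hHh x hx, hh]; ring⟩
  · intro x hx
    by_cases e : x = Y
    · subst e; exact (hsm x hu.mem).continuousAt.continuousWithinAt
    · have hc : ContinuousOn h (closure Ω \ {Y}) := (hu.ct.const_smul (1 : ℝ)).add (hv.ct.const_smul (-1 : ℝ))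
      have h1 : ContinuousWithinAt h (closure Ω) x := by
        refine (hc x ⟨hx, e⟩).mono_of_mem_nhdsWithin ?_
        exact Filter.inter_mem self_mem_nhdsWithin (mem_nhdsWithin_of_mem_nhds (isOpen_ne.mem_nhds e))
      exact h1.congr_of_eventuallyEq (mem_nhdsWithin_of_mem_nhds (hev x e)) (hHh x e)
  · refine hw.l1.congr ?_
    filter_upwards [ae_restrict_of_ae hgr] with z hz
    rw [hz]
  · rw [zero_mul, ← zero_mul (φ Y), ← hw.wk φ h1 h2 h3]
    refine integral_congr_ae ?_
    filter_upwards [ae_restrict_of_ae hgr] with z hz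
    rw [hz]

theorem exists_notMem (hn : 1 ≤ n) (hb : Bornology.IsBounded Ω) : ∃ x, x ∉ Ω := by
  haveI : Nonempty (Fin n) := ⟨⟨0, by omega⟩⟩
  by_contra! h
  exact NormedSpace.unbounded_univ ℝ E (hb.subset fun x _ => h x)

theorem green_le (hn : 2 ≤ n) {Y : E} {u v : E → ℝ} (hu : Pl Ω Y u) (hv : Pl Ω Y v)
    (h0 : ∀ Q ∈ frontier Ω, v Q = 0) {x : E} (hx : x ∈ closure Ω) (hxY : x ≠ Y) : v x ≤ u x := by
  obtain ⟨H, h1, -, h3, h4⟩ := hfun hn hu hv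
  obtain ⟨Z, hZ⟩ := exists_notMem oz hu.bd
  have := maxp hn hu.bd (h3 Z) hZ h1 (fun P hP => by
    have hne : P ≠ Y := fun e => hP.2 (by rw [hu.wk.op.interior_eq, e]; exact hu.mem)
    rw [h4 P hne, h0 P hP, sub_zero]; exact hu.nn P hP.1 hne) x hx
  rw [h4 x hxY] at this; linarith

theorem csq {α : Type*} [MeasurableSpace α] (μ : Measure α) {f : α → ℝ≥0∞} (hf : AEMeasurable f μ) :
    (∫⁻ a, f a ∂μ) ^ 2 ≤ μ univ * ∫⁻ a, f a ^ 2 ∂μ := by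
  have := ENNReal.lintegral_mul_le_Lp_mul_Lq μ (Real.HolderConjugate.two_two) (f := fun _ => 1) (g := f)
    aemeasurable_const hf
  simp only [Pi.mul_apply, one_mul, ENNReal.one_rpow, ENNReal.rpow_two, one_pow, lintegral_one] at this
  calc _ ≤ (μ univ ^ ((1 : ℝ) / 2) * (∫⁻ a, f a ^ 2 ∂μ) ^ ((1 : ℝ) / 2)) ^ 2 := by gcongr
    _ = _ := by
      rw [mul_pow, ← ENNReal.rpow_natCast, ← ENNReal.rpow_natCast, ← ENNReal.rpow_mul, ← ENNReal.rpow_mul]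
      norm_num

noncomputable def gg (φ : E → ℝ) (z : E) : ℝ≥0∞ := ‖fderiv ℝ φ z‖ₑ ^ 2

theorem gg_meas (φ : E → ℝ) : Measurable (gg φ) := (measurable_fderiv ℝ φ).enorm.pow_const 2

noncomputable def dd (φ : E → ℝ) (A : E) (r : ℝ) (A' : E) (r' : ℝ) : ℝ≥0∞ :=
  ∫⁻ y in ball oE 1, ‖φ (A + r • y) - φ (A' + r' • y)‖ₑ ^ 2

theorem seg_pt (ho : IsOpen Ω) {φ : E → ℝ} (hφ : ∀ x ∈ Ω, ContDiffAt ℝ 1 φ x)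
    {a v : E} (h : ∀ τ ∈ Icc (0 : ℝ) 1, a + τ • v ∈ Ω) :
    ‖φ a - φ (a + v)‖ₑ ^ 2 ≤ ofReal (‖v‖ ^ 2) * ∫⁻ τ in Icc (0 : ℝ) 1, gg φ (a + τ • v) := by
  have hφ' : ContinuousOn (fderiv ℝ φ) Ω := fun x hx =>
    ((hφ x hx).fderiv_right (m := 0) sz).continuousAt.continuousWithinAt
  have hl : Continuous fun τ : ℝ => a + τ • v := by fun_prop
  have hcont : ContinuousOn (fun τ : ℝ => fderiv ℝ φ (a + τ • v) v) (uIcc 0 1) := by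
    rw [uIcc_of_le zero_le_one]
    exact (hφ'.comp hl.continuousOn h).clm_apply continuousOn_const
  have h1 : ∫ τ in (0 : ℝ)..1, fderiv ℝ φ (a + τ • v) v = φ (a + (1 : ℝ) • v) - φ (a + (0 : ℝ) • v) := by
    refine intervalIntegral.integral_eq_sub_of_hasDerivAt (f := fun τ : ℝ => φ (a + τ • v)) (fun τ hτ => ?_)
      hcont.intervalIntegrable
    rw [uIcc_of_le zero_le_one] at hτ
    have hd := ((hφ _ (h τ hτ)).differentiableAt sz).hasFDerivAt
    have hv : HasDerivAt (fun τ : ℝ => a + τ • v) v τ := by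
      simpa using ((hasDerivAt_id τ).smul_const v).const_add a
    exact hd.comp_hasDerivAt τ hv
  rw [one_smul, zero_smul, add_zero, intervalIntegral.integral_of_le zero_le_one] at h1
  rw [← enorm_neg, neg_sub, ← h1]
  have hm : Measurable fun τ : ℝ => ‖fderiv ℝ φ (a + τ • v)‖ₑ := (measurable_fderiv ℝ φ).enorm.comp hl.measurable
  calc _ ≤ (∫⁻ τ in Ioc (0 : ℝ) 1, ‖fderiv ℝ φ (a + τ • v) v‖ₑ) ^ 2 := by
        gcongr; exact enorm_integral_le_lintegral_enorm _
    _ ≤ (∫⁻ τ in Icc (0 : ℝ) 1, ‖v‖ₑ * ‖fderiv ℝ φ (a + τ • v)‖ₑ) ^ 2 := by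
        gcongr 1
        refine (lintegral_mono_set Ioc_subset_Icc_self).trans (lintegral_mono fun τ => ?_)
        rw [mul_comm]; exact ContinuousLinearMap.le_opENorm _ _
    _ = ‖v‖ₑ ^ 2 * (∫⁻ τ in Icc (0 : ℝ) 1, ‖fderiv ℝ φ (a + τ • v)‖ₑ) ^ 2 := by
        rw [lintegral_const_mul _ hm, mul_pow]
    _ ≤ ‖v‖ₑ ^ 2 * ∫⁻ τ in Icc (0 : ℝ) 1, gg φ (a + τ • v) := by
        gcongr 1
        refine (csq _ hm.aemeasurable).trans (le_of_eq ?_)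
        simp [gg]
    _ = _ := by rw [← ofReal_norm, ofReal_pow (norm_nonneg _)]

theorem seg (ho : IsOpen Ω) {φ : E → ℝ} (hφ : ∀ x ∈ Ω, ContDiffAt ℝ 1 φ x)
    {A A' : E} {r r' r0 L : ℝ} (hr0 : 0 < r0) (hr : r0 ≤ r) (hr' : r0 ≤ r') {S : SE} (hS : MeasurableSet S)
    (hSΩ : S ⊆ Ω) (hL : dist A A' + |r' - r| ≤ L)
    (h : ∀ τ ∈ Icc (0 : ℝ) 1, ball (A + τ • (A' - A)) (r + τ * (r' - r)) ⊆ S) :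
    dd φ A r A' r' ≤ ofReal (L ^ 2 * (r0 ^ n)⁻¹) * ∫⁻ z in S, gg φ z := by
  have hrt : ∀ τ ∈ Icc (0 : ℝ) 1, r0 ≤ r + τ * (r' - r) := fun τ hτ => by
    nlinarith [hτ.1, hτ.2, mul_nonneg hτ.1 (sub_nonneg.2 hr'), mul_nonneg (sub_nonneg.2 hτ.2) (sub_nonneg.2 hr)]
  have e : ∀ (y : E) (τ : ℝ), A + r • y + τ • ((A' - A) + (r' - r) • y) =
      (A + τ • (A' - A)) + (r + τ * (r' - r)) • y := fun y τ => by
    rw [add_smul, smul_add, smul_smul]; abel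
  have hin : ∀ y ∈ ball oE 1, ∀ τ ∈ Icc (0 : ℝ) 1,
      (A + τ • (A' - A)) + (r + τ * (r' - r)) • y ∈ S := fun y hy τ hτ => h τ hτ <| by
    have := hrt τ hτ
    rw [mem_ball, dist_eq_norm, add_sub_cancel_left, norm_smul, norm_of_nonneg lz]
    rw [mem_ball, dist_zero_right] at hy
    nlinarith
  have hjm : Measurable fun q : E × ℝ => gg φ ((A + q.2 • (A' - A)) + (r + q.2 * (r' - r)) • q.1) :=
    (gg_meas φ).comp (by fun_prop)
  calc dd φ A r A' r' ≤ ∫⁻ y in ball oE 1, ofReal (L ^ 2) *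
        ∫⁻ τ in Icc (0 : ℝ) 1, gg φ ((A + τ • (A' - A)) + (r + τ * (r' - r)) • y) := by
        refine setLIntegral_mono' measurableSet_ball fun y hy => ?_
        have h1 := seg_pt ho hφ (a := A + r • y) (v := (A' - A) + (r' - r) • y) (fun τ hτ => by
          rw [e]; exact hSΩ (hin y hy τ hτ))
        simp_rw [e] at h1
        have e2 : A + r • y + (A' - A + (r' - r) • y) = A' + r' • y := by rw [sub_smul]; abel
        rw [e2] at h1
        refine h1.trans ?_
        gcongr
        refine le_trans ((norm_add_le _ _).trans ?_) hL
        rw [← dist_eq_norm, dist_comm, norm_smul, norm_eq_abs]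
        rw [mem_ball, dist_zero_right] at hy
        gcongr
        nlinarith [abs_nonneg (r' - r)]
    _ = ofReal (L ^ 2) * ∫⁻ τ in Icc (0 : ℝ) 1, ∫⁻ y in ball oE 1,
          gg φ ((A + τ • (A' - A)) + (r + τ * (r' - r)) • y) := by
        rw [lintegral_const_mul' _ _ ofReal_ne_top, lintegral_lintegral_swap]
        exact hjm.aemeasurable
    _ ≤ ofReal (L ^ 2) * ∫⁻ τ in Icc (0 : ℝ) 1, ofReal (r0 ^ n)⁻¹ * ∫⁻ z in S, gg φ z := by
        gcongr 1
        refine setLIntegral_mono' measurableSet_Icc fun τ hτ => ?_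
        have hp := hrt τ hτ
        calc _ ≤ ∫⁻ y, S.indicator (gg φ) ((A + τ • (A' - A)) + (r + τ * (r' - r)) • y) := by
              rw [← lintegral_indicator measurableSet_ball]
              refine lintegral_mono fun y => ?_
              by_cases hy : y ∈ ball oE 1
              · simp only [indicator_of_mem hy, indicator_of_mem (hin y hy τ hτ), le_refl]
              · simp only [indicator_of_notMem hy, zero_le]
          _ = _ := lint_aff _ _ (hr0.trans_le hp)
          _ ≤ _ := by rw [lintegral_indicator hS]; gcongr
    _ = _ := by
        rw [lintegral_const, Measure.restrict_apply_univ, Real.volume_Icc, ofReal_mul pz]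
        simp [mul_assoc]

theorem path (M : ℝ) {c0 K0 : ℝ} (hc0 : 0 < c0) (hK0 : 0 < K0) : ∃ (N : ℕ) (c1 K1 : ℝ), 0 < c1 ∧ 0 < K1 ∧
    ∀ (n : ℕ) (Ω : Set (EE n)), IsOneSidedNTA M Ω → ∀ (t : ℝ) (A A' : EE n), 0 < t → A ∈ Ω → A' ∈ Ω → c0 * t ≤ dl Ω A →
    c0 * t ≤ dl Ω A' → dist A A' ≤ K0 * t → K0 * t < diam Ω / 10 → ∃ p : ℕ → EE n, p 0 = A ∧ p N = A' ∧
    ∀ j < N, ∀ τ ∈ Icc (0 : ℝ) 1, p j + τ • (p (j + 1) - p j) ∈ Ω ∧ c1 * t ≤ dl Ω (p j + τ • (p (j + 1) - p j)) ∧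
      dist (p j + τ • (p (j + 1) - p j)) A ≤ K1 * t := by
  obtain ⟨k0, hk0⟩ := pow_unbounded_of_one_lt (K0 / c0) (one_lt_two (α := ℝ))
  set k := k0 + 1 with hk
  set N' := ⌈M * (k : ℝ)⌉₊ with hN'
  have hdist : ∀ {n : ℕ} (a b : EE n) (τ : ℝ), τ ∈ Icc (0 : ℝ) 1 → dist (a + τ • (b - a)) a ≤ dist b a := by
    intro n a b τ hτ
    rw [dist_eq_norm, add_sub_cancel_left, norm_smul, norm_of_nonneg hτ.1, ← dist_eq_norm]
    nlinarith [hτ.2, dist_nonneg (x := b) (y := a)]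
  refine ⟨N' - 1, min (c0 / 2) ((9 / 10) ^ N' * c0 / 2), K0 + (11 / 10) ^ N' * (2 * K0), by positivity, by positivity, ?_⟩
  intro n Ω hΩ t A A' ht hA hA' hδ hδ' hd hD
  have hNn : 2 ≤ N' := by
    have h1 := Nat.le_ceil (M * (k : ℝ))
    have h2 : (1 : ℝ) ≤ k := by exact_mod_cast (by omega : 1 ≤ k)
    have h3 := hΩ.M_gt_one
    have : (1 : ℝ) < N' := by rw [hN']; nlinarith
    exact_mod_cast this
  by_cases hdir : dist A' A ≤ dl Ω A / 2
  · refine ⟨fun j => if j = 0 then A else A', by simp, by simp [show N' - 1 ≠ 0 by omega], fun j hj τ hτ => ?_⟩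
    set w := (if j = 0 then A else A') + τ • ((if j + 1 = 0 then A else A') - (if j = 0 then A else A')) with hw
    have hwA : dist w A ≤ dist A' A := by
      by_cases h0 : j = 0
      · simp only [hw, h0, if_true]; simpa using hdist A A' τ hτ
      · simp [hw, h0]
    have hpos : 0 < dl Ω A := lt_of_lt_of_le pz hδ
    have hl := dl_lip Ω A w
    rw [dist_comm A w] at hl
    rw [dist_comm] at hd
    refine ⟨dl_ball hA (by rw [mem_ball]; linarith), ?_, ?_⟩
    · calc _ ≤ c0 / 2 * t := by gcongr; exact min_le_left _ _
        _ ≤ _ := by linarith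
    · have : 0 ≤ (11 / 10) ^ N' * (2 * K0) * t := by positivity
      show dist w A ≤ _
      nlinarith
  · rw [not_le] at hdir
    have hpos : 0 < dist A A' := by
      rw [dist_comm]; refine lt_of_le_of_lt ?_ hdir; have := infDist_nonneg (x := A) (s := frontier Ω); positivity
    obtain ⟨c, ρ, h1, h2, h3⟩ := hΩ.harnack (dist A A') (c0 * t) k hpos (hd.trans_lt hD) pz oz
      A hA A' hA' rfl hδ hδ' (by
        refine hd.trans ?_
        rw [← mul_assoc]; gcongr
        rw [div_lt_iff₀ hc0] at hk0
        rw [hk, pow_succ]; nlinarith)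
    rw [← hN'] at h2 h3
    have hstep : ∀ i, 1 ≤ i → i < N' → dist (c (i + 1)) (c i) < dl Ω (c i) / 10 := fun i hi hi' =>
      lt_of_lt_of_le (mem_ball.1 ((h3 i hi hi'.le).2.2.2 hi')) (h3 i hi hi'.le).2.1
    have hmem : ∀ i, 1 ≤ i → i ≤ N' → c i ∈ Ω := fun i hi hi' =>
      (h3 i hi hi').2.2.1 (mem_ball_self (h3 i hi hi').1)
    have hind : ∀ i, i < N' → (9 / 10 : ℝ) ^ i * dl Ω A ≤ dl Ω (c (i + 1)) ∧
        dl Ω (c (i + 1)) ≤ (11 / 10) ^ i * dl Ω A ∧ dist (c (i + 1)) A ≤ ((11 / 10) ^ i - 1) * dl Ω A := by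
      intro i
      induction i with
      | zero => intro _; simp [h1]
      | succ i ih =>
        intro hi
        obtain ⟨i1, i2, i3⟩ := ih oz
        have hs := hstep (i + 1) oz hi
        have l1 := dl_lip Ω (c (i + 1)) (c (i + 1 + 1))
        have l2 := dl_lip Ω (c (i + 1 + 1)) (c (i + 1))
        have l3 := dist_triangle (c (i + 1 + 1)) (c (i + 1)) A
        rw [dist_comm] at l1
        rw [pow_succ, pow_succ]
        refine ⟨by linarith, by linarith, by linarith⟩
    refine ⟨fun j => c (j + 1), h1, ?_, fun j hj τ hτ => ?_⟩
    · show c (N' - 1 + 1) = A'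
      rw [Nat.sub_add_cancel oz, h2]
    obtain ⟨i1, i2, i3⟩ := hind j oz
    have hs := hstep (j + 1) oz oz
    set w := c (j + 1) + τ • (c (j + 1 + 1) - c (j + 1)) with hw
    have hwc : dist w (c (j + 1)) ≤ dist (c (j + 1 + 1)) (c (j + 1)) := hdist _ _ τ hτ
    have hδA : 0 ≤ dl Ω A := infDist_nonneg
    have hl := dl_lip Ω (c (j + 1)) w
    rw [dist_comm _ w] at hl
    have hdl0 : 0 ≤ dl Ω (c (j + 1)) := infDist_nonneg
    refine ⟨dl_ball (hmem (j + 1) oz oz) (by rw [mem_ball]; linarith [dist_nonneg (x := w) (y := c (j + 1)), dist_nonneg (x := c (j + 1 + 1)) (y := c (j + 1))]), ?_, ?_⟩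
    · have e1 : (9 / 10 : ℝ) ^ N' * c0 * t ≤ (9 / 10) ^ j * dl Ω A := by
        rw [mul_assoc]
        gcongr ?_ * ?_
        exact pow_le_pow_of_le_one nz nz oz
      calc _ ≤ ((9 / 10) ^ N' * c0 / 2) * t := by gcongr; exact min_le_right _ _
        _ ≤ dl Ω w := by linarith
    · have e1 : (11 / 10 : ℝ) ^ j * dl Ω A ≤ (11 / 10) ^ N' * (2 * K0 * t) / (11 / 10) := by
        rw [le_div_iff₀ nz]
        calc (11 / 10 : ℝ) ^ j * dl Ω A * (11 / 10) = (11 / 10) ^ (j + 1) * dl Ω A := by ring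
          _ ≤ _ := by
            rw [dist_comm] at hdir
            gcongr ?_ * ?_
            · exact pow_le_pow_right₀ nz oz
            · linarith
      have l3 := dist_triangle w (c (j + 1)) A
      have : 0 ≤ K0 * t := by positivity
      show dist w A ≤ _
      linarith

def SS (Ω : SE) (K c t : ℝ) (ξ : E) : SE :=
  {z | z ∈ Ω ∧ dist z ξ < K * t ∧ c * t ≤ dl Ω z}

theorem SS_meas (ho : IsOpen Ω) (K c t : ℝ) (ξ : E) : MeasurableSet (SS Ω K c t ξ) :=
  ho.measurableSet.inter ((measurableSet_lt (measurable_id.dist measurable_const) measurable_const).inter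
    (measurableSet_le measurable_const (continuous_infDist_pt _).measurable))

theorem en_tri (a b c : ℝ) : ‖a - c‖ₑ ^ 2 ≤ 2 * ‖a - b‖ₑ ^ 2 + 2 * ‖b - c‖ₑ ^ 2 := by
  have : ‖a - c‖ ^ 2 ≤ 2 * ‖a - b‖ ^ 2 + 2 * ‖b - c‖ ^ 2 := by
    simp only [norm_eq_abs, sq_abs]; nlinarith [sq_nonneg (a - b - (b - c))]
  have h := ofReal_le_ofReal this
  rw [ofReal_add pz pz, ofReal_mul nz,
    ofReal_mul nz, ofReal_pow (norm_nonneg _), ofReal_pow (norm_nonneg _),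
    ofReal_pow (norm_nonneg _)] at h
  simpa only [ofReal_norm, ofReal_ofNat] using h

theorem aff_mem {A y : E} {r : ℝ} (hr : 0 < r) (hy : y ∈ ball oE 1) : A + r • y ∈ ball A r := by
  rw [mem_ball, dist_eq_norm, add_sub_cancel_left, norm_smul, norm_of_nonneg hr.le]
  rw [mem_ball, dist_zero_right] at hy
  nlinarith

theorem aff_meas {φ : E → ℝ} (hφ : ContinuousOn φ Ω) {A : E} {r : ℝ} (hr : 0 < r)
    (hA : ball A r ⊆ Ω) : AEMeasurable (fun y => φ (A + r • y)) (volume.restrict (ball oE 1)) :=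
  ContinuousOn.aemeasurable (hφ.comp (by fun_prop) fun _ hy => hA (aff_mem hr hy)) measurableSet_ball

theorem dd_tri {φ : E → ℝ} (hφ : ContinuousOn φ Ω) {A A' A'' : E} {r r' r'' : ℝ}
    (hr : 0 < r) (hr' : 0 < r') (hA : ball A r ⊆ Ω) (hA' : ball A' r' ⊆ Ω) :
    dd φ A r A'' r'' ≤ 2 * dd φ A r A' r' + 2 * dd φ A' r' A'' r'' := by
  unfold dd
  rw [← lintegral_const_mul' _ _ sz, ← lintegral_const_mul' _ _ sz, ← lintegral_add_left']
  · exact lintegral_mono fun y => en_tri _ _ _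
  · exact (((aff_meas hφ hr hA).sub (aff_meas hφ hr' hA')).enorm.pow_const 2).const_mul 2

theorem sq_inv_pow (hn : 2 ≤ n) {t : ℝ} (ht : 0 < t) : t ^ 2 * (t ^ n)⁻¹ = (t ^ nm)⁻¹ := by
  obtain ⟨m, rfl⟩ := Nat.exists_eq_add_of_le hn
  rw [Nat.add_sub_cancel_left, pow_add]; field_simp

theorem chain (hn : 2 ≤ n) (M : ℝ) {c0 K0 : ℝ} (hc0 : 0 < c0) (hK0 : 0 < K0) : ∃ θ c1 K1 C : ℝ, 0 < θ ∧ θ ≤ c0 / 2 ∧ 0 < c1 ∧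
    0 < K1 ∧ 0 < C ∧ ∀ (Ω : SE), IsOneSidedNTA M Ω → ∀ φ : E → ℝ, (∀ x ∈ Ω, ContDiffAt ℝ 1 φ x) →
    ∀ (t s s' : ℝ) (A A' : E), 0 < t → A ∈ Ω → A' ∈ Ω → c0 * t ≤ dl Ω A →
    c0 * t ≤ dl Ω A' → dist A A' ≤ K0 * t → K0 * t < diam Ω / 10 → θ * t / 2 ≤ s → s ≤ θ * t → θ * t / 2 ≤ s' → s' ≤ θ * t →
    dd φ A s A' s' ≤ ofReal (C * (t ^ nm)⁻¹) * ∫⁻ z in SS Ω K1 c1 t A, gg φ z := by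
  obtain ⟨N, c1, K1, hc1, hK1, H⟩ := path M hc0 hK0
  set c := min c0 c1 / 2 with hc
  have hcp : 0 < c := by positivity
  have hcc0 : 2 * c ≤ c0 := by rw [hc]; linarith [min_le_left c0 c1]
  have hcc1 : 2 * c ≤ c1 := by rw [hc]; linarith [min_le_right c0 c1]
  refine ⟨c, c, K1 + c, 4 ^ N * ((2 * K1 + c) ^ 2 * ((c / 2) ^ n)⁻¹), hcp, by linarith, hcp, by positivity, by positivity, ?_⟩
  intro Ω hΩ φ hφ t s s' A A' ht hA hA' hδ hδ' hd hD hs1 hs2 hs1' hs2'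
  obtain ⟨p, hp0, hpN, hp⟩ := H n Ω hΩ t A A' ht hA hA' hδ hδ' hd hD
  have hcont : ContinuousOn φ Ω := fun x hx => (hφ x hx).continuousAt.continuousWithinAt
  have hct : 0 < c * t := by positivity
  have h2a : 2 * (c * t) ≤ c0 * t := by rw [← mul_assoc]; gcongr
  have h2b : 2 * (c * t) ≤ c1 * t := by rw [← mul_assoc]; gcongr
  have key : ∀ w : E, w ∈ Ω → 2 * (c * t) ≤ dl Ω w → dist w A ≤ K1 * t → ∀ r ≤ c * t, ball w r ⊆ SS Ω (K1 + c) c t A := by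
    intro w hw hw1 hw2 r hr z hz
    rw [mem_ball] at hz
    have := dl_lip Ω w z
    rw [dist_comm w z] at this
    have h3 := dist_triangle z w A
    refine ⟨dl_ball hw (by rw [mem_ball]; linarith), by linarith, by linarith⟩
  set B := (2 * K1 + c) ^ 2 * ((c / 2) ^ n)⁻¹ * (t ^ nm)⁻¹ with hB
  have hBe : ((2 * K1 + c) * t) ^ 2 * ((c * t / 2) ^ n)⁻¹ = B := by
    rw [hB, ← sq_inv_pow hn ht, mul_pow, show c * t / 2 = c / 2 * t by ring, mul_pow, mul_inv]; ring
  have hB0 : 0 ≤ B := by positivity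
  set I := ∫⁻ z in SS Ω (K1 + c) c t A, gg φ z
  have hSm := SS_meas hΩ.isOpen (K1 + c) c t A
  have hSΩ : SS Ω (K1 + c) c t A ⊆ Ω := fun z hz => hz.1
  have hAA : ∀ r ≤ c * t, ball A r ⊆ SS Ω (K1 + c) c t A := key A hA (h2a.trans hδ) (by simp; positivity)
  have main : ∀ j ≤ N, (j = 0 ∨ ball (p j) s' ⊆ Ω) ∧ dd φ A s (p j) s' ≤ ofReal (4 ^ j * B) * I := by
    intro j
    induction j with
    | zero =>
      intro _
      refine ⟨Or.inl rfl, ?_⟩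
      rw [hp0, pow_zero, one_mul, ← hBe]
      refine seg hΩ.isOpen hφ pz hs1 hs1' hSm hSΩ ?_ ?_
      · have : 0 < K1 * t := by positivity
        rw [dist_self, zero_add, abs_le]; constructor <;> linarith
      · intro τ hτ
        rw [sub_self, smul_zero, add_zero]
        exact hAA _ (by nlinarith [hτ.1, hτ.2])
    | succ j ih =>
      intro hj
      have hb := fun τ hτ => hp j oz τ hτ
      have h0 := hb 0 sz
      have h1 := hb 1 sz
      simp only [zero_smul, add_zero, one_smul, add_sub_cancel] at h0 h1
      have hb0 : ball (p j) s' ⊆ Ω := (key _ h0.1 (h2b.trans h0.2.1) h0.2.2 _ hs2').trans hSΩ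
      have hb1 : ball (p (j + 1)) s' ⊆ Ω := (key _ h1.1 (h2b.trans h1.2.1) h1.2.2 _ hs2').trans hSΩ
      refine ⟨Or.inr hb1, (dd_tri hcont lz lz ((hAA _ hs2).trans hSΩ) hb0).trans ?_⟩
      have hseg : dd φ (p j) s' (p (j + 1)) s' ≤ ofReal B * I := by
        rw [← hBe]
        refine seg hΩ.isOpen hφ pz hs1' hs1' hSm hSΩ ?_ ?_
        · rw [sub_self, abs_zero, add_zero]
          have := dist_triangle_right (p j) (p (j + 1)) A
          have e1 := h0.2.2
          have e2 := h1.2.2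
          linarith
        · intro τ hτ
          rw [sub_self, mul_zero, add_zero]
          have := hb τ hτ
          exact key _ this.1 (h2b.trans this.2.1) this.2.2 _ hs2'
      calc _ ≤ 2 * (ofReal (4 ^ j * B) * I) + 2 * (ofReal B * I) := by
            gcongr; exact (ih oz).2
        _ = ofReal (2 * (4 ^ j * B) + 2 * B) * I := by
            rw [ofReal_add pz pz, ofReal_mul (p := 2) (q := 4 ^ j * B) nz,
              ofReal_mul (p := 2) (q := B) nz, ofReal_ofNat]; ring
        _ ≤ _ := by
            gcongr
            have : (1 : ℝ) ≤ 4 ^ j := one_le_pow₀ nz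
            rw [pow_succ]; nlinarith
  have := (main N le_rfl).2
  rw [hpN] at this
  refine this.trans (le_of_eq ?_)
  rw [hB]; ring_nf

theorem tele {s : ℝ} (hs : 1 < s) : ∃ C : ℝ, 0 < C ∧ ∀ (a : ℕ → ℝ) (l : ℝ), Filter.Tendsto a Filter.atTop (𝓝 l) →
    ‖l - a 0‖ₑ ^ 2 ≤ ofReal C * ∑' i, ofReal ((s ^ 2) ^ i) * ‖a i - a (i + 1)‖ₑ ^ 2 := by
  have h0 : (0 : ℝ) ≤ (s ^ 2)⁻¹ := by positivity
  have h1 : (s ^ 2)⁻¹ < 1 := inv_lt_one_of_one_lt₀ (by nlinarith)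
  refine ⟨(1 - (s ^ 2)⁻¹)⁻¹, by rw [inv_pos]; linarith, fun a l hl => ?_⟩
  have hb : ‖l - a 0‖ₑ ≤ ∑' i, ‖a i - a (i + 1)‖ₑ := by
    have ht : Filter.Tendsto (fun k => ‖a k - a 0‖ₑ) Filter.atTop (𝓝 ‖l - a 0‖ₑ) := (hl.sub_const _).enorm
    refine le_of_tendsto' ht fun k => ?_
    have : ‖a k - a 0‖ₑ ≤ ∑ i ∈ Finset.range k, ‖a i - a (i + 1)‖ₑ := by
      induction k with
      | zero => simp
      | succ k ih =>
        rw [Finset.sum_range_succ, add_comm (Finset.sum _ _)]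
        calc _ = ‖-(a k - a (k + 1)) + (a k - a 0)‖ₑ := by congr 1; ring
          _ ≤ ‖-(a k - a (k + 1))‖ₑ + ‖a k - a 0‖ₑ := enorm_add_le _ _
          _ ≤ _ := by rw [enorm_neg]; gcongr
    exact this.trans (ENNReal.sum_le_tsum _)
  have hC := ENNReal.lintegral_mul_le_Lp_mul_Lq (Measure.count : Measure ℕ) (Real.HolderConjugate.two_two)
    (f := fun i => ofReal (s⁻¹ ^ i)) (g := fun i => ofReal (s ^ i) * ‖a i - a (i + 1)‖ₑ)
    (measurable_of_countable _).aemeasurable (measurable_of_countable _).aemeasurable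
  simp only [lintegral_count, Pi.mul_apply, ENNReal.rpow_two, mul_pow] at hC
  have e1 : ∀ i, ofReal (s⁻¹ ^ i) * (ofReal (s ^ i) * ‖a i - a (i + 1)‖ₑ) = ‖a i - a (i + 1)‖ₑ := fun i => by
    rw [← mul_assoc, ← ofReal_mul pz, ← mul_pow, inv_mul_cancel₀ lz, one_pow,
      ofReal_one, one_mul]
  have e2 : ∀ i, ofReal (s⁻¹ ^ i) ^ 2 = ofReal ((s ^ 2)⁻¹ ^ i) := fun i => by
    rw [← ofReal_pow pz, ← pow_mul, mul_comm i 2, pow_mul, inv_pow]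
  have e3 : ∀ i, ofReal (s ^ i) ^ 2 = ofReal ((s ^ 2) ^ i) := fun i => by
    rw [← ofReal_pow pz, ← pow_mul, mul_comm i 2, pow_mul]
  simp only [e1, e2, e3] at hC
  rw [← ofReal_tsum_of_nonneg (fun i => by positivity) (summable_geometric_of_lt_one h0 h1),
    tsum_geometric_of_lt_one h0 h1] at hC
  calc _ ≤ _ := pow_le_pow_left₀ sz (hb.trans hC) 2
    _ = _ := by
      rw [mul_pow, ← ENNReal.rpow_natCast, ← ENNReal.rpow_natCast, ← ENNReal.rpow_mul, ← ENNReal.rpow_mul]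
      norm_num

noncomputable def MM (Ω : SE) (φ : E → ℝ) (K c p t : ℝ) (ξ : E) : ℝ≥0∞ :=
  ∑' i : ℕ, ofReal (p ^ i * ((t / 2 ^ i) ^ nm)⁻¹) * ∫⁻ z in SS Ω K c (t / 2 ^ i) ξ, gg φ z

theorem fr_ne (hn : 1 ≤ n) (hb : Bornology.IsBounded Ω) (hne : Ω.Nonempty) : (frontier Ω).Nonempty := by
  have : Nonempty (Fin n) := ⟨⟨0, hn⟩⟩
  obtain ⟨v, hv⟩ := exists_ne oE
  by_contra h
  rw [not_nonempty_iff_eq_empty, frontier_eq_empty_iff] at h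
  rcases h with h | h
  · exact hne.ne_empty h
  · rw [h] at hb
    exact NormedSpace.unbounded_univ ℝ E hb

theorem near_pt (hf : (frontier Ω).Nonempty) (x : E) : ∃ Q ∈ frontier Ω, dist x Q = dl Ω x := by
  obtain ⟨Q, hQ, h⟩ := isClosed_frontier.exists_infDist_eq_dist hf x
  exact ⟨Q, hQ, h.symm⟩

theorem mem_of_dl {x : E} (ho : IsOpen Ω) (hx : x ∈ closure Ω) (h : 0 < dl Ω x) : x ∈ Ω := by
  by_contra hn
  have : x ∈ frontier Ω := by rw [ho.frontier_eq]; exact ⟨hx, hn⟩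
  simp [dl, infDist_zero_of_mem this] at h

theorem seqA {M : ℝ} (hΩ : IsOneSidedNTA M Ω) (hf : (frontier Ω).Nonempty) {ξ : E}
    (hξ : ξ ∈ closure Ω) {t : ℝ} (ht : 0 < t) (hD : t < diam Ω / 10) :
    ∃ A ∈ Ω, dist A ξ ≤ 2 * t ∧ t / M ≤ dl Ω A := by
  by_cases h : t ≤ dl Ω ξ
  · refine ⟨ξ, mem_of_dl hΩ.isOpen hξ lz, by simp; positivity, le_trans ?_ h⟩
    exact div_le_self ht.le hΩ.M_gt_one.le
  · obtain ⟨Q, hQ, hd⟩ := near_pt hf ξ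
    obtain ⟨A, ⟨hA, hAb⟩, hA2⟩ := hΩ.corkscrew Q hQ t ht hD
    rw [mem_ball] at hAb
    refine ⟨A, hA, ?_, hA2⟩
    have := dist_triangle_right A ξ Q
    rw [not_le] at h
    linarith

theorem master (hn : 2 ≤ n) {M : ℝ} (hM : 1 < M) {c0 K0 p : ℝ} (hc0 : 0 < c0) (hK0 : 0 < K0) (hp : 1 < p) :
    ∃ θ c1 K1 C : ℝ, 0 < θ ∧ θ ≤ c0 / 2 ∧ 0 < c1 ∧
    0 < K1 ∧ 0 < C ∧ ∀ (Ω : SE), IsOneSidedNTA M Ω → (frontier Ω).Nonempty → ∀ φ : E → ℝ, ContinuousOn φ (closure Ω) →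
    (∀ x ∈ Ω, ContDiffAt ℝ 1 φ x) →
    ∀ ξ ∈ closure Ω, ∀ t, 0 < t → (2 * K0 + 4) * t < diam Ω / 10 → ∀ A ∈ Ω, c0 * t ≤ dl Ω A → dist A ξ ≤ K0 * t →
    ∫⁻ y in ball oE 1, ‖φ ξ - φ (A + (θ * t) • y)‖ₑ ^ 2 ≤ ofReal C * MM Ω φ K1 c1 p t ξ := by
  have hM0 : 0 < M := by linarith
  obtain ⟨θ, c1, K1, C, hθ, hθ', hc1, hK1, hC, H⟩ := chain (n := n) hn M (c0 := min c0 (1 / M) / 2) (K0 := 2 * K0 + 4) pz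
    pz
  have hs : 1 < √p := by rw [Real.lt_sqrt nz]; simpa using hp
  obtain ⟨C2, hC2, H2⟩ := tele hs
  have hcm1 := min_le_left c0 (1 / M)
  have hcm2 := min_le_right c0 (1 / M)
  refine ⟨θ, c1, K1 + K0 + 2, C2 * C, hθ, by linarith, hc1, by positivity, by positivity, ?_⟩
  intro Ω hΩ hf φ hφ hφ1 ξ hξ t ht hD A hA hA1 hA2
  have hφΩ : ContinuousOn φ Ω := hφ.mono subset_closure
  set T : ℕ → ℝ := fun i => t / 2 ^ i with hT
  have hTp : ∀ i, 0 < T i := fun i => by positivity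
  have hTs : ∀ i, T (i + 1) = T i / 2 := fun i => by simp only [hT, pow_succ]; field_simp
  have hTt : ∀ i, T i ≤ t := fun i => div_le_self ht.le (one_le_pow₀ nz)
  have hs1 : ∀ i, ∃ A ∈ Ω, dist A ξ ≤ 2 * T i ∧ T i / M ≤ dl Ω A := fun i =>
    seqA hΩ hf hξ (hTp i) (by nlinarith [hTt i, hTp i])
  choose A' hA'1 hA'2 hA'3 using hs1
  set B : ℕ → E := fun i => if i = 0 then A else A' i with hB
  have hBm : ∀ i, B i ∈ Ω := fun i => by by_cases h : i = 0 <;> simp [hB, h, hA, hA'1]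
  have hBd : ∀ i, dist (B i) ξ ≤ (K0 + 2) * T i := fun i => by
    have := hTp i
    by_cases h : i = 0
    · subst h; simp only [hB, if_true, hT]; simp; nlinarith
    · simp only [hB, h, if_false]; nlinarith [hA'2 i]
  have hBd' : ∀ i, dist (B (i + 1)) ξ ≤ 2 * T (i + 1) := fun i => hA'2 (i + 1)
  have hBd0 : ∀ i, dist (B i) ξ ≤ (max K0 2) * T i := fun i => by
    have := hTp i
    by_cases h : i = 0
    · subst h; simp only [hB, if_true, hT]; simp; nlinarith [le_max_left K0 2]
    · simp only [hB, h, if_false]; nlinarith [hA'2 i, le_max_right K0 2]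
  have hBl : ∀ i, min c0 (1 / M) * T i ≤ dl Ω (B i) := fun i => by
    have := hTp i
    by_cases h : i = 0
    · subst h
      have h0 : T 0 = t := by simp [hT]
      simp only [hB, if_true]; rw [h0]; nlinarith
    · simp only [hB, h, if_false]
      refine le_trans ?_ (hA'3 i)
      rw [div_eq_mul_one_div (T i), mul_comm]; gcongr
  have hmax : max K0 2 ≤ K0 + 2 := max_le lz lz
  have hstep : ∀ i, dd φ (B i) (θ * T i) (B (i + 1)) (θ * T (i + 1)) ≤
      ofReal (C * ((T i) ^ nm)⁻¹) * ∫⁻ z in SS Ω (K1 + K0 + 2) c1 (T i) ξ, gg φ z := by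
    intro i
    have hi := hTp i
    have hm : 0 < min c0 (1 / M) := by positivity
    refine (H Ω hΩ φ hφ1 (T i) (θ * T i) (θ * T (i + 1)) (B i) (B (i + 1)) hi (hBm i) (hBm _) ?_ ?_ ?_ ?_ ?_ le_rfl ?_ ?_).trans ?_
    · refine le_trans ?_ (hBl i); nlinarith
    · refine le_trans (le_of_eq ?_) (hBl (i + 1)); rw [hTs]; ring
    · have h1 := dist_triangle_right (B i) (B (i + 1)) ξ
      have h2 := hBd i
      have h3 := hBd' i
      rw [hTs] at h3
      nlinarith
    · refine lt_of_le_of_lt ?_ hD; gcongr; exact hTt i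
    · have := mul_pos hθ hi; linarith
    · rw [hTs]; linarith
    · rw [hTs]; nlinarith
    · gcongr
      intro z hz
      refine ⟨hz.1, ?_, hz.2.2⟩
      have h1 := dist_triangle z (B i) ξ
      have h2 := hz.2.1
      have h3 := hBd i
      linarith
  have hball : ∀ i, ball (B i) (θ * T i) ⊆ Ω := fun i => by
    refine (ball_subset_ball ?_).trans (dl_ball (hBm i))
    have := hTp i
    have hm : 0 < min c0 (1 / M) := by positivity
    refine le_trans ?_ (hBl i)
    gcongr; linarith
  have hT0 : Filter.Tendsto T Filter.atTop (𝓝 0) := by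
    have := (tendsto_pow_atTop_nhds_zero_of_lt_one (r := (1 / 2 : ℝ)) nz nz).const_mul t
    simp only [mul_zero] at this
    refine this.congr fun i => ?_
    simp only [hT]; rw [one_div, inv_pow]; rfl
  have hpt : ∀ y ∈ ball oE 1, ‖φ ξ - φ (A + (θ * t) • y)‖ₑ ^ 2 ≤ ofReal C2 *
      ∑' i, ofReal (p ^ i) * ‖φ (B i + (θ * T i) • y) - φ (B (i + 1) + (θ * T (i + 1)) • y)‖ₑ ^ 2 := by
    intro y hy
    have hconv : Filter.Tendsto (fun i => φ (B i + (θ * T i) • y)) Filter.atTop (𝓝 (φ ξ)) := by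
      refine (hφ ξ hξ).tendsto.comp ?_
      rw [tendsto_nhdsWithin_iff]
      refine ⟨?_, Filter.Eventually.of_forall fun i => subset_closure (hball i (aff_mem (by have := hTp i; positivity) hy))⟩
      rw [tendsto_iff_dist_tendsto_zero]
      have hz : Filter.Tendsto (fun i => (K0 + 2 + θ) * T i) Filter.atTop (𝓝 0) := by simpa using hT0.const_mul (K0 + 2 + θ)
      refine squeeze_zero (fun _ => dist_nonneg) (fun i => ?_) hz
      have h1 := aff_mem (A := B i) (mul_pos hθ (hTp i)) hy
      rw [mem_ball] at h1
      have h2 := dist_triangle (B i + (θ * T i) • y) (B i) ξ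
      linarith [hBd i]
    have := H2 _ _ hconv
    rw [Real.sq_sqrt lz] at this
    simpa [hB, hT] using this
  calc _ ≤ ∫⁻ y in ball oE 1, ofReal C2 *
      ∑' i, ofReal (p ^ i) * ‖φ (B i + (θ * T i) • y) - φ (B (i + 1) + (θ * T (i + 1)) • y)‖ₑ ^ 2 :=
        setLIntegral_mono' measurableSet_ball hpt
    _ = ofReal C2 * ∑' i, ofReal (p ^ i) * dd φ (B i) (θ * T i) (B (i + 1)) (θ * T (i + 1)) := by
        rw [lintegral_const_mul' _ _ ofReal_ne_top, lintegral_tsum]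
        · simp_rw [dd, lintegral_const_mul' _ _ ofReal_ne_top]
        · intro i
          exact (((aff_meas hφΩ (mul_pos hθ (hTp i)) (hball i)).sub
            (aff_meas hφΩ (mul_pos hθ (hTp (i + 1))) (hball (i + 1)))).enorm.pow_const 2).const_mul _
    _ ≤ ofReal C2 * ∑' i, ofReal C * (ofReal (p ^ i * ((T i) ^ nm)⁻¹) * ∫⁻ z in SS Ω (K1 + K0 + 2) c1 (T i) ξ, gg φ z) := by
        refine mul_le_mul_right (ENNReal.tsum_le_tsum fun i => ?_) _
        refine (mul_le_mul_right (hstep i) _).trans (le_of_eq ?_)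
        have : 0 < p := by linarith
        rw [ofReal_mul hC.le, ofReal_mul pz]; ring
    _ = _ := by rw [ENNReal.tsum_mul_left, ← mul_assoc, ← ofReal_mul hC2.le]; rfl

theorem MM_mono {φ : E → ℝ} {K K' c c' p t : ℝ} {ξ : E} (ht : 0 ≤ t) (hK : K ≤ K') (hc : c' ≤ c) :
    MM Ω φ K c p t ξ ≤ MM Ω φ K' c' p t ξ := by
  refine ENNReal.tsum_le_tsum fun i => mul_le_mul' le_rfl (lintegral_mono_set ?_)
  intro z hz
  exact ⟨hz.1, hz.2.1.trans_le (by gcongr), le_trans (by gcongr) hz.2.2⟩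

theorem MM_scale {φ : E → ℝ} {K c p t e : ℝ} {ξ : E} (he : 0 < e) (ht : 0 ≤ t) (hp : 0 ≤ p) :
    MM Ω φ K c p (e * t) ξ = ofReal ((e ^ nm)⁻¹) * MM Ω φ (K * e) (c * e) p t ξ := by
  unfold MM
  rw [← ENNReal.tsum_mul_left]
  congr 1; funext i
  rw [← mul_assoc, ← ofReal_mul pz]
  congr 2
  · rw [mul_div_assoc, mul_pow, mul_inv]; ring
  · rw [show SS Ω K c (e * t / 2 ^ i) ξ = SS Ω (K * e) (c * e) (t / 2 ^ i) ξ by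
      simp only [SS, mul_div_assoc, mul_assoc]]

theorem MM_zero {φ : E → ℝ} {K c p t : ℝ} {ξ : E} :
    ofReal ((t ^ nm)⁻¹) * ∫⁻ z in SS Ω K c t ξ, gg φ z ≤ MM Ω φ K c p t ξ := by
  have := ENNReal.le_tsum (f := fun i : ℕ => ofReal (p ^ i * ((t / 2 ^ i) ^ nm)⁻¹) * ∫⁻ z in SS Ω K c (t / 2 ^ i) ξ, gg φ z) 0
  simpa [MM] using this

theorem fub (ho : IsOpen Ω) (φ : E → ℝ) {Λ : Type*} [MeasurableSpace Λ] (μ : Measure Λ) [SFinite μ]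
    {b : Λ → ℝ≥0∞} (hb : Measurable b) {ξ : Λ → E} (hξ : Measurable ξ) {t : Λ → ℝ} (ht : Measurable t)
    {K c p q C : ℝ} (hp : 0 ≤ p) (hq : 0 ≤ q) (hC : 0 ≤ C) (hpq : p * q < 1)
    (H : ∀ z ∈ Ω, ∀ i : ℕ, ∫⁻ l, b l * {l | z ∈ SS Ω K c (t l / 2 ^ i) (ξ l)}.indicator (fun l => ofReal (((t l / 2 ^ i) ^ nm)⁻¹)) l ∂μ ≤
      ofReal (C * q ^ i)) :
    ∫⁻ l, b l * MM Ω φ K c p (t l) (ξ l) ∂μ ≤ ofReal (C * (1 - p * q)⁻¹) * ∫⁻ z in Ω, gg φ z := by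
  have hJ : ∀ i : ℕ, MeasurableSet {w : Λ × E | w.2 ∈ SS Ω K c (t w.1 / 2 ^ i) (ξ w.1)} := fun i =>
    (ho.measurableSet.preimage measurable_snd).inter (((measurableSet_lt (measurable_snd.dist (hξ.comp measurable_fst))
      (((ht.comp measurable_fst).div_const _).const_mul K))).inter
      (measurableSet_le (((ht.comp measurable_fst).div_const _).const_mul c) ((continuous_infDist_pt _).measurable.comp measurable_snd)))
  set F : ℕ → Λ → E → ℝ≥0∞ := fun i l z => {w : Λ × E | w.2 ∈ SS Ω K c (t w.1 / 2 ^ i) (ξ w.1)}.indicator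
    (fun w => ofReal (((t w.1 / 2 ^ i) ^ nm)⁻¹)) (l, z) with hF
  have hFm : ∀ i, Measurable (fun w : Λ × E => F i w.1 w.2) := fun i =>
    Measurable.indicator (by fun_prop) (hJ i)
  have e1 : ∀ l, b l * MM Ω φ K c p (t l) (ξ l) = ∑' i : ℕ, ∫⁻ z, ofReal (p ^ i) * (b l * F i l z * gg φ z) := by
    intro l
    unfold MM
    rw [← ENNReal.tsum_mul_left]
    congr 1; funext i
    rw [lintegral_const_mul' _ _ ofReal_ne_top]
    rw [ofReal_mul pz, ← lintegral_indicator (SS_meas ho _ _ _ _)]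
    rw [show b l * (ofReal (p ^ i) * ofReal (((t l / 2 ^ i) ^ nm)⁻¹) *
      ∫⁻ z, (SS Ω K c (t l / 2 ^ i) (ξ l)).indicator (gg φ) z) = ofReal (p ^ i) * (b l * ofReal (((t l / 2 ^ i) ^ nm)⁻¹) *
      ∫⁻ z, (SS Ω K c (t l / 2 ^ i) (ξ l)).indicator (gg φ) z) by ring]
    rw [← lintegral_const_mul _ ((gg_meas φ).indicator (SS_meas ho _ _ _ _))]
    congr 1
    refine lintegral_congr fun z => ?_
    by_cases hz : z ∈ SS Ω K c (t l / 2 ^ i) (ξ l)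
    · simp [F, hz]
    · simp [F, hz]
  simp_rw [e1]
  have hgm := gg_meas φ
  rw [lintegral_tsum]
  swap
  · intro i
    refine Measurable.aemeasurable (Measurable.lintegral_prod_right' (f := fun w : Λ × E => ofReal (p ^ i) * (b w.1 * F i w.1 w.2 * gg φ w.2)) ?_)
    exact (((hb.comp measurable_fst).mul (hFm i)).mul (hgm.comp measurable_snd)).const_mul _
  have hpq0 : 0 ≤ p * q := mul_nonneg hp hq
  rw [← tsum_geometric_of_lt_one hpq0 hpq, ← tsum_mul_left, ofReal_tsum_of_nonneg (fun i => by positivity)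
    ((summable_geometric_of_lt_one hpq0 hpq).mul_left _), ← ENNReal.tsum_mul_right]
  refine ENNReal.tsum_le_tsum fun i => ?_
  rw [lintegral_lintegral_swap]
  swap
  · exact ((((hb.comp measurable_fst).mul (hFm i)).mul (hgm.comp measurable_snd)).const_mul _).aemeasurable
  rw [← lintegral_indicator ho.measurableSet, ← lintegral_const_mul _ (hgm.indicator ho.measurableSet)]
  refine lintegral_mono fun z => ?_
  dsimp only
  by_cases hz : z ∈ Ω
  · rw [lintegral_const_mul' _ _ ofReal_ne_top, lintegral_mul_const, indicator_of_mem hz]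
    · refine (mul_le_mul' le_rfl (mul_le_mul' (H z hz i) le_rfl)).trans_eq ?_
      rw [← mul_assoc, ← ofReal_mul pz]
      congr 2; rw [mul_pow]; ring
    · exact hb.mul (Measurable.of_uncurry_right (hFm i))
  · have : ∀ l, F i l z = 0 := fun l => indicator_of_notMem (fun h => hz h.1) _
    simp [this]

theorem vol_ball (x : E) {r : ℝ} (hr : 0 < r) : volume (ball x r) = ofReal (r ^ n) * volume (ball oE 1) := by
  have := Measure.addHaar_ball_of_pos (volume : ME) x hr
  rwa [finrank_euclideanSpace_fin] at this

theorem poinc (hn : 2 ≤ n) {K c p : ℝ} (hK : 0 < K) (hc : 0 < c) (hp : 1 < p) (hp4 : p < 4) : ∃ C : ℝ, 0 < C ∧ ∀ Ω : SE, IsOpen Ω →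
    ∀ φ : E → ℝ, ∀ t : E → ℝ, (∀ x, 0 ≤ t x) → (∀ x ∈ Ω, 0 < t x) → (∀ x y, t x ≤ t y + dist x y) → (∀ x, dl Ω x ≤ t x) →
    ∫⁻ x in Ω, ofReal ((t x ^ 2)⁻¹) * MM Ω φ K c p (t x) x ≤ ofReal C * ∫⁻ z in Ω, gg φ z := by
  set B := 2 * K / c + K + 2 with hB
  have hB2 : 0 < 2 * K / c := by positivity
  set V := (volume (ball oE 1)).toReal with hV
  have hV0 : 0 ≤ V := ENNReal.toReal_nonneg
  have hpq : p * (1 / 4) < 1 := by linarith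
  refine ⟨(B ^ n * (K * B) ^ n * (V + 1)) * (1 - p * (1 / 4))⁻¹, mul_pos pz (inv_pos.2 lz), ?_⟩
  intro Ω ho φ t ht0 htp htL htd
  have htc : Continuous t := LipschitzWith.continuous (K := 1) (LipschitzWith.of_le_add_mul 1 (by simpa using htL))
  refine fub ho φ (volume.restrict Ω) (b := fun x => ofReal ((t x ^ 2)⁻¹)) ((htc.measurable.pow_const 2).inv.ennreal_ofReal) measurable_id htc.measurable
    lz nz pz hpq fun z hz i => ?_
  have hs := htp z hz
  set s := t z with hsd
  have h2i : (1 : ℝ) ≤ 2 ^ i := one_le_pow₀ nz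
  have key : ∀ x ∈ Ω, z ∈ SS Ω K c (t x / 2 ^ i) x → x ∈ ball z (K * B * s / 2 ^ i) ∧
      (t x ^ 2)⁻¹ * ((t x / 2 ^ i) ^ nm)⁻¹ ≤ B ^ n * (s ^ n)⁻¹ * (2 ^ i) ^ nm := by
    intro x hx hz'
    have hx0 := htp x hx
    have h1 : dist z x < K * (t x / 2 ^ i) := hz'.2.1
    have h2 : c * (t x / 2 ^ i) ≤ s := hz'.2.2.trans (htd z)
    have h3 : s ≤ t x + dist z x := htL z x
    have h4 : t x ≤ s + dist z x := by have := htL x z; rwa [dist_comm] at this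
    have hxs : t x ≤ B * s := by
      by_cases h : 2 ^ i ≤ 2 * K
      · have : c * t x ≤ s * 2 ^ i := by rw [← mul_div_assoc, div_le_iff₀ pz] at h2; exact h2
        have h5 : c * t x ≤ s * (2 * K) := this.trans (by gcongr)
        have : t x ≤ 2 * K / c * s := by rw [div_mul_eq_mul_div, le_div_iff₀ hc]; linarith
        refine this.trans ?_
        gcongr; linarith
      · have : K * (t x / 2 ^ i) ≤ t x / 2 := by
          rw [← mul_div_assoc, div_le_div_iff₀ pz nz]
          nlinarith
        nlinarith
    refine ⟨?_, ?_⟩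
    · rw [mem_ball, dist_comm]
      refine h1.trans_le ?_
      rw [mul_assoc, mul_div_assoc]; gcongr
    · have hsx : s ≤ B * t x := by
        have : K * (t x / 2 ^ i) ≤ K * t x := by gcongr; exact div_le_self hx0.le h2i
        nlinarith
      rw [div_pow, inv_div, ← mul_div_assoc, mul_comm ((t x ^ 2)⁻¹), mul_div_assoc, mul_comm]
      gcongr
      rw [sq_inv_pow hn hx0 |> fun h => show (t x ^ 2)⁻¹ / t x ^ nm = (t x ^ n)⁻¹ by
        rw [div_eq_mul_inv, ← h, ← mul_assoc, inv_mul_cancel₀ pz, one_mul]]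
      rw [← div_eq_mul_inv, le_div_iff₀ pz, inv_mul_le_iff₀ pz, ← mul_pow, mul_comm]
      gcongr
  calc _ ≤ ∫⁻ x in Ω, (ball z (K * B * s / 2 ^ i)).indicator (fun _ => ofReal (B ^ n * (s ^ n)⁻¹ * (2 ^ i) ^ nm)) x := by
        refine setLIntegral_mono' ho.measurableSet fun x hx => ?_
        by_cases h : z ∈ SS Ω K c (t x / 2 ^ i) x
        · obtain ⟨k1, k2⟩ := key x hx h
          rw [indicator_of_mem k1, indicator_of_mem (by exact h), ← ofReal_mul pz]
          exact ofReal_le_ofReal k2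
        · rw [indicator_of_notMem (by exact h), mul_zero]; exact bot_le
    _ ≤ ofReal (B ^ n * (s ^ n)⁻¹ * (2 ^ i) ^ nm) * volume (ball z (K * B * s / 2 ^ i)) := by
        refine (setLIntegral_le_lintegral _ _).trans ?_
        rw [lintegral_indicator_const measurableSet_ball]
    _ ≤ _ := by
        rw [vol_ball _ pz, ← ofReal_toReal (a := volume (ball oE 1)) measure_ball_lt_top.ne,
          ← ofReal_mul pz, ← ofReal_mul pz]
        apply ofReal_le_ofReal
        have e : (s ^ n)⁻¹ * (2 ^ i) ^ nm * (K * B * s / 2 ^ i) ^ n = (K * B) ^ n * (1 / 4) ^ i := by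
          obtain ⟨m, rfl⟩ := Nat.exists_eq_add_of_le hn
          rw [Nat.add_sub_cancel_left, div_pow, mul_pow, pow_add (2 ^ i) 2 m, one_div, inv_pow, show (4 : ℝ) ^ i = (2 ^ i) ^ 2 by
            rw [← pow_mul, mul_comm, pow_mul]; norm_num]
          field_simp
        calc _ = B ^ n * ((s ^ n)⁻¹ * (2 ^ i) ^ nm * (K * B * s / 2 ^ i) ^ n) * V := by ring
          _ = B ^ n * ((K * B) ^ n * (1 / 4) ^ i) * V := by rw [e]
          _ ≤ B ^ n * ((K * B) ^ n * (1 / 4) ^ i) * (V + 1) := by gcongr; linarith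
          _ = _ := by ring

variable (n) in
theorem vb_pos : volume (ball oE 1) ≠ 0 := (measure_ball_pos _ _ one_pos).ne'
variable (n) in
theorem vb_fin : volume (ball oE 1) ≠ ⊤ := measure_ball_lt_top.ne

theorem cmp2 (a b : ℝ) {f : E → ℝ} (hf : AEMeasurable f (volume.restrict (ball oE 1))) :
    volume (ball oE 1) * ‖a - b‖ₑ ^ 2 ≤ 2 * (∫⁻ y in ball oE 1, ‖a - f y‖ₑ ^ 2) + 2 * ∫⁻ y in ball oE 1, ‖b - f y‖ₑ ^ 2 := by
  rw [mul_comm, ← setLIntegral_const, ← lintegral_const_mul' _ _ sz, ← lintegral_const_mul' _ _ sz, ← lintegral_add_left']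
  · refine lintegral_mono fun y => (en_tri a (f y) b).trans_eq ?_
    rw [← enorm_neg (f y - b), neg_sub]
  · exact ((aemeasurable_const.sub hf).enorm.pow_const 2).const_mul _

theorem en_div {V a b : ℝ≥0∞} {C : ℝ} (h0 : V ≠ 0) (ht : V ≠ ⊤) (h : V * a ≤ ofReal C * b) :
    a ≤ ofReal (C / V.toReal) * b := by
  have hv : 0 < V.toReal := ENNReal.toReal_pos h0 ht
  rw [ofReal_div_of_pos hv, ofReal_toReal ht, div_eq_mul_inv, mul_right_comm, ← div_eq_mul_inv,
    ENNReal.le_div_iff_mul_le (Or.inl h0) (Or.inl ht), mul_comm a]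
  simpa [mul_comm] using h

theorem dl_le_diam (hb : Bornology.IsBounded Ω) (hf : (frontier Ω).Nonempty) {x : E} (hx : x ∈ closure Ω) : dl Ω x ≤ diam Ω := by
  obtain ⟨Q, hQ, h⟩ := near_pt hf x
  rw [← h, ← diam_closure]
  exact dist_le_diam_of_mem hb.closure hx (frontier_subset_closure hQ)

set_option maxHeartbeats 400000 in
theorem m1pt (hn : 2 ≤ n) {M p : ℝ} (hM : 1 < M) (hp : 1 < p) : ∃ K c C : ℝ, 1 ≤ K ∧ 0 < c ∧ 0 < C ∧
    ∀ (Ω : SE), IsOneSidedNTA M Ω → Bornology.IsBounded Ω → (frontier Ω).Nonempty → ∀ φ : E → ℝ, ContinuousOn φ (closure Ω) →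
    (∀ x ∈ Ω, ContDiffAt ℝ 1 φ x) → ∀ x ∈ Ω, ∀ P ∈ frontier Ω, ∀ t, 0 < t → dl Ω x ≤ t → (t = dl Ω x ∨ 100 * t ≤ diam Ω) →
    dist x P < (1 + 1/1000000) * t → ‖φ x - φ P‖ₑ ^ 2 ≤ ofReal C * (MM Ω φ K c p t x + MM Ω φ K c p t P) := by
  obtain ⟨ε, hε⟩ : ∃ ε : ℝ, ε = 1/1000000 := ⟨_, rfl⟩
  have hε0 : 0 < ε := by rw [hε]; norm_num
  have hM0 : 0 < 1 / M := by positivity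
  obtain ⟨θ, c1, K1, C1, hθ, hθc, hc1, hK1, hC1, H⟩ := master hn hM (c0 := min ε (1/M)) (K0 := 1003) (lt_min hε0 hM0) nz hp
  have hθε : θ ≤ ε / 2 := hθc.trans (by gcongr; exact min_le_left _ _)
  rw [← hε]
  set V := volume (ball oE 1) with hV
  have hv : 0 < V.toReal := ENNReal.toReal_pos (vb_pos n) (vb_fin n)
  set K := max 2 K1
  set c := min (ε ^ 2 / 2) (c1 * ε)
  set B := C1 * (ε ^ nm)⁻¹ with hB
  set B' := 4 * ((θ * ε) ^ n)⁻¹ with hB'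
  have hBp : 0 < B := by positivity
  have hBp' : 0 < B' := by positivity
  refine ⟨K, c, (6 * B + 4 * B') / V.toReal, le_trans nz (le_max_left _ _), by positivity, by positivity, ?_⟩
  intro Ω hΩ hb hf φ hφc hφ x hx P hP t ht hxt hcase hdist
  have hφΩ : ContinuousOn φ Ω := hφc.mono subset_closure
  have hPc := frontier_subset_closure hP
  have conv : ∀ e, ε ≤ e → e ≤ 1 → ∀ ξ, ofReal C1 * MM Ω φ K1 c1 p (e * t) ξ ≤ ofReal B * MM Ω φ K c p t ξ := by
    intro e he he1 ξ
    have he0 : 0 < e := by linarith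
    rw [MM_scale he0 ht.le lz, ← mul_assoc, ← ofReal_mul hC1.le]
    refine mul_le_mul' (ofReal_le_ofReal (by rw [hB]; gcongr)) (MM_mono ht.le ?_ ?_)
    · exact (mul_le_of_le_one_right hK1.le he1).trans (le_max_right _ _)
    · exact (min_le_right _ _).trans (by gcongr)
  refine en_div (vb_pos n) (vb_fin n) ?_
  have hMx : ∀ a b : ℝ≥0∞, ∀ k : ℝ, k ≤ 6 * B + 4 * B' → ofReal k * (a + b) ≤ ofReal (6 * B + 4 * B') * (a + b) :=
    fun a b k h => mul_le_mul' (ofReal_le_ofReal h) le_rfl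
  rcases hcase with hc | hc
  · have htD : t ≤ diam Ω := hc ▸ dl_le_diam hb hf (subset_closure hx)
    set A := x + (1 - ε) • (P - x) with hA
    have hxP : 0 ≤ dist x P := dist_nonneg
    have hxA : dist x A = (1 - ε) * dist x P := by
      rw [hA, dist_self_add_right, norm_smul, norm_of_nonneg (by rw [hε]; norm_num), ← dist_eq_norm, dist_comm]
    have hAP : dist A P = ε * dist x P := by
      rw [hA, dist_eq_norm, show x + (1 - ε) • (P - x) - P = ε • (x - P) by module, norm_smul, norm_of_nonneg hε0.le, dist_eq_norm]
    have hlin : (1 - ε) * dist x P ≤ t - ε * (ε * t) := by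
      have : (1 - ε) * dist x P ≤ (1 - ε) * ((1 + ε) * t) := by
        gcongr; rw [hε]; norm_num
      nlinarith
    have hdA : ε * (ε * t) ≤ dl Ω A := by
      have := dl_lip Ω x A
      rw [hxA] at this; linarith
    have hAΩ : A ∈ Ω := by
      have : A ∈ ball x (dl Ω x) := by
        rw [mem_ball, dist_comm, hxA, ← hc]; nlinarith [mul_pos hε0 (mul_pos hε0 ht)]
      exact dl_ball hx this
    have hs : 0 < ε * t := by positivity
    have hsD : (2 * 1003 + 4) * (ε * t) < diam Ω / 10 := by rw [hε]; linarith
    have i1 := H Ω hΩ hf φ hφc hφ x (subset_closure hx) (ε * t) hs hsD x hx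
      (by rw [← hc]; have : min ε (1/M) * (ε * t) ≤ ε * (ε * t) := by gcongr; exact min_le_left _ _
          rw [hε] at this ⊢; linarith) (by simp; positivity)
    have i2 := H Ω hΩ hf φ hφc hφ P hPc (ε * t) hs hsD A hAΩ
      (le_trans (by gcongr; exact min_le_left _ _) hdA) (by rw [hAP]; rw [hε] at *; linarith)
    have hθs : 0 < θ * (ε * t) := by positivity
    have hθs2 : θ * (ε * t) ≤ ε * (ε * t) / 2 := by nlinarith
    have hball : ∀ τ ∈ Icc (0 : ℝ) 1, ball (x + τ • (A - x)) (θ * (ε * t) + τ * (θ * (ε * t) - θ * (ε * t))) ⊆ SS Ω 2 (ε ^ 2 / 2) t x := by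
      intro τ hτ z hz
      rw [sub_self, mul_zero, add_zero, mem_ball] at hz
      have e1 : dist (x + τ • (A - x)) x ≤ (1 - ε) * dist x P := by
        rw [dist_self_add_left, norm_smul, norm_of_nonneg hτ.1, ← dist_eq_norm, dist_comm, hxA]
        have : 0 ≤ (1 - ε) * dist x P := by rw [← hxA]; exact dist_nonneg
        nlinarith [hτ.2]
      have e2 := dist_triangle z (x + τ • (A - x)) x
      have e3 := dl_lip Ω x z
      rw [dist_comm x z] at e3
      have e4 : dist z x < t - ε * (ε * t) / 2 := by linarith
      have e5 : 0 < ε * (ε * t) := by positivity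
      refine ⟨dl_ball hx (by rw [mem_ball, ← hc]; linarith), by linarith, by linarith⟩
    have i3 := seg hΩ.isOpen hφ hθs le_rfl le_rfl (SS_meas hΩ.isOpen 2 (ε ^ 2 / 2) t x) (fun z hz => hz.1) (L := 2 * t)
      (A := x) (A' := A) (by rw [sub_self, abs_zero, add_zero, hxA]; nlinarith [mul_pos hε0 (mul_pos hε0 ht)]) hball
    have i3' : dd φ x (θ * (ε * t)) A (θ * (ε * t)) ≤ ofReal B' * MM Ω φ K c p t x := by
      refine i3.trans ?_
      rw [show (2 * t) ^ 2 * ((θ * (ε * t)) ^ n)⁻¹ = B' * (t ^ nm)⁻¹ by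
        rw [hB', ← sq_inv_pow hn ht, ← mul_assoc, mul_pow (θ * ε), mul_inv]; ring, ofReal_mul hBp'.le, mul_assoc]
      exact mul_le_mul' le_rfl (MM_zero.trans (MM_mono ht.le (le_max_left _ _) (min_le_left _ _)))
    have hxb : ball x (θ * (ε * t)) ⊆ Ω := by
      have := hball 0 sz
      simp at this
      exact fun z hz => (this hz).1
    have hAb : ball A (θ * (ε * t)) ⊆ Ω := by
      have := hball 1 sz
      simp at this
      exact fun z hz => (this hz).1
    have hm := aff_meas hφΩ hθs hxb
    have hm' := aff_meas hφΩ hθs hAb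
    have i4 : ∫⁻ y in ball oE 1, ‖φ P - φ (x + (θ * (ε * t)) • y)‖ₑ ^ 2 ≤
        2 * (∫⁻ y in ball oE 1, ‖φ P - φ (A + (θ * (ε * t)) • y)‖ₑ ^ 2) + 2 * dd φ x (θ * (ε * t)) A (θ * (ε * t)) := by
      unfold dd
      rw [← lintegral_const_mul' _ _ sz, ← lintegral_const_mul' _ _ sz, ← lintegral_add_left']
      · refine lintegral_mono fun y => (en_tri _ (φ (A + (θ * (ε * t)) • y)) _).trans_eq ?_
        rw [← enorm_neg (φ (A + (θ * (ε * t)) • y) - _), neg_sub]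
      · exact ((aemeasurable_const.sub hm').enorm.pow_const 2).const_mul _
    refine (cmp2 (φ x) (φ P) hm).trans ?_
    have j1 := i1.trans (conv ε le_rfl (by rw [hε]; norm_num) x)
    have j2 := i2.trans (conv ε le_rfl (by rw [hε]; norm_num) P)
    set X := MM Ω φ K c p t x
    set Z := MM Ω φ K c p t P
    calc _ ≤ 2 * (ofReal B * X) + 2 * (2 * (ofReal B * Z) + 2 * (ofReal B' * X)) := by
          gcongr
          exact i4.trans (by gcongr)
      _ ≤ 2 * (ofReal B * (X + Z)) + 2 * (2 * (ofReal B * (X + Z)) + 2 * (ofReal B' * (X + Z))) := by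
          have hX : X ≤ X + Z := le_self_add
          have hZ : Z ≤ X + Z := le_add_self
          gcongr
      _ = ofReal (6 * B + 4 * B') * (X + Z) := by
          rw [ofReal_add pz pz, ofReal_mul (p := 6) nz,
            ofReal_mul (p := 4) (q := B') nz]
          rw [ofReal_ofNat, ofReal_ofNat]; ring
  · obtain ⟨e, he⟩ : ∃ e : ℝ, e = 1/1000 := ⟨_, rfl⟩
    have he0 : 0 < e := by rw [he]; norm_num
    have hs : 0 < e * t := by positivity
    have hsD : (2 * 1003 + 4) * (e * t) < diam Ω / 10 := by rw [he]; linarith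
    obtain ⟨A, hAΩ, hAP, hAd⟩ := seqA hΩ hf hPc hs lz
    have hcA : min ε (1/M) * (e * t) ≤ dl Ω A := le_trans (by
      rw [show e * t / M = (1 / M) * (e * t) by ring]; gcongr; exact min_le_right _ _) hAd
    have i1 := H Ω hΩ hf φ hφc hφ x (subset_closure hx) (e * t) hs hsD A hAΩ hcA (by
      have := dist_triangle A P x
      rw [dist_comm P x] at this; rw [hε] at hdist; rw [he] at *; linarith)
    have i2 := H Ω hΩ hf φ hφc hφ P hPc (e * t) hs hsD A hAΩ hcA lz
    have hAb : ball A (θ * (e * t)) ⊆ Ω := (ball_subset_ball (by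
      have : θ ≤ min ε (1/M) := hθc.trans (half_le_self pz)
      exact le_trans (by gcongr) hcA)).trans (dl_ball hAΩ)
    have hm := aff_meas hφΩ (by positivity : 0 < θ * (e * t)) hAb
    refine (cmp2 (φ x) (φ P) hm).trans ?_
    have j1 := i1.trans (conv e (by rw [hε, he]; norm_num) (by rw [he]; norm_num) x)
    have j2 := i2.trans (conv e (by rw [hε, he]; norm_num) (by rw [he]; norm_num) P)
    refine le_trans ?_ (hMx _ _ (2 * B) lz)
    rw [ofReal_mul (p := 2) nz, ofReal_ofNat, mul_add, mul_assoc, mul_assoc]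
    gcongr

section sig

theorem sig_fin (hP : IsMixedPair M Cσ d cd Ω σ) : IsFiniteMeasure σ := by
  refine ⟨?_⟩
  rw [← union_compl_self (frontier Ω)]
  exact (measure_union_le _ _).trans_lt (by rw [hP.null_outside, add_zero]; exact hP.finite.lt_top)

theorem diam_pos' (hn : 1 ≤ n) (hP : IsMixedPair M Cσ d cd Ω σ) : 0 < diam Ω := by
  have : Nonempty (Fin n) := ⟨⟨0, hn⟩⟩
  obtain ⟨x, hx⟩ := hP.nonempty
  have hne : (𝓝[≠] x).NeBot := inferInstance
  obtain ⟨y, hy, hy'⟩ := (hne.nonempty_of_mem (Filter.inter_mem self_mem_nhdsWithin (mem_nhdsWithin_of_mem_nhds (hP.nta.isOpen.mem_nhds hx))))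
  exact (dist_pos.2 hy).trans_le (dist_le_diam_of_mem hP.bounded hy' hx)

theorem fr_dist (hP : IsMixedPair M Cσ d cd Ω σ) {x y : E} (hx : x ∈ closure Ω) (hy : y ∈ closure Ω) : dist x y ≤ diam Ω := by
  rw [← diam_closure]; exact dist_le_diam_of_mem hP.bounded.closure hx hy

theorem sig_mono (hP : IsMixedPair M Cσ d cd Ω σ) {S T : SE} (h : S ∩ frontier Ω ⊆ T) : σ.real S ≤ σ.real T := by
  have := sig_fin hP
  refine ENNReal.toReal_mono (measure_ne_top _ _) ?_
  have : S ⊆ (S ∩ frontier Ω) ∪ (frontier Ω)ᶜ := fun x hx => by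
    by_cases h : x ∈ frontier Ω
    · exact Or.inl ⟨hx, h⟩
    · exact Or.inr h
  exact (measure_mono this).trans ((measure_union_le _ _).trans (by rw [hP.null_outside, add_zero]; exact measure_mono h))

theorem sig_dbl1 (hn : 1 ≤ n) (hP : IsMixedPair M Cσ d cd Ω σ) {Q : E} (hQ : Q ∈ frontier Ω) {r : ℝ} (hr : 0 < r) :
    σ.real (ball Q (2 * r)) ≤ Cσ * σ.real (ball Q r) := by
  have hD := diam_pos' hn hP
  by_cases h : r < diam Ω
  · exact hP.doubling Q hQ r hr h
  · have h1 := hP.doubling Q hQ (3 / 4 * diam Ω) pz lz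
    calc σ.real (ball Q (2 * r)) ≤ σ.real (ball Q (2 * (3 / 4 * diam Ω))) := sig_mono hP fun y hy => by
          have := fr_dist hP (frontier_subset_closure hy.2) (frontier_subset_closure hQ)
          rw [mem_ball]; linarith
      _ ≤ Cσ * σ.real (ball Q (3 / 4 * diam Ω)) := h1
      _ ≤ _ := mul_le_mul_of_nonneg_left (sig_mono hP (inter_subset_left.trans (ball_subset_ball lz))) hP.Cσ_pos.le

theorem sig_dbl (hn : 1 ≤ n) (hP : IsMixedPair M Cσ d cd Ω σ) {Q : E} (hQ : Q ∈ frontier Ω) {r : ℝ} (hr : 0 < r) (k : ℕ) :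
    σ.real (ball Q (2 ^ k * r)) ≤ Cσ ^ k * σ.real (ball Q r) := by
  induction k with
  | zero => simp
  | succ k ih =>
    have := sig_dbl1 hn hP hQ (r := 2 ^ k * r) pz
    rw [pow_succ', mul_assoc, pow_succ', mul_assoc]
    exact this.trans (mul_le_mul_of_nonneg_left ih hP.Cσ_pos.le)

theorem sig_shift (hn : 1 ≤ n) (hP : IsMixedPair M Cσ d cd Ω σ) {Q Q' : E} (hQ : Q ∈ frontier Ω) {s s' : ℝ} (hs : 0 < s) (k : ℕ)
    (h : dist Q Q' + s' ≤ 2 ^ k * s) : σ.real (ball Q' s') ≤ Cσ ^ k * σ.real (ball Q s) :=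
  (sig_mono hP (inter_subset_left.trans (ball_subset_ball' (by rw [dist_comm]; linarith)))).trans (sig_dbl hn hP hQ hs k)

theorem sig_low (hn : 2 ≤ n) (hP : IsMixedPair M Cσ d cd Ω σ) {Q : E} (hQ : Q ∈ frontier Ω) {s r K : ℝ} (hs : 0 < s) (hK : 1 ≤ K) (hsr : s ≤ r)
    (hr : r ≤ K * diam Ω) : min cd 1 / (2 * K) ^ d * (r / s) ^ d * σ.real (ball Q s) ≤ σ.real (ball Q r) := by
  have hD := diam_pos' oz hP
  have hd : 0 < d := by
    have := hP.d_gt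
    have h2 : (2 : ℝ) ≤ n := by exact_mod_cast hn
    linarith
  have hc := hP.cd_pos
  have hr0 : 0 < r := by linarith
  have hmono : σ.real (ball Q s) ≤ σ.real (ball Q r) := sig_mono hP (inter_subset_left.trans (ball_subset_ball hsr))
  have hK1 : 1 ≤ (2 * K) ^ d := Real.one_le_rpow lz hd.le
  have hm1 : min cd 1 / (2 * K) ^ d ≤ min cd 1 := div_le_self pz hK1
  have h0 : 0 ≤ σ.real (ball Q s) := measureReal_nonneg
  have triv : (r / s) ^ d ≤ (2 * K) ^ d → min cd 1 / (2 * K) ^ d * (r / s) ^ d * σ.real (ball Q s) ≤ σ.real (ball Q r) := fun h =>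
    le_trans (mul_le_of_le_one_left h0 (by
      rw [div_mul_eq_mul_div, div_le_one pz]
      exact (mul_le_mul (min_le_right cd 1) h pz zero_le_one).trans sz)) hmono
  rcases lt_or_ge s (diam Ω / 2) with h1 | h1
  swap
  · exact triv (Real.rpow_le_rpow pz (by rw [div_le_iff₀ hs]; nlinarith) hd.le)
  rcases eq_or_lt_of_le hsr with h2 | h2
  · exact triv (by rw [h2, div_self hr0.ne', Real.one_rpow]; exact hK1)
  rcases lt_or_ge r (diam Ω) with h3 | h3
  · refine le_trans ?_ (hP.lower_dim Q hQ r s hs h2 h3)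
    change _ ≤ _ * σ.real (ball Q s)
    gcongr
    exact hm1.trans (min_le_left _ _)
  · have := hP.lower_dim Q hQ (diam Ω / 2) s hs h1 lz
    change _ * σ.real (ball Q s) ≤ σ.real _ at this
    calc _ ≤ cd / (2 * K) ^ d * ((2 * K) ^ d * (diam Ω / 2 / s) ^ d) * σ.real (ball Q s) := by
          gcongr
          · exact min_le_left _ _
          · rw [← Real.mul_rpow pz pz]
            refine Real.rpow_le_rpow pz ?_ hd.le
            rw [← mul_div_assoc]; gcongr; linarith
      _ = cd * (diam Ω / 2 / s) ^ d * σ.real (ball Q s) := by field_simp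
      _ ≤ _ := this.trans (sig_mono hP (inter_subset_left.trans (ball_subset_ball lz)))
end sig

theorem MM_meas (ho : IsOpen Ω) (φ : E → ℝ) {Λ : Type*} [MeasurableSpace Λ]
    {ξ : Λ → E} (hξ : Measurable ξ) {t : Λ → ℝ} (ht : Measurable t) (K c p : ℝ) : Measurable fun l => MM Ω φ K c p (t l) (ξ l) := by
  unfold MM
  refine Measurable.tsum fun i => Measurable.mul (by fun_prop) ?_
  have hJ : MeasurableSet {w : Λ × E | w.2 ∈ SS Ω K c (t w.1 / 2 ^ i) (ξ w.1)} :=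
    (ho.measurableSet.preimage measurable_snd).inter (((measurableSet_lt (measurable_snd.dist (hξ.comp measurable_fst))
      (((ht.comp measurable_fst).div_const _).const_mul K))).inter
      (measurableSet_le (((ht.comp measurable_fst).div_const _).const_mul c) ((continuous_infDist_pt _).measurable.comp measurable_snd)))
  have : ∀ l, ∫⁻ z in SS Ω K c (t l / 2 ^ i) (ξ l), gg φ z =
      ∫⁻ z, {w : Λ × E | w.2 ∈ SS Ω K c (t w.1 / 2 ^ i) (ξ w.1)}.indicator (fun w => gg φ w.2) (l, z) := fun l => by
    rw [← lintegral_indicator (SS_meas ho _ _ _ _)]; rfl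
  simp_rw [this]
  exact Measurable.lintegral_prod_right' (((gg_meas φ).comp measurable_snd).indicator hJ)

abbrev bb (t : E → ℝ) (x : E) : SE := ball x ((1 + 1/1000000) * t x)

abbrev WW (Ω : SE) (t : E → ℝ) : Set (E × E) := {w | w.1 ∈ Ω ∧ w.2 ∈ frontier Ω ∧ dist w.2 w.1 < (1 + 1/1000000) * t w.1}

noncomputable def bw (Ω : SE) (σ : ME) (t : E → ℝ) : E × E → ℝ≥0∞ :=
  (WW Ω t).indicator fun w => ofReal ((t w.1 ^ 2)⁻¹) * (σ (bb t w.1))⁻¹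

theorem bw_meas (ho : IsOpen Ω) (σ : ME) [IsFiniteMeasure σ] {t : E → ℝ} (ht : Measurable t) : Measurable (bw Ω σ t) := by
  have h1 : MeasurableSet {w : E × E | dist w.2 w.1 < (1 + 1/1000000) * t w.1} :=
    measurableSet_lt (measurable_snd.dist measurable_fst) ((ht.comp measurable_fst).const_mul _)
  refine Measurable.indicator (Measurable.mul (by fun_prop) (Measurable.inv ?_))
    ((ho.measurableSet.preimage measurable_fst).inter ((isClosed_frontier.measurableSet.preimage measurable_snd).inter h1))
  exact (measurable_measure_prodMk_left (ν := σ) h1).comp measurable_fst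

section sig

theorem bx_low (hn : 1 ≤ n) (hP : IsMixedPair M Cσ d cd Ω σ) {t : E → ℝ} {x P : E} (ht : 0 < t x) (hd : dl Ω x ≤ t x)
    (hxP : dist P x < (1 + 1/1000000) * t x) {R : ℝ} (k : ℕ) (hk : R + 3 * t x ≤ 2 ^ k * (t x / 1000000)) :
    σ (ball P R) ≤ ofReal (Cσ ^ k) * σ (bb t x) := by
  have := sig_fin hP
  obtain ⟨Q, hQ, hxQ⟩ := near_pt (fr_ne hn hP.bounded hP.nonempty) x
  have h1 := sig_shift hn hP hQ (by positivity : 0 < t x / 1000000) k (Q' := P) (s' := R) (by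
    have := dist_triangle Q x P
    rw [dist_comm Q x, dist_comm x P] at this; linarith)
  have h2 : σ.real (ball Q (t x / 1000000)) ≤ σ.real (bb t x) := sig_mono hP (inter_subset_left.trans (ball_subset_ball' (by
    rw [dist_comm]; linarith)))
  have hC := hP.Cσ_pos
  rw [← ofReal_toReal (measure_ne_top σ (ball P R)), ← ofReal_toReal (measure_ne_top σ (bb t x)), ← ofReal_mul pz]
  exact ofReal_le_ofReal (h1.trans (mul_le_mul_of_nonneg_left h2 pz))

theorem bb_pos (hn : 1 ≤ n) (hP : IsMixedPair M Cσ d cd Ω σ) {t : E → ℝ} {x : E} (ht : 0 < t x) (hd : dl Ω x ≤ t x) : σ (bb t x) ≠ 0 := by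
  obtain ⟨Q, hQ, hxQ⟩ := near_pt (fr_ne hn hP.bounded hP.nonempty) x
  refine ((hP.supp_pos Q hQ (t x / 1000000) pz).trans_le (measure_mono (ball_subset_ball' ?_))).ne'
  rw [dist_comm]; linarith
end sig

theorem pow_two_big (B : ℝ) : ∃ k : ℕ, B ≤ 2 ^ k := (pow_unbounded_of_one_lt B one_lt_two).imp fun _ h => h.le

theorem d_pos (hn : 2 ≤ n) {d : ℝ} (h : (n : ℝ) - 2 < d) : 0 < d := by
  have h2 : (2 : ℝ) ≤ n := by exact_mod_cast hn
  linarith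

theorem en4 {a b c : ℝ} (ha : 0 ≤ a) (hb : 0 ≤ b) (hc : 0 ≤ c) (e : ℝ) (S T : ℝ≥0∞) : ofReal a * S * ofReal b *
    (ofReal c * (ofReal e * T)) = ofReal (a * b * c * e) * (S * T) := by
  rw [ofReal_mul pz, ofReal_mul pz, ofReal_mul pz]; ring

set_option maxHeartbeats 400000 in
theorem trace2 (hn : 2 ≤ n) (M : ℝ) {Cσ d cd K c : ℝ} (hK : 1 ≤ K) (hc : 0 < c) (hcd : 0 < cd) (hC : 0 < Cσ) : ∃ C : ℝ, 0 < C ∧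
    ∀ (Ω : SE) σ, IsMixedPair M Cσ d cd Ω σ → ∀ t : E → ℝ, Measurable t →
    (∀ x ∈ Ω, 0 < t x) → (∀ x, dl Ω x ≤ t x) → (∀ x ∈ Ω, t x ≤ diam Ω) → ∀ p, 0 ≤ p → p * (2 ^ nm / 2 ^ d) < 1 → ∀ φ : E → ℝ,
    ∫⁻ w, bw Ω σ t w * MM Ω φ K c p (t w.1) w.2 ∂(volume.prod σ) ≤ ofReal (C * (1 - p * (2 ^ nm / 2 ^ d))⁻¹) * ∫⁻ z in Ω, gg φ z := by
  obtain ⟨k, hk⟩ := pow_two_big ((2 * K + 3) * 1000000)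
  set cl := min cd 1 / (2 * (2 * K)) ^ d with hcl
  have hcl0 : 0 < cl := by positivity
  set B := (2 + K) / c + 1 with hB
  have hB0 : 0 < B := by positivity
  set V := (volume (ball oE 1)).toReal with hV
  have hV0 : 0 < V := ENNReal.toReal_pos (vb_pos n) (vb_fin n)
  refine ⟨cl⁻¹ * Cσ ^ k * K ^ n * B ^ n * V, by positivity, ?_⟩
  intro Ω σ hP t htm htp htd htD p hp0 hpq φ
  have := sig_fin hP
  have ho := hP.nta.isOpen
  set q : ℝ := 2 ^ nm / 2 ^ d with hq
  refine fub ho φ _ (bw_meas ho σ htm) measurable_snd (htm.comp measurable_fst) hp0 pz pz hpq fun z hz i => ?_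
  refine (lintegral_prod_le _).trans ?_
  have hΔ0 : 0 ≤ dl Ω z := infDist_nonneg
  set Δ := dl Ω z with hΔ
  set C1 := cl⁻¹ * Cσ ^ k * q ^ i * (K ^ n * ((2 ^ i * Δ) ^ n)⁻¹) with hC1
  obtain ⟨J, hJ⟩ : ∃ J : Set (E × E), J = {l : E × E | z ∈ SS Ω K c (t l.1 / 2 ^ i) l.2} := ⟨_, rfl⟩
  have hJm : ∀ x P, (x, P) ∈ J ↔ z ∈ SS Ω K c (t x / 2 ^ i) P := fun x P => by rw [hJ, mem_setOf_eq]
  change ∫⁻ x, ∫⁻ P, bw Ω σ t (x, P) * {l : E × E | z ∈ SS Ω K c (t l.1 / 2 ^ i) l.2}.indicator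
      (fun l => ofReal (((t l.1 / 2 ^ i) ^ nm)⁻¹)) (x, P) ∂σ ≤ _
  rw [← hJ]
  have key : ∀ x, ∫⁻ P, bw Ω σ t (x, P) * J.indicator
      (fun l => ofReal (((t l.1 / 2 ^ i) ^ nm)⁻¹)) (x, P) ∂σ ≤ (ball z (B * (2 ^ i * Δ))).indicator (fun _ => ofReal C1) x := by
    intro x
    by_cases hex : ∃ P, (x, P) ∈ WW Ω t ∧ z ∈ SS Ω K c (t x / 2 ^ i) P
    swap
    · rw [lintegral_congr (g := fun _ => 0), lintegral_zero]
      · exact bot_le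
      intro P
      by_cases h1 : (x, P) ∈ WW Ω t
      · rw [indicator_of_notMem (fun h => hex ⟨P, h1, (hJm x P).1 h⟩), mul_zero]
      · rw [bw, indicator_of_notMem h1, zero_mul]
    obtain ⟨P0, ⟨hxΩ, hP0, hxP⟩, -, hzP, hzt⟩ := hex
    dsimp only at hxΩ hP0 hxP
    have ht0 := htp x hxΩ
    have h2i : (1 : ℝ) ≤ 2 ^ i := one_le_pow₀ one_le_two
    have hΔt : Δ < K * (t x / 2 ^ i) := (infDist_le_dist_of_mem hP0).trans_lt hzP
    have hΔp : 0 < Δ := lt_of_lt_of_le pz hzt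
    have hti : t x / 2 ^ i ≤ t x := div_le_self ht0.le h2i
    have e1 : t x ≤ 2 ^ i * Δ / c := by
      rw [le_div_iff₀ hc]
      have : c * (t x / 2 ^ i) * 2 ^ i = t x * c := by field_simp
      nlinarith
    have e2 : 2 ^ i * Δ ≤ K * t x := by
      have : K * (t x / 2 ^ i) * 2 ^ i = K * t x := by field_simp
      nlinarith
    have hxz : x ∈ ball z (B * (2 ^ i * Δ)) := by
      rw [mem_ball, dist_comm]
      have := dist_triangle z P0 x
      have : dist z x < (2 + K) * t x := by nlinarith
      refine this.trans_le ?_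
      calc (2 + K) * t x ≤ (2 + K) * (2 ^ i * Δ / c) := by gcongr
        _ = (2 + K) / c * (2 ^ i * Δ) := by ring
        _ ≤ _ := by gcongr; rw [hB]; linarith
    rw [indicator_of_mem hxz]
    set s := K * (t x / 2 ^ i) with hs
    have hs0 : 0 < s := by positivity
    have m1 : σ (ball z s) ≤ ofReal (cl⁻¹ * ((2 ^ d) ^ i)⁻¹) * σ (ball P0 (2 * K * t x)) := by
      have := sig_low hn hP hP0 (s := 2 * s) (r := 2 * K * t x) (K := 2 * K) pz lz (by
        rw [hs]; nlinarith) (by have := htD x hxΩ; gcongr)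
      rw [show 2 * K * t x / (2 * s) = 2 ^ i by rw [hs]; field_simp, ← rpow_natCast, ← Real.rpow_mul nz, mul_comm (i : ℝ),
        Real.rpow_mul nz, rpow_natCast, ← hcl] at this
      have h3 : σ.real (ball z s) ≤ σ.real (ball P0 (2 * s)) := sig_mono hP (inter_subset_left.trans (ball_subset_ball' lz))
      rw [← ofReal_toReal (measure_ne_top σ (ball z s)), ← ofReal_toReal (measure_ne_top σ (ball P0 _)), ← ofReal_mul pz]
      refine ofReal_le_ofReal (h3.trans ?_)
      rw [← mul_inv, inv_mul_eq_div, le_div_iff₀ pz, mul_comm]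
      exact this
    have m2 := bx_low oz hP ht0 (htd x) hxP (R := 2 * K * t x) k (by
      have : 2 ^ k * (t x / 1000000) = 2 ^ k / 1000000 * t x := by ring
      rw [this]
      have : 2 * K + 3 ≤ 2 ^ k / 1000000 := by rw [le_div_iff₀ nz]; exact hk
      nlinarith)
    have hb0 := bb_pos oz hP ht0 (htd x)
    calc _ ≤ ∫⁻ P, (ball z s).indicator (fun _ => ofReal ((t x ^ 2)⁻¹) * (σ (bb t x))⁻¹ * ofReal (((t x / 2 ^ i) ^ nm)⁻¹)) P ∂σ := by
          refine lintegral_mono fun P => ?_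
          by_cases h : z ∈ SS Ω K c (t x / 2 ^ i) P
          · rw [indicator_of_mem (s := ball z s) (by rw [mem_ball, dist_comm]; exact h.2.1)]
            have a1 : bw Ω σ t (x, P) ≤ ofReal ((t x ^ 2)⁻¹) * (σ (bb t x))⁻¹ := indicator_le_self _ _ _
            rw [indicator_of_mem ((hJm x P).2 h)]
            exact mul_le_mul' a1 le_rfl
          · rw [indicator_of_notMem (mt (hJm x P).1 h), mul_zero]; exact bot_le
      _ = ofReal ((t x ^ 2)⁻¹) * (σ (bb t x))⁻¹ * ofReal (((t x / 2 ^ i) ^ nm)⁻¹) * σ (ball z s) := by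
          rw [lintegral_indicator measurableSet_ball, setLIntegral_const]
      _ ≤ ofReal ((t x ^ 2)⁻¹) * (σ (bb t x))⁻¹ * ofReal (((t x / 2 ^ i) ^ nm)⁻¹) *
          (ofReal (cl⁻¹ * ((2 ^ d) ^ i)⁻¹) * (ofReal (Cσ ^ k) * σ (bb t x))) :=
          mul_le_mul' le_rfl (m1.trans (mul_le_mul' le_rfl m2))
      _ = ofReal ((t x ^ 2)⁻¹ * ((t x / 2 ^ i) ^ nm)⁻¹ * (cl⁻¹ * ((2 ^ d) ^ i)⁻¹) * Cσ ^ k) * ((σ (bb t x))⁻¹ * σ (bb t x)) := by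
          exact en4 pz pz pz _ _ _
      _ ≤ _ := by
          rw [ENNReal.inv_mul_cancel hb0 (measure_ne_top _ _), mul_one]
          refine ofReal_le_ofReal ?_
          have hqi : q ^ i = (2 ^ i) ^ nm * ((2 ^ d) ^ i)⁻¹ := by
            rw [hq, div_pow, div_eq_mul_inv, ← pow_mul, ← pow_mul, mul_comm i]
          have hpow : (t x ^ n)⁻¹ ≤ K ^ n * ((2 ^ i * Δ) ^ n)⁻¹ := by
            rw [← div_eq_mul_inv, inv_eq_one_div, div_le_div_iff₀ pz pz, one_mul, ← mul_pow]
            gcongr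
          calc _ = cl⁻¹ * Cσ ^ k * q ^ i * ((t x ^ 2)⁻¹ * (t x ^ nm)⁻¹) := by
                rw [hqi, div_pow, inv_div]; ring
            _ = cl⁻¹ * Cσ ^ k * q ^ i * (t x ^ n)⁻¹ := by
                rw [← sq_inv_pow hn ht0]; field_simp
            _ ≤ _ := by rw [hC1]; gcongr
  refine (lintegral_mono key).trans ?_
  rw [lintegral_indicator measurableSet_ball, setLIntegral_const]
  have hΔp : 0 < Δ := by
    refine lt_of_le_of_ne hΔ0 fun h => ?_
    have := (isClosed_frontier.mem_iff_infDist_zero (fr_ne oz hP.bounded hP.nonempty)).2 h.symm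
    rw [ho.frontier_eq] at this; exact this.2 hz
  rw [vol_ball _ pz, ← ofReal_toReal (vb_fin n), ← ofReal_mul pz, ← ofReal_mul pz]
  refine ofReal_le_ofReal (le_of_eq ?_)
  rw [hC1, ← hV, mul_pow B]
  have : ((2 : ℝ) ^ i * Δ) ^ n ≠ 0 := by positivity
  field_simp

theorem trace3 (hn : 2 ≤ n) (M : ℝ) {Cσ d cd : ℝ} (hcd : 0 < cd) (hC : 0 < Cσ) (hd : (n : ℝ) - 2 < d) : ∃ C : ℝ, 0 < C ∧
    ∀ (Ω : SE) σ, IsMixedPair M Cσ d cd Ω σ → ∀ t r : E → ℝ,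
    (∀ x ∈ Ω, 0 < t x) → (∀ x, dl Ω x ≤ t x) → (∀ x ∈ Ω, t x ≤ diam Ω) → (∀ x, r x ≤ t x) → (∀ x y, r x ≤ r y + dist x y) → (∀ x, 0 < r x) →
    ∀ b : ℝ, 0 < b → ∀ P ∈ frontier Ω, r P ^ nm ≤ b * σ.real (ball P (r P)) →
    ∫⁻ x, bw Ω σ t (x, P) ≤ ofReal (C * b) := by
  obtain ⟨k, hk⟩ := pow_two_big 6000000
  set cl := min cd 1 / (2 * 3) ^ d with hcl
  have hcl0 : 0 < cl := by positivity
  have hd0 := d_pos hn hd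
  have hI : (∫⁻ x : E, ofReal ((1 + ‖x‖) ^ (-(d + 2)))) < ⊤ := finite_integral_one_add_norm (by
    rw [finrank_euclideanSpace_fin]; linarith)
  set I := ∫⁻ x : E, ofReal ((1 + ‖x‖) ^ (-(d + 2)))
  set C0 := Cσ ^ k * cl⁻¹ * 5 ^ (d + 2) with hC0
  have hC00 : 0 < C0 := by positivity
  refine ⟨C0 * (I.toReal + 1), by positivity, ?_⟩
  intro Ω σ hP t r htp htd htD hrt hrL hr0 b hb P hPf hPr
  have := sig_fin hP
  have hr := hr0 P
  have key : ∀ x, bw Ω σ t (x, P) ≤ ofReal (C0 * b) * (ofReal ((r P ^ n)⁻¹) * ofReal ((1 + ‖x - P‖ / r P) ^ (-(d + 2)))) := by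
    intro x
    by_cases h : (x, P) ∈ WW Ω t
    swap
    · rw [bw, indicator_of_notMem h]; exact bot_le
    rw [bw, indicator_of_mem h]
    obtain ⟨hx, -, hxP⟩ := h
    dsimp only at hx hxP ⊢
    have ht := htp x hx
    have m2 := bx_low oz hP ht (htd x) hxP (R := 3 * t x) k (by
      have : 2 ^ k * (t x / 1000000) = 2 ^ k / 1000000 * t x := by ring
      rw [this]
      have : 6 ≤ (2 : ℝ) ^ k / 1000000 := by rw [le_div_iff₀ nz]; linarith
      nlinarith)
    have hb0 := bb_pos oz hP ht (htd x)
    have hbr : 0 < σ.real (bb t x) := ENNReal.toReal_pos hb0 (measure_ne_top _ _)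
    have m2' : σ.real (ball P (3 * t x)) ≤ Cσ ^ k * σ.real (bb t x) := by
      have := ENNReal.toReal_mono (ENNReal.mul_ne_top ofReal_ne_top (measure_ne_top _ _)) m2
      rwa [ENNReal.toReal_mul, ENNReal.toReal_ofReal pz] at this
    have hrP := hrL P x
    have hrx := hrt x
    have m3 := sig_low hn hP hPf (s := r P) (r := 3 * t x) (K := 3) hr nz lz (by have := htD x hx; linarith)
    rw [← hcl] at m3
    set T := t x / r P with hT
    have hT0 : 0 < T := by positivity
    have htT : t x = T * r P := by rw [hT]; field_simp
    set y := ‖x - P‖ / r P with hy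
    have hy0 : 0 ≤ y := by positivity
    have hyT : 1 + y ≤ 5 * T := by
      rw [hy, hT, ← mul_div_assoc, le_div_iff₀ hr, add_mul, div_mul_cancel₀ _ hr.ne', ← dist_eq_norm, dist_comm]; linarith
    have m4 : cl * T ^ d * r P ^ nm ≤ b * (Cσ ^ k * σ.real (bb t x)) := by
      have a1 : T ^ d ≤ (3 * t x / r P) ^ d := Real.rpow_le_rpow hT0.le (by rw [hT]; gcongr; linarith) hd0.le
      calc _ ≤ cl * (3 * t x / r P) ^ d * (b * σ.real (ball P (r P))) := by gcongr
        _ = b * (cl * (3 * t x / r P) ^ d * σ.real (ball P (r P))) := by ring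
        _ ≤ _ := mul_le_mul_of_nonneg_left (m3.trans m2') hb.le
    have e0 : ofReal (σ.real (bb t x)) = σ (bb t x) := ofReal_toReal (measure_ne_top _ _)
    rw [← e0, ← ofReal_inv_of_pos hbr, ← ofReal_mul pz,
      ← ofReal_mul pz, ← ofReal_mul pz]
    refine ofReal_le_ofReal ?_
    set S := σ.real (bb t x)
    have m5 : (1 + y) ^ (d + 2) ≤ 5 ^ (d + 2) * (T ^ d * T ^ 2) := by
      rw [← rpow_natCast T 2, Nat.cast_ofNat, ← Real.rpow_add hT0, ← Real.mul_rpow nz hT0.le]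
      exact Real.rpow_le_rpow pz hyT pz
    have m6 : S⁻¹ ≤ b * Cσ ^ k * cl⁻¹ * (T ^ d)⁻¹ * (r P ^ nm)⁻¹ := by
      rw [inv_eq_one_div, div_le_iff₀ hbr]
      have e1 : b * Cσ ^ k * cl⁻¹ * (T ^ d)⁻¹ * (r P ^ nm)⁻¹ * S = (b * (Cσ ^ k * S)) / (cl * T ^ d * r P ^ nm) := by field_simp
      rw [e1, one_le_div pz]; exact m4
    have m7 : (T ^ d)⁻¹ * (T ^ 2)⁻¹ ≤ 5 ^ (d + 2) * (1 + y) ^ (-(d + 2)) := by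
      rw [Real.rpow_neg pz, ← mul_inv, ← div_eq_mul_inv, inv_eq_one_div, div_le_div_iff₀ pz pz, one_mul]
      exact m5
    calc (t x ^ 2)⁻¹ * S⁻¹ ≤ (t x ^ 2)⁻¹ * (b * Cσ ^ k * cl⁻¹ * (T ^ d)⁻¹ * (r P ^ nm)⁻¹) := by gcongr
      _ = b * Cσ ^ k * cl⁻¹ * (r P ^ n)⁻¹ * ((T ^ d)⁻¹ * (T ^ 2)⁻¹) := by
          rw [htT, ← sq_inv_pow hn hr]; field_simp
      _ ≤ b * Cσ ^ k * cl⁻¹ * (r P ^ n)⁻¹ * (5 ^ (d + 2) * (1 + y) ^ (-(d + 2))) := by gcongr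
      _ = _ := by rw [hC0]; ring
  refine (lintegral_mono key).trans ?_
  rw [lintegral_const_mul' _ _ ofReal_ne_top, lintegral_const_mul' _ _ ofReal_ne_top]
  rw [← lint_aff (fun x => ofReal ((1 + ‖x - P‖ / r P) ^ (-(d + 2)))) P hr]
  have : ∀ y : E, ofReal ((1 + ‖P + r P • y - P‖ / r P) ^ (-(d + 2))) = ofReal ((1 + ‖y‖) ^ (-(d + 2))) := fun y => by
    rw [add_sub_cancel_left, norm_smul, norm_of_nonneg hr.le, mul_div_cancel_left₀ _ hr.ne']
  simp_rw [this]
  change _ * I ≤ _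
  obtain ⟨i, hi⟩ : ∃ i, i = I.toReal := ⟨_, rfl⟩
  rw [show I = ofReal i by rw [hi, ofReal_toReal hI.ne], ← ofReal_mul pz,
    ENNReal.toReal_ofReal (by rw [hi]; positivity)]
  refine ofReal_le_ofReal ?_
  have e1 : C0 * (i + 1) * b = C0 * b * i + C0 * b := by ring
  have e2 := mul_pos hC00 hb
  linarith

theorem lip_meas {t : E → ℝ} (h : ∀ x y, t x ≤ t y + dist x y) : Continuous t :=
  LipschitzWith.continuous (K := 1) (LipschitzWith.of_le_add_mul 1 (by simpa using h))

theorem dl_pos (ho : IsOpen Ω) (hf : (frontier Ω).Nonempty) {x : E} (hx : x ∈ Ω) : 0 < dl Ω x := by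
  refine lt_of_le_of_ne infDist_nonneg fun h => ?_
  have := (isClosed_frontier.mem_iff_infDist_zero hf).2 h.symm
  rw [ho.frontier_eq] at this; exact this.2 hx

variable (n) in
theorem hardy (hn : 2 ≤ n) (M Cσ d cd : ℝ) : ∃ C : ℝ, 0 < C ∧
    ∀ (Ω : SE) σ, IsMixedPair M Cσ d cd Ω σ → ∀ r : E → ℝ,
    (∀ x, 0 < r x) → (∀ x y, r x ≤ r y + dist x y) → (∀ x ∈ Ω, 100 * r x ≤ diam Ω) →
    ∀ b : ℝ, 0 < b → (∀ P ∈ frontier Ω, r P ^ nm ≤ b * σ.real (ball P (r P))) →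
    ∀ φ : E → ℝ, ContinuousOn φ (closure Ω) → (∀ x ∈ Ω, ContDiffAt ℝ 1 φ x) →
    ∫⁻ x in Ω, ofReal ((max (dl Ω x) (r x) ^ 2)⁻¹) * ‖φ x‖ₑ ^ 2 ≤
      ofReal C * ((∫⁻ z in Ω, gg φ z) + ofReal b * ∫⁻ P in frontier Ω, ‖φ P‖ₑ ^ 2 ∂σ) := by
  by_cases hyp : 1 < M ∧ 0 < cd ∧ 0 < Cσ ∧ (n : ℝ) - 2 < d
  swap
  · exact ⟨1, one_pos, fun Ω σ hP => absurd ⟨hP.nta.M_gt_one, hP.cd_pos, hP.Cσ_pos, hP.d_gt⟩ hyp⟩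
  obtain ⟨hM, hcd, hC, hd⟩ := hyp
  have hd0 := d_pos hn hd
  set q : ℝ := 2 ^ nm / 2 ^ d with hq
  have hq0 : 0 < q := by positivity
  have hq1 : q < 1 := by
    rw [hq, div_lt_one pz, ← rpow_natCast]
    exact Real.rpow_lt_rpow_of_exponent_lt nz (by push_cast [Nat.cast_sub hn]; linarith)
  have hqi : 1 < q⁻¹ := (one_lt_inv₀ hq0).2 hq1
  set p := min 2 ((1 + q⁻¹) / 2) with hpdef
  have hp1 : 1 < p := lt_min nz lz
  have hp4 : p < 4 := (min_le_left _ _).trans_lt nz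
  have hpq : p * q < 1 := by
    have : p * q ≤ (1 + q⁻¹) / 2 * q := by gcongr; exact min_le_right _ _
    have e : (1 + q⁻¹) / 2 * q = (q + 1) / 2 := by field_simp
    linarith
  obtain ⟨K, c, C1, hK, hc, hC1, H1⟩ := m1pt hn hM hp1
  obtain ⟨C2, hC2, H2⟩ := trace2 hn M (d := d) hK hc hcd hC
  obtain ⟨C3, hC3, H3⟩ := trace3 hn M hcd hC hd
  obtain ⟨C4, hC4, H4⟩ := poinc hn (by linarith : 0 < K) hc hp1 hp4
  have hpqi : 0 < (1 - p * q)⁻¹ := inv_pos.2 lz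
  refine ⟨2 * C1 * (C4 + C2 * (1 - p * q)⁻¹) + 2 * C3, by positivity, ?_⟩
  intro Ω σ hP r hr0 hrL hrD b hb hrP φ hφc hφ
  have := sig_fin hP
  have ho := hP.nta.isOpen
  have hf := fr_ne oz hP.bounded hP.nonempty
  obtain ⟨t, htdef⟩ : ∃ t : E → ℝ, ∀ x, t x = max (dl Ω x) (r x) := ⟨_, fun _ => rfl⟩
  simp_rw [← htdef]
  have htp : ∀ x, 0 < t x := fun x => by rw [htdef]; exact lt_max_of_lt_right (hr0 x)
  have htd : ∀ x, dl Ω x ≤ t x := fun x => by rw [htdef]; exact le_max_left _ _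
  have htr : ∀ x, r x ≤ t x := fun x => by rw [htdef]; exact le_max_right _ _
  have htL : ∀ x y, t x ≤ t y + dist x y := fun x y => by
    rw [htdef x]; exact max_le ((dl_lip Ω x y).trans (by linarith [htd y])) ((hrL x y).trans (by linarith [htr y]))
  have htD : ∀ x ∈ Ω, t x ≤ diam Ω := fun x hx => by
    rw [htdef]; exact max_le (dl_le_diam hP.bounded hf (subset_closure hx)) (by linarith [hrD x hx, hr0 x])
  have htm : Measurable t := (lip_meas htL).measurable
  have hbm := bw_meas ho σ htm
  set φ' := (frontier Ω).indicator φ with hφ'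
  have hφm : Measurable φ' := by
    classical
    have := ContinuousOn.measurable_piecewise (hφc.mono frontier_subset_closure) (continuousOn_const (c := (0 : ℝ))) isClosed_frontier.measurableSet
    exact this
  have hMM1 : Measurable fun x => MM Ω φ K c p (t x) x := MM_meas ho φ measurable_id htm K c p
  have hMM2 : Measurable fun w : E × E => MM Ω φ K c p (t w.1) w.2 := MM_meas ho φ measurable_snd (htm.comp measurable_fst) K c p
  have hf2 : Measurable fun w : E × E => ‖φ' w.2‖ₑ ^ 2 := (hφm.comp measurable_snd).enorm.pow_const 2
  have key : ∀ x ∈ Ω, ofReal ((t x ^ 2)⁻¹) * ‖φ x‖ₑ ^ 2 ≤ ofReal (2 * C1) * (ofReal ((t x ^ 2)⁻¹) * MM Ω φ K c p (t x) x) +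
      (ofReal (2 * C1) * (∫⁻ P, bw Ω σ t (x, P) * MM Ω φ K c p (t x) P ∂σ) + 2 * ∫⁻ P, bw Ω σ t (x, P) * ‖φ' P‖ₑ ^ 2 ∂σ) := by
    intro x hx
    set w := ofReal ((t x ^ 2)⁻¹) * (σ (bb t x))⁻¹ with hw
    have hb0 := bb_pos oz hP (htp x) (htd x)
    have hwt : w ≠ ⊤ := ENNReal.mul_ne_top ofReal_ne_top (ENNReal.inv_ne_top.2 hb0)
    set S := bb t x ∩ frontier Ω
    have hS : MeasurableSet S := measurableSet_ball.inter isClosed_frontier.measurableSet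
    have hSσ : σ S = σ (bb t x) := measure_inter_conull hP.null_outside
    have hbw : ∀ P, bw Ω σ t (x, P) = S.indicator (fun _ => w) P := fun P => by
      by_cases h : P ∈ S
      · rw [indicator_of_mem h, bw, indicator_of_mem (show (x, P) ∈ WW Ω t from ⟨hx, h.2, h.1⟩)]
      · rw [indicator_of_notMem h, bw, indicator_of_notMem (show (x, P) ∉ WW Ω t from fun h' => h ⟨h'.2.2, h'.2.1⟩)]
    have hww : w * σ S = ofReal ((t x ^ 2)⁻¹) := by
      rw [hSσ, hw, mul_assoc, ENNReal.inv_mul_cancel hb0 (measure_ne_top _ _), mul_one]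
    have hi : ∀ F : E → ℝ≥0∞, ∫⁻ P, bw Ω σ t (x, P) * F P ∂σ = w * ∫⁻ P in S, F P ∂σ := fun F => by
      rw [← lintegral_const_mul' _ _ hwt, ← lintegral_indicator hS]
      refine lintegral_congr fun P => ?_
      rw [hbw]
      by_cases h : P ∈ S <;> simp [h]
    rw [hi, hi, ← hww]
    have hpt : ∀ P ∈ S, ‖φ x‖ₑ ^ 2 ≤ ofReal (2 * C1) * MM Ω φ K c p (t x) x + (ofReal (2 * C1) * MM Ω φ K c p (t x) P + 2 * ‖φ' P‖ₑ ^ 2) := by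
      intro P hPS
      have h1 := H1 Ω hP.nta hP.bounded hf φ hφc hφ x hx P hPS.2 (t x) (htp x) (htd x) (by
        rw [htdef]
        rcases le_total (r x) (dl Ω x) with h | h
        · left; exact max_eq_left h
        · right; rw [max_eq_right h]; exact hrD x hx) (by rw [dist_comm]; exact hPS.1)
      have h2 := en_tri (φ x) (φ P) 0
      rw [sub_zero, sub_zero] at h2
      rw [hφ', indicator_of_mem hPS.2, ← add_assoc, ← mul_add, ofReal_mul nz, ofReal_ofNat, mul_assoc]
      exact h2.trans (by gcongr)
    have : σ S * ‖φ x‖ₑ ^ 2 ≤ ofReal (2 * C1) * MM Ω φ K c p (t x) x * σ S + (ofReal (2 * C1) * (∫⁻ P in S, MM Ω φ K c p (t x) P ∂σ)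
        + 2 * ∫⁻ P in S, ‖φ' P‖ₑ ^ 2 ∂σ) := by
      rw [mul_comm, ← setLIntegral_const, ← setLIntegral_const, ← lintegral_const_mul' _ _ ofReal_ne_top, ← lintegral_const_mul' _ _ sz,
        ← lintegral_add_left (by exact (hMM2.comp (measurable_prodMk_left (x := x))).const_mul _), ← lintegral_add_left measurable_const]
      exact setLIntegral_mono' hS hpt
    calc _ = w * (σ S * ‖φ x‖ₑ ^ 2) := by ring
      _ ≤ _ := mul_le_mul' le_rfl this
      _ = _ := by ring
  refine (setLIntegral_mono' ho.measurableSet key).trans ?_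
  have mt : Measurable fun x => ofReal ((t x ^ 2)⁻¹) := by fun_prop
  have mI2 : Measurable fun x => ∫⁻ P, bw Ω σ t (x, P) * MM Ω φ K c p (t x) P ∂σ := Measurable.lintegral_prod_right' (hbm.mul hMM2)
  have m1 : Measurable fun x => ofReal (2 * C1) * (ofReal ((t x ^ 2)⁻¹) * MM Ω φ K c p (t x) x) := (mt.mul hMM1).const_mul _
  have m2 : Measurable fun x => ofReal (2 * C1) * (∫⁻ P, bw Ω σ t (x, P) * MM Ω φ K c p (t x) P ∂σ) := mI2.const_mul _
  rw [lintegral_add_left m1, lintegral_add_left m2, lintegral_const_mul' _ _ ofReal_ne_top,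
    lintegral_const_mul' _ _ ofReal_ne_top, lintegral_const_mul' _ _ sz]
  have T1 := H4 Ω ho φ t (fun x => (htp x).le) (fun x _ => htp x) htL htd
  have T2 : ∫⁻ x in Ω, ∫⁻ P, bw Ω σ t (x, P) * MM Ω φ K c p (t x) P ∂σ ≤ ofReal (C2 * (1 - p * q)⁻¹) * ∫⁻ z in Ω, gg φ z := by
    refine le_trans ?_ (H2 Ω σ hP t htm (fun x _ => htp x) htd htD p lz hpq φ)
    have := lintegral_prod (μ := volume) (ν := σ) (fun w : E × E => bw Ω σ t w * MM Ω φ K c p (t w.1) w.2) (hbm.mul hMM2).aemeasurable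
    rw [this]
    exact setLIntegral_le_lintegral _ _
  have T3 : ∫⁻ x in Ω, ∫⁻ P, bw Ω σ t (x, P) * ‖φ' P‖ₑ ^ 2 ∂σ ≤ ofReal (C3 * b) * ∫⁻ P in frontier Ω, ‖φ P‖ₑ ^ 2 ∂σ := by
    refine (setLIntegral_le_lintegral _ _).trans ?_
    rw [lintegral_lintegral_swap (hbm.mul hf2).aemeasurable, ← lintegral_indicator isClosed_frontier.measurableSet,
      ← lintegral_const_mul' _ _ ofReal_ne_top]
    refine lintegral_mono fun P => ?_
    by_cases h : P ∈ frontier Ω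
    · have mP : Measurable fun x => bw Ω σ t (x, P) := hbm.comp (measurable_prodMk_right (y := P))
      rw [lintegral_mul_const _ mP, indicator_of_mem h, hφ', indicator_of_mem h]
      exact mul_le_mul' (H3 Ω σ hP t r (fun x _ => htp x) htd htD htr hrL hr0 b hb P h (hrP P h)) le_rfl
    · simp [hφ', h]
  refine (add_le_add (mul_le_mul' le_rfl T1) (add_le_add (mul_le_mul' le_rfl T2) (mul_le_mul' le_rfl T3))).trans ?_
  set G := ∫⁻ z in Ω, gg φ z
  set F := ∫⁻ P in frontier Ω, ‖φ P‖ₑ ^ 2 ∂σ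
  rw [← mul_assoc, ← ofReal_mul pz, ← mul_assoc, ← ofReal_mul pz, ← add_assoc, ← add_mul,
    ← ofReal_add pz pz, ← ofReal_ofNat 2, ofReal_mul (p := C3) hC3.le, mul_assoc (ofReal C3), ← mul_assoc _ (ofReal C3),
    ← ofReal_mul pz, mul_add]
  refine add_le_add (mul_le_mul' (ofReal_le_ofReal ?_) le_rfl) (mul_le_mul' (ofReal_le_ofReal ?_) le_rfl)
  · rw [mul_add]; linarith
  · have : 0 < 2 * C1 * (C4 + C2 * (1 - p * q)⁻¹) := by positivity
    linarith

theorem av_le {F : E → ℝ} (hF : Integrable fun y => F y * etk y) {c ε : ℝ}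
    (h : ∀ y : E, ‖y‖ < 1 → |F y - c| ≤ ε) : |(ceta n)⁻¹ * (∫ y, F y * etk y) - c| ≤ ε := by
  have hc := ceta_pos n
  have e : (ceta n)⁻¹ * (∫ y, F y * etk y) - c = (ceta n)⁻¹ * ∫ y, (F y - c) * etk y := by
    simp_rw [sub_mul]
    rw [integral_sub hF (etk_integrable.const_mul c), integral_const_mul, mul_sub]
    congr 1
    show c = (ceta n)⁻¹ * (c * ceta n)
    field_simp
  rw [e, abs_mul, abs_of_pos (inv_pos.2 hc), inv_mul_le_iff₀ hc]
  have : ‖∫ y, (F y - c) * etk y‖ ≤ ∫ y : E, ε * etk y := by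
    refine norm_integral_le_of_norm_le (etk_integrable.const_mul ε) (Filter.Eventually.of_forall fun y => ?_)
    rw [norm_mul, norm_eq_abs, norm_eq_abs, abs_of_nonneg (etk_nonneg y)]
    by_cases hy : ‖y‖ < 1
    · exact mul_le_mul_of_nonneg_right (h y hy) (etk_nonneg y)
    · rw [etk_zero (not_lt.1 hy)]; simp
  rw [integral_const_mul] at this
  rw [mul_comm]; exact this

variable (n) in
theorem molli : ∃ C : ℝ, 0 < C ∧ ∀ f : E → ℝ, LocallyIntegrable f → ∀ τ, 0 < τ →
    ∃ ψ : E → ℝ, CD ψ ∧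
      (∀ x c ε, (∀ z ∈ ball x τ, |f z - c| ≤ ε) → |ψ x - c| ≤ ε) ∧
      (∀ x x' c ε, (∀ t, ‖t‖ < τ → |f (x + t) - f (x' + t) - c| ≤ ε) → |ψ x - ψ x' - c| ≤ ε) ∧
      (∀ x c ε, (∀ z ∈ ball x (2 * τ), |f z - c| ≤ ε) → ‖fderiv ℝ ψ x‖ ≤ C / τ * ε) := by
  obtain ⟨L, hL⟩ := etk_lip n
  have hc := ceta_pos n
  set V := (volume (ball oE 2)).toReal with hV
  have hV0 : 0 ≤ V := ENNReal.toReal_nonneg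
  refine ⟨(ceta n)⁻¹ * (L * V) + 1, by positivity, fun f hf τ hτ => ?_⟩
  have hsm : CD (fun z : E => etk (τ⁻¹ • z)) := etk_contDiff.comp (by fun_prop)
  have hcs : HasCompactSupport (fun z : E => etk (τ⁻¹ • z)) := by
    refine (isCompact_closedBall oE τ).of_isClosed_subset (isClosed_tsupport _)
      (closure_minimal (fun z hz => ?_) isClosed_closedBall)
    exact (etk_supp (x := 0) (z := z) hτ (by simpa using hz)).le
  have hI : ∀ x : E, Integrable fun y => f (x + τ • y) * etk y := fun x => by
    have h1 : Integrable fun z => f z * etk (τ⁻¹ • (z - x)) := by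
      have := hf.integrable_smul_right_of_hasCompactSupport (g := fun z => etk (τ⁻¹ • (z - x)))
        (etk_contDiff.continuous.comp (by fun_prop)) (hcs.comp_homeomorph (Homeomorph.subRight x))
      exact this
    have := (integrable_aff _ x hτ).2 h1
    simpa [smul_smul, inv_mul_cancel₀ hτ.ne'] using this
  have hval : ∀ x : E, (ceta n)⁻¹ * ∫ y, f (x + τ • y) * etk y =
      (ceta n)⁻¹ * ((τ ^ n)⁻¹ * (convolution f (fun z : E => etk (τ⁻¹ • z))
        (ContinuousLinearMap.mul ℝ ℝ) volume) x) := fun x => by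
    have := int_aff (fun z => f z * etk (τ⁻¹ • (z - x))) x hτ
    simp only [add_sub_cancel_left, smul_smul, inv_mul_cancel₀ hτ.ne', one_smul] at this
    rw [this, convolution_def]
    congr 3; ext z
    rw [ContinuousLinearMap.mul_apply']
    have e : etk (τ⁻¹ • (x - z)) = etk (τ⁻¹ • (z - x)) := by
      unfold etk; rw [norm_smul, norm_smul, norm_sub_rev]
    rw [e]
  have mem : ∀ (x y : E) (s : ℝ), ‖y‖ < s → x + τ • y ∈ ball x (s * τ) := fun x y s hy => by
    rw [mem_ball, dist_eq_norm, add_sub_cancel_left, norm_smul, norm_eq_abs, abs_of_pos hτ]; nlinarith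
  refine ⟨fun x => (ceta n)⁻¹ * ∫ y, f (x + τ • y) * etk y, ?_, ?_, ?_, ?_⟩
  · simp_rw [hval]
    exact contDiff_const.mul (contDiff_const.mul (hcs.contDiff_convolution_right _ hf hsm))
  · intro x c ε h
    exact av_le (hI x) fun y hy => h _ (by simpa using mem x y 1 hy)
  · intro x x' c ε h
    have h2 := av_le (F := fun y => f (x + τ • y) - f (x' + τ • y)) (c := c) (ε := ε)
      (by simp_rw [sub_mul]; exact (hI x).sub (hI x')) fun y hy => h (τ • y) (by
        rw [norm_smul, norm_eq_abs, abs_of_pos hτ]; nlinarith)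
    simp_rw [sub_mul] at h2
    rwa [integral_sub (hI x) (hI x'), mul_sub] at h2
  · intro x c ε h
    have hε : 0 ≤ ε := (abs_nonneg _).trans (h x (mem_ball_self pz))
    refine (norm_fderiv_le_of_lip' ℝ (C := (ceta n)⁻¹ * (L * V) / τ * ε) pz ?_).trans
      (mul_le_mul_of_nonneg_right (div_le_div_of_nonneg_right lz hτ.le) hε)
    filter_upwards [ball_mem_nhds x hτ] with x' hx'
    obtain ⟨t, rfl⟩ : ∃ t, x' = x + τ • t := ⟨τ⁻¹ • (x' - x), by simp [smul_smul, mul_inv_cancel₀ hτ.ne']⟩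
    have ht : ‖t‖ < 1 := by
      rw [mem_ball, dist_eq_norm, add_sub_cancel_left, norm_smul, norm_eq_abs, abs_of_pos hτ] at hx'
      nlinarith
    have e1 : ∫ y, f (x + τ • t + τ • y) * etk y = ∫ y, f (x + τ • y) * etk (y - t) := by
      rw [← integral_add_right_eq_self (fun y => f (x + τ • y) * etk (y - t)) t]
      congr 1; ext y; rw [add_sub_cancel_right]; congr 2; rw [smul_add]; abel
    have hI' : Integrable fun y => f (x + τ • y) * etk (y - t) := by
      have := (hI (x + τ • t)).comp_sub_right t
      refine this.congr (Filter.Eventually.of_forall fun y => ?_)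
      simp only [smul_sub]; congr 2; abel
    have e2 : ∫ y : E, etk (y - t) = ∫ y : E, etk y := integral_sub_right_eq_self etk t
    have e3 : (∫ y, f (x + τ • y) * etk (y - t)) - ∫ y, f (x + τ • y) * etk y =
        ∫ y, (f (x + τ • y) - c) * (etk (y - t) - etk y) := by
      have : ∀ y, (f (x + τ • y) - c) * (etk (y - t) - etk y) = (f (x + τ • y) * etk (y - t) -
        f (x + τ • y) * etk y) - (c * etk (y - t) - c * etk y) := fun y => by ring
      have i1 := (etk_integrable (n := n)).comp_sub_right t
      have i2 : Integrable fun y => f (x + τ • y) * etk (y - t) - f (x + τ • y) * etk y := hI'.sub (hI x)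
      have i3 : Integrable fun y => c * etk (y - t) - c * etk y := (i1.const_mul c).sub (etk_integrable.const_mul c)
      rw [integral_congr_ae (Filter.Eventually.of_forall this), integral_sub i2 i3, integral_sub hI' (hI x), integral_sub (i1.const_mul c) (etk_integrable.const_mul c),
        integral_const_mul, integral_const_mul, e2]; ring
    have e4 : ‖∫ y, (f (x + τ • y) - c) * (etk (y - t) - etk y)‖ ≤ ε * (L * ‖t‖) * V := by
      have hs : ∀ y ∉ ball oE 2, (f (x + τ • y) - c) * (etk (y - t) - etk y) = 0 := fun y hy => by
        have hy2 : 2 ≤ ‖y‖ := by simpa using hy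
        have : ‖y‖ ≤ ‖y - t‖ + ‖t‖ := by simpa using norm_add_le (y - t) t
        rw [etk_zero lz, etk_zero lz]; simp
      rw [← setIntegral_eq_integral_of_forall_compl_eq_zero hs]
      refine norm_setIntegral_le_of_norm_le_const measure_ball_lt_top fun y hy => ?_
      rw [norm_mul]
      refine mul_le_mul (h _ (mem x y 2 (by simpa using hy))) ?_ (norm_nonneg _) hε
      have := hL.dist_le_mul (y - t) y
      rw [dist_eq_norm, dist_eq_norm, sub_sub_cancel_left, norm_neg] at this
      exact this
    rw [e1, ← mul_sub, e3, norm_mul, norm_eq_abs, abs_of_pos (inv_pos.2 hc), add_sub_cancel_left, norm_smul,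
      norm_of_nonneg hτ.le]
    calc _ ≤ (ceta n)⁻¹ * (ε * (L * ‖t‖) * V) := mul_le_mul_of_nonneg_left e4 pz
      _ = _ := by field_simp

theorem lip_smooth {f : E → ℝ} {K : ℝ} (hK : 0 ≤ K) (hf : ∀ x y, f x ≤ f y + K * dist x y) {τ : ℝ}
    (hτ : 0 < τ) : ∃ ψ : E → ℝ, CD ψ ∧ (∀ x, |ψ x - f x| ≤ K * τ) ∧
      ∀ x, ‖fderiv ℝ ψ x‖ ≤ K := by
  obtain ⟨C, -, H⟩ := molli n
  have ha : ∀ x y, |f x - f y| ≤ K * dist x y := fun x y => abs_le.2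
    ⟨by rw [dist_comm]; linarith [hf y x], by linarith [hf x y]⟩
  have hcf : Continuous f := (LipschitzWith.of_dist_le_mul (K := ⟨K, hK⟩) ha).continuous
  obtain ⟨ψ, h0, h1, h2, -⟩ := H f hcf.locallyIntegrable τ hτ
  refine ⟨ψ, h0, fun x => h1 x _ _ fun z hz => (ha z x).trans ?_, fun x => ?_⟩
  · exact mul_le_mul_of_nonneg_left (mem_ball.1 hz).le hK
  · refine norm_fderiv_le_of_lip' ℝ hK (Filter.Eventually.of_forall fun x' => ?_)
    have := h2 x' x 0 (K * ‖x' - x‖) fun t _ => by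
      have := ha (x' + t) (x + t)
      rw [dist_add_right, dist_eq_norm] at this
      simpa using this
    simpa using this

theorem c1_approx {φ : E → ℝ} (h1 : ContDiff ℝ 1 φ) (hc : HasCompactSupport φ) {ε : ℝ} (hε : 0 < ε) :
    ∃ ψ : E → ℝ, CD ψ ∧ HasCompactSupport ψ ∧ tsupport ψ ⊆ cthickening ε (tsupport φ) ∧
      (∀ x, |ψ x - φ x| ≤ ε) ∧ ∀ x, ‖fderiv ℝ ψ x - fderiv ℝ φ x‖ ≤ ε := by
  obtain ⟨C, -, H⟩ := molli n
  have u1 := hc.uniformContinuous_of_continuous h1.continuous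
  have u2 := (hc.fderiv ℝ).uniformContinuous_of_continuous (h1.continuous_fderiv sz)
  obtain ⟨d1, p1, q1⟩ := Metric.uniformContinuous_iff.1 u1 ε hε
  obtain ⟨d2, p2, q2⟩ := Metric.uniformContinuous_iff.1 u2 ε hε
  obtain ⟨τ, hτ, t1, t2, t3⟩ : ∃ τ : ℝ, 0 < τ ∧ τ ≤ d1 ∧ 2 * τ ≤ d2 ∧ τ ≤ ε :=
    ⟨min d1 (min (d2 / 2) ε), by positivity, min_le_left _ _,
      by linarith [(min_le_right d1 (min (d2 / 2) ε)).trans (min_le_left _ _)],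
      (min_le_right _ _).trans (min_le_right _ _)⟩
  obtain ⟨ψ, h0, hA, hB, -⟩ := H φ h1.continuous.locallyIntegrable τ hτ
  have hs : tsupport ψ ⊆ cthickening ε (tsupport φ) := by
    refine closure_minimal (fun x hx => ?_) isClosed_cthickening
    by_contra hn'
    have h9 := hA x 0 0 fun z hz => ?_
    · exact hx (abs_nonpos_iff.1 (by simpa only [sub_zero] using h9))
    have : z ∉ tsupport φ := fun hz' => hn' (mem_cthickening_of_dist_le x z ε _ hz' (by
      rw [dist_comm]; exact (mem_ball.1 hz).le.trans t3))
    simp [image_eq_zero_of_notMem_tsupport this]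
  refine ⟨ψ, h0, (hc.isCompact.cthickening).of_isClosed_subset (isClosed_tsupport _) hs, hs, fun x => hA x _ _ fun z hz => ?_,
    fun x => ?_⟩
  · exact (q1 (a := z) (b := x) ((mem_ball.1 hz).trans_le t1)).le
  · have hd : fderiv ℝ ψ x - fderiv ℝ φ x = fderiv ℝ (fun y => ψ y - fderiv ℝ φ x y) x := by
      rw [fderiv_fun_sub (h0.differentiable sz x) (by fun_prop), ContinuousLinearMap.fderiv]
    rw [hd]
    refine norm_fderiv_le_of_lip' ℝ hε.le ?_
    filter_upwards [ball_mem_nhds x hτ] with x' hx'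
    have := hB x' x (fderiv ℝ φ x (x' - x)) (ε * ‖x' - x‖) fun t ht => by
      have hcv := (convex_ball x (2 * τ)).norm_image_sub_le_of_norm_fderiv_le (𝕜 := ℝ)
        (f := fun y => φ y - fderiv ℝ φ x y) (C := ε) (x := x + t) (y := x' + t) (fun y _ => by
          have := (h1.differentiable sz); fun_prop) (fun y hy => by
          rw [fderiv_fun_sub (h1.differentiable sz y) (by fun_prop), ContinuousLinearMap.fderiv, ← dist_eq_norm]
          exact (q2 (a := y) (b := x) ((mem_ball.1 hy).trans_le t2)).le) (by simp; linarith) (by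
            rw [mem_ball] at *; rw [dist_eq_norm] at *
            calc _ = ‖(x' - x) + t‖ := by congr 1; abel
              _ ≤ _ := norm_add_le _ _
              _ < _ := by linarith)
      rw [add_sub_add_right_eq_sub] at hcv
      rw [norm_eq_abs] at hcv
      convert hcv using 2
      simp only [map_add, map_sub]; ring
    rw [norm_eq_abs]
    convert this using 2
    rw [map_sub]; ring

theorem av_sq {f : E → ℝ} (hf : IntegrableOn f (ball oE 1)) (c : ℝ) :
    volume (ball oE 1) * ‖(volume (ball oE 1)).toReal⁻¹ * (∫ y in ball oE 1, f y) - c‖ₑ ^ 2 ≤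
      ∫⁻ y in ball oE 1, ‖c - f y‖ₑ ^ 2 := by
  have h0 := vb_pos n; have ht := vb_fin n
  have : IsFiniteMeasure (volume.restrict (ball oE 1)) := ⟨by simpa using ht.lt_top⟩
  set V := volume (ball oE 1) with hV
  have hv : 0 < V.toReal := ENNReal.toReal_pos h0 ht
  set S := V.toReal⁻¹ * (∫ y in ball oE 1, f y) - c with hS
  have e1 : V.toReal * S = -∫ y in ball oE 1, (c - f y) := by
    rw [integral_sub (integrable_const c) hf, setIntegral_const, smul_eq_mul, Measure.real, ← hV, hS]
    field_simp; ring
  have e2 : V * ‖S‖ₑ ≤ ∫⁻ y in ball oE 1, ‖c - f y‖ₑ := by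
    calc V * ‖S‖ₑ = ‖V.toReal * S‖ₑ := by
          rw [enorm_mul, Real.enorm_of_nonneg hv.le, ofReal_toReal ht]
      _ ≤ _ := by rw [e1, enorm_neg]; exact enorm_integral_le_lintegral_enorm _
  have e3 := csq (volume.restrict (ball oE 1)) (f := fun y => ‖c - f y‖ₑ)
    ((aemeasurable_const.sub hf.1.aemeasurable).enorm)
  rw [Measure.restrict_apply_univ, ← hV] at e3
  have e4 : V * (V * ‖S‖ₑ ^ 2) ≤ V * ∫⁻ y in ball oE 1, ‖c - f y‖ₑ ^ 2 := by
    refine le_trans (le_of_eq ?_) ((pow_le_pow_left' e2 2).trans e3); ring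
  exact (ENNReal.mul_le_mul_iff_right h0 ht).1 e4

variable (n) in
theorem ext_T (hn : 2 ≤ n) {M : ℝ} (hM : 1 < M) : ∃ c1 K1 C : ℝ, 0 < c1 ∧ 0 < K1 ∧ 0 < C ∧ ∀ Ω : SE,
    IsOneSidedNTA M Ω → Bornology.IsBounded Ω → (frontier Ω).Nonempty → ∀ φ : E → ℝ, ContinuousOn φ (closure Ω) →
    (∀ x ∈ Ω, ContDiffAt ℝ 1 φ x) → ∀ T, 0 < T → K1 * T < diam Ω / 10 → ∃ Φ : E → ℝ, CD Φ ∧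
    ∀ x ∈ closure Ω, ‖Φ x - φ x‖ₑ ^ 2 ≤ ofReal C * MM Ω φ K1 c1 (3 / 2) T x ∧
      (ofReal T * ‖fderiv ℝ Φ x‖ₑ) ^ 2 ≤ ofReal C * MM Ω φ K1 c1 (3 / 2) T x ∧
      ∀ ε, (∀ z ∈ closure Ω, dist z x ≤ K1 * T → |φ z - φ x| ≤ ε) → |Φ x - φ x| ≤ ε := by
  obtain ⟨C0, hC0, HM⟩ := molli n
  have hM0 : 0 < M := by linarith
  obtain ⟨θ, c1, K1, C, hθ, hθ', hc1, hK1, hC, H⟩ := master hn hM (c0 := 1 / M) (K0 := n + 6) (p := 3 / 2) pz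
    pz nz
  have hθ1 : θ ≤ 1 := hθ'.trans (by rw [div_div, div_le_one pz]; linarith)
  set V := volume (ball oE 1) with hV
  have hv : 0 < V.toReal := ENNReal.toReal_pos (vb_pos n) (vb_fin n)
  refine ⟨c1, K1 + 2 * (n + 6) + 4, C / V.toReal + C0 ^ 2 * (C / V.toReal), hc1, by positivity, by positivity, ?_⟩
  intro Ω hΩ hb hf φ hφ hφ1 T hT hD
  have : IsFiniteMeasure (volume.restrict (ball oE 1)) := ⟨by simpa using (vb_fin n).lt_top⟩
  have hKT := mul_pos hK1 hT
  have hnT : (0 : ℝ) ≤ n * T := by positivity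
  set C' := C / V.toReal with hC'
  have hC'0 : 0 < C' := by positivity
  have hcpt : IsCompact (closure Ω) := hb.isCompact_closure
  obtain ⟨B, hB⟩ := hcpt.exists_bound_of_continuousOn hφ
  let g : E → (Fin n → ℤ) := fun z i => ⌊z i / T⌋
  have hg : Measurable g := measurable_pi_lambda _ fun i =>
    Int.measurable_floor.comp ((EuclideanSpace.proj (𝕜 := ℝ) i).continuous.measurable.div_const T)
  have hgd : ∀ z z', g z = g z' → dist z z' ≤ n * T := fun z z' h => by
    have h1 : ∀ i, (z i - z' i) ^ 2 ≤ T ^ 2 := fun i => by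
      have h2 : |z i / T - z' i / T| < 1 := Int.abs_sub_lt_one_of_floor_eq_floor (congrFun h i)
      rw [← sub_div, abs_div, abs_of_pos hT, div_lt_one hT] at h2
      exact sq_le_sq' (by linarith [(abs_lt.1 h2).1]) (abs_lt.1 h2).2.le
    rw [EuclideanSpace.dist_eq]
    refine Real.sqrt_le_iff.2 ⟨by positivity, ?_⟩
    have hn1 : (1 : ℝ) ≤ n := by exact_mod_cast (by omega : 1 ≤ n)
    calc ∑ i, dist (z i) (z' i) ^ 2 ≤ ∑ i : Fin n, T ^ 2 := Finset.sum_le_sum fun i _ => by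
          rw [Real.dist_eq, sq_abs]; exact h1 i
      _ = n * T ^ 2 := by simp
      _ ≤ (n * T) ^ 2 := by rw [mul_pow]; exact mul_le_mul_of_nonneg_right (by nlinarith) pz
  have key : ∀ k : Fin n → ℤ, ∃ c : ℝ, |c| ≤ |B| ∧ ∀ x ∈ closure Ω, ∀ z, g z = k → dist z x < 2 * T →
      ‖c - φ x‖ₑ ^ 2 ≤ ofReal C' * MM Ω φ K1 c1 (3 / 2) T x ∧
      ∀ ε, (∀ z ∈ closure Ω, dist z x ≤ (K1 + 2 * (n + 6) + 4) * T → |φ z - φ x| ≤ ε) → |c - φ x| ≤ ε := by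
    intro k
    by_cases hk : ∃ x0 ∈ closure Ω, ∃ z0, g z0 = k ∧ dist z0 x0 < 2 * T
    swap
    · exact ⟨0, by simp, fun x hx z hz hd => absurd ⟨x, hx, z, hz, hd⟩ hk⟩
    obtain ⟨x0, hx0, z0, hz0, hd0⟩ := hk
    obtain ⟨A, hA, hA1, hA2⟩ := seqA hΩ hf hx0 hT (by nlinarith)
    have hin : ∀ y ∈ ball oE 1, A + (θ * T) • y ∈ closure Ω ∧ dist (A + (θ * T) • y) A < T := fun y hy => by
      have := aff_mem (A := A) (mul_pos hθ hT) hy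
      have h3 : θ * T ≤ dl Ω A := le_trans (by rw [div_eq_mul_inv, mul_comm T, ← one_div]; nlinarith [one_div_pos.2 hM0]) hA2
      exact ⟨subset_closure (dl_ball hA (ball_subset_ball h3 this)), (mem_ball.1 this).trans_le (by nlinarith)⟩
    have hco : ContinuousOn (fun y : E => φ (A + (θ * T) • y)) (ball oE 1) :=
      hφ.comp (by fun_prop) fun y hy => (hin y hy).1
    have hint : IntegrableOn (fun y : E => φ (A + (θ * T) • y)) (ball oE 1) :=
      Integrable.of_bound (hco.aestronglyMeasurable measurableSet_ball) B
        ((ae_restrict_iff' measurableSet_ball).2 (Filter.Eventually.of_forall fun y hy => hB _ (hin y hy).1))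
    have sup : ∀ b ε, (∀ y ∈ ball oE 1, |φ (A + (θ * T) • y) - b| ≤ ε) →
        |V.toReal⁻¹ * (∫ y in ball oE 1, φ (A + (θ * T) • y)) - b| ≤ ε := fun b ε h => by
      have e1 : V.toReal⁻¹ * (∫ y in ball oE 1, φ (A + (θ * T) • y)) - b =
          V.toReal⁻¹ * ∫ y in ball oE 1, (φ (A + (θ * T) • y) - b) := by
        rw [integral_sub hint (integrable_const b), setIntegral_const, smul_eq_mul, Measure.real, ← hV]
        field_simp
      rw [e1, abs_mul, abs_of_pos (inv_pos.2 hv), inv_mul_le_iff₀ hv, mul_comm V.toReal]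
      exact norm_setIntegral_le_of_norm_le_const (f := fun y : E => φ (A + (θ * T) • y) - b) (vb_fin n).lt_top h
    refine ⟨V.toReal⁻¹ * ∫ y in ball oE 1, φ (A + (θ * T) • y), ?_, fun x hx z hz hd => ?_⟩
    · simpa using sup 0 |B| fun y hy => by simpa using (hB _ (hin y hy).1).trans (le_abs_self B)
    · have hAx : dist A x ≤ (n + 6) * T := by
        have := hgd z0 z (hz0.trans hz.symm)
        have t1 := dist_triangle4 A x0 z0 x
        have t2 := dist_triangle z0 z x
        rw [dist_comm x0] at t1
        linarith
      refine ⟨en_div (vb_pos n) (vb_fin n) ((av_sq hint (φ x)).trans (H Ω hΩ hf φ hφ hφ1 x hx T hT ?_ A hA ?_ hAx)), fun ε h => ?_⟩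
      · linarith
      · rwa [one_div, inv_mul_eq_div]
      · refine sup _ _ fun y hy => h _ (hin y hy).1 ?_
        have := dist_triangle (A + (θ * T) • y) A x
        linarith [(hin y hy).2]
  choose F0 hF1 hF2 using key
  have hVm : Measurable fun z => F0 (g z) := (Measurable.of_discrete (f := F0)).comp hg
  have hli : LocallyIntegrable fun z => F0 (g z) := by
    refine (locallyIntegrable_const |B|).mono hVm.aestronglyMeasurable (Filter.Eventually.of_forall fun z => ?_)
    simpa using hF1 (g z)
  obtain ⟨Φ, h0, h1, -, h3⟩ := HM _ hli T hT
  have mono : MM Ω φ K1 c1 (3 / 2) T ≤ MM Ω φ (K1 + 2 * (n + 6) + 4) c1 (3 / 2) T := fun x =>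
    MM_mono hT.le lz le_rfl
  refine ⟨Φ, h0, fun x hx => ?_⟩
  have hq : ofReal (C' + C0 ^ 2 * C') * MM Ω φ K1 c1 (3 / 2) T x ≤
      ofReal (C' + C0 ^ 2 * C') * MM Ω φ (K1 + 2 * (n + 6) + 4) c1 (3 / 2) T x := mul_le_mul' le_rfl (mono x)
  refine ⟨?_, ?_, fun ε h => h1 x _ _ fun z hz => (hF2 _ x hx z rfl (by rw [mem_ball] at hz; linarith)).2 ε h⟩
  all_goals refine le_trans ?_ hq
  all_goals by_cases hMt : MM Ω φ K1 c1 (3 / 2) T x = ⊤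
  any_goals rw [hMt, ENNReal.mul_top (by simp; positivity)]; exact le_top
  all_goals
    obtain ⟨m, hm0, hm⟩ : ∃ m : ℝ, 0 ≤ m ∧ MM Ω φ K1 c1 (3 / 2) T x = ofReal m :=
      ⟨_, ENNReal.toReal_nonneg, (ofReal_toReal hMt).symm⟩
    have hε : ∀ z ∈ ball x (2 * T), |F0 (g z) - φ x| ≤ √(C' * m) := fun z hz => by
      have := (hF2 _ x hx z rfl (mem_ball.1 hz)).1
      rw [hm, ← ofReal_mul hC'0.le, Real.enorm_eq_ofReal_abs, ← ofReal_pow (abs_nonneg _),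
        ofReal_le_ofReal_iff pz] at this
      exact Real.le_sqrt_of_sq_le this
    have hsq := Real.sq_sqrt (show 0 ≤ C' * m by positivity)
    have hs0 := Real.sqrt_nonneg (C' * m)
    rw [hm, ← ofReal_mul pz]
  · have := h1 x _ _ fun z hz => hε z (ball_subset_ball lz hz)
    rw [Real.enorm_eq_ofReal_abs, ← ofReal_pow (abs_nonneg _)]
    refine ofReal_le_ofReal ?_
    have := pow_le_pow_left₀ (abs_nonneg _) this 2
    have : 0 ≤ C0 ^ 2 * C' * m := by positivity
    nlinarith
  · have := h3 x _ _ hε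
    rw [← ofReal_norm_eq_enorm, ← ofReal_mul hT.le, ← ofReal_pow pz]
    refine ofReal_le_ofReal ?_
    have h5 : T * ‖fderiv ℝ Φ x‖ ≤ C0 * √(C' * m) := by
      calc _ ≤ T * (C0 / T * √(C' * m)) := mul_le_mul_of_nonneg_left this hT.le
        _ = _ := by field_simp
    have := pow_le_pow_left₀ pz h5 2
    rw [mul_pow C0, hsq] at this
    nlinarith [mul_nonneg hC'0.le hm0]

theorem cs2 {α : Type*} [MeasurableSpace α] (μ : Measure α) {f g : α → ℝ≥0∞} (hf : AEMeasurable f μ) (hg : AEMeasurable g μ) :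
    (∫⁻ a, f a * g a ∂μ) ^ 2 ≤ (∫⁻ a, f a ^ 2 ∂μ) * ∫⁻ a, g a ^ 2 ∂μ := by
  have := ENNReal.lintegral_mul_le_Lp_mul_Lq μ (Real.HolderConjugate.two_two) hf hg
  simp only [Pi.mul_apply, ENNReal.rpow_two] at this
  refine (pow_le_pow_left' this 2).trans_eq ?_
  rw [mul_pow, ← ENNReal.rpow_two, ← ENNReal.rpow_two, ← ENNReal.rpow_mul, ← ENNReal.rpow_mul]; norm_num

theorem st_bd : ∃ L : ℝ, 0 < L ∧ ∀ x, |deriv smoothTransition x| ≤ L := by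
  have hd : Continuous (deriv smoothTransition) := (smoothTransition.contDiff (n := 1)).continuous_deriv le_rfl
  obtain ⟨B, hB⟩ := isCompact_Icc (a := (0 : ℝ)) (b := 1) |>.exists_bound_of_continuousOn hd.continuousOn
  refine ⟨|B| + 1, by positivity, fun x => ?_⟩
  by_cases hx : x ∈ Icc (0 : ℝ) 1
  · exact (hB x hx).trans (by linarith [le_abs_self B])
  · have : deriv smoothTransition x = 0 := by
      rcases lt_or_gt_of_ne (show x ≠ 0 by rintro rfl; simp at hx) with h | h
      · have : smoothTransition =ᶠ[𝓝 x] fun _ => 0 := by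
          filter_upwards [Iio_mem_nhds h] with y hy using smoothTransition.zero_of_nonpos (le_of_lt hy)
        rw [this.deriv_eq]; simp
      · have h1 : 1 < x := by by_contra h2; exact hx ⟨h.le, not_lt.1 h2⟩
        have : smoothTransition =ᶠ[𝓝 x] fun _ => 1 := by
          filter_upwards [Ioi_mem_nhds h1] with y hy using smoothTransition.one_of_one_le (le_of_lt hy)
        rw [this.deriv_eq]; simp
    rw [this]; simp; positivity

theorem st_fderiv {g : E → ℝ} {x : E} (hg : DifferentiableAt ℝ g x) {L : ℝ}
    (hL : ∀ x, |deriv smoothTransition x| ≤ L) :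
    ‖fderiv ℝ (fun z => smoothTransition (g z)) x‖ ≤ L * ‖fderiv ℝ g x‖ := by
  have h1 : HasDerivAt smoothTransition (deriv smoothTransition (g x)) (g x) :=
    ((smoothTransition.contDiff (n := 1)).differentiable sz _).hasDerivAt
  rw [show (fun z => smoothTransition (g z)) = smoothTransition ∘ g from rfl,
    (h1.comp_hasFDerivAt x hg.hasFDerivAt).fderiv, norm_smul]
  exact mul_le_mul_of_nonneg_right (hL _) (norm_nonneg _)

theorem ip_int {U : SE} {F : E → E} (hF : IntegrableOn F U) {φ : E → ℝ} {B : ℝ}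
    (hB : ∀ᵐ x ∂volume.restrict U, ‖fderiv ℝ φ x‖ ≤ B) : IntegrableOn (fun z => ⟪F z, gradient φ z⟫) U := by
  refine (hF.norm.mul_const B).mono' (hF.1.inner (grad_meas φ).aestronglyMeasurable) (hB.mono fun z hz => ?_)
  exact (norm_inner_le_norm _ _).trans (mul_le_mul_of_nonneg_left ((grad_norm φ z).trans_le hz) (norm_nonneg _))

theorem grad_sub {f g : E → ℝ} {x : E} (hf : DifferentiableAt ℝ f x) (hg : DifferentiableAt ℝ g x) :
    gradient (fun z => f z - g z) x = gradient f x - gradient g x := by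
  unfold gradient; rw [fderiv_fun_sub hf hg, map_sub]

theorem weak_c1 {U V : SE} {F : E → E} (hF : IntegrableOn F U) {ν : ME} {w : E → ℝ}
    (hw : Integrable w ν) {κ : ℝ} {Y : E} (hV : IsOpen V) (h : ∀ φ : E → ℝ, CD φ → HasCompactSupport φ →
      tsupport φ ⊆ V → (∫ z in U, ⟪F z, gradient φ z⟫) + ∫ P, w P * φ P ∂ν = κ * φ Y) {φ : E → ℝ} (h1 : ContDiff ℝ 1 φ)
    (hc : HasCompactSupport φ) (hs : tsupport φ ⊆ V) :
    (∫ z in U, ⟪F z, gradient φ z⟫) + ∫ P, w P * φ P ∂ν = κ * φ Y := by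
  obtain ⟨e0, he0, hth⟩ := hc.isCompact.exists_cthickening_subset_open hV hs
  have bd : ∀ ψ : E → ℝ, ContDiff ℝ 1 ψ → HasCompactSupport ψ → IntegrableOn (fun z => ⟪F z, gradient ψ z⟫) U ∧
      Integrable (fun P => w P * ψ P) ν := fun ψ p1 p2 => by
    obtain ⟨B, hB⟩ := (p1.continuous_fderiv sz).bounded_above_of_compact_support (p2.fderiv ℝ)
    obtain ⟨B', hB'⟩ := p1.continuous.bounded_above_of_compact_support p2
    exact ⟨ip_int hF (Filter.Eventually.of_forall hB), hw.mul_bdd p1.continuous.aestronglyMeasurable (Filter.Eventually.of_forall hB')⟩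
  set I := (∫ z in U, ‖F z‖) + (∫ P, ‖w P‖ ∂ν) + |κ| with hI
  have i1 : 0 ≤ ∫ z in U, ‖F z‖ := integral_nonneg fun _ => norm_nonneg _
  have i2 : 0 ≤ ∫ P, ‖w P‖ ∂ν := integral_nonneg fun _ => norm_nonneg _
  have key : ∀ ε, 0 < ε → ε ≤ e0 → |(∫ z in U, ⟪F z, gradient φ z⟫) + (∫ P, w P * φ P ∂ν) - κ * φ Y| ≤ ε * I := by
    intro ε hε hε'
    obtain ⟨ψ, a1, a2, a3, a4, a5⟩ := c1_approx h1 hc hε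
    have a1' : ContDiff ℝ 1 ψ := a1.of_le (by exact_mod_cast le_top)
    have e := h ψ a1 a2 (a3.trans ((cthickening_mono hε' _).trans hth))
    obtain ⟨b1, b2⟩ := bd φ h1 hc
    obtain ⟨b3, b4⟩ := bd ψ a1' a2
    have d1 : ‖∫ z in U, (⟪F z, gradient φ z⟫ - ⟪F z, gradient ψ z⟫)‖ ≤ ∫ z in U, ‖F z‖ * ε := by
      refine norm_integral_le_of_norm_le (hF.norm.mul_const _) (Filter.Eventually.of_forall fun z => ?_)
      rw [← inner_sub_right, ← grad_sub (h1.differentiable sz z) (a1'.differentiable sz z)]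
      refine (norm_inner_le_norm _ _).trans (mul_le_mul_of_nonneg_left ?_ (norm_nonneg _))
      rw [grad_norm, fderiv_fun_sub (h1.differentiable sz z) (a1'.differentiable sz z), norm_sub_rev]
      exact a5 z
    have d2 : ‖∫ P, (w P * φ P - w P * ψ P) ∂ν‖ ≤ ∫ P, ‖w P‖ * ε ∂ν := by
      refine norm_integral_le_of_norm_le (hw.norm.mul_const _) (Filter.Eventually.of_forall fun z => ?_)
      rw [← mul_sub, norm_mul]
      exact mul_le_mul_of_nonneg_left (by rw [norm_sub_rev]; exact a4 z) (norm_nonneg _)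
    have d3 : |κ * (φ Y - ψ Y)| ≤ |κ| * ε := by
      rw [abs_mul, abs_sub_comm]; exact mul_le_mul_of_nonneg_left (a4 Y) (abs_nonneg _)
    rw [integral_sub b1 b3, integral_mul_const, norm_eq_abs, abs_le] at d1
    rw [integral_sub b2 b4, integral_mul_const, norm_eq_abs, abs_le] at d2
    rw [abs_le] at d3 ⊢
    constructor <;> rw [hI] <;> nlinarith
  have hI0 : 0 ≤ I := by positivity
  have : |(∫ z in U, ⟪F z, gradient φ z⟫) + (∫ P, w P * φ P ∂ν) - κ * φ Y| ≤ 0 := by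
    refine le_of_forall_pos_le_add fun ε hε => ?_
    have := key (min e0 (ε / (I + 1))) pz (min_le_left _ _)
    have h2 : min e0 (ε / (I + 1)) * I ≤ ε / (I + 1) * (I + 1) :=
      mul_le_mul (min_le_right _ _) lz hI0 pz
    rw [div_mul_cancel₀ _ pz] at h2
    linarith
  linarith [abs_nonpos_iff.1 this]

theorem Wk.int {U : SE} {Y : E} {κ : ℝ} {g : E → ℝ} (h : Wk U Y κ g) : IntegrableOn (gradient g) U :=
  (integrable_norm_iff (grad_meas g).aestronglyMeasurable).1 h.l1

theorem Wk.c1t {U : SE} {Y : E} {κ : ℝ} {g : E → ℝ} (h : Wk U Y κ g) {φ : E → ℝ} (h1 : ContDiff ℝ 1 φ)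
    (hc : HasCompactSupport φ) (hs : tsupport φ ⊆ U) : ∫ z in U, ⟪gradient g z, gradient φ z⟫ = κ * φ Y := by
  have := weak_c1 h.int (ν := 0) (w := fun _ => 0) (κ := κ) (Y := Y) sz h.op (fun φ a b c => by
    simpa using h.wk φ a b c) h1 hc hs
  simpa using this

def Rw (Ω : SE) (σ : ME) (a : ℝ) (Y : E) (u : E → ℝ) : Prop :=
  ∀ φ : E → ℝ, CD φ → HasCompactSupport φ →
    (∫ X in Ω, ⟪gradient u X, gradient φ X⟫) + a * ∫ P in frontier Ω, u P * φ P ∂σ = φ Y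

theorem fr_int {M Cσ d cd : ℝ} (hP : IsMixedPair M Cσ d cd Ω σ) {f : E → ℝ}
    (hf : ContinuousOn f (frontier Ω)) : IntegrableOn f (frontier Ω) σ := by
  have hk : IsCompact (frontier Ω) := hP.bounded.isCompact_closure.of_isClosed_subset isClosed_frontier frontier_subset_closure
  have := sig_fin hP
  exact hf.integrableOn_compact hk

theorem rob_c1 {M Cσ d cd : ℝ} (hP : IsMixedPair M Cσ d cd Ω σ) {a : ℝ} {Y : E}
    {u : E → ℝ} (hu : Pl Ω Y u) (hw : Rw Ω σ a Y u) {φ : E → ℝ} (h1 : ContDiff ℝ 1 φ) :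
    (∫ X in Ω, ⟪gradient u X, gradient φ X⟫) + a * ∫ P in frontier Ω, u P * φ P ∂σ = φ Y := by
  have hcu : ContinuousOn u (frontier Ω) := hu.ct.mono fun x hx => ⟨frontier_subset_closure hx, fun h => by
    rw [mem_singleton_iff.1 h, hP.nta.isOpen.frontier_eq] at hx; exact hx.2 hu.mem⟩
  obtain ⟨R, hR⟩ := hP.bounded.closure.subset_ball oE
  have hR0 : 0 < R := by
    have := hR (subset_closure hu.mem); simp only [mem_ball] at this; exact dist_nonneg.trans_lt this
  let b : ContDiffBump oE := ⟨R, R + 1, hR0, by linarith⟩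
  have hb1 : ∀ x ∈ ball oE R, b x = 1 := fun x hx => b.one_of_mem_closedBall (ball_subset_closedBall hx)
  have hb2 : ∀ x ∈ Ω, gradient (fun z => b z * φ z) x = gradient φ x := fun x hx => by
    unfold gradient; congr 1
    refine Filter.EventuallyEq.fderiv_eq ?_
    filter_upwards [isOpen_ball.mem_nhds (hR (subset_closure hx))] with z hz
    rw [hb1 z hz, one_mul]
  have := weak_c1 hu.wk.int (ν := σ.restrict (frontier Ω)) (w := fun P => a * u P) (κ := 1) (Y := Y)
    (V := univ) ((fr_int hP hcu).const_mul a) isOpen_univ (fun φ p q _ => by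
      have := hw φ p q
      simp_rw [mul_assoc]; rw [integral_const_mul, one_mul]; exact this) (φ := fun z => b z * φ z) (b.contDiff.mul h1)
      b.hasCompactSupport.mul_right (subset_univ _)
  simp_rw [mul_assoc] at this
  rw [integral_const_mul, one_mul, hb1 Y (hR (subset_closure hu.mem)), one_mul, setIntegral_congr_fun hP.nta.isOpen.measurableSet
    (g := fun z => ⟪gradient u z, gradient φ z⟫) fun x hx => by simp only; rw [hb2 x hx]] at this
  rw [← this]; congr 2
  refine setIntegral_congr_fun isClosed_frontier.measurableSet fun x hx => ?_
  beta_reduce; rw [hb1 x (hR (frontier_subset_closure hx)), one_mul]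

theorem dl_compl (ho : IsOpen Ω) (hf : (frontier Ω).Nonempty) {x : E} (hx : x ∈ Ω) :
    infDist x Ωᶜ = dl Ω x := by
  have hs : frontier Ω ⊆ Ωᶜ := fun z hz h => by rw [ho.frontier_eq] at hz; exact hz.2 h
  refine le_antisymm (infDist_le_infDist_of_subset hs hf) ((le_infDist (hf.mono hs)).2 fun y hy => ?_)
  by_contra h
  exact hy (dl_ball hx (by rw [mem_ball, dist_comm]; exact not_le.1 h))

theorem cutoff (ho : IsOpen Ω) (hf : (frontier Ω).Nonempty) {L : ℝ}
    (hL : ∀ x, |deriv smoothTransition x| ≤ L) {T : ℝ} (hT : 0 < T) : ∃ χ : E → ℝ,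
    CD χ ∧ (∀ x, 0 ≤ χ x ∧ χ x ≤ 1) ∧ (∀ x ∉ Ω, χ =ᶠ[𝓝 x] fun _ => 0) ∧ (∀ x ∈ Ω, T < dl Ω x → χ =ᶠ[𝓝 x] fun _ => 1) ∧
    ∀ x, ‖fderiv ℝ χ x‖ ≤ 4 * L / T := by
  have hL0 : 0 ≤ L := (abs_nonneg _).trans (hL 0)
  have hs : frontier Ω ⊆ Ωᶜ := fun z hz h => by rw [ho.frontier_eq] at hz; exact hz.2 h
  have hne := hf.mono hs
  obtain ⟨g, g0, g1, g2⟩ := lip_smooth (n := n) (f := fun x => infDist x Ωᶜ) (K := 1) zero_le_one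
    (fun x y => by rw [one_mul]; exact infDist_le_infDist_add_dist) (τ := T / 8) pz
  have hc : Continuous fun x : E => infDist x Ωᶜ := continuous_infDist_pt _
  have hg' : CD fun z => 4 / T * g z - 5 / 2 := (contDiff_const.mul g0).sub contDiff_const
  refine ⟨fun z => smoothTransition (4 / T * g z - 5 / 2), smoothTransition.contDiff.comp hg',
    fun x => ⟨smoothTransition.nonneg _, smoothTransition.le_one _⟩, fun x hx => ?_, fun x hx h => ?_, fun x => ?_⟩
  · have h0 : infDist x Ωᶜ < T / 2 := by rw [infDist_zero_of_mem (show x ∈ Ωᶜ from hx)]; positivity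
    filter_upwards [hc.tendsto x |>.eventually (gt_mem_nhds h0)] with z hz
    refine smoothTransition.zero_of_nonpos ?_
    have := (abs_le.1 (g1 z)).2
    have : g z ≤ 5 / 8 * T := by linarith
    have := mul_le_mul_of_nonneg_left this (show 0 ≤ 4 / T by positivity)
    rw [show 4 / T * (5 / 8 * T) = 5 / 2 by field_simp; norm_num] at this
    linarith
  · rw [← dl_compl ho hf hx] at h
    filter_upwards [hc.tendsto x |>.eventually (lt_mem_nhds h)] with z hz
    refine smoothTransition.one_of_one_le ?_
    have := (abs_le.1 (g1 z)).1
    have : 7 / 8 * T ≤ g z := by linarith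
    have := mul_le_mul_of_nonneg_left this (show 0 ≤ 4 / T by positivity)
    rw [show 4 / T * (7 / 8 * T) = 7 / 2 by field_simp; norm_num] at this
    linarith
  · have hgd := g0.differentiable sz x
    refine (st_fderiv (hg'.differentiable sz x) hL).trans ?_
    rw [fderiv_sub_const, fderiv_const_mul hgd, norm_smul, norm_of_nonneg pz]
    calc L * (4 / T * ‖fderiv ℝ g x‖) ≤ L * (4 / T * 1) := by have := g2 x; gcongr
      _ = _ := by ring

theorem lay (ho : IsOpen Ω) (hf : (frontier Ω).Nonempty) {F : E → ℝ≥0∞} {r : ℝ} {Y : E}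
    (hr : 0 < r) (hF : ∫⁻ x in Ω \ ball Y r, F x ≠ ⊤) (hY : 2 * r ≤ dl Ω Y) {ε : ℝ≥0∞} (hε : ε ≠ 0) :
    ∃ T0 > 0, ∀ T, 0 < T → T ≤ T0 → ∫⁻ x in Ω ∩ {x | dl Ω x ≤ T}, F x < ε := by
  set ν := (volume.restrict (Ω \ ball Y r)).withDensity F with hν
  have hfin : IsFiniteMeasure ν := isFiniteMeasure_withDensity hF
  have hm : ∀ T : ℝ, MeasurableSet (Ω ∩ {x | dl Ω x ≤ T}) := fun T =>
    ho.measurableSet.inter (isClosed_le (continuous_infDist_pt _) continuous_const).measurableSet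
  have ht := tendsto_measure_iInter_atTop (μ := ν) (s := fun k : ℕ => Ω ∩ {x : E | dl Ω x ≤ 1 / ((k : ℝ) + 1)})
    (fun k => (hm _).nullMeasurableSet) (fun i j hij x hx => ⟨hx.1, mem_setOf.2 ((mem_setOf.1 hx.2).trans (Nat.one_div_le_one_div hij))⟩)
    ⟨0, measure_ne_top _ _⟩
  have h0 : (⋂ k : ℕ, Ω ∩ {x : E | dl Ω x ≤ 1 / ((k : ℝ) + 1)}) = ∅ := by
    refine eq_empty_of_forall_notMem fun x hx => ?_
    rw [mem_iInter] at hx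
    obtain ⟨k, hk⟩ := exists_nat_one_div_lt (dl_pos ho hf (hx 0).1)
    exact absurd (hx k).2 (not_le.2 hk)
  rw [h0, measure_empty] at ht
  obtain ⟨k, hk⟩ := (ht.eventually (gt_mem_nhds (pos_iff_ne_zero.2 hε))).exists
  refine ⟨min (1 / ((k : ℝ) + 1)) (r / 2), by positivity, fun T hT hT0 => lt_of_le_of_lt ?_ hk⟩
  have h1 := hT0.trans (min_le_left _ _)
  have h2 := hT0.trans (min_le_right _ _)
  show _ ≤ ν (Ω ∩ {x : E | dl Ω x ≤ 1 / ((k : ℝ) + 1)})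
  rw [hν, withDensity_apply _ (hm _), Measure.restrict_restrict (hm _)]
  refine lintegral_mono_set fun x hx => ⟨⟨hx.1, le_trans hx.2 h1⟩, hx.1, fun h => ?_⟩
  have := dl_lip Ω Y x; rw [mem_ball, dist_comm] at h; have : dl Ω x ≤ T := hx.2
  linarith

theorem ip_l2 {Y : E} {u : E → ℝ} (hu : Pl Ω Y u) {φ : E → ℝ}
    (hfin : ∫⁻ z in Ω, gg φ z ≠ ⊤) {ρ : ℝ} (hρ : 0 < ρ) (hloc : ∀ z ∈ ball Y ρ, φ z = φ Y) :
    IntegrableOn (fun z => ⟪gradient u z, gradient φ z⟫) Ω := by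
  have h0 : ∀ z ∈ ball Y ρ, gradient φ z = 0 := fun z hz => by
    have : φ =ᶠ[𝓝 z] fun _ => φ Y := by filter_upwards [isOpen_ball.mem_nhds hz] with w hw using hloc w hw
    unfold gradient; rw [this.fderiv_eq]; simp
  have h1 : IntegrableOn (fun z => ‖gradient φ z‖ ^ 2) Ω := by
    refine ⟨((grad_meas φ).norm.pow_const 2).aestronglyMeasurable, lt_of_le_of_lt (lintegral_mono fun z => ?_) hfin.lt_top⟩
    rw [enorm_pow, enorm_norm, ← ofReal_norm_eq_enorm, grad_norm, gg, ofReal_norm_eq_enorm]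
  have h2 : IntegrableOn (fun z => ⟪gradient u z, gradient φ z⟫) (Ω \ ball Y ρ) := by
    refine ((hu.l2 ρ hρ).add (h1.mono_set diff_subset)).mono' ((grad_meas u).inner (grad_meas φ)).aestronglyMeasurable
      (Filter.Eventually.of_forall fun z => (norm_inner_le_norm _ _).trans ?_)
    simp only [Pi.add_apply]; nlinarith [sq_nonneg (‖gradient u z‖ - ‖gradient φ z‖), sq_nonneg ‖gradient u z‖, sq_nonneg ‖gradient φ z‖]
  have h3 : IntegrableOn (fun z => ⟪gradient u z, gradient φ z⟫) (Ω ∩ ball Y ρ) :=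
    (integrableOn_congr_fun (fun z hz => by rw [h0 z hz.2, inner_zero_right]; rfl) (hu.wk.op.measurableSet.inter measurableSet_ball)).2
      (integrable_zero _ ℝ _)
  have := h2.union h3
  rwa [diff_union_inter] at this

theorem dens (hn : 2 ≤ n) {M Cσ d cd : ℝ} (hP : IsMixedPair M Cσ d cd Ω σ) {a : ℝ} {Y : E}
    {u : E → ℝ} (hu : Pl Ω Y u) (hw : Rw Ω σ a Y u) {φ : E → ℝ} (hφ : ContinuousOn φ (closure Ω))
    (hφ1 : ∀ x ∈ Ω, ContDiffAt ℝ 1 φ x) (hfin : ∫⁻ z in Ω, gg φ z ≠ ⊤) {ρ : ℝ} (hρ : 0 < ρ) (hloc : ∀ z ∈ ball Y ρ, φ z = φ Y) :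
    (∫ X in Ω, ⟪gradient u X, gradient φ X⟫) + a * ∫ P in frontier Ω, u P * φ P ∂σ = φ Y := by
  have ho := hP.nta.isOpen
  have hf := fr_ne oz hP.bounded hP.nonempty
  have hD := diam_pos' oz hP
  obtain ⟨c1, K1, C, hc1, hK1, hC, H⟩ := ext_T n hn hP.nta.M_gt_one
  obtain ⟨C2, hC2, Hp⟩ := poinc hn hK1 hc1 (p := 3 / 2) nz nz
  obtain ⟨L, hL0, hL⟩ := st_bd
  have hcu : ContinuousOn u (frontier Ω) := hu.ct.mono fun x hx => ⟨frontier_subset_closure hx, fun h => by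
    rw [mem_singleton_iff.1 h, ho.frontier_eq] at hx; exact hx.2 hu.mem⟩
  have hiu := fr_int hP hcu
  have hii := ip_l2 hu hfin hρ hloc
  have hdY := dl_pos ho hf hu.mem
  set I := ∫ P in frontier Ω, ‖u P‖ ∂σ with hI
  have hI0 : 0 ≤ I := integral_nonneg fun _ => norm_nonneg _
  set G := ∫⁻ z in Ω, gg φ z with hG
  set K := 3 * (ofReal (C * (1 + (4 * L) ^ 2)) * (ofReal C2 * G) + G) with hK
  have hKt : K ≠ ⊤ := by
    rw [hK]; exact ENNReal.mul_ne_top sz (ENNReal.add_ne_top.2 ⟨ENNReal.mul_ne_top sz (ENNReal.mul_ne_top sz hfin), hfin⟩)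
  have hF : ∫⁻ x in Ω \ ball Y (dl Ω Y / 2), ‖gradient u x‖ₑ ^ 2 ≠ ⊤ := by
    have := (hu.l2 (dl Ω Y / 2) pz).2.ne
    simpa only [enorm_pow, enorm_norm] using this
  have key : ∀ ε : ℝ, 0 < ε → |(∫ X in Ω, ⟪gradient u X, gradient φ X⟫) + a * (∫ P in frontier Ω, u P * φ P ∂σ) - φ Y| ≤ ε + |a| * (I * ε) := by
    intro ε hε
    obtain ⟨T0, hT0, HT⟩ := lay ho hf pz hF lz (ε := ofReal (ε ^ 2) / (K + 1))
      (ENNReal.div_ne_zero.2 ⟨by simpa using hε.ne', by simpa using hKt⟩)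
    obtain ⟨η, hη, hη2⟩ := Metric.uniformContinuousOn_iff.1 (hP.bounded.isCompact_closure.uniformContinuousOn_of_continuous hφ) ε hε
    obtain ⟨T, hT, t1, t2, t3, t4⟩ : ∃ T : ℝ, 0 < T ∧ T ≤ T0 ∧ K1 * T < diam Ω / 10 ∧ K1 * T < η ∧ T < dl Ω Y := by
      refine ⟨min T0 (min (diam Ω / 20 / K1) (min (η / 2 / K1) (dl Ω Y / 2))), by positivity, min_le_left _ _, ?_, ?_, ?_⟩
      · have := (min_le_right T0 (min (diam Ω / 20 / K1) (min (η / 2 / K1) (dl Ω Y / 2)))).trans (min_le_left _ _)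
        rw [le_div_iff₀ hK1] at this; linarith
      · have := ((min_le_right T0 (min (diam Ω / 20 / K1) (min (η / 2 / K1) (dl Ω Y / 2)))).trans (min_le_right _ _)).trans (min_le_left _ _)
        rw [le_div_iff₀ hK1] at this; linarith
      · have := ((min_le_right T0 (min (diam Ω / 20 / K1) (min (η / 2 / K1) (dl Ω Y / 2)))).trans (min_le_right _ _)).trans (min_le_right _ _)
        linarith
    obtain ⟨Φ, hΦ, HΦ⟩ := H Ω hP.nta hP.bounded hf φ hφ hφ1 T hT t2
    obtain ⟨χ, x0, x1, x2, x3, x4⟩ := cutoff ho hf hL hT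
    have dΦ := hΦ.differentiable sz
    have dχ := x0.differentiable sz
    set ψ : E → ℝ := fun z => χ z * φ z + (1 - χ z) * Φ z with hψ
    have hψ1 : ContDiff ℝ 1 ψ := contDiff_iff_contDiffAt.2 fun x => by
      have a1 : ContDiffAt ℝ 1 χ x := (x0.of_le (by exact_mod_cast le_top)).contDiffAt
      have a2 : ContDiffAt ℝ 1 Φ x := (hΦ.of_le (by exact_mod_cast le_top)).contDiffAt
      by_cases hx : x ∈ Ω
      · exact (a1.mul (hφ1 x hx)).add ((contDiffAt_const.sub a1).mul a2)
      · refine a2.congr_of_eventuallyEq ?_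
        filter_upwards [x2 x hx] with z hz
        simp [hψ, hz]
    have e := rob_c1 hP hu hw hψ1
    have eY : ψ Y = φ Y := by simp [hψ, (x3 Y hu.mem t4).eq_of_nhds]
    have hdf : ∀ x ∈ Ω, DifferentiableAt ℝ φ x := fun x hx => (hφ1 x hx).differentiableAt sz
    have hψd := hψ1.differentiable sz
    have hS : MeasurableSet (Ω ∩ {x | dl Ω x ≤ T}) :=
      ho.measurableSet.inter (isClosed_le (continuous_infDist_pt _) continuous_const).measurableSet
    have g1 : ∀ x ∈ Ω, T < dl Ω x → gradient (fun z => ψ z - φ z) x = 0 := fun x hx hxT => by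
      have : (fun z => ψ z - φ z) =ᶠ[𝓝 x] fun _ => 0 := by filter_upwards [x3 x hx hxT] with z hz; simp [hψ, hz]
      unfold gradient; rw [this.fderiv_eq]; simp
    have g2 : ∀ x ∈ Ω, ‖gradient (fun z => ψ z - φ z) x‖ₑ ^ 2 ≤
        3 * (ofReal (C * (1 + (4 * L) ^ 2)) * (ofReal ((T ^ 2)⁻¹) * MM Ω φ K1 c1 (3 / 2) T x) + gg φ x) := fun x hx => by
      obtain ⟨q1, q2, -⟩ := HΦ x (subset_closure hx)
      by_cases hMt : MM Ω φ K1 c1 (3 / 2) T x = ⊤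
      · rw [hMt, ENNReal.mul_top (by simpa using hT.ne'), ENNReal.mul_top (by simp; positivity), top_add, ENNReal.mul_top sz]; exact le_top
      obtain ⟨m, hm0, hm⟩ : ∃ m : ℝ, 0 ≤ m ∧ MM Ω φ K1 c1 (3 / 2) T x = ofReal m :=
        ⟨_, ENNReal.toReal_nonneg, (ofReal_toReal hMt).symm⟩
      rw [hm, ← ofReal_mul hC.le] at q1 q2
      rw [Real.enorm_eq_ofReal_abs, ← ofReal_pow (abs_nonneg _), ofReal_le_ofReal_iff pz] at q1
      rw [← ofReal_norm_eq_enorm, ← ofReal_mul hT.le, ← ofReal_pow pz,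
        ofReal_le_ofReal_iff pz] at q2
      rw [hm, gg, ← ofReal_norm_eq_enorm, ← ofReal_norm_eq_enorm, ← ofReal_mul pz, ← ofReal_mul pz,
        ← ofReal_pow (norm_nonneg _), ← ofReal_pow (norm_nonneg _), ← ofReal_add pz pz,
        show (3 : ℝ≥0∞) = ofReal 3 by simp, ← ofReal_mul nz]
      refine ofReal_le_ofReal ?_
      have he : (fun z => ψ z - φ z) = fun z => (1 - χ z) * (Φ z - φ z) := by ext z; simp only [hψ]; ring
      have d1 : DifferentiableAt ℝ (fun z => 1 - χ z) x := (differentiableAt_const _).sub (dχ x)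
      have d2 : DifferentiableAt ℝ (fun z => Φ z - φ z) x := (dΦ x).sub (hdf x hx)
      rw [grad_norm, he, fderiv_fun_mul d1 d2, fderiv_fun_sub (dΦ x) (hdf x hx), fderiv_const_sub]
      have n1 : ‖(1 - χ x) • (fderiv ℝ Φ x - fderiv ℝ φ x) + (Φ x - φ x) • -fderiv ℝ χ x‖ ≤
          ‖fderiv ℝ Φ x‖ + ‖fderiv ℝ φ x‖ + |Φ x - φ x| * (4 * L / T) := by
        refine (norm_add_le _ _).trans (add_le_add ?_ ?_)
        · rw [norm_smul, norm_of_nonneg (by linarith [(x1 x).2])]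
          exact (mul_le_of_le_one_left (norm_nonneg _) (by linarith [(x1 x).1])).trans (norm_sub_le _ _)
        · rw [norm_smul, norm_neg, norm_eq_abs]; exact mul_le_mul_of_nonneg_left (x4 x) (abs_nonneg _)
      have n2 := pow_le_pow_left₀ (norm_nonneg _) n1 2
      have n3 : ‖fderiv ℝ Φ x‖ ^ 2 ≤ (T ^ 2)⁻¹ * (C * m) := by
        rw [mul_pow] at q2; rw [inv_mul_eq_div, le_div_iff₀ pz]; linarith
      have n4 : (|Φ x - φ x| * (4 * L / T)) ^ 2 ≤ (T ^ 2)⁻¹ * ((4 * L) ^ 2 * (C * m)) := by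
        calc _ = (T ^ 2)⁻¹ * ((4 * L) ^ 2 * |Φ x - φ x| ^ 2) := by field_simp
          _ ≤ _ := by gcongr
      refine n2.trans ?_
      nlinarith [sq_nonneg (‖fderiv ℝ Φ x‖ - ‖fderiv ℝ φ x‖), sq_nonneg (‖fderiv ℝ Φ x‖ - |Φ x - φ x| * (4 * L / T)),
        sq_nonneg (‖fderiv ℝ φ x‖ - |Φ x - φ x| * (4 * L / T))]
    have g3 : ∫⁻ x in Ω ∩ {x | dl Ω x ≤ T}, ‖gradient (fun z => ψ z - φ z) x‖ₑ ^ 2 ≤ K := by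
      refine (setLIntegral_mono' hS fun x hx => g2 x hx.1).trans ?_
      rw [lintegral_const_mul' _ _ sz, hK]
      refine mul_le_mul' le_rfl ?_
      rw [lintegral_add_right _ (gg_meas φ), lintegral_const_mul' _ _ sz]
      refine add_le_add (mul_le_mul' le_rfl ?_) (lintegral_mono_set inter_subset_left)
      refine le_trans ?_ (Hp Ω ho φ (fun x => max (dl Ω x) T) (fun x => le_max_of_le_right hT.le) (fun x _ => lt_max_of_lt_right hT)
        (fun x y => max_le ((dl_lip Ω x y).trans (by gcongr; exact le_max_left _ _)) ((le_max_right _ _).trans (le_add_of_nonneg_right dist_nonneg)))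
        (fun x => le_max_left _ _))
      refine le_trans (le_of_eq (setLIntegral_congr_fun hS fun x hx => ?_)) (lintegral_mono_set inter_subset_left)
      simp only [max_eq_right (mem_setOf.1 hx.2)]
    have hiψ : IntegrableOn (fun z => ⟪gradient u z, gradient ψ z⟫) Ω := by
      obtain ⟨B, hB⟩ := hP.bounded.isCompact_closure.exists_bound_of_continuousOn (hψ1.continuous_fderiv sz).continuousOn
      exact ip_int hu.wk.int ((ae_restrict_iff' ho.measurableSet).2 (Filter.Eventually.of_forall fun x hx => hB x (subset_closure hx)))
    have b1 : |(∫ X in Ω, ⟪gradient u X, gradient ψ X⟫) - ∫ X in Ω, ⟪gradient u X, gradient φ X⟫| ≤ ε := by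
      rw [← integral_sub hiψ hii]
      have f1 : ‖∫ X in Ω, (⟪gradient u X, gradient ψ X⟫ - ⟪gradient u X, gradient φ X⟫)‖ₑ ≤
          ∫⁻ X in Ω ∩ {x | dl Ω x ≤ T}, ‖gradient u X‖ₑ * ‖gradient (fun z => ψ z - φ z) X‖ₑ := by
        refine (enorm_integral_le_lintegral_enorm _).trans ?_
        rw [← lintegral_indicator ho.measurableSet, ← lintegral_indicator hS]
        refine lintegral_mono fun x => ?_
        by_cases hx : x ∈ Ω
        · rw [indicator_of_mem hx, ← inner_sub_right, ← grad_sub (hψd x) (hdf x hx)]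
          by_cases hxT : dl Ω x ≤ T
          · rw [indicator_of_mem (show x ∈ Ω ∩ {x | dl Ω x ≤ T} from ⟨hx, hxT⟩), ← ofReal_norm_eq_enorm, ← ofReal_norm_eq_enorm, ← ofReal_norm_eq_enorm, ← ofReal_mul (norm_nonneg _)]
            exact ofReal_le_ofReal (norm_inner_le_norm _ _)
          · rw [g1 x hx (not_le.1 hxT)]; simp
        · rw [indicator_of_notMem hx]; exact bot_le
      have f2 := (pow_le_pow_left' f1 2).trans (cs2 _ (grad_meas u).enorm.aemeasurable (grad_meas _).enorm.aemeasurable)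
      have f3 := f2.trans (mul_le_mul' (HT T hT t1).le (g3.trans (le_self_add (b := 1))))
      rw [ENNReal.div_mul_cancel sz (by simpa using hKt), Real.enorm_eq_ofReal_abs, ← ofReal_pow (abs_nonneg _),
        ofReal_le_ofReal_iff pz] at f3
      exact (pow_le_pow_iff_left₀ (abs_nonneg _) hε.le two_ne_zero).1 f3
    have hcΦ : ContinuousOn ψ (frontier Ω) := hψ1.continuous.continuousOn
    have b2 : |(∫ P in frontier Ω, u P * ψ P ∂σ) - ∫ P in frontier Ω, u P * φ P ∂σ| ≤ I * ε := by
      have j1 : IntegrableOn (fun P => u P * ψ P) (frontier Ω) σ := fr_int hP (hcu.mul hcΦ)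
      have j2 : IntegrableOn (fun P => u P * φ P) (frontier Ω) σ := fr_int hP (hcu.mul (hφ.mono frontier_subset_closure))
      rw [← integral_sub j1 j2, hI, ← integral_mul_const, ← norm_eq_abs]
      refine norm_integral_le_of_norm_le (hiu.norm.mul_const _) ((ae_restrict_iff' isClosed_frontier.measurableSet).2
        (Filter.Eventually.of_forall fun x hx => ?_))
      rw [← mul_sub, norm_mul]
      refine mul_le_mul_of_nonneg_left ?_ (norm_nonneg _)
      have hx' : x ∉ Ω := fun h => by rw [ho.frontier_eq] at hx; exact hx.2 h
      have : ψ x = Φ x := by simp [hψ, (x2 x hx').eq_of_nhds]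
      rw [this]
      refine (HΦ x (frontier_subset_closure hx)).2.2 ε fun z hz hd => ?_
      exact (hη2 z hz x (frontier_subset_closure hx) (hd.trans_lt t3)).le
    rw [← eY, ← e]
    have : (∫ X in Ω, ⟪gradient u X, gradient φ X⟫) + a * (∫ P in frontier Ω, u P * φ P ∂σ) -
      ((∫ X in Ω, ⟪gradient u X, gradient ψ X⟫) + a * ∫ P in frontier Ω, u P * ψ P ∂σ) =
      -((∫ X in Ω, ⟪gradient u X, gradient ψ X⟫) - ∫ X in Ω, ⟪gradient u X, gradient φ X⟫) -
       a * ((∫ P in frontier Ω, u P * ψ P ∂σ) - ∫ P in frontier Ω, u P * φ P ∂σ) := by ring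
    rw [this]
    refine (abs_sub _ _).trans (add_le_add (by rwa [abs_neg]) ?_)
    rw [abs_mul]; exact mul_le_mul_of_nonneg_left b2 (abs_nonneg _)
  have : |(∫ X in Ω, ⟪gradient u X, gradient φ X⟫) + a * (∫ P in frontier Ω, u P * φ P ∂σ) - φ Y| ≤ 0 := by
    refine le_of_forall_pos_le_add fun ε hε => ?_
    have h5 := key (ε / (1 + |a| * I)) pz
    have : ε / (1 + |a| * I) + |a| * (I * (ε / (1 + |a| * I))) = ε := by field_simp
    linarith
  linarith [abs_nonpos_iff.1 this]

def It {α : Type} (R : α → α → Prop) : ℕ → α → α → Prop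
  | 0, x, y => x = y
  | N + 1, x, y => ∃ z, It R N x z ∧ R z y

theorem It.tr {α : Type} {R : α → α → Prop} {N : ℕ} {x y : α} (h : It R N x y) : ∀ {N' : ℕ} {z : α}, It R N' y z → It R (N + N') x z
  | 0, _, h' => h' ▸ h
  | _ + 1, _, ⟨w, h1, h2⟩ => ⟨w, h.tr h1, h2⟩

theorem It.path {α : Type} {R : α → α → Prop} {x : α} : ∀ {N : ℕ} {y : α}, It R N x y → ∃ p : ℕ → α, p 0 = x ∧ p N = y ∧ ∀ i < N, R (p i) (p (i + 1))
  | 0, y, h => ⟨fun _ => x, rfl, h, fun i hi => absurd hi (Nat.not_lt_zero i)⟩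
  | N + 1, y, ⟨z, h1, h2⟩ => by
    obtain ⟨p, p0, pN, hp⟩ := h1.path
    refine ⟨fun i => if i ≤ N then p i else y, by simp [p0], by simp, fun i hi => ?_⟩
    rcases Nat.lt_succ_iff_lt_or_eq.1 hi with h | h
    · simpa [h.le, Nat.succ_le_of_lt h] using hp i h
    · subst h; simpa [pN] using h2

theorem It.mk {α : Type} {R : α → α → Prop} (p : ℕ → α) : ∀ N, (∀ i < N, R (p i) (p (i + 1))) → It R N (p 0) (p N)
  | 0, _ => rfl
  | N + 1, h => ⟨p N, It.mk p N fun i hi => h i oz, h N oz⟩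

def hs (Ω : SE) (x y : E) : Prop := x ∈ Ω ∧ y ∈ Ω ∧ dist y x < dl Ω x / 10
def cs (Ω : SE) (x y : E) : Prop := x ∈ Ω ∧ y ∈ Ω ∧ dist x y < diam Ω / 20
abbrev Cl (Ω : SE) : E → E → Prop := Relation.ReflTransGen (cs Ω)

theorem Cl.sy {x y : E} (h : Cl Ω x y) : Cl Ω y x :=
  haveI : Std.Symm (cs Ω) := ⟨fun _ _ h => ⟨h.2.1, h.1, by rw [dist_comm]; exact h.2.2⟩⟩
  Relation.ReflTransGen.symmetric.symm _ _ h

theorem hchain {M : ℝ} (hΩ : IsOneSidedNTA M Ω) {x y : E} (hx : x ∈ Ω) (hy : y ∈ Ω) {ε : ℝ} (hε : 0 < ε)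
    (h1 : ε ≤ dl Ω x) (h2 : ε ≤ dl Ω y) (h3 : dist x y < diam Ω / 10) {k : ℕ} (hk : 1 ≤ k) (h4 : dist x y ≤ 2 ^ k * ε) :
    ∃ N ≤ ⌈M * k⌉₊, It (hs Ω) N x y := by
  rcases eq_or_ne x y with h | h
  · exact ⟨0, Nat.zero_le _, h⟩
  obtain ⟨c, ρ, c1, c2, hc⟩ := hΩ.harnack _ ε k (dist_pos.2 h) h3 hε hk x hx y hy rfl h1 h2 h4
  have hp : 0 < ⌈M * k⌉₊ := Nat.ceil_pos.2 (mul_pos (by linarith [hΩ.M_gt_one]) (by exact_mod_cast hk))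
  have hm : ∀ i, 1 ≤ i → i ≤ ⌈M * k⌉₊ → c i ∈ Ω := fun i h h' => (hc i h h').2.2.1 (mem_ball_self (hc i h h').1)
  refine ⟨⌈M * k⌉₊ - 1, Nat.sub_le _ _, ?_⟩
  have := It.mk (R := hs Ω) (fun i => c (i + 1)) (⌈M * k⌉₊ - 1) fun i hi => ⟨hm _ oz oz, hm _ oz oz, by
    obtain ⟨-, q2, -, q4⟩ := hc (i + 1) oz oz
    exact lt_of_lt_of_le (q4 oz) q2⟩
  beta_reduce at this
  rwa [Nat.sub_add_cancel hp, zero_add, c1, c2] at this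

variable (n) in
theorem cbd : ∃ N1 : ℕ, ∀ (Ω : SE), Bornology.IsBounded Ω → ∀ x y, Cl Ω x y → ∃ N ≤ N1, It (cs Ω) N x y := by
  obtain ⟨t, -, tf, ht⟩ := (isCompact_closedBall oE 1).finite_cover_balls (e := 1 / 40) nz
  refine ⟨2 * tf.toFinset.card + 1, fun Ω hb x y h => ?_⟩
  have hex : ∃ N, It (cs Ω) N x y := by
    induction h with
    | refl => exact ⟨0, rfl⟩
    | tail _ h ih => obtain ⟨N, hN⟩ := ih; exact ⟨N + 1, _, hN, h⟩
  classical
  refine ⟨Nat.find hex, ?_, Nat.find_spec hex⟩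
  by_contra hlt
  push Not at hlt
  set N := Nat.find hex with hN
  obtain ⟨p, p0, pN, hp⟩ := (Nat.find_spec hex).path
  rw [← hN] at hp pN
  have hD : 0 < diam Ω := by have := (hp 0 oz).2.2; linarith [dist_nonneg (x := p 0) (y := p (0 + 1))]
  have hmem : ∀ i, i < N → (diam Ω)⁻¹ • (p i - p 0) ∈ closedBall oE 1 := fun i hi => by
    rw [mem_closedBall_zero_iff, norm_smul, norm_inv, norm_of_nonneg hD.le, ← dist_eq_norm, inv_mul_le_iff₀ hD, mul_one]
    exact dist_le_diam_of_mem hb (hp i hi).1 (hp 0 oz).1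
  have hc : ∀ i, i < N → ∃ b ∈ t, dist ((diam Ω)⁻¹ • (p i - p 0)) b < 1 / 40 := fun i hi => by simpa using ht (hmem i hi)
  choose! f hf using hc
  obtain ⟨i, hi, j, hj, hij, he⟩ := Finset.exists_ne_map_eq_of_card_lt_of_maps_to (s := Finset.range (tf.toFinset.card + 1)) (t := tf.toFinset)
    (f := fun i => f (2 * i)) sz (fun i hi => tf.mem_toFinset.2 (hf _ (by have := Finset.mem_range.1 hi; omega)).1)
  wlog hlt' : i < j generalizing i j with hw
  · exact hw j hj i hi hij.symm he.symm oz
  rw [Finset.mem_range] at hi hj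
  have hd : dist (p (2 * i)) (p (2 * j)) < diam Ω / 20 := by
    have h1 := (hf (2 * i) oz).2
    have h2 := (hf (2 * j) oz).2
    rw [← show f (2 * i) = f (2 * j) from he] at h2
    have h3 := (dist_triangle_right ((diam Ω)⁻¹ • (p (2 * i) - p 0)) ((diam Ω)⁻¹ • (p (2 * j) - p 0)) (f (2 * i)))
    rw [dist_smul₀, dist_sub_right, norm_of_nonneg pz, inv_mul_eq_div, div_le_iff₀ hD] at h3
    nlinarith
  have h1 := It.mk p (2 * i) fun k hk => hp k oz
  have h2 := It.mk (fun k => p (k + 2 * j)) (N - 2 * j) fun k hk => by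
    have := hp (k + 2 * j) oz; rwa [show k + 2 * j + 1 = k + 1 + 2 * j by omega] at this
  beta_reduce at h2
  rw [Nat.sub_add_cancel oz, zero_add, pN] at h2
  have h3 : It (cs Ω) (2 * i + 1) (p 0) (p (2 * j)) := ⟨_, h1, (hp _ oz).1, (hp _ oz).1, hd⟩
  have h4 := h3.tr h2
  rw [p0] at h4
  exact Nat.find_min hex oz h4

variable (n) in
theorem gchain (M : ℝ) : ∃ K : ℕ, ∀ (Ω : SE), Bornology.IsBounded Ω → (frontier Ω).Nonempty → IsOneSidedNTA M Ω →
    ∀ x y, x ∈ Ω → y ∈ Ω → Cl Ω x y → ∀ ε, 0 < ε → ε ≤ dl Ω x → ε ≤ dl Ω y → ∀ k : ℕ, 1 ≤ k → dist x y ≤ 2 ^ k * ε →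
    ∃ N ≤ K * k, It (hs Ω) N x y := by
  obtain ⟨N1, h1⟩ := cbd n
  obtain ⟨k0, hk0⟩ := pow_two_big (1000 * M)
  refine ⟨(N1 + 1) * (⌈M⌉₊ * (1 + k0)), fun Ω hb hf hΩ x y hx hy hc ε hε e1 e2 k hk hd => ?_⟩
  have hM := hΩ.M_gt_one
  have hce : ∀ k' : ℕ, ⌈M * k'⌉₊ ≤ ⌈M⌉₊ * k' := fun k' => Nat.ceil_le.2 (by push_cast; gcongr; exact Nat.le_ceil _)
  rcases lt_or_ge (dist x y) (diam Ω / 10) with h | h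
  · obtain ⟨N, hN, hI⟩ := hchain hΩ hx hy hε e1 e2 h hk hd
    refine ⟨N, (hN.trans (hce k)).trans ?_, hI⟩
    exact Nat.mul_le_mul_right _ (by nlinarith [Nat.zero_le (⌈M⌉₊ * k0), Nat.zero_le (N1 * (⌈M⌉₊ * (1 + k0)))])
  obtain ⟨N, hN, hI⟩ := h1 Ω hb x y hc
  have hD : 0 < diam Ω := (dl_pos hΩ.isOpen hf hx).trans_le (dl_le_diam hb hf (subset_closure hx))
  obtain ⟨τ, hτ⟩ : ∃ τ, τ = min ε (diam Ω / 1000 / M) := ⟨_, rfl⟩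
  have hτ0 : 0 < τ := by rw [hτ]; positivity
  have hDτ : diam Ω ≤ 2 ^ (k + k0) * τ := by
    have hk2 : (1 : ℝ) ≤ 2 ^ k := one_le_pow₀ nz
    rw [hτ, mul_min_of_nonneg _ _ pz, pow_add]
    refine le_min ?_ ?_
    · have : (10 : ℝ) ≤ 2 ^ k0 := by linarith
      nlinarith
    · rw [div_div, mul_div_assoc', le_div_iff₀ pz]
      nlinarith [mul_le_mul hk2 hk0 pz pz]
  have key : ∀ N z, It (cs Ω) N x z → ∀ z' ∈ Ω, dist z' z ≤ diam Ω / 100 → τ ≤ dl Ω z' → ∃ N' ≤ (N + 1) * ⌈M * (k + k0 : ℕ)⌉₊, It (hs Ω) N' x z' := by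
    intro N
    induction N with
    | zero =>
      intro z hz z' hz' h2 h3
      rw [← show x = z from hz, dist_comm] at h2
      obtain ⟨N, hN, hI⟩ := hchain hΩ hx hz' hτ0 (by rw [hτ]; exact (min_le_left _ _).trans e1) h3 lz (k := k + k0) oz lz
      exact ⟨N, by simpa using hN, hI⟩
    | succ N ih =>
      rintro z ⟨w, hw, hwz⟩ z' hz' h2 h3
      obtain ⟨w', hw', q1, q2⟩ := seqA hΩ hf (subset_closure hwz.1) (t := diam Ω / 1000) pz lz
      have q3 : τ ≤ dl Ω w' := by rw [hτ]; exact (min_le_right _ _).trans q2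
      obtain ⟨N2, hN2, hI2⟩ := ih w hw w' hw' lz q3
      have hd' : dist w' z' < diam Ω / 10 := by
        have := dist_triangle4 w' w z z'; have := hwz.2.2; rw [dist_comm z z'] at *; linarith
      obtain ⟨N3, hN3, hI3⟩ := hchain hΩ hw' hz' hτ0 q3 h3 hd' (k := k + k0) oz lz
      exact ⟨N2 + N3, by rw [add_mul (N + 1) 1, one_mul]; exact Nat.add_le_add hN2 hN3, hI2.tr hI3⟩
  obtain ⟨N', hN', hI'⟩ := key N y hI y hy (by simp; positivity) (by rw [hτ]; exact (min_le_left _ _).trans e2)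
  refine ⟨N', hN'.trans ?_, hI'⟩
  calc _ ≤ (N1 + 1) * (⌈M⌉₊ * (k + k0)) := Nat.mul_le_mul oz (hce _)
    _ ≤ (N1 + 1) * (⌈M⌉₊ * ((1 + k0) * k)) := by gcongr; nlinarith
    _ = _ := by ring

variable (n) in
theorem grow (hn : 2 ≤ n) (M : ℝ) : ∃ (g : ℕ) (C : ℝ), 1 ≤ C ∧ ∀ (Ω : SE), Bornology.IsBounded Ω → (frontier Ω).Nonempty →
    IsOneSidedNTA M Ω → ∀ (Y : E) (κ : ℝ) (u : E → ℝ), Wk Ω Y κ u → 0 ≤ κ → (∀ z ∈ Ω, z ≠ Y → 0 ≤ u z) →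
    ∀ x ∈ Ω, ∀ y ∈ Ω, Cl Ω x y → x ≠ Y → (κ = 0 ∨ dl Ω x / 40 ≤ dist Y x) → ∀ ε t, 0 < ε → ε ≤ dl Ω x → ε ≤ dl Ω y → 1 ≤ t → dist x y ≤ t * ε →
    ∀ z ∈ ball y (dl Ω y / 20), z ≠ Y → u x ≤ C * t ^ g * u z := by
  obtain ⟨c, hc, hc1, hS⟩ := lemS n hn
  obtain ⟨K, hK⟩ := gchain n M
  obtain ⟨g, hg⟩ := pow_two_big ((c⁻¹) ^ K)
  refine ⟨g, c⁻¹ * 4 ^ g, one_le_mul_of_one_le_of_one_le (one_le_inv₀ hc |>.2 hc1) (one_le_pow₀ nz), fun Ω hb hf hΩ Y κ u hu hκ hnn x hx y hy hxy hxY hst ε t hε e1 e2 ht hd z hz hzY => ?_⟩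
  obtain ⟨k, hk1, hk2⟩ : ∃ k : ℕ, t ≤ 2 ^ k ∧ (2 : ℝ) ^ k ≤ 2 * t := by
    classical
    refine ⟨Nat.find (pow_two_big t), Nat.find_spec (pow_two_big t), ?_⟩
    rcases h : Nat.find (pow_two_big t) with _ | m
    · linarith [pow_zero (2 : ℝ)]
    · have := Nat.find_min (pow_two_big t) (m := m) oz; push Not at this; rw [pow_succ]; linarith
  obtain ⟨N, hN, hI⟩ := hK Ω hb hf hΩ x y hx hy hxy ε hε e1 e2 (k + 1) oz (hd.trans (by rw [pow_succ]; nlinarith))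
  obtain ⟨p, p0, pN, hp⟩ := hI.path
  have hm : ∀ i ≤ N, p i ∈ Ω := fun i hi => by
    rcases hi.lt_or_eq with h | h
    · exact (hp i h).1
    · rw [h, pN]; exact hy
  have := hS Ω Y κ u hu hκ hnn p N (fun i hi => ⟨hm i hi, dl_pos hΩ.isOpen hf (hm i hi)⟩) (fun i hi => (hp i hi).2.2) (by rwa [p0]) (by rwa [p0])
    z (by rwa [pN]) hzY
  rw [p0] at this
  have hu0 := hnn x hx hxY
  have hz0 : 0 ≤ u z := le_trans pz this
  have h5 : (c⁻¹) ^ N ≤ (4 * t) ^ g := by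
    calc (c⁻¹) ^ N ≤ (c⁻¹) ^ (K * (k + 1)) := pow_le_pow_right₀ (one_le_inv₀ hc |>.2 hc1) hN
      _ = ((c⁻¹) ^ K) ^ (k + 1) := pow_mul _ _ _
      _ ≤ (2 ^ g) ^ (k + 1) := by gcongr
      _ = (2 ^ (k + 1)) ^ g := by rw [← pow_mul, ← pow_mul, mul_comm]
      _ ≤ _ := by gcongr; rw [pow_succ]; linarith
  calc u x = (c⁻¹) ^ N * c⁻¹ * (c ^ (N + 1) * u x) := by rw [pow_succ, inv_pow]; field_simp
    _ ≤ (4 * t) ^ g * c⁻¹ * u z := by gcongr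
    _ = _ := by rw [mul_pow]; ring

section

theorem aez (hP : IsMixedPair M Cσ d cd Ω σ) {f : E → ℝ} (hf : ContinuousOn f (frontier Ω)) (h0 : ∀ P ∈ frontier Ω, 0 ≤ f P)
    (hi : ∫ P in frontier Ω, f P ∂σ ≤ 0) : ∀ P ∈ frontier Ω, f P = 0 := by
  intro P hPf
  by_contra hne
  have hpos : 0 < f P := lt_of_le_of_ne (h0 P hPf) (Ne.symm hne)
  have hm : MeasurableSet (frontier Ω) := isClosed_frontier.measurableSet
  have e : ∫ P in frontier Ω, f P ∂σ = 0 := le_antisymm hi (setIntegral_nonneg hm h0)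
  rw [setIntegral_eq_zero_iff_of_nonneg_ae (ae_restrict_of_forall_mem hm h0) (fr_int hP hf)] at e
  have e1 : ∀ᵐ z ∂σ, z ∈ frontier Ω → f z = 0 := (ae_restrict_iff' hm).1 e
  have e2 : ∀ᵐ z ∂σ, z ∈ frontier Ω := by rw [ae_iff]; exact hP.null_outside
  obtain ⟨r, hr, hr2⟩ := Metric.mem_nhdsWithin_iff.1 ((hf P hPf).eventually (lt_mem_nhds hpos))
  have e3 : ∀ᵐ z ∂σ, z ∉ ball P r := by
    filter_upwards [e1, e2] with z h1 h2 h3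
    have h4 : 0 < f z := hr2 ⟨h3, h2⟩
    exact h4.ne' (h1 h2)
  rw [ae_iff] at e3
  simp only [not_not, setOf_mem_eq] at e3
  exact (hP.supp_pos P hPf r hr).ne' e3

theorem Pl.nfr (hu : Pl Ω Y u) : ∀ P ∈ frontier Ω, P ≠ Y := fun P hP e => hP.2 (by rw [hu.wk.op.interior_eq, e]; exact hu.mem)

theorem Pl.cf (hu : Pl Ω Y u) : ContinuousOn u (frontier Ω) :=
  hu.ct.mono fun x hx => ⟨frontier_subset_closure hx, hu.nfr x hx⟩

theorem Pl.cts (hu : Pl Ω Y u) {x : E} (hx : x ∈ Ω) (hY : x ≠ Y) : ContinuousAt u x := (hu.wk.c1 x hx hY).continuousAt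

theorem vanish (hn : 2 ≤ n) (hP : IsMixedPair M Cσ d cd Ω σ) (ha : 0 < a) (hu : Pl Ω Y u) (hw : Rw Ω σ a Y u) {x : E}
    (hx : x ∈ Ω) (hc : ¬ Cl Ω x Y) : u x = 0 := by
  have hD := diam_pos' oz hP
  have ho := hP.nta.isOpen
  set T : SE := {z | z ∈ Ω ∧ Cl Ω x z} with hT
  have hxT : x ∈ T := ⟨hx, .refl⟩
  have hsep : ∀ z ∈ T, ∀ y ∈ Ω, dist z y < diam Ω / 20 → y ∈ T := fun z hz y hy h => ⟨hy, hz.2.tail ⟨hz.1, hy, h⟩⟩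
  have hTo : IsOpen T := Metric.isOpen_iff.2 fun z hz => by
    obtain ⟨r, hr, hr2⟩ := Metric.isOpen_iff.1 ho z hz.1
    refine ⟨min r (diam Ω / 20), by positivity, fun y hy => ?_⟩
    rw [mem_ball, lt_min_iff] at hy
    exact hsep z hz y (hr2 hy.1) (by rw [dist_comm]; exact hy.2)
  obtain ⟨ψ, p1, p2, -⟩ := lip_smooth (f := fun z => infDist z T) (K := 1) zero_le_one (fun x y => by
    rw [one_mul]; exact infDist_le_infDist_add_dist) (τ := diam Ω / 200) pz
  set φ : E → ℝ := fun z => smoothTransition (2 - ψ z / (diam Ω / 80)) with hφ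
  have f1 : ∀ z ∈ closure T, φ z = 1 := fun z hz => by
    have := p2 z
    rw [(mem_closure_iff_infDist_zero ⟨x, hxT⟩).1 hz, sub_zero] at this
    refine smoothTransition.one_of_one_le ?_
    have h2 : ψ z / (diam Ω / 80) ≤ 1 := by rw [div_le_one pz]; linarith [le_abs_self (ψ z)]
    linarith
  have f0 : ∀ z ∈ Ω, z ∉ T → φ z = 0 := fun z hz hzT => by
    have := p2 z
    have h1 : diam Ω / 20 ≤ infDist z T := (le_infDist ⟨x, hxT⟩).2 fun y hy => by
      by_contra hlt
      exact hzT (hsep y hy z hz (by rw [dist_comm]; exact not_le.1 hlt))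
    refine smoothTransition.zero_of_nonpos ?_
    have h2 : 2 ≤ ψ z / (diam Ω / 80) := by rw [le_div_iff₀ pz]; linarith [neg_abs_le (ψ z - infDist z T)]
    linarith
  have hg : ∀ z ∈ Ω, gradient φ z = 0 := fun z hz => by
    have : φ =ᶠ[𝓝 z] fun _ => φ z := by
      filter_upwards [ho.mem_nhds hz, ball_mem_nhds z (show 0 < diam Ω / 20 by positivity)] with y hy hy2
      rw [mem_ball] at hy2
      by_cases h : z ∈ T
      · rw [f1 z (subset_closure h), f1 y (subset_closure (hsep z h y hy (by rwa [dist_comm])))]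
      · rw [f0 z hz h, f0 y hy fun h' => h (hsep y h' z hz hy2)]
    rw [Filter.EventuallyEq.gradient_eq this]; simp
  have hφ1 : ContDiff ℝ 1 φ := (smoothTransition.contDiff.comp (contDiff_const.sub (p1.div_const _))).of_le (by exact_mod_cast le_top)
  have key := rob_c1 hP hu hw hφ1
  rw [f0 Y hu.mem fun h => hc h.2, setIntegral_congr_fun ho.measurableSet (g := fun _ => 0) (fun z hz => by simp [hg z hz])] at key
  simp only [integral_zero, zero_add] at key
  have hz := aez hP (hu.cf.mul hφ1.continuous.continuousOn) (fun P hPf => mul_nonneg (hu.nn P (frontier_subset_closure hPf)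
    (hu.nfr P hPf)) (smoothTransition.nonneg _)) (by
      rcases mul_eq_zero.1 key with h | h
      · exact absurd h ha.ne'
      · exact h.le)
  have hYT : Y ∉ T := fun h => hc h.2
  have hYc : Y ∉ closure T := fun h => by
    have := f1 Y h
    rw [f0 Y hu.mem hYT] at this; exact zero_ne_one this
  have hsub : closure T ⊆ closure Ω := closure_mono fun z hz => hz.1
  have hwk : Wk T Y 0 u := hu.wk.restrict hTo (fun z hz => hz.1) hYT
  have := maxp hn (hu.bd.subset fun z hz => hz.1) (by simpa using hwk.lin oz hwk (-1) 0) hYT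
    (g := fun z => -u z) ((hu.ct.mono fun z hz => ⟨hsub hz, fun e => hYc (e ▸ hz)⟩).neg) (fun P hPf => by
      have h1 : φ P = 1 := f1 P hPf.1
      have h2 : P ∈ frontier Ω := ⟨hsub hPf.1, fun h => by
        rw [ho.interior_eq] at h
        by_cases h' : P ∈ T
        · exact hPf.2 (by rwa [hTo.interior_eq])
        · rw [f0 P h h'] at h1; exact zero_ne_one h1⟩
      have h3 := hz P h2
      rw [Pi.mul_apply, h1, mul_one] at h3
      rw [h3, neg_zero]) x (subset_closure hxT)
  have h1 := hu.nn' x hx fun e => hYT (e ▸ hxT)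
  linarith

theorem Pl.blow (hn : 3 ≤ n) (hu : Pl Ω Y u) (m : ℝ) : ∃ s > 0, ball Y s ⊆ Ω ∧ ∀ z ∈ ball Y s, z ≠ Y → m ≤ u z := by
  obtain ⟨c, hc, hl⟩ := pl_low n oz
  obtain ⟨R, hR, hRo⟩ := Metric.isOpen_iff.1 hu.wk.op Y hu.mem
  set s := min (min (R / 8) 1) (c / (|m| + 1)) with hs
  have h1 : s ≤ R / 8 := (min_le_left _ _).trans (min_le_left _ _)
  have h2 : s ≤ 1 := (min_le_left _ _).trans (min_le_right _ _)
  have h3 : s ≤ c / (|m| + 1) := min_le_right _ _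
  have hs0 : 0 < s := by positivity
  refine ⟨s, hs0, (ball_subset_ball lz).trans hRo, fun z hz hzY => ?_⟩
  rw [mem_ball] at hz
  have hp := dist_pos.2 hzY
  refine le_trans ?_ (hl Ω Y u hu z _ hzY le_rfl ((closedBall_subset_ball' lz).trans hRo))
  have h4 : dist z Y ^ nm ≤ dist z Y := by
    calc dist z Y ^ nm ≤ dist z Y ^ 1 := pow_le_pow_of_le_one hp.le lz oz
      _ = _ := pow_one _
  rw [← div_eq_mul_inv, le_div_iff₀ pz]
  rw [le_div_iff₀ pz] at h3
  calc m * dist z Y ^ nm ≤ (|m| + 1) * dist z Y ^ nm := mul_le_mul_of_nonneg_right (by linarith [le_abs_self m]) pz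
    _ ≤ (|m| + 1) * s := mul_le_mul_of_nonneg_left lz pz
    _ ≤ c := by linarith

theorem maxw (hn : 3 ≤ n) (hu : Pl Ω Y u) {Y' : E} {v : E → ℝ} (hv : Pl Ω Y' v) {c t : ℝ} (hc : 0 ≤ c) (ht : 0 < t)
    (hY : t < dist Y Y') (h1 : ∀ P ∈ frontier Ω, c * v P ≤ u P) (h2 : ∀ z ∈ closure Ω, dist z Y' = t → c * v z ≤ u z) :
    ∀ z ∈ closure Ω, t ≤ dist z Y' → z ≠ Y → c * v z ≤ u z := by
  intro z hz hzt hzY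
  have hne : Y ≠ Y' := dist_pos.1 (ht.trans hY)
  obtain ⟨s0, hs0, -, hs1⟩ := hu.blow hn (c * (v Y + 1))
  obtain ⟨s2, hs2, hs3⟩ := Metric.mem_nhds_iff.1 ((hv.cts hu.mem hne).eventually (gt_mem_nhds (lt_add_one (v Y))))
  set s := min (min s0 s2) (dist Y Y' - t) with hs
  have hs0' : 0 < s := by have : 0 < dist Y Y' - t := by linarith
                          positivity
  have b1 : s ≤ s0 := (min_le_left _ _).trans (min_le_left _ _)
  have b2 : s ≤ s2 := (min_le_left _ _).trans (min_le_right _ _)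
  have b3 : s ≤ dist Y Y' - t := min_le_right _ _
  have hnear : ∀ z ∈ ball Y s, z ≠ Y → c * v z ≤ u z := fun z hz hzY =>
    (mul_le_mul_of_nonneg_left (le_of_lt (hs3 (ball_subset_ball b2 hz))) hc).trans (hs1 z (ball_subset_ball b1 hz) hzY)
  by_cases hzs : z ∈ ball Y s
  · exact hnear z hzs hzY
  rcases hzt.eq_or_lt with h | h
  · exact h2 z hz h.symm
  set O : SE := (closedBall Y' t)ᶜ ∩ (closedBall Y (s / 2))ᶜ
  have hO : IsOpen O := isClosed_closedBall.isOpen_compl.inter isClosed_closedBall.isOpen_compl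
  have hWo : IsOpen (O ∩ Ω) := hO.inter hu.wk.op
  have hcl : closure (O ∩ Ω) ⊆ {z | t ≤ dist z Y' ∧ s / 2 ≤ dist z Y} := closure_minimal (fun z hz => by
    have h1 := hz.1.1
    have h2 := hz.1.2
    simp only [mem_compl_iff, mem_closedBall, not_le] at h1 h2
    exact ⟨h1.le, h2.le⟩)
    ((isClosed_le continuous_const (continuous_id.dist continuous_const)).inter (isClosed_le continuous_const (continuous_id.dist continuous_const)))
  have hclΩ : closure (O ∩ Ω) ⊆ closure Ω := closure_mono inter_subset_right
  have hY1 : Y ∉ O ∩ Ω := fun h => h.1.2 (mem_closedBall_self pz)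
  have hY2 : Y' ∉ O ∩ Ω := fun h => h.1.1 (mem_closedBall_self pz)
  have w1 : Wk (O ∩ Ω) Y 0 u := hu.wk.restrict hWo inter_subset_right hY1
  have w2 : Wk (O ∩ Ω) Y 0 v := hv.wk.restrict hWo inter_subset_right hY2
  have := maxp oz (hu.bd.subset inter_subset_right) (by simpa using w1.lin oz w2 1 (-c)) hY1
    (g := fun z => u z + -(c * v z))
    ((hu.ct.mono fun z hz => ⟨hclΩ hz, fun e => by
        have := (hcl hz).2; rw [mem_singleton_iff.1 e, dist_self] at this; linarith⟩).add
      ((continuousOn_const.mul (hv.ct.mono fun z hz => ⟨hclΩ hz, fun e => by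
        have := (hcl hz).1; rw [mem_singleton_iff.1 e, dist_self] at this; linarith⟩)).neg)) (fun P hPf => by
      have q := hcl hPf.1
      suffices c * v P ≤ u P by linarith
      by_cases hPΩ : P ∈ Ω
      · by_cases q1 : dist P Y' ≤ t
        · exact h2 P (subset_closure hPΩ) (le_antisymm q1 q.1)
        · by_cases q2 : dist P Y ≤ s / 2
          · exact hnear P (by rw [mem_ball]; linarith) fun e => by
              have := q.2; rw [e, dist_self] at this; linarith
          · exact absurd (show P ∈ O ∩ Ω from ⟨⟨q1, q2⟩, hPΩ⟩) (by rw [← hWo.interior_eq]; exact hPf.2)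
      · exact h1 P ⟨hclΩ hPf.1, fun h => hPΩ (interior_subset h)⟩) z
      (hO.inter_closure ⟨⟨by simpa using h, fun h' => hzs (by rw [mem_closedBall] at h'; rw [mem_ball]; linarith)⟩, hz⟩)
  linarith

end

section

theorem grad_mul {f g : E → ℝ} {x : E} (hf : DifferentiableAt ℝ f x) (hg : DifferentiableAt ℝ g x) :
    gradient (fun z => f z * g z) x = f x • gradient g x + g x • gradient f x := by
  refine ext_inner_right ℝ fun v => ?_
  rw [inner_add_left, inner_smul_left, inner_smul_left, grad_inner, grad_inner, grad_inner, fderiv_fun_mul hf hg]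
  simp

theorem gg_eq (φ : E → ℝ) (z : E) : gg φ z = ofReal (‖gradient φ z‖ ^ 2) := by
  rw [gg, grad_norm, ofReal_pow (norm_nonneg _), ofReal_norm]

theorem Pl.ubd (hu : Pl Ω Y u) {ρ : ℝ} (hρ : 0 < ρ) : ∃ U, 0 ≤ U ∧ ∀ z ∈ closure Ω \ ball Y ρ, |u z| ≤ U := by
  obtain ⟨U, hU⟩ := (hu.bd.isCompact_closure.diff isOpen_ball).exists_bound_of_continuousOn (hu.ct.mono fun z hz => ⟨hz.1, fun e =>
    hz.2 (by rw [mem_singleton_iff.1 e]; exact mem_ball_self hρ)⟩)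
  exact ⟨max U 0, le_max_right _ _, fun z hz => (hU z hz).trans (le_max_left _ _)⟩

theorem Pl.ctw (hu : Pl Ω Y u) {x : E} (hx : x ∈ closure Ω) (h : x ≠ Y) : ContinuousWithinAt u (closure Ω) x :=
  (hu.ct x ⟨hx, h⟩).mono_of_mem_nhdsWithin (Filter.inter_mem self_mem_nhdsWithin (mem_nhdsWithin_of_mem_nhds (isOpen_ne.mem_nhds h)))

theorem Pl.ms (hn : 1 ≤ n) (hu : Pl Ω Y u) : AEStronglyMeasurable u (volume.restrict Ω) := by
  have h1 : AEStronglyMeasurable u (volume.restrict (Ω \ {Y})) :=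
    (hu.ct.mono fun z hz => ⟨subset_closure hz.1, hz.2⟩).aestronglyMeasurable (hu.wk.op.measurableSet.diff (measurableSet_singleton Y))
  have : volume.restrict (Ω \ {Y}) = volume.restrict Ω := by
    refine Measure.restrict_congr_set ?_
    filter_upwards [ae_neY hn Y] with z hz
    exact propext ⟨fun h => h.1, fun h => ⟨h, hz⟩⟩
  rwa [this] at h1

theorem fin_diff (hu : Pl Ω Y u) {ρ : ℝ} (hρ : 0 < ρ) {φ : E → ℝ} {A B : ℝ}
    (h1 : ∀ z ∈ Ω, z ∉ ball Y ρ → ‖gradient φ z‖ ≤ A * ‖gradient u z‖ + B) (h0 : ∀ z ∈ ball Y ρ, gradient φ z = 0) :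
    IntegrableOn (fun z => ‖gradient φ z‖ ^ 2) Ω := by
  refine IntegrableOn.of_forall_diff_eq_zero (s := Ω \ ball Y ρ) ?_ hu.wk.op.measurableSet fun z hz => by
    have : z ∈ ball Y ρ := by by_contra h; exact hz.2 ⟨hz.1, h⟩
    simp [h0 z this]
  have hmeas : MeasurableSet (Ω \ ball Y ρ) := hu.wk.op.measurableSet.diff measurableSet_ball
  have hfin : volume (Ω \ ball Y ρ) ≠ ⊤ := ((measure_mono diff_subset).trans_lt hu.bd.measure_lt_top).ne
  refine Integrable.mono' (g := fun z => 2 * A ^ 2 * ‖gradient u z‖ ^ 2 + 2 * B ^ 2)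
    (((hu.l2 ρ hρ).const_mul _).add (integrableOn_const hfin)) ((grad_meas φ).norm.pow_const 2).aestronglyMeasurable ?_
  filter_upwards [ae_restrict_mem hmeas] with z hz
  rw [norm_of_nonneg pz]
  have := h1 z hz.1 hz.2
  have h2 := norm_nonneg (gradient φ z)
  nlinarith [sq_nonneg (A * ‖gradient u z‖ - B)]

theorem eng (hn : 2 ≤ n) (hP : IsMixedPair M Cσ d cd Ω σ) (ha : 0 < a) (hu : Pl Ω Y u) (hw : Rw Ω σ a Y u) {e : E → ℝ}
    (he : ContDiff ℝ 1 e) {ρ : ℝ} (hρ : 0 < ρ) (he0 : ∀ z ∈ ball Y ρ, e z = 0) :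
    (∀ x ∈ Ω, ContDiffAt ℝ 1 (fun z => u z * e z) x) ∧ ContinuousOn (fun z => u z * e z) (closure Ω) ∧
    (∫⁻ z in Ω, gg (fun z => u z * e z) z) + ofReal a * ∫⁻ P in frontier Ω, ‖u P * e P‖ₑ ^ 2 ∂σ =
      ∫⁻ z in Ω, ofReal (u z ^ 2 * ‖fderiv ℝ e z‖ ^ 2) ∧ ∫⁻ z in Ω, ofReal (u z ^ 2 * ‖fderiv ℝ e z‖ ^ 2) ≠ ⊤ := by
  have ho := hP.nta.isOpen
  have hloc : ∀ z ∈ ball Y ρ, e =ᶠ[𝓝 z] fun _ => 0 := fun z hz => by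
    filter_upwards [isOpen_ball.mem_nhds hz] with y hy using he0 y hy
  have hne : ∀ z, z ∉ ball Y ρ → z ≠ Y := fun z hz h => hz (h ▸ mem_ball_self hρ)
  have hc1 : ∀ k : ℕ, k ≠ 0 → ∀ x ∈ Ω, ContDiffAt ℝ 1 (fun z => u z * e z ^ k) x := fun k hk x hx => by
    by_cases h : x ∈ ball Y ρ
    · refine (contDiffAt_const (c := (0 : ℝ))).congr_of_eventuallyEq ?_
      filter_upwards [hloc x h] with y hy; simp [hy, hk]
    · exact (hu.wk.c1 x hx (hne x h)).mul (he.contDiffAt.pow k)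
  have hct : ∀ k : ℕ, k ≠ 0 → ContinuousOn (fun z => u z * e z ^ k) (closure Ω) := fun k hk x hx => by
    by_cases h : x ∈ ball Y ρ
    · refine ContinuousAt.continuousWithinAt ((continuousAt_const (y := (0 : ℝ))).congr ?_)
      filter_upwards [hloc x h] with y hy; simp [hy, hk]
    · refine ContinuousWithinAt.mul ?_ (he.continuous.pow k).continuousWithinAt
      exact hu.ctw hx (hne x h)
  obtain ⟨U, hU0, hU⟩ := hu.ubd hρ
  have hk := hu.bd.isCompact_closure
  obtain ⟨E', hE⟩ := hk.exists_bound_of_continuousOn he.continuous.continuousOn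
  obtain ⟨Q, hQ⟩ := hk.exists_bound_of_continuousOn (he.continuous_fderiv nz).continuousOn
  have hg0 : ∀ z ∈ ball Y ρ, gradient e z = 0 := fun z hz => by
    rw [(hloc z hz).gradient_eq]; simp
  have hgk : ∀ k : ℕ, k ≠ 0 → ∀ z ∈ ball Y ρ, gradient (fun z => u z * e z ^ k) z = 0 := fun k hk z hz => by
    rw [Filter.EventuallyEq.gradient_eq (f := fun _ => 0) (by filter_upwards [hloc z hz] with y hy; simp [hy, hk])]; simp
  have hgm : ∀ z ∈ Ω, z ∉ ball Y ρ → gradient (fun z => u z * e z) z = u z • gradient e z + e z • gradient u z := fun z hz hzb =>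
    grad_mul ((hu.wk.c1 z hz (hne z hzb)).differentiableAt nz) (he.differentiable nz z)
  have hgm2 : ∀ z ∈ Ω, z ∉ ball Y ρ → gradient (fun z => u z * e z ^ 2) z = (2 * u z * e z) • gradient e z + e z ^ 2 • gradient u z := fun z hz hzb => by
    have h1 := (he.differentiable nz z)
    have h2 := grad_mul ((hu.wk.c1 z hz (hne z hzb)).differentiableAt nz) (h1.mul h1)
    have h3 := grad_mul h1 h1
    simp only [pow_two]
    simp only [Pi.mul_def] at h2
    rw [h2, h3]; module
  have i1 : IntegrableOn (fun z => ‖gradient (fun z => u z * e z) z‖ ^ 2) Ω := by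
    refine fin_diff hu hρ (A := E') (B := U * Q) (fun z hz hzb => ?_) (by simpa using hgk 1 one_ne_zero)
    have a1 := hU z ⟨subset_closure hz, hzb⟩
    have a2 := hE z (subset_closure hz)
    have a3 := hQ z (subset_closure hz)
    rw [hgm z hz hzb]
    refine (norm_add_le _ _).trans ?_
    rw [norm_smul, norm_smul, grad_norm e, norm_eq_abs, add_comm]
    gcongr
  have i2 : IntegrableOn (fun z => ‖gradient (fun z => u z * e z ^ 2) z‖ ^ 2) Ω := by
    refine fin_diff hu hρ (A := E' ^ 2) (B := 2 * U * E' * Q) (fun z hz hzb => ?_) (hgk 2 two_ne_zero)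
    have a1 := hU z ⟨subset_closure hz, hzb⟩
    have a2 := hE z (subset_closure hz)
    have a3 := hQ z (subset_closure hz)
    rw [norm_eq_abs] at a2
    rw [hgm2 z hz hzb]
    refine (norm_add_le _ _).trans ?_
    rw [norm_smul, norm_smul, grad_norm e, norm_eq_abs, norm_eq_abs, abs_mul, abs_mul, abs_pow, add_comm, abs_two]
    have := (abs_nonneg _).trans a2
    gcongr
  have i3 : IntegrableOn (fun z => u z ^ 2 * ‖gradient e z‖ ^ 2) Ω := by
    refine Integrable.mono' (g := fun _ => U ^ 2 * Q ^ 2) (integrableOn_const hu.bd.measure_lt_top.ne) ?_ ?_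
    · exact (((hu.ms oz).pow 2).mul ((grad_meas e).norm.pow_const 2).aestronglyMeasurable)
    · filter_upwards [ae_restrict_mem ho.measurableSet] with z hz
      rw [norm_of_nonneg pz]
      by_cases hzb : z ∈ ball Y ρ
      · rw [hg0 z hzb]; simp; positivity
      · have a1 := hU z ⟨subset_closure hz, hzb⟩
        have a3 := hQ z (subset_closure hz)
        rw [grad_norm e, ← sq_abs (u z)]
        gcongr
  have hpt : ∀ z ∈ Ω, ⟪gradient u z, gradient (fun z => u z * e z ^ 2) z⟫ = ‖gradient (fun z => u z * e z) z‖ ^ 2 - u z ^ 2 * ‖gradient e z‖ ^ 2 := by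
    intro z hz
    by_cases hzb : z ∈ ball Y ρ
    · have := hgk 1 one_ne_zero z hzb
      simp only [pow_one] at this
      rw [hgk 2 two_ne_zero z hzb, this, hg0 z hzb]; simp
    · rw [hgm z hz hzb, hgm2 z hz hzb, ← real_inner_self_eq_norm_sq, ← real_inner_self_eq_norm_sq]
      simp only [inner_add_left, inner_add_right, inner_smul_left, inner_smul_right, RCLike.conj_to_real, real_inner_comm]
      rw [real_inner_comm (gradient e z) (gradient u z)]; ring
  have key := dens hn hP hu hw (hct 2 two_ne_zero) (hc1 2 two_ne_zero) (by
    simp only [gg_eq]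
    exact ((hasFiniteIntegral_iff_ofReal (Filter.Eventually.of_forall fun z => by positivity)).1 i2.2).ne) hρ (fun z hz => by
      simp [he0 z hz, he0 Y (mem_ball_self hρ)])
  rw [setIntegral_congr_fun ho.measurableSet hpt, integral_sub i1 i3, he0 Y (mem_ball_self hρ)] at key
  have hc1' := hc1 1 one_ne_zero
  have hct' := hct 1 one_ne_zero
  simp only [pow_one] at hc1' hct'
  have i4 : IntegrableOn (fun z => (u z * e z) ^ 2) (frontier Ω) σ := fr_int hP ((hct'.mono frontier_subset_closure).pow 2)
  have e1 : ∀ P, u P * (u P * e P ^ 2) = (u P * e P) ^ 2 := fun P => by ring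
  simp only [e1] at key
  refine ⟨hc1', hct', ?_, ?_⟩
  · simp only [gg_eq, ← grad_norm e]
    rw [← ofReal_integral_eq_lintegral_ofReal i1 (Filter.Eventually.of_forall fun z => by positivity),
      ← ofReal_integral_eq_lintegral_ofReal i3 (Filter.Eventually.of_forall fun z => by positivity)]
    have : ∀ P, ‖u P * e P‖ₑ ^ 2 = ofReal ((u P * e P) ^ 2) := fun P => by
      rw [← sq_abs, ofReal_pow (abs_nonneg _), ← Real.enorm_eq_ofReal_abs]
    simp only [this]
    rw [← ofReal_integral_eq_lintegral_ofReal i4 (Filter.Eventually.of_forall fun z => by positivity), ← ofReal_mul ha.le,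
      ← ofReal_add (integral_nonneg fun z => by positivity) (mul_nonneg ha.le (integral_nonneg fun z => by positivity))]
    congr 1; simp at key; linarith
  · simp only [← grad_norm e]
    exact ((hasFiniteIntegral_iff_ofReal (Filter.Eventually.of_forall fun z => by positivity)).1 i3.2).ne

end

theorem psq_deriv (x : ℝ) : HasDerivAt (fun x : ℝ => (max x 0) ^ 2) (2 * max x 0) x := by
  rcases lt_trichotomy x 0 with h | h | h
  · rw [max_eq_right h.le, mul_zero]
    refine (hasDerivAt_const x (0 : ℝ)).congr_of_eventuallyEq ?_
    filter_upwards [gt_mem_nhds h] with y hy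
    rw [max_eq_right hy.le]; norm_num
  · subst h
    rw [max_self, mul_zero, hasDerivAt_iff_isLittleO_nhds_zero]
    simp only [zero_add, max_self, smul_zero, sub_zero, ne_eq, OfNat.ofNat_ne_zero, not_false_eq_true, zero_pow]
    refine Asymptotics.IsBigO.trans_isLittleO (g := fun h : ℝ => h ^ 2) ?_ (Asymptotics.isLittleO_pow_id one_lt_two)
    refine Asymptotics.isBigO_of_le _ fun h => ?_
    rw [norm_of_nonneg pz, norm_of_nonneg pz]
    rcases le_total h 0 with h' | h'
    · rw [max_eq_right h']; nlinarith
    · rw [max_eq_left h']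
  · rw [max_eq_left h.le]
    have := hasDerivAt_pow 2 x
    simp only [Nat.cast_ofNat, Nat.add_one_sub_one, pow_one] at this
    refine this.congr_of_eventuallyEq ?_
    filter_upwards [lt_mem_nhds h] with y hy
    rw [max_eq_left hy.le]

theorem psq_c1 : ContDiff ℝ 1 (fun x : ℝ => (max x 0) ^ 2) := by
  rw [contDiff_one_iff_deriv]
  refine ⟨fun x => (psq_deriv x).differentiableAt, ?_⟩
  rw [show deriv (fun x : ℝ => (max x 0) ^ 2) = fun x => 2 * max x 0 from funext fun x => (psq_deriv x).deriv]
  fun_prop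

noncomputable def fm (m t : ℝ) : ℝ := m - (max (2 * m - t) 0) ^ 2 / (4 * m)

theorem fm_deriv (m t : ℝ) : HasDerivAt (fm m) (max (2 * m - t) 0 / (2 * m)) t := by
  have h1 : HasDerivAt (fun t : ℝ => 2 * m - t) (-1) t := by simpa using (hasDerivAt_id t).const_sub (2 * m)
  have h2 := (((psq_deriv (2 * m - t)).comp t h1).div_const (4 * m)).const_sub m
  have e : max (2 * m - t) 0 / (2 * m) = -(2 * max (2 * m - t) 0 * -1 / (4 * m)) := by
    rcases eq_or_ne m 0 with h | h
    · simp [h]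
    · field_simp; ring
  rw [e]; exact h2

theorem fm_c1 (m : ℝ) : ContDiff ℝ 1 (fm m) :=
  contDiff_const.sub ((psq_c1.comp (contDiff_const.sub contDiff_id)).div_const _)

theorem fm_big {m t : ℝ} (h : 2 * m ≤ t) : fm m t = m := by rw [fm, max_eq_right lz]; simp

theorem fm_le {m t : ℝ} (hm : 0 < m) (ht : 0 ≤ t) : 0 ≤ fm m t ∧ fm m t ≤ t ∧ fm m t ≤ m := by
  rcases le_total (2 * m) t with h | h
  · rw [fm_big h]; exact ⟨hm.le, by linarith, le_rfl⟩
  · rw [fm, max_eq_left lz]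
    have : (2 * m - t) ^ 2 / (4 * m) = m - t + t ^ 2 / (4 * m) := by field_simp; ring
    have h2 : t ^ 2 / (4 * m) ≤ t := by rw [div_le_iff₀ pz]; nlinarith
    have h3 : 0 ≤ t ^ 2 / (4 * m) := by positivity
    have h4 : 0 ≤ (2 * m - t) ^ 2 / (4 * m) := by positivity
    refine ⟨by rw [this]; linarith, by rw [this]; linarith, by linarith⟩

theorem fm_d {m t : ℝ} (hm : 0 < m) (ht : 0 ≤ t) : 0 ≤ max (2 * m - t) 0 / (2 * m) ∧ max (2 * m - t) 0 / (2 * m) ≤ 1 :=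
  ⟨by positivity, by rw [div_le_one pz]; exact max_le lz lz⟩

section

theorem grad_comp {f : ℝ → ℝ} {f' : ℝ} {g : E → ℝ} {x : E} (hf : HasDerivAt f f' (g x)) (hg : DifferentiableAt ℝ g x) :
    gradient (fun z => f (g z)) x = f' • gradient g x := by
  refine ext_inner_right ℝ fun v => ?_
  have : HasFDerivAt (fun z => f (g z)) (f' • fderiv ℝ g x) x := hf.comp_hasFDerivAt x hg.hasFDerivAt
  rw [inner_smul_left, grad_inner, grad_inner, this.fderiv]; simp

theorem trunc (hn : 3 ≤ n) (hu : Pl Ω Y u) {m : ℝ} (hm : 0 < m) : ∃ φ : E → ℝ, ∃ ρ > 0, ball Y ρ ⊆ Ω ∧ (∀ z ∈ ball Y ρ, φ z = m) ∧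
    (∀ z, z ≠ Y → φ z = fm m (u z)) ∧ (∀ x ∈ Ω, ContDiffAt ℝ 1 φ x) ∧ ContinuousOn φ (closure Ω) ∧
    (∀ z ∈ Ω, z ≠ Y → gradient φ z = (max (2 * m - u z) 0 / (2 * m)) • gradient u z) ∧ (∀ z ∈ ball Y ρ, gradient φ z = 0) ∧
    IntegrableOn (fun z => ‖gradient φ z‖ ^ 2) Ω ∧ ∫⁻ z in Ω, gg φ z ≠ ⊤ := by
  classical
  obtain ⟨ρ, hρ, hb, hbu⟩ := hu.blow hn (2 * m)
  set φ : E → ℝ := fun z => if z = Y then m else fm m (u z) with hφ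
  have h1 : ∀ z, z ≠ Y → φ z = fm m (u z) := fun z hz => if_neg hz
  have h0 : ∀ z ∈ ball Y ρ, φ z = m := fun z hz => by
    by_cases h : z = Y
    · simp [hφ, h]
    · rw [h1 z h, fm_big (hbu z hz h)]
  have hev : ∀ z ∈ ball Y ρ, φ =ᶠ[𝓝 z] fun _ => m := fun z hz => by
    filter_upwards [isOpen_ball.mem_nhds hz] with y hy using h0 y hy
  have hev1 : ∀ z, z ≠ Y → φ =ᶠ[𝓝 z] fun z => fm m (u z) := fun z hz => by
    filter_upwards [isOpen_ne.mem_nhds hz] with y hy using h1 y hy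
  have hg : ∀ z ∈ Ω, z ≠ Y → gradient φ z = (max (2 * m - u z) 0 / (2 * m)) • gradient u z := fun z hz hzY => by
    rw [(hev1 z hzY).gradient_eq]
    exact grad_comp (fm_deriv m _) ((hu.wk.c1 z hz hzY).differentiableAt nz)
  have hg0 : ∀ z ∈ ball Y ρ, gradient φ z = 0 := fun z hz => by rw [(hev z hz).gradient_eq]; simp
  have hi : IntegrableOn (fun z => ‖gradient φ z‖ ^ 2) Ω := fin_diff hu hρ (A := 1) (B := 0) (fun z hz hzb => by
    have hzY : z ≠ Y := fun h => hzb (h ▸ mem_ball_self hρ)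
    have := fm_d hm (hu.nn' z hz hzY)
    rw [hg z hz hzY, norm_smul, norm_of_nonneg this.1, add_zero]
    exact mul_le_mul_of_nonneg_right this.2 (norm_nonneg _)) hg0
  refine ⟨φ, ρ, hρ, hb, h0, h1, fun x hx => ?_, fun x hx => ?_, hg, hg0, hi, ?_⟩
  · by_cases h : x = Y
    · exact contDiffAt_const.congr_of_eventuallyEq (hev x (h ▸ mem_ball_self hρ))
    · exact ((fm_c1 m).contDiffAt.comp x (hu.wk.c1 x hx h)).congr_of_eventuallyEq (hev1 x h)
  · by_cases h : x = Y
    · exact (continuousAt_const.congr (hev x (h ▸ mem_ball_self hρ)).symm).continuousWithinAt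
    · exact ((fm_c1 m).continuous.continuousAt.comp_continuousWithinAt (hu.ctw hx h)).congr_of_eventuallyEq
        (nhdsWithin_le_nhds (hev1 x h)) (h1 x h)
  · simp only [gg_eq]
    exact ((hasFiniteIntegral_iff_ofReal (Filter.Eventually.of_forall fun z => by positivity)).1 hi.2).ne

theorem cap (hn : 3 ≤ n) (hP : IsMixedPair M Cσ d cd Ω σ) (ha : 0 < a) (hu : Pl Ω Y u) (hw : Rw Ω σ a Y u) {m : ℝ} (hm : 0 < m) :
    ∃ φ : E → ℝ, (∀ z, z ≠ Y → φ z = fm m (u z)) ∧ (∀ x ∈ Ω, ContDiffAt ℝ 1 φ x) ∧ ContinuousOn φ (closure Ω) ∧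
    (∫⁻ z in Ω, gg φ z) + ofReal a * ∫⁻ P in frontier Ω, ‖φ P‖ₑ ^ 2 ∂σ ≤ ofReal m := by
  obtain ⟨φ, ρ, hρ, -, h0, h1, h2, h3, h4, h5, h6, h7⟩ := trunc hn hu hm
  refine ⟨φ, h1, h2, h3, ?_⟩
  have ho := hu.wk.op
  have hloc : ∀ z ∈ ball Y ρ, φ z = φ Y := fun z hz => by rw [h0 z hz, h0 Y (mem_ball_self hρ)]
  have key := dens oz hP hu hw h3 h2 h7 hρ hloc
  rw [h0 Y (mem_ball_self hρ)] at key
  have q1 : ∫ z in Ω, ‖gradient φ z‖ ^ 2 ≤ ∫ z in Ω, ⟪gradient u z, gradient φ z⟫ := by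
    refine setIntegral_mono_ae_restrict h6 (ip_l2 hu h7 hρ hloc) ?_
    filter_upwards [ae_restrict_mem ho.measurableSet, ae_restrict_of_ae (ae_neY oz Y)] with z hz hzY
    obtain ⟨d1, d2⟩ := fm_d hm (hu.nn' z hz hzY)
    rw [h4 z hz hzY, norm_smul, norm_of_nonneg d1, inner_smul_right, real_inner_self_eq_norm_sq, mul_pow]
    exact mul_le_mul_of_nonneg_right (by nlinarith) pz
  have hcf := h3.mono (frontier_subset_closure (s := Ω))
  have i4 : IntegrableOn (fun z => φ z ^ 2) (frontier Ω) σ := fr_int hP (hcf.pow 2)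
  have q2 : ∫ P in frontier Ω, φ P ^ 2 ∂σ ≤ ∫ P in frontier Ω, u P * φ P ∂σ := by
    refine setIntegral_mono_on i4 (fr_int hP (hu.cf.mul hcf)) isClosed_frontier.measurableSet fun P hPf => ?_
    obtain ⟨e1, e2, -⟩ := fm_le hm (hu.nn P (frontier_subset_closure hPf) (hu.nfr P hPf))
    rw [h1 P (hu.nfr P hPf), pow_two]
    exact mul_le_mul_of_nonneg_right e2 e1
  have : ∀ P, ‖φ P‖ₑ ^ 2 = ofReal (φ P ^ 2) := fun P => by
    rw [← sq_abs, ofReal_pow (abs_nonneg _), ← Real.enorm_eq_ofReal_abs]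
  simp only [gg_eq, this]
  rw [← ofReal_integral_eq_lintegral_ofReal h6 (Filter.Eventually.of_forall fun z => by positivity),
    ← ofReal_integral_eq_lintegral_ofReal i4 (Filter.Eventually.of_forall fun z => by positivity), ← ofReal_mul ha.le,
    ← ofReal_add (integral_nonneg fun z => by positivity) (mul_nonneg ha.le (integral_nonneg fun z => by positivity))]
  refine ofReal_le_ofReal ?_
  have := mul_le_mul_of_nonneg_left q2 ha.le
  linarith

structure Hd (Ω : SE) (σ : ME) (b : ℝ) (r : E → ℝ) : Prop where
  pos : ∀ x, 0 < r x
  lip : ∀ x y, r x ≤ r y + dist x y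
  dm : ∀ x ∈ Ω, 100 * r x ≤ diam Ω
  fr : ∀ P ∈ frontier Ω, r P ^ nm ≤ b * σ.real (ball P (r P))

variable (n) in
theorem pole (hn : 3 ≤ n) (M Cσ d cd K : ℝ) (hK : 1 ≤ K) : ∃ C : ℝ, 0 < C ∧ ∀ (Ω : SE) σ,
    IsMixedPair M Cσ d cd Ω σ → ∀ a, 0 < a → ∀ r, Hd Ω σ (K * a) r → ∀ Y u, Pl Ω Y u → Rw Ω σ a Y u → ∀ X ∈ Ω, X ≠ Y →
      dl Ω X / 400 ≤ dist X Y → (∀ z ∈ ball X (dl Ω X / 400), r z ≤ 2 * dl Ω X) → u X * dl Ω X ^ nm ≤ C := by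
  obtain ⟨H, hH, harn⟩ := harn n oz
  obtain ⟨C, hC, hardy⟩ := hardy n oz M Cσ d cd
  set V := (volume (ball oE 1)).toReal with hV
  have hV0 : 0 < V := ENNReal.toReal_pos (vb_pos n) (vb_fin n)
  refine ⟨H * 4 ^ n * (C * K * (16 * 400 ^ n) / V), by positivity, fun Ω σ hP a ha r hr Y u hu hw X hX hXY hd hrX => ?_⟩
  have ho := hu.wk.op
  have hf := fr_ne oz hP.bounded hP.nonempty
  have hδ := dl_pos ho hf hX
  set δ := dl Ω X with hδd
  rcases (hu.nn' X hX hXY).eq_or_lt with h0 | h0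
  · rw [← h0, zero_mul]; positivity
  set m := u X / (H * 4 ^ n) with hm
  have hm0 : 0 < m := by positivity
  obtain ⟨φ, f1, f2, f3, f4⟩ := cap hn hP ha hu hw hm0
  have hsub : ball X (δ / 400) ⊆ Ω := (ball_subset_ball lz).trans (dl_ball hX)
  have low : ∀ z ∈ ball X (δ / 400), z ≠ Y → m / 2 ≤ φ z := fun z hz hzY => by
    rw [mem_ball] at hz
    have := harn Ω Y 1 u hu.wk zero_le_one hu.nn' z X (4 * (δ / 400)) (δ / 400) hzY hXY pz pz
      (Or.inr (by rw [dist_comm]; exact hd)) (by rw [dist_comm]; linarith) (dl_cball hX lz)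
    have h1 : m ≤ u z := by
      rw [hm, div_le_iff₀ pz]
      rw [mul_pow] at this
      have h3 : 0 < (δ / 400) ^ n := by positivity
      nlinarith
    rw [f1 z hzY, fm]
    have h2 : (max (2 * m - u z) 0) ^ 2 ≤ m ^ 2 := pow_le_pow_left₀ (le_max_right _ _) (max_le lz hm0.le) 2
    have h3 : (max (2 * m - u z) 0) ^ 2 / (4 * m) ≤ m / 4 := by rw [div_le_iff₀ pz]; nlinarith
    linarith
  have hh := hardy Ω σ hP r hr.pos hr.lip hr.dm (K * a) pz hr.fr φ f3 f2
  have hE : (∫⁻ z in Ω, gg φ z) + ofReal (K * a) * ∫⁻ P in frontier Ω, ‖φ P‖ₑ ^ 2 ∂σ ≤ ofReal (K * m) := by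
    rw [ofReal_mul lz, ofReal_mul (p := K) (q := m) lz]
    refine le_trans ?_ (mul_le_mul' le_rfl f4)
    rw [mul_add, mul_assoc]
    refine add_le_add (le_mul_of_one_le_left bot_le ?_) le_rfl
    rw [← ofReal_one]; exact ofReal_le_ofReal hK
  have hlow : ofReal (((2 * δ) ^ 2)⁻¹ * (m / 2) ^ 2) * volume (ball X (δ / 400)) ≤
      ∫⁻ x in Ω, ofReal ((max (dl Ω x) (r x) ^ 2)⁻¹) * ‖φ x‖ₑ ^ 2 := by
    rw [← setLIntegral_const]
    refine le_trans (setLIntegral_mono_ae' measurableSet_ball ?_) (lintegral_mono_set hsub)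
    filter_upwards [ae_neY oz Y] with z hzY hz
    rw [ofReal_mul pz, ofReal_pow pz]
    have l1 := low z hz hzY
    refine mul_le_mul' (ofReal_le_ofReal (inv_anti₀ (pow_pos (lt_max_of_lt_right (hr.pos z)) 2)
      (pow_le_pow_left₀ ((hr.pos z).le.trans (le_max_right _ _)) (max_le ?_ (hrX z hz)) 2))) (pow_le_pow_left' ?_ 2)
    · have := dl_lip Ω z X; rw [mem_ball] at hz; linarith
    · rw [Real.enorm_eq_ofReal_abs]; exact ofReal_le_ofReal (l1.trans (le_abs_self _))
  have fin := hlow.trans (hh.trans (mul_le_mul' le_rfl hE))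
  rw [vol_ball X pz, ← ofReal_toReal (vb_fin n), ← ofReal_mul pz, ← ofReal_mul pz,
    ← ofReal_mul hC.le, ofReal_le_ofReal_iff pz] at fin
  have e2 : (δ / 400) ^ n = δ ^ 2 * δ ^ nm / 400 ^ n := by rw [div_pow, ← pow_add]; congr 2; omega
  have e3 : ((2 * δ) ^ 2)⁻¹ * (m / 2) ^ 2 * ((δ / 400) ^ n * V) = m * (m * δ ^ nm * V / (16 * 400 ^ n)) := by
    rw [e2]; field_simp; ring
  rw [e3, show C * (K * m) = m * (C * K) by ring] at fin
  have fin2 := le_of_mul_le_mul_left fin hm0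
  rw [div_le_iff₀ pz] at fin2
  have e4 : u X = H * 4 ^ n * m := by rw [hm]; field_simp
  rw [e4, mul_assoc]
  refine mul_le_mul_of_nonneg_left ?_ pz
  rw [le_div_iff₀ hV0]; linarith
end

section

theorem near0 (hn : 3 ≤ n) (hu : Pl Ω Y u) {v : E → ℝ} (hv : ContinuousAt v Y) {c : ℝ} (hc : 0 ≤ c) :
    ∃ s > 0, ∀ z ∈ ball Y s, z ≠ Y → c * v z ≤ u z := by
  obtain ⟨s0, hs0, -, hs1⟩ := hu.blow hn (c * (v Y + 1))
  obtain ⟨s2, hs2, hs3⟩ := Metric.mem_nhds_iff.1 (hv.eventually (gt_mem_nhds (lt_add_one (v Y))))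
  exact ⟨min s0 s2, by positivity, fun z hz hzY => (mul_le_mul_of_nonneg_left (le_of_lt (hs3 (ball_subset_ball (min_le_right _ _) hz))) hc).trans
    (hs1 z (ball_subset_ball (min_le_left _ _) hz) hzY)⟩

theorem max_rob (hn : 3 ≤ n) (hP : IsMixedPair M Cσ d cd Ω σ) (ha : 0 < a) (hu : Pl Ω Y u) (hw : Rw Ω σ a Y u) {A : E} {v : E → ℝ}
    (hv : Pl Ω A v) (hvw : Rw Ω σ a A v) {c t t' : ℝ} (hc : 0 ≤ c) (ht : 0 < t) (htt : t < t') (hY : t < dist Y A)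
    (h1 : ∀ z ∈ Ω, t ≤ dist z A → dist z A < t' → z ≠ Y → c * v z ≤ u z) (hb : ball A t' ⊆ Ω) :
    ∀ z ∈ closure Ω, t ≤ dist z A → z ≠ Y → c * v z ≤ u z := by
  classical
  have ho := hu.wk.op
  have hYA : Y ≠ A := dist_pos.1 (ht.trans hY)
  have hm := ho.measurableSet
  obtain ⟨s, hs, hns⟩ := near0 hn hu (hv.cts hu.mem hYA) hc
  set w : E → ℝ := fun z => c * v z - u z with hwd
  set φ : E → ℝ := fun z => if dist z A ≤ t ∨ z = Y then 0 else (max (w z) 0) ^ 2 with hφ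
  set O : SE := ball A t' ∪ ball Y s with hO
  have hOo : IsOpen O := isOpen_ball.union isOpen_ball
  have z0 : ∀ z ∈ O, φ z = 0 := fun z hz => by
    simp only [hφ]
    split_ifs with h
    · rfl
    · push Not at h
      have : w z ≤ 0 := by
        rcases hz with hz | hz
        · linarith [h1 z (hb hz) h.1.le hz h.2]
        · linarith [hns z hz h.2]
      rw [max_eq_right this]; norm_num
  have hOne : ∀ z, z ∉ O → z ≠ A ∧ z ≠ Y ∧ t < dist z A := fun z hz => by
    have : t' ≤ dist z A := not_lt.1 fun h => hz (Or.inl h)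
    exact ⟨fun h => hz (Or.inl (h ▸ mem_ball_self (ht.trans htt))), fun h => hz (Or.inr (h ▸ mem_ball_self hs)), htt.trans_le this⟩
  have ev0 : ∀ z ∈ O, φ =ᶠ[𝓝 z] fun _ => 0 := fun z hz => by filter_upwards [hOo.mem_nhds hz] with y hy using z0 y hy
  have ev1 : ∀ z, z ≠ Y → t < dist z A → φ =ᶠ[𝓝 z] fun z => (max (w z) 0) ^ 2 := fun z hz hz2 => by
    filter_upwards [isOpen_ne.mem_nhds hz, (isOpen_lt continuous_const (continuous_id.dist continuous_const)).mem_nhds hz2] with y hy hy2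
    have hy3 : t < dist y A := hy2
    simp only [hφ]; rw [if_neg (by push Not; exact ⟨hy3, hy⟩)]
  have c1w : ∀ z ∈ Ω, z ≠ A → z ≠ Y → ContDiffAt ℝ 1 w z := fun z hz h h' => ((hv.wk.c1 z hz h).const_smul c).sub (hu.wk.c1 z hz h')
  have gw : ∀ z ∈ Ω, z ≠ A → z ≠ Y → gradient w z = c • gradient v z - gradient u z := fun z hz h h' => by
    have d1 := (hv.wk.c1 z hz h).differentiableAt nz
    have d2 := (hu.wk.c1 z hz h').differentiableAt nz
    have := grad_lin d1 d2 c (-1)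
    simp only [neg_mul, one_mul, ← sub_eq_add_neg, neg_smul, one_smul] at this; exact this
  have gφ : ∀ z ∈ Ω, z ∉ O → gradient φ z = (2 * max (w z) 0) • gradient w z := fun z hz hzO => by
    obtain ⟨q1, q2, q3⟩ := hOne z hzO
    rw [(ev1 z q2 q3).gradient_eq]
    exact grad_comp (psq_deriv _) ((c1w z hz q1 q2).differentiableAt nz)
  have gφ0 : ∀ z ∈ O, gradient φ z = 0 := fun z hz => by rw [(ev0 z hz).gradient_eq]; simp
  have hc1 : ∀ x ∈ Ω, ContDiffAt ℝ 1 φ x := fun x hx => by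
    by_cases h : x ∈ O
    · exact contDiffAt_const.congr_of_eventuallyEq (ev0 x h)
    · obtain ⟨q1, q2, q3⟩ := hOne x h
      exact (psq_c1.contDiffAt.comp x (c1w x hx q1 q2)).congr_of_eventuallyEq (ev1 x q2 q3)
  have hct : ContinuousOn φ (closure Ω) := fun x hx => by
    by_cases h : x ∈ O
    · exact (continuousAt_const.congr (ev0 x h).symm).continuousWithinAt
    · obtain ⟨q1, q2, q3⟩ := hOne x h
      have : ContinuousWithinAt w (closure Ω) x := (continuousWithinAt_const.mul (hv.ctw hx q1)).sub (hu.ctw hx q2)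
      have h2 := psq_c1.continuous.continuousAt.comp_continuousWithinAt this
      exact h2.congr_of_eventuallyEq (nhdsWithin_le_nhds (ev1 x q2 q3)) ((ev1 x q2 q3).self_of_nhds)
  have hρ : 0 < min t' s := lt_min (ht.trans htt) hs
  obtain ⟨U, hU0, hU⟩ := hu.ubd hs
  obtain ⟨V, hV0, hV⟩ := hv.ubd (ht.trans htt)
  have hi : IntegrableOn (fun z => ‖gradient φ z‖ ^ 2) Ω := by
    refine IntegrableOn.of_forall_diff_eq_zero (s := Ω \ O) ?_ hm fun z hz => by
      have : z ∈ O := by by_contra h; exact hz.2 ⟨hz.1, h⟩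
      simp [gφ0 z this]
    set W := c * V + U
    have j1 : IntegrableOn (fun x => ‖gradient v x‖ ^ 2) (Ω \ O) := (hv.l2 t' (ht.trans htt)).mono_set (diff_subset_diff_right subset_union_left)
    have j2 : IntegrableOn (fun x => ‖gradient u x‖ ^ 2) (Ω \ O) := (hu.l2 s hs).mono_set (diff_subset_diff_right subset_union_right)
    refine Integrable.mono' (g := fun z => 8 * W ^ 2 * c ^ 2 * ‖gradient v z‖ ^ 2 + 8 * W ^ 2 * ‖gradient u z‖ ^ 2)
      ((j1.const_mul _).add (j2.const_mul _)) ((grad_meas φ).norm.pow_const 2).aestronglyMeasurable ?_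
    filter_upwards [ae_restrict_mem (hm.diff hOo.measurableSet)] with z hz
    obtain ⟨q1, q2, q3⟩ := hOne z hz.2
    have k1 := hU z ⟨subset_closure hz.1, fun h => hz.2 (Or.inr h)⟩
    have k2 := hV z ⟨subset_closure hz.1, fun h => hz.2 (Or.inl h)⟩
    have k3 : max (w z) 0 ≤ W := max_le (by
      have := mul_le_mul_of_nonneg_left ((le_abs_self _).trans k2) hc
      have := neg_abs_le (u z)
      simp only [hwd]; linarith) pz
    have k4 : ‖gradient w z‖ ≤ c * ‖gradient v z‖ + ‖gradient u z‖ := by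
      rw [gw z hz.1 q1 q2]; refine (norm_sub_le _ _).trans ?_; rw [norm_smul, norm_of_nonneg hc]
    have k0 : (0 : ℝ) ≤ max (w z) 0 := le_max_right _ _
    rw [norm_of_nonneg pz, gφ z hz.1 hz.2, norm_smul, norm_of_nonneg pz]
    calc (2 * max (w z) 0 * ‖gradient w z‖) ^ 2 ≤ (2 * W * (c * ‖gradient v z‖ + ‖gradient u z‖)) ^ 2 := by gcongr
      _ ≤ _ := by nlinarith [mul_nonneg (sq_nonneg W) (sq_nonneg (c * ‖gradient v z‖ - ‖gradient u z‖))]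
  have hfin : ∫⁻ z in Ω, gg φ z ≠ ⊤ := by
    simp only [gg_eq]
    exact ((hasFiniteIntegral_iff_ofReal (Filter.Eventually.of_forall fun z => by positivity)).1 hi.2).ne
  have l1 : ∀ z ∈ ball A (min t' s), φ z = φ A := fun z hz => by
    rw [z0 z (Or.inl (ball_subset_ball (min_le_left _ _) hz)), z0 A (Or.inl (mem_ball_self (ht.trans htt)))]
  have l2 : ∀ z ∈ ball Y (min t' s), φ z = φ Y := fun z hz => by
    rw [z0 z (Or.inr (ball_subset_ball (min_le_right _ _) hz)), z0 Y (Or.inr (mem_ball_self hs))]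
  have e1 := dens oz hP hv hvw hct hc1 hfin hρ l1
  have e2 := dens oz hP hu hw hct hc1 hfin hρ l2
  rw [z0 A (Or.inl (mem_ball_self (ht.trans htt)))] at e1
  rw [z0 Y (Or.inr (mem_ball_self hs))] at e2
  have i1 := ip_l2 hv hfin hρ l1
  have i2 := ip_l2 hu hfin hρ l2
  have hcf := hct.mono (frontier_subset_closure (s := Ω))
  have b1 : IntegrableOn (fun z => v z * φ z) (frontier Ω) σ := fr_int hP (hv.cf.mul hcf)
  have b2 : IntegrableOn (fun z => u z * φ z) (frontier Ω) σ := fr_int hP (hu.cf.mul hcf)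
  have p1 : 0 ≤ ∫ z in Ω, (c * ⟪gradient v z, gradient φ z⟫ - ⟪gradient u z, gradient φ z⟫) := setIntegral_nonneg hm fun z hz => by
    rw [← real_inner_smul_left, ← inner_sub_left]
    by_cases h : z ∈ O
    · rw [gφ0 z h, inner_zero_right]
    · obtain ⟨q1, q2, -⟩ := hOne z h
      rw [← gw z hz q1 q2, gφ z hz h, inner_smul_right, real_inner_self_eq_norm_sq]
      have : (0 : ℝ) ≤ max (w z) 0 := le_max_right _ _
      positivity
  rw [integral_sub (i1.const_mul c) i2, integral_const_mul] at p1
  have p2 : ∫ P in frontier Ω, w P * φ P ∂σ ≤ 0 := by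
    have : ∀ P, w P * φ P = c * (v P * φ P) - u P * φ P := fun P => by simp only [hwd]; ring
    simp only [this]
    rw [integral_sub (b1.const_mul c) b2, integral_const_mul]
    by_contra hlt
    push Not at hlt
    have := mul_pos ha hlt
    have e3 := congrArg (fun x => c * x) e1
    simp only [mul_zero] at e3
    linarith
  have fφ : ∀ P ∈ frontier Ω, φ P = (max (w P) 0) ^ 2 := fun P hPf => by
    have : P ∉ Ω := fun h => hPf.2 (by rwa [ho.interior_eq])
    simp only [hφ]; rw [if_neg]
    push Not
    exact ⟨not_le.1 fun h => this (hb (by rw [mem_ball]; linarith)), hu.nfr P hPf⟩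
  have hz := aez hP (f := fun P => w P * φ P) (((continuousOn_const.mul hv.cf).sub hu.cf).mul hcf) (fun P hPf => by
    rw [fφ P hPf]
    rcases le_total (w P) 0 with h | h
    · rw [max_eq_right h]; norm_num
    · positivity) p2
  refine maxw hn hu hv hc ht hY (fun P hPf => ?_) (fun z hz hzt => h1 z (hb (by rw [mem_ball]; linarith)) hzt.ge lz fun h => by
    rw [h] at hzt; linarith)
  have h := hz P hPf
  rw [fφ P hPf] at h
  by_contra hlt
  have hlt : 0 < w P := by simp only [hwd]; linarith
  rw [max_eq_left hlt.le] at h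
  have : 0 < w P * w P ^ 2 := by positivity
  linarith
end

variable (n) in
theorem prod3 (hn : 3 ≤ n) (M Cσ d cd : ℝ) : ∃ C : ℝ, 0 < C ∧ ∀ (Ω : SE) σ,
    IsMixedPair M Cσ d cd Ω σ → ∀ a, 0 < a → ∀ r, Hd Ω σ a r → ∀ A Y v u, Pl Ω A v → Rw Ω σ a A v → Pl Ω Y u → Rw Ω σ a Y u →
    dl Ω A / 40 ≤ dist Y A → (∀ z ∈ ball A (dl Ω A / 10), r z ≤ dl Ω A) → ∀ z ∈ closure Ω, dl Ω A / 50 ≤ dist z A → z ≠ Y →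
      v z * (u A * dl Ω A ^ nm) ≤ C * u z := by
  obtain ⟨C, hC, pole⟩ := pole n hn M Cσ d cd 1 le_rfl
  obtain ⟨g, G, hG, grow⟩ := grow n oz M
  refine ⟨C * 2 ^ nm * G, by positivity, fun Ω σ hP a ha r hr A Y v u hv hvw hu hw hAY hrA => ?_⟩
  have ho := hu.wk.op
  have hf := fr_ne oz hP.bounded hP.nonempty
  have hδ := dl_pos ho hf hv.mem
  set δ := dl Ω A with hδd
  have hne : A ≠ Y := fun h => by rw [h, dist_self] at hAY; linarith
  have huA := hu.nn' A hv.mem hne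
  have main := max_rob hn hP ha hu hw hv hvw (c := u A * δ ^ nm / (C * 2 ^ nm * G)) (t := δ / 50) (t' := δ / 20) pz lz
    lz lz (fun z hz h1 h2 hzY => ?_) ((ball_subset_ball lz).trans (dl_ball hv.mem))
  · intro z hz h1 h2
    have := main z hz h1 h2
    rw [div_mul_eq_mul_div, div_le_iff₀ pz] at this
    linarith
  have g1 := grow Ω hP.bounded hf hP.nta Y 1 u hu.wk zero_le_one hu.nn' A hv.mem A hv.mem .refl hne (Or.inr hAY) δ 1 hδ le_rfl le_rfl le_rfl
    (by rw [dist_self]; positivity) z h2 hzY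
  rw [one_pow, mul_one] at g1
  have l1 := dl_lip Ω A z
  have l2 := dl_lip Ω z A
  rw [dist_comm] at l1
  have hzA : z ≠ A := fun h => by rw [h, dist_self] at h1; linarith
  have g2 := pole Ω σ hP a ha r (by rwa [one_mul]) A v hv hvw z hz hzA lz (fun y hy => by
    rw [mem_ball] at hy
    refine (hrA y ?_).trans lz
    rw [mem_ball]
    linarith [dist_triangle y z A])
  have g3 : v z * δ ^ nm ≤ C * 2 ^ nm := by
    calc v z * δ ^ nm ≤ v z * (2 * dl Ω z) ^ nm := by
          have := hv.nn' z hz hzA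
          gcongr; linarith
      _ = 2 ^ nm * (v z * dl Ω z ^ nm) := by rw [mul_pow]; ring
      _ ≤ 2 ^ nm * C := by gcongr
      _ = _ := mul_comm _ _
  rw [div_mul_eq_mul_div, div_le_iff₀ pz]
  calc u A * δ ^ nm * v z = u A * (v z * δ ^ nm) := by ring
    _ ≤ u A * (C * 2 ^ nm) := by gcongr
    _ ≤ (G * u z) * (C * 2 ^ nm) := by gcongr
    _ = _ := by ring

section

def LB (f : E → ℝ) (K : ℝ) (z : E) : Prop := 0 < f z ∧ ∃ f' : E →L[ℝ] ℝ, HasFDerivAt f f' z ∧ ‖f'‖ ≤ K * f z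

theorem LB.mul {f g : E → ℝ} {K L : ℝ} {z : E} (hf : LB f K z) (hg : LB g L z) : LB (fun z => f z * g z) (K + L) z := by
  obtain ⟨h, f', h1, h2⟩ := hf
  obtain ⟨h', g', h3, h4⟩ := hg
  refine ⟨mul_pos h h', _, h1.mul h3, (norm_add_le _ _).trans ?_⟩
  rw [norm_smul, norm_smul, norm_of_nonneg h.le, norm_of_nonneg h'.le]
  nlinarith [mul_le_mul_of_nonneg_left h4 h.le, mul_le_mul_of_nonneg_left h2 h'.le]

theorem LB.rpow {f : E → ℝ} {K : ℝ} {z : E} (hf : LB f K z) (c : ℝ) : LB (fun z => f z ^ c) (|c| * K) z := by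
  obtain ⟨h, f', h1, h2⟩ := hf
  refine ⟨Real.rpow_pos_of_pos h c, _, h1.rpow_const (Or.inl h.ne'), ?_⟩
  rw [norm_smul, norm_mul, norm_of_nonneg (Real.rpow_nonneg h.le _), norm_eq_abs]
  have : f z ^ c = f z ^ (c - 1) * f z := by rw [← Real.rpow_add_one h.ne']; simp
  beta_reduce; rw [this]
  calc |c| * f z ^ (c - 1) * ‖f'‖ ≤ |c| * f z ^ (c - 1) * (K * f z) := by gcongr
    _ = _ := by ring

theorem LB.inv {f : E → ℝ} {K : ℝ} {z : E} (hf : LB f K z) : LB (fun z => (f z)⁻¹) K z := by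
  have := hf.rpow (-1)
  simp only [Real.rpow_neg_one, abs_neg, abs_one, one_mul] at this; exact this

theorem LB.pow {f : E → ℝ} {K : ℝ} {z : E} (hf : LB f K z) (N : ℕ) : LB (fun z => f z ^ N) (N * K) z := by
  have := hf.rpow N
  simp only [rpow_natCast, Nat.abs_cast] at this; exact this

theorem nsq_d (c : ℝ) (W z : E) : ∃ f' : E →L[ℝ] ℝ, HasFDerivAt (fun z : E => c + ‖z - W‖ ^ 2) f' z ∧ ‖f'‖ ≤ 2 * ‖z - W‖ := by
  refine ⟨_, ((hasFDerivAt_id z).sub_const W).norm_sq.const_add c, ?_⟩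
  rw [two_smul]
  refine (norm_add_le _ _).trans ?_
  have : ‖(innerSL ℝ) (id z - W) ∘SL ContinuousLinearMap.id ℝ E‖ ≤ ‖z - W‖ := by
    rw [ContinuousLinearMap.comp_id, innerSL_apply_norm]; rfl
  linarith

theorem LB.sq {W z : E} {c K : ℝ} (h : 0 < c + ‖z - W‖ ^ 2) (hK : 2 * ‖z - W‖ ≤ K * (c + ‖z - W‖ ^ 2)) :
    LB (fun z => c + ‖z - W‖ ^ 2) K z := by
  obtain ⟨f', h1, h2⟩ := nsq_d c W z
  exact ⟨h, f', h1, h2.trans hK⟩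

noncomputable def Bw (ρ : ℝ) (X W z : E) : ℝ := ρ ^ 2 * (0 + ‖z - W‖ ^ 2) * (ρ ^ 2 + ‖z - X‖ ^ 2)⁻¹ * (ρ ^ 2 + ‖z - W‖ ^ 2)⁻¹
noncomputable def rp (ρ : ℝ) (X W z : E) : ℝ := min (√(ρ ^ 2 + ‖z - X‖ ^ 2)) (dist z W)

theorem rp_pos {ρ : ℝ} {X W z : E} (hρ : 0 < ρ) (hz : z ≠ W) : 0 < rp ρ X W z :=
  lt_min (Real.sqrt_pos.2 pz) (dist_pos.2 hz)

theorem Bw_LB {ρ : ℝ} {X W z : E} (hρ : 0 < ρ) (hz : z ≠ W) : LB (Bw ρ X W) (6 / rp ρ X W z) z := by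
  have hp := rp_pos (X := X) hρ hz
  have hs : 0 < ‖z - W‖ := norm_pos_iff.2 (sub_ne_zero.2 hz)
  have h1 : rp ρ X W z ≤ ‖z - W‖ := (min_le_right _ _).trans (dist_eq_norm _ _).le
  have h2 : rp ρ X W z ≤ √(ρ ^ 2 + ‖z - X‖ ^ 2) := min_le_left _ _
  have h3 : ‖z - X‖ ≤ √(ρ ^ 2 + ‖z - X‖ ^ 2) := Real.le_sqrt_of_sq_le (by nlinarith)
  have h4 := Real.sq_sqrt (show 0 ≤ ρ ^ 2 + ‖z - X‖ ^ 2 by positivity)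
  have c : LB (fun _ : E => ρ ^ 2) 0 z := ⟨by positivity, 0, hasFDerivAt_const _ _, by simp⟩
  have a1 : LB (fun z : E => 0 + ‖z - W‖ ^ 2) (2 / rp ρ X W z) z := LB.sq pz (by
    rw [div_mul_eq_mul_div, le_div_iff₀ hp]; nlinarith)
  have a2 : LB (fun z : E => ρ ^ 2 + ‖z - X‖ ^ 2) (2 / rp ρ X W z) z := LB.sq pz (by
    rw [div_mul_eq_mul_div, le_div_iff₀ hp, ← h4]; nlinarith [norm_nonneg (z - X), mul_le_mul h3 h2 hp.le (Real.sqrt_nonneg _)])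
  have a3 : LB (fun z : E => ρ ^ 2 + ‖z - W‖ ^ 2) (2 / rp ρ X W z) z := LB.sq pz (by
    rw [div_mul_eq_mul_div, le_div_iff₀ hp]; nlinarith)
  have := ((c.mul a1).mul a2.inv).mul a3.inv
  rw [show 0 + 2 / rp ρ X W z + 2 / rp ρ X W z + 2 / rp ρ X W z = 6 / rp ρ X W z by ring] at this
  exact this

theorem Bw_prop {ρ : ℝ} {X W z : E} (hρ : 0 < ρ) (hz : z ≠ W) : 0 < Bw ρ X W z ∧ Bw ρ X W z ≤ 1 ∧
    Bw ρ X W z ≤ ρ ^ 2 / (ρ ^ 2 + ‖z - X‖ ^ 2) ∧ ρ ^ 2 * Bw ρ X W z ≤ 2 * rp ρ X W z ^ 2 := by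
  have hs : 0 < ‖z - W‖ := norm_pos_iff.2 (sub_ne_zero.2 hz)
  have h0 := (Bw_LB (X := X) hρ hz).1
  have h1 : Bw ρ X W z ≤ ρ ^ 2 / (ρ ^ 2 + ‖z - X‖ ^ 2) := by
    rw [Bw, zero_add, div_eq_mul_inv, mul_right_comm, mul_assoc _ (‖z - W‖ ^ 2), mul_right_comm]
    refine mul_le_of_le_one_right pz ?_
    rw [← div_eq_mul_inv, div_le_one pz]; nlinarith
  have h2 : ρ ^ 2 / (ρ ^ 2 + ‖z - X‖ ^ 2) ≤ 1 := by rw [div_le_one pz]; nlinarith [norm_nonneg (z - X)]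
  refine ⟨h0, h1.trans h2, h1, ?_⟩
  rw [rp]
  rcases min_cases (√(ρ ^ 2 + ‖z - X‖ ^ 2)) (dist z W) with ⟨h, -⟩ | ⟨h, -⟩
  · rw [h, Real.sq_sqrt pz]
    have := mul_le_mul_of_nonneg_left (h1.trans h2) (by positivity : 0 ≤ ρ ^ 2)
    nlinarith [norm_nonneg (z - X)]
  · rw [h, dist_eq_norm]
    have : ρ ^ 2 * Bw ρ X W z = ‖z - W‖ ^ 2 * ((ρ ^ 2 / (ρ ^ 2 + ‖z - X‖ ^ 2)) * (ρ ^ 2 / (ρ ^ 2 + ‖z - W‖ ^ 2))) := by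
      rw [Bw]; field_simp; ring
    rw [this]
    have h3 : ρ ^ 2 / (ρ ^ 2 + ‖z - W‖ ^ 2) ≤ 1 := by rw [div_le_one pz]; nlinarith [norm_nonneg (z - W)]
    have := mul_le_mul_of_nonneg_left (mul_le_one₀ h2 pz h3) (by positivity : 0 ≤ ‖z - W‖ ^ 2)
    nlinarith

variable (n) in
theorem jap (hn : 1 ≤ n) : ∃ J : ℝ, 0 < J ∧ ∀ (X : E) (ρ : ℝ), 0 < ρ →
    ∫⁻ z : E, ofReal ((ρ ^ 2 / (ρ ^ 2 + ‖z - X‖ ^ 2)) ^ n) ≤ ofReal (J * ρ ^ n) := by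
  have hi : Integrable (fun x : E => ((1 : ℝ) + ‖x‖ ^ 2) ^ (-(2 * n : ℝ) / 2)) :=
    integrable_rpow_neg_one_add_norm_sq (by rw [finrank_euclideanSpace_fin]; have : (1 : ℝ) ≤ n := by exact_mod_cast hn
                                            linarith)
  refine ⟨(∫ x : E, ((1 : ℝ) + ‖x‖ ^ 2) ^ (-(2 * n : ℝ) / 2)) + 1, add_pos_of_nonneg_of_pos (integral_nonneg fun x => by positivity) one_pos, fun X ρ hρ => ?_⟩
  have h := lint_aff (fun z : E => ofReal ((ρ ^ 2 / (ρ ^ 2 + ‖z - X‖ ^ 2)) ^ n)) X hρ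
  have e : ∀ y : E, (ρ ^ 2 / (ρ ^ 2 + ‖X + ρ • y - X‖ ^ 2)) ^ n = ((1 : ℝ) + ‖y‖ ^ 2) ^ (-(2 * n : ℝ) / 2) := fun y => by
    rw [add_sub_cancel_left, norm_smul, norm_of_nonneg hρ.le, show -(2 * n : ℝ) / 2 = -(n : ℝ) by ring, Real.rpow_neg pz,
      rpow_natCast, ← inv_pow]
    congr 1; field_simp
  simp only [e] at h
  rw [← ofReal_integral_eq_lintegral_ofReal hi (Filter.Eventually.of_forall fun x => by positivity)] at h
  have h2 : ∫⁻ z : E, ofReal ((ρ ^ 2 / (ρ ^ 2 + ‖z - X‖ ^ 2)) ^ n) =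
      ofReal (ρ ^ n) * (ofReal ((ρ ^ n)⁻¹) * ∫⁻ z : E, ofReal ((ρ ^ 2 / (ρ ^ 2 + ‖z - X‖ ^ 2)) ^ n)) := by
    rw [← mul_assoc, ← ofReal_mul pz, mul_inv_cancel₀ pz, ofReal_one, one_mul]
  rw [h2, ← h, ← ofReal_mul pz]
  refine ofReal_le_ofReal ?_
  rw [mul_comm]
  exact mul_le_mul_of_nonneg_right lz pz
end

variable (n) in
set_option maxHeartbeats 1600000 in
theorem agmon (hn : 3 ≤ n) (M Cσ d cd : ℝ) (Γ : ℕ) : ∃ β ϑ C : ℝ, 0 < β ∧ β ≤ 1 ∧ 0 < ϑ ∧ ϑ ≤ 1 / 4 ∧ 0 < C ∧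
    ∀ (Ω : SE) σ, IsMixedPair M Cσ d cd Ω σ → ∀ a, 0 < a → ∀ r, Hd Ω σ a r → ∀ r0, 0 < r0 → (∀ z, r0 ≤ r z) →
      ∀ W u, Pl Ω W u → Rw Ω σ a W u → ∀ X ρ, 0 < ρ → (∀ z ∈ Ω, dl Ω W / 2 ≤ dist z W → r z ≤ ϑ * rp ρ X W z) → ∀ U,
      (∀ z ∈ Ω, dl Ω W / 2 ≤ dist z W → ϑ * rp ρ X W z < dl Ω z → u z * Bw ρ X W z ^ Γ ≤ U) → ∀ μ, 0 < μ → ∀ S : SE, MeasurableSet S → S ⊆ Ω →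
      (∀ z ∈ S, dist z X ≤ ρ ∧ ρ / 2 ≤ dist z W ∧ 3 * dl Ω W / 4 ≤ dist z W ∧ max (dl Ω z) (r z) ≤ μ * ρ) →
      ∫⁻ z in S, ofReal (u z ^ 2 * (max (dl Ω z) (r z) ^ 2)⁻¹) ≤ ofReal (C * (μ ^ β) ^ 2 * (U ^ 2 * ρ ^ nm)) := by
  obtain ⟨CH, hCH, hardy⟩ := hardy n oz M Cσ d cd
  obtain ⟨L, hL, hLd⟩ := st_bd
  obtain ⟨J, hJ, jap⟩ := jap n oz
  obtain ⟨N, hN⟩ : ∃ N : ℕ, N = Γ + (1 + n) := ⟨_, rfl⟩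
  obtain ⟨q, hq, hq1, hqC⟩ : ∃ q : ℝ, 0 < q ∧ q ≤ 1 ∧ q ^ 2 ≤ 1 / (2 * CH) := by
    have h0 : 0 < min 1 (1 / (2 * CH)) := by positivity
    exact ⟨min 1 (1 / (2 * CH)), h0, min_le_left _ _, by nlinarith [min_le_left 1 (1 / (2 * CH)), min_le_right 1 (1 / (2 * CH))]⟩
  obtain ⟨β, hβ⟩ : ∃ β : ℝ, β = q / 4 := ⟨_, rfl⟩
  obtain ⟨ϑ, hϑ⟩ : ∃ ϑ : ℝ, ϑ = q / (12 * (N + 1)) := ⟨_, rfl⟩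
  have hβ0 : 0 < β := by rw [hβ]; positivity
  have hϑ0 : 0 < ϑ := by rw [hϑ]; positivity
  have hϑ4 : ϑ ≤ 1 / 4 := by
    rw [hϑ, div_le_div_iff₀ pz nz]; nlinarith [Nat.cast_nonneg (α := ℝ) N]
  have hab : N * (6 * ϑ) + 2 * β ≤ q := by
    have : N * (6 * ϑ) ≤ q / 2 := by
      rw [hϑ]; have : (N : ℝ) * (6 * (q / (12 * (N + 1)))) = q / 2 * (N / (N + 1)) := by field_simp; ring
      rw [this]; exact mul_le_of_le_one_right pz (by rw [div_le_one pz]; linarith)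
    rw [hβ]; linarith
  obtain ⟨K2, hK2⟩ : ∃ K2 : ℝ, K2 = N * 6 + 2 * β / ϑ + 7 * L := ⟨_, rfl⟩
  have hK20 : 0 < K2 := by rw [hK2]; positivity
  refine ⟨β, ϑ, (10 ^ N) ^ 2 * (3 / 2) ^ 2 * (2 * CH * (K2 ^ 2 * (16 / ϑ ^ 2) * J)), hβ0, by linarith, hϑ0, hϑ4, by positivity,
    fun Ω σ hP a ha r hr r0 hr0 hr00 W u hu hw X ρ hρ hrs U hU μ hμ S hSm hSO hS => ?_⟩
  have ho := hu.wk.op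
  have hf := fr_ne oz hP.bounded hP.nonempty
  have hδ := dl_pos ho hf hu.mem
  obtain ⟨m, hm⟩ : ∃ m : E → ℝ, ∀ z, m z = max (dl Ω z) (r z) := ⟨_, fun z => rfl⟩
  have hm0 : ∀ z, 0 < m z := fun z => by rw [hm]; exact lt_max_of_lt_right (hr.pos z)
  obtain ⟨ψ, ψ1, ψ2, ψ3⟩ := lip_smooth (f := m) zero_le_one (fun x y => by
    rw [hm, hm, one_mul]
    refine max_le ?_ ?_
    · linarith [dl_lip Ω x y, le_max_left (dl Ω y) (r y)]
    · linarith [hr.lip x y, le_max_right (dl Ω y) (r y)]) (half_pos hr0)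
  have ψm : ∀ z, m z / 2 ≤ ψ z ∧ ψ z ≤ 3 / 2 * m z := fun z => by
    have h1 := abs_le.1 (ψ2 z)
    have h2 : r0 ≤ m z := by rw [hm]; exact (hr00 z).trans (le_max_right _ _)
    constructor <;> linarith
  have ψ0 : ∀ z, 0 < ψ z := fun z => by linarith [(ψm z).1, hm0 z]
  set δ := dl Ω W with hδd
  obtain ⟨g, hg⟩ : ∃ g : E → ℝ, g = fun z => (16 / (5 * δ ^ 2)) * (-(δ ^ 2 / 4) + ‖z - W‖ ^ 2) := ⟨_, rfl⟩
  obtain ⟨F, hF⟩ : ∃ F : E → ℝ, F = fun z => Bw ρ X W z ^ N * (ρ * (ψ z)⁻¹) ^ β := ⟨_, rfl⟩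
  obtain ⟨st, hst⟩ : ∃ st : E → ℝ, st = fun z => smoothTransition (g z) := ⟨_, rfl⟩
  have nc : ∀ V : E, ContDiff ℝ 1 fun z => ‖z - V‖ ^ 2 := fun V => (contDiff_id.sub contDiff_const).norm_sq ℝ
  have gc : ContDiff ℝ 1 g := by rw [hg]; exact contDiff_const.mul (contDiff_const.add (nc W))
  have stc : ContDiff ℝ 1 st := by rw [hst]; exact (smoothTransition.contDiff (n := 1)).comp gc
  have Fc : ContDiff ℝ 1 F := by
    rw [hF]
    refine ContDiff.mul (ContDiff.pow ?_ _) ((contDiff_const.mul ((ψ1.of_le (by exact_mod_cast le_top)).inv fun z => (ψ0 z).ne')).rpow_const_of_ne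
      fun z => (mul_pos hρ (inv_pos.2 (ψ0 z))).ne')
    unfold Bw
    refine ((contDiff_const.mul (contDiff_const.add (nc W))).mul ((contDiff_const.add (nc X)).inv fun z => by positivity)).mul
      ((contDiff_const.add (nc W)).inv fun z => by positivity)
  have st0 : ∀ z, dist z W ≤ δ / 2 → st z = 0 := fun z hz => by
    rw [hst]; refine smoothTransition.zero_of_nonpos ?_
    rw [hg]; rw [dist_eq_norm] at hz
    exact mul_nonpos_of_nonneg_of_nonpos pz (by nlinarith only [norm_nonneg (z - W), hz, hδ])
  have st1 : ∀ z, 3 * δ / 4 ≤ dist z W → st z = 1 := fun z hz => by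
    rw [hst]; refine smoothTransition.one_of_one_le ?_
    rw [hg]; rw [dist_eq_norm] at hz
    have : 5 * δ ^ 2 / 16 ≤ -(δ ^ 2 / 4) + ‖z - W‖ ^ 2 := by nlinarith only [hz, hδ]
    calc (1 : ℝ) = 16 / (5 * δ ^ 2) * (5 * δ ^ 2 / 16) := by field_simp
      _ ≤ _ := mul_le_mul_of_nonneg_left this pz
  obtain ⟨e, he⟩ : ∃ e : E → ℝ, e = fun z => st z * F z := ⟨_, rfl⟩
  have ec : ContDiff ℝ 1 e := by rw [he]; exact stc.mul Fc
  obtain ⟨E1, E2, E3, E4⟩ := eng oz hP ha hu hw ec (half_pos hδ) (fun z hz => by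
    rw [he]; beta_reduce; rw [st0 z (le_of_lt hz), zero_mul])
  have hh := hardy Ω σ hP r hr.pos hr.lip hr.dm a ha hr.fr _ E2 E1
  rw [E3] at hh
  have conv : ∀ z, ofReal ((max (dl Ω z) (r z) ^ 2)⁻¹) * ‖u z * e z‖ₑ ^ 2 = ofReal ((m z ^ 2)⁻¹ * (u z * e z) ^ 2) := fun z => by
    rw [ofReal_mul pz, hm, ← enorm_pow, Real.enorm_eq_ofReal pz]
  simp only [conv] at hh
  have FL : ∀ z, z ≠ W → LB F (N * (6 / rp ρ X W z) + β * (2 / m z)) z := fun z hz => by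
    rw [hF]
    refine ((Bw_LB hρ hz).pow N).mul ?_
    have h1 : LB ψ (2 / m z) z := ⟨ψ0 z, _, (ψ1.differentiable sz z).hasFDerivAt, (ψ3 z).trans (by
      rw [div_mul_eq_mul_div, le_div_iff₀ (hm0 z)]; linarith [(ψm z).1])⟩
    have c : LB (fun _ : E => ρ) 0 z := ⟨hρ, 0, hasFDerivAt_const _ _, by simp⟩
    have := (c.mul h1.inv).rpow β
    rw [abs_of_pos hβ0, zero_add] at this; exact this
  have key : ∀ z ∈ Ω, z ≠ W → u z ^ 2 * ‖fderiv ℝ e z‖ ^ 2 ≤ 1 / (2 * CH) * ((m z ^ 2)⁻¹ * (u z * e z) ^ 2) +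
      K2 ^ 2 * (16 / ϑ ^ 2) * (U ^ 2 / ρ ^ 2) * (ρ ^ 2 / (ρ ^ 2 + ‖z - X‖ ^ 2)) ^ n := fun z hz hzW => by
    have hR : 0 ≤ K2 ^ 2 * (16 / ϑ ^ 2) * (U ^ 2 / ρ ^ 2) * (ρ ^ 2 / (ρ ^ 2 + ‖z - X‖ ^ 2)) ^ n := by positivity
    have hL0 : 0 ≤ 1 / (2 * CH) * ((m z ^ 2)⁻¹ * (u z * e z) ^ 2) := by positivity
    rcases lt_or_ge (dist z W) (δ / 2) with hs | hs
    · have : e =ᶠ[𝓝 z] fun _ => 0 := by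
        filter_upwards [(isOpen_ball (x := W) (ε := δ / 2)).mem_nhds hs] with y hy
        rw [he]; beta_reduce; rw [st0 y (le_of_lt hy), zero_mul]
      rw [this.fderiv_eq, fderiv_fun_const, Pi.zero_apply, norm_zero, zero_pow two_ne_zero, mul_zero]; linarith only [hR, hL0]
    obtain ⟨F0, F', F1, F2⟩ := FL z hzW
    have hp := rp_pos (X := X) hρ hzW
    obtain ⟨B0, B1, B2, B3⟩ := Bw_prop (X := X) hρ hzW
    have hu0 := hu.nn' z hz hzW
    have hds := dl_lip Ω W z; rw [dist_comm] at hds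
    have hpd : rp ρ X W z ≤ dist z W := min_le_right _ _
    have nst : 0 ≤ st z := by rw [hst]; exact smoothTransition.nonneg _
    have nst1 : st z ≤ 1 := by rw [hst]; exact smoothTransition.le_one _
    have hde : ‖fderiv ℝ e z‖ ≤ st z * F z * (N * (6 / rp ρ X W z) + β * (2 / m z)) + F z * ‖fderiv ℝ st z‖ := by
      have h1 := ((stc.differentiable sz z).hasFDerivAt).mul F1
      have h2 : fderiv ℝ e z = st z • F' + F z • fderiv ℝ st z := by rw [he]; exact h1.fderiv
      rw [h2]
      refine (norm_add_le _ _).trans ?_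
      rw [norm_smul, norm_smul, norm_of_nonneg nst, norm_of_nonneg F0.le]
      linarith only [mul_le_mul_of_nonneg_left F2 nst]
    rcases le_or_gt (dl Ω z) (ϑ * rp ρ X W z) with hd | hd
    · have h1 : fderiv ℝ st z = 0 := by
        have h3 : 3 * δ / 4 < dist z W := by linarith only [mul_le_mul hϑ4 hpd hp.le nz, hd, hds, hδ]
        have : st =ᶠ[𝓝 z] fun _ => 1 := by
          filter_upwards [(isOpen_lt continuous_const (continuous_id.dist continuous_const)).mem_nhds h3] with y hy
          exact st1 y (le_of_lt hy)
        rw [this.fderiv_eq]; simp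
      have hmz : m z ≤ ϑ * rp ρ X W z := by rw [hm]; exact max_le hd (hrs z hz hs)
      have h2 : N * (6 / rp ρ X W z) + β * (2 / m z) ≤ q / m z := by
        rw [le_div_iff₀ (hm0 z), add_mul]
        have : m z / rp ρ X W z ≤ ϑ := by rwa [div_le_iff₀ hp]
        calc N * (6 / rp ρ X W z) * m z + β * (2 / m z) * m z = N * (6 * (m z / rp ρ X W z)) + 2 * β := by have := (hm0 z).ne'; field_simp
          _ ≤ N * (6 * ϑ) + 2 * β := by gcongr
          _ ≤ q := hab
      rw [h1, norm_zero, mul_zero, add_zero] at hde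
      have h3 : ‖fderiv ℝ e z‖ ≤ e z * (q / m z) := by
        refine hde.trans ?_
        rw [he]; exact mul_le_mul_of_nonneg_left h2 (mul_nonneg nst F0.le)
      have h4 := pow_le_pow_left₀ (norm_nonneg _) h3 2
      calc u z ^ 2 * ‖fderiv ℝ e z‖ ^ 2 ≤ u z ^ 2 * (e z * (q / m z)) ^ 2 := by gcongr
        _ = q ^ 2 * ((m z ^ 2)⁻¹ * (u z * e z) ^ 2) := by rw [div_eq_mul_inv]; ring
        _ ≤ 1 / (2 * CH) * ((m z ^ 2)⁻¹ * (u z * e z) ^ 2) := by gcongr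
        _ ≤ _ := by linarith
    · have hmz : ϑ * rp ρ X W z ≤ m z := by rw [hm]; exact hd.le.trans (le_max_left _ _)
      have h1 : ‖fderiv ℝ st z‖ ≤ 7 * L / rp ρ X W z := by
        rcases lt_or_ge (3 * δ / 4) (dist z W) with h3 | h3
        · have : st =ᶠ[𝓝 z] fun _ => 1 := by
            filter_upwards [(isOpen_lt continuous_const (continuous_id.dist continuous_const)).mem_nhds h3] with y hy
            exact st1 y (le_of_lt hy)
          rw [this.fderiv_eq]; simp; positivity
        · have h5 : ‖fderiv ℝ g z‖ ≤ 7 / rp ρ X W z := by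
            obtain ⟨f', h6, h7⟩ := nsq_d (-(δ ^ 2 / 4)) W z
            rw [hg, (h6.const_mul (16 / (5 * δ ^ 2))).fderiv, norm_smul, norm_of_nonneg pz]
            rw [← dist_eq_norm] at h7
            refine (mul_le_mul_of_nonneg_left h7 pz).trans ?_
            rw [div_mul_eq_mul_div, div_le_div_iff₀ pz hp]
            nlinarith only [hδ, mul_le_mul hpd h3 dist_nonneg dist_nonneg, mul_le_mul h3 h3 dist_nonneg pz]
          have := st_fderiv (gc.differentiable sz z) hLd
          rw [← hst] at this
          refine this.trans ((mul_le_mul_of_nonneg_left h5 hL.le).trans (le_of_eq (by ring)))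
      have h2 : ‖fderiv ℝ e z‖ ≤ F z * (K2 / rp ρ X W z) := by
        have h3 : β * (2 / m z) ≤ 2 * β / ϑ / rp ρ X W z := by
          rw [div_div, mul_div_assoc', mul_comm β]; gcongr
        have h4 : st z * F z * (N * (6 / rp ρ X W z) + β * (2 / m z)) ≤ F z * (N * (6 / rp ρ X W z) + 2 * β / ϑ / rp ρ X W z) :=
          mul_le_mul (mul_le_of_le_one_left F0.le nst1) lz (by have := hm0 z; positivity) F0.le
        refine hde.trans ((add_le_add h4 (mul_le_mul_of_nonneg_left h1 F0.le)).trans (le_of_eq ?_))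
        rw [hK2]; ring
      have hw0 : 0 < ρ * (ψ z)⁻¹ := mul_pos hρ (inv_pos.2 (ψ0 z))
      obtain ⟨B, hB⟩ : ∃ B, B = Bw ρ X W z := ⟨_, rfl⟩
      have hT : B * ((ρ * (ψ z)⁻¹) ^ β) ^ 2 ≤ 8 / ϑ ^ 2 := by
        rw [← hB] at B0 B1 B3
        have hψ : ϑ * rp ρ X W z / 2 ≤ ψ z := by linarith [(ψm z).1]
        have h3 : (ρ * (ψ z)⁻¹) ^ 2 ≤ 8 / (ϑ ^ 2 * B) := by
          have h5 := pow_le_pow_left₀ pz hψ 2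
          rw [mul_pow, inv_pow, ← div_eq_mul_inv, div_le_div_iff₀ (pow_pos (ψ0 z) 2) pz]
          linarith only [h5, mul_le_mul_of_nonneg_left B3 (sq_nonneg ϑ)]
        have h4 : 1 ≤ 8 / (ϑ ^ 2 * B) := by
          rw [one_le_div pz]; have : ϑ ^ 2 ≤ 1 := by nlinarith only [hϑ0, hϑ4]
          linarith only [mul_le_mul this B1 B0.le zero_le_one]
        have h6 : ((ρ * (ψ z)⁻¹) ^ β) ^ 2 ≤ 8 / (ϑ ^ 2 * B) := by
          rw [← rpow_natCast, ← Real.rpow_mul hw0.le, mul_comm β, Real.rpow_mul hw0.le, rpow_natCast]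
          exact (Real.rpow_le_rpow pz h3 hβ0.le).trans (Real.rpow_le_self_of_one_le h4 lz)
        calc _ ≤ B * (8 / (ϑ ^ 2 * B)) := by gcongr
          _ = _ := by field_simp
      have hg1 := hU z hz hs hd
      rw [← hB] at B0 B1 B2 B3 hg1
      have hFz : F z = B ^ Γ * B * B ^ n * (ρ * (ψ z)⁻¹) ^ β := by rw [hF]; beta_reduce; rw [← hB, hN]; ring
      have hBp : B / rp ρ X W z ^ 2 ≤ 2 / ρ ^ 2 := by rw [div_le_div_iff₀ pz pz]; linarith
      have hBn : (B ^ n) ^ 2 ≤ (ρ ^ 2 / (ρ ^ 2 + ‖z - X‖ ^ 2)) ^ n := by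
        have : B ^ n ≤ 1 := pow_le_one₀ B0.le B1
        exact le_trans (by rw [sq]; exact mul_le_of_le_one_left pz this) (pow_le_pow_left₀ B0.le B2 n)
      calc u z ^ 2 * ‖fderiv ℝ e z‖ ^ 2 ≤ u z ^ 2 * (F z * (K2 / rp ρ X W z)) ^ 2 := by gcongr
        _ = K2 ^ 2 * (B * ((ρ * (ψ z)⁻¹) ^ β) ^ 2) * (B / rp ρ X W z ^ 2) * (u z * B ^ Γ) ^ 2 * (B ^ n) ^ 2 := by rw [hFz]; ring
        _ ≤ K2 ^ 2 * (8 / ϑ ^ 2) * (2 / ρ ^ 2) * U ^ 2 * (ρ ^ 2 / (ρ ^ 2 + ‖z - X‖ ^ 2)) ^ n := by gcongr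
        _ = K2 ^ 2 * (16 / ϑ ^ 2) * (U ^ 2 / ρ ^ 2) * (ρ ^ 2 / (ρ ^ 2 + ‖z - X‖ ^ 2)) ^ n := by ring
        _ ≤ _ := by linarith
  set c := K2 ^ 2 * (16 / ϑ ^ 2) * (U ^ 2 / ρ ^ 2) with hc
  have hc0 : 0 ≤ c := by positivity
  obtain ⟨R, hR⟩ : ∃ R, R = ∫⁻ z in Ω, ofReal (u z ^ 2 * ‖fderiv ℝ e z‖ ^ 2) := ⟨_, rfl⟩
  obtain ⟨I, hI⟩ : ∃ I, I = ∫⁻ z in Ω, ofReal ((m z ^ 2)⁻¹ * (u z * e z) ^ 2) := ⟨_, rfl⟩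
  have k1 : R ≤ ofReal (1 / (2 * CH)) * I + ofReal (c * (J * ρ ^ n)) := by
    have k2 : R ≤ ∫⁻ z in Ω, (ofReal (1 / (2 * CH)) * ofReal ((m z ^ 2)⁻¹ * (u z * e z) ^ 2) +
        ofReal c * ofReal ((ρ ^ 2 / (ρ ^ 2 + ‖z - X‖ ^ 2)) ^ n)) := by
      rw [hR]
      refine setLIntegral_mono_ae' ho.measurableSet ?_
      filter_upwards [ae_neY oz W] with z hzW hz
      rw [← ofReal_mul pz, ← ofReal_mul hc0, ← ofReal_add pz pz]
      exact ofReal_le_ofReal (key z hz hzW)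
    refine k2.trans ?_
    rw [lintegral_add_right _ (by fun_prop), lintegral_const_mul' _ _ ofReal_ne_top, lintegral_const_mul' _ _ ofReal_ne_top, ← hI,
      ofReal_mul hc0]
    exact add_le_add le_rfl (mul_le_mul' le_rfl ((setLIntegral_le_lintegral _ _).trans (jap X ρ hρ)))
  rw [← hR] at hh E4
  rw [← hI] at hh
  have k3 := k1.trans (add_le_add (mul_le_mul' le_rfl hh) le_rfl)
  rw [← ofReal_toReal E4] at k3 hh
  have hR0 := ENNReal.toReal_nonneg (a := R)
  rw [← ofReal_mul hCH.le, ← ofReal_mul pz, ← ofReal_add pz pz,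
    ofReal_le_ofReal_iff pz, show 1 / (2 * CH) * (CH * R.toReal) = R.toReal / 2 by field_simp] at k3
  rw [← ofReal_mul hCH.le] at hh
  have k4 : I ≤ ofReal (CH * (2 * (c * (J * ρ ^ n)))) := hh.trans (ofReal_le_ofReal (mul_le_mul_of_nonneg_left lz hCH.le))
  have hμβ : 0 < μ ^ β := Real.rpow_pos_of_pos hμ _
  have k5 : ∫⁻ z in S, ofReal (u z ^ 2 * (max (dl Ω z) (r z) ^ 2)⁻¹) ≤ ofReal ((10 ^ N) ^ 2 * (3 / 2) ^ 2 * (μ ^ β) ^ 2) * I := by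
    rw [hI, ← lintegral_const_mul' _ _ ofReal_ne_top]
    refine le_trans (setLIntegral_mono' hSm fun z hz => ?_) (lintegral_mono_set hSO)
    rw [← ofReal_mul pz, ← hm]
    refine ofReal_le_ofReal ?_
    obtain ⟨s1, s2, s3, s4⟩ := hS z hz
    rw [← hm] at s4
    have hB : 1 ≤ 10 * Bw ρ X W z := by
      rw [dist_eq_norm] at s1 s2
      rw [Bw, ← div_eq_mul_inv, ← div_eq_mul_inv, div_div, mul_div_assoc', le_div_iff₀ pz, one_mul, zero_add]
      have h1 : ‖z - X‖ ^ 2 ≤ ρ ^ 2 := pow_le_pow_left₀ (norm_nonneg _) s1 2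
      have h2 : (ρ / 2) ^ 2 ≤ ‖z - W‖ ^ 2 := pow_le_pow_left₀ pz s2 2
      linarith only [mul_le_mul_of_nonneg_right h1 (by positivity : 0 ≤ ρ ^ 2 + ‖z - W‖ ^ 2), mul_le_mul_of_nonneg_left h2 (sq_nonneg ρ)]
    have hψ : 1 ≤ ρ * (ψ z)⁻¹ * (3 / 2 * μ) := by
      rw [mul_right_comm, ← div_eq_mul_inv, one_le_div (ψ0 z)]; linarith [(ψm z).2]
    have hw0 : 0 < ρ * (ψ z)⁻¹ := mul_pos hρ (inv_pos.2 (ψ0 z))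
    have h3 : 1 ≤ (ρ * (ψ z)⁻¹) ^ β * (3 / 2 * μ ^ β) := by
      have := Real.one_le_rpow hψ hβ0.le
      rw [Real.mul_rpow hw0.le pz, Real.mul_rpow nz hμ.le] at this
      refine this.trans (mul_le_mul_of_nonneg_left (mul_le_mul_of_nonneg_right (Real.rpow_le_self_of_one_le nz lz) hμβ.le) pz)
    have h4 : 1 ≤ (10 * Bw ρ X W z) ^ N := one_le_pow₀ hB
    have h5 : 1 ≤ 10 ^ N * (3 / 2) * μ ^ β * e z := by
      rw [he]; beta_reduce; rw [st1 z s3, hF]; beta_reduce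
      calc (1 : ℝ) ≤ (10 * Bw ρ X W z) ^ N * ((ρ * (ψ z)⁻¹) ^ β * (3 / 2 * μ ^ β)) := one_le_mul_of_one_le_of_one_le h4 h3
        _ = _ := by rw [mul_pow]; ring
    have h6 : 1 ≤ (10 ^ N * (3 / 2) * μ ^ β * e z) ^ 2 := one_le_pow₀ h5
    calc u z ^ 2 * (m z ^ 2)⁻¹ ≤ u z ^ 2 * (m z ^ 2)⁻¹ * (10 ^ N * (3 / 2) * μ ^ β * e z) ^ 2 := le_mul_of_one_le_right pz h6
      _ = _ := by ring
  refine k5.trans ((mul_le_mul' le_rfl k4).trans ?_)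
  rw [← ofReal_mul pz]
  refine ofReal_le_ofReal (le_of_eq ?_)
  rw [hc, show ρ ^ n = ρ ^ nm * ρ ^ 2 by rw [← pow_add]; congr 1; omega]
  field_simp

noncomputable def gf (α δ R : ℝ) : ℝ := R * (δ / R) ^ α

theorem gf_bd {α δ R : ℝ} (hα : 0 ≤ α) (hα1 : α ≤ 1) (hδ : 0 < δ) (hR : δ ≤ R) : δ ≤ gf α δ R ∧ gf α δ R ≤ R := by
  have h0 : 0 < δ / R := div_pos hδ (hδ.trans_le hR)
  have h1 : δ / R ≤ 1 := (div_le_one (hδ.trans_le hR)).2 hR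
  have hR0 := hδ.trans_le hR
  refine ⟨?_, ?_⟩
  · have := Real.rpow_le_rpow_of_exponent_ge h0 h1 hα1
    rw [Real.rpow_one] at this
    calc δ = R * (δ / R) := by field_simp
      _ ≤ _ := mul_le_mul_of_nonneg_left this hR0.le
  · exact mul_le_of_le_one_right hR0.le (Real.rpow_le_one h0.le h1 hα)

theorem gf_lip {α δ x y : ℝ} (hα : 0 ≤ α) (hα1 : α ≤ 1) (hδ : 0 < δ) (hx : δ ≤ x) (hy : δ ≤ y) {s : ℝ} (hs : 0 ≤ s) (h : x ≤ y + s) :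
    gf α δ x ≤ gf α δ y + s := by
  have hx0 := hδ.trans_le hx
  have hy0 := hδ.trans_le hy
  rcases le_total x y with hxy | hxy
  · have h1 : (y / x) ^ α ≤ y / x := by
      have := Real.rpow_le_rpow_of_exponent_le ((one_le_div hx0).2 hxy) hα1
      rwa [Real.rpow_one] at this
    have h2 : δ / x = δ / y * (y / x) := by field_simp
    have h3 : gf α δ x ≤ gf α δ y := by
      unfold gf
      rw [h2, Real.mul_rpow pz pz]
      have := mul_le_mul_of_nonneg_left h1 (a := x * (δ / y) ^ α) pz
      calc _ = x * (δ / y) ^ α * (y / x) ^ α := by ring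
        _ ≤ _ := this
        _ = _ := by field_simp
    linarith
  · have h1 : (δ / x) ^ α ≤ (δ / y) ^ α := Real.rpow_le_rpow pz (by gcongr) hα
    have h2 : (δ / y) ^ α ≤ 1 := Real.rpow_le_one pz ((div_le_one hy0).2 hy) hα
    unfold gf
    nlinarith only [h1, h2, hx0, hy0, h, hxy, hs]

section

def Dp (Ω : SE) (σ : ME) (a L : ℝ) (W : E) : Prop :=
  ∃ Q ∈ frontier Ω, dist W Q = dl Ω W ∧ L * dl Ω W ^ nm ≤ a * σ.real (ball Q (dl Ω W))

variable (n) in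
theorem deep (hn : 3 ≤ n) (M Cσ d cd : ℝ) : ∃ α : ℝ, 0 < α ∧ α ≤ 1 / 2 ∧ ∀ κ, 0 < κ → κ ≤ 1 → ∃ L : ℝ, 1 ≤ L ∧
    ∀ (Ω : SE) σ, IsMixedPair M Cσ d cd Ω σ → ∀ a, 0 < a → ∀ W ∈ Ω, Dp Ω σ a L W → ∀ P ∈ frontier Ω,
      (κ * gf α (dl Ω W) (max (dist P W) (dl Ω W))) ^ nm ≤
        a * σ.real (ball P (κ * gf α (dl Ω W) (max (dist P W) (dl Ω W)))) := by
  by_cases hyp : (n : ℝ) - 2 < d ∧ 0 < cd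
  swap
  · refine ⟨1 / 2, by norm_num, le_rfl, fun κ _ _ => ⟨1, le_rfl, fun Ω σ hP => ?_⟩⟩
    exact absurd ⟨hP.d_gt, hP.cd_pos⟩ hyp
  obtain ⟨hd, hcd⟩ := hyp
  obtain ⟨s, hs⟩ := pow_two_big Cσ
  obtain ⟨α, hα⟩ : ∃ α : ℝ, α = min (1 / 2) ((d - n + 2) / (s + 1)) := ⟨_, rfl⟩
  have hα0 : 0 < α := by
    rw [hα]; exact lt_min nz (div_pos lz pz)
  have hα1 : α ≤ 1 / 2 := hα.le.trans (min_le_left _ _)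
  have hαs : α * s ≤ d - n + 2 := by
    have h1 : α ≤ (d - n + 2) / (s + 1) := hα.le.trans (min_le_right _ _)
    rw [le_div_iff₀ pz] at h1
    nlinarith
  refine ⟨α, hα0, hα1, fun κ hκ hκ1 => ?_⟩
  obtain ⟨c0, hc0⟩ : ∃ c0 : ℝ, c0 = min cd 1 / (2 * 1) ^ d := ⟨_, rfl⟩
  have hc0p : 0 < c0 := by rw [hc0]; positivity
  refine ⟨max 1 (Cσ ^ 2 * (2 / κ) ^ s / c0), le_max_left _ _, ?_⟩
  intro Ω σ hP a ha W hW ⟨Q, hQ, hWQ, hdeep⟩ P hPf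
  have hf := fr_ne oz hP.bounded hP.nonempty
  have hδ := dl_pos hP.nta.isOpen hf hW
  obtain ⟨δ, hδe⟩ : ∃ δ, δ = dl Ω W := ⟨_, rfl⟩
  rw [← hδe] at hδ hdeep hWQ ⊢
  obtain ⟨R, hR⟩ : ∃ R, R = max (dist P W) δ := ⟨_, rfl⟩
  rw [← hR]
  have hRδ : δ ≤ R := hR.ge.trans' (le_max_right _ _)
  have hR0 := hδ.trans_le hRδ
  have hRD : R ≤ 1 * diam Ω := by
    rw [one_mul, hR, hδe]
    exact max_le (fr_dist hP (frontier_subset_closure hPf) (subset_closure hW)) (dl_le_diam hP.bounded hf (subset_closure hW))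
  have hCσ := hP.Cσ_pos
  obtain ⟨w, hw⟩ : ∃ w, w = (δ / R) ^ α := ⟨_, rfl⟩
  have hw0 : 0 < w := by rw [hw]; positivity
  have hw1 : w ≤ 1 := by rw [hw]; exact Real.rpow_le_one pz ((div_le_one hR0).2 hRδ) hα0.le
  have hr : κ * gf α δ R = κ * R * w := by rw [gf, hw]; ring
  rw [hr]
  have hr0 : 0 < κ * R * w := by positivity
  have hκw : κ * w ≤ 1 := mul_le_one₀ hκ1 hw0.le hw1
  have s1 := sig_low oz hP hQ hδ le_rfl hRδ hRD
  rw [← hc0] at s1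
  have s2 := sig_shift oz hP hPf hR0 (Q' := Q) (s' := R) 2 (by
    have h1 : dist P W ≤ R := hR.ge.trans' (le_max_left _ _)
    have := dist_triangle P W Q
    linarith)
  obtain ⟨k, hk1, hk2⟩ := exists_nat_pow_near (x := 1 / (κ * w)) (y := 2) ((one_le_div pz).2 hκw) one_lt_two
  have s3 := sig_shift oz hP hPf hr0 (Q' := P) (s' := R) (k + 1) (by
    rw [dist_self, zero_add]
    rw [div_lt_iff₀ pz] at hk2
    nlinarith)
  have s4 : Cσ ^ (k + 1) ≤ (2 / (κ * w)) ^ s := by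
    calc Cσ ^ (k + 1) ≤ (2 ^ s) ^ (k + 1) := by gcongr
      _ = (2 ^ (k + 1)) ^ s := by rw [← pow_mul, ← pow_mul, mul_comm]
      _ ≤ _ := by
        gcongr
        rw [pow_succ]
        calc (2 : ℝ) ^ k * 2 ≤ 1 / (κ * w) * 2 := by gcongr
          _ = _ := by ring
  have s5 : (R / δ) ^ nm ≤ (R / δ) ^ d * w ^ s := by
    have ht : 1 ≤ R / δ := (one_le_div hδ).2 hRδ
    have e1 : w = (R / δ) ^ (-α) := by
      rw [hw, ← inv_div R δ, Real.inv_rpow pz, Real.rpow_neg pz]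
    rw [e1, ← rpow_natCast (_ ^ (-α)), ← Real.rpow_mul pz, ← Real.rpow_add pz, ← rpow_natCast]
    refine Real.rpow_le_rpow_of_exponent_le ht ?_
    rw [Nat.cast_sub oz]; push_cast; linarith
  have hd' : (Cσ ^ 2 * (2 / κ) ^ s / c0) * δ ^ nm ≤ a * σ.real (ball Q δ) :=
    (mul_le_mul_of_nonneg_right (le_max_right _ _) pz).trans hdeep
  have hS : c0 * (R / δ) ^ d * σ.real (ball Q δ) ≤ Cσ ^ 2 * ((2 / (κ * w)) ^ s * σ.real (ball P (κ * R * w))) :=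
    s1.trans (s2.trans (mul_le_mul_of_nonneg_left (s3.trans (mul_le_mul_of_nonneg_right s4 measureReal_nonneg)) pz))
  have hX : (κ * R * w) ^ nm ≤ (R / δ) ^ d * w ^ s * δ ^ nm := by
    calc (κ * R * w) ^ nm ≤ R ^ nm := by
          refine pow_le_pow_left₀ hr0.le ?_ _
          nlinarith
      _ = (R / δ) ^ nm * δ ^ nm := by rw [div_pow]; field_simp
      _ ≤ _ := by gcongr
  have hA : (2 / (κ * w)) ^ s * w ^ s = (2 / κ) ^ s := by rw [← mul_pow]; congr 1; field_simp
  have hZ : (0 : ℝ) < Cσ ^ 2 * (2 / (κ * w)) ^ s := by positivity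
  refine le_of_mul_le_mul_left ?_ hZ
  calc Cσ ^ 2 * (2 / (κ * w)) ^ s * (κ * R * w) ^ nm ≤ Cσ ^ 2 * (2 / (κ * w)) ^ s * ((R / δ) ^ d * w ^ s * δ ^ nm) := by gcongr
    _ = c0 * (R / δ) ^ d * ((Cσ ^ 2 * (2 / κ) ^ s / c0) * δ ^ nm) := by rw [← hA]; field_simp
    _ ≤ c0 * (R / δ) ^ d * (a * σ.real (ball Q δ)) := by gcongr
    _ = a * (c0 * (R / δ) ^ d * σ.real (ball Q δ)) := by ring
    _ ≤ a * (Cσ ^ 2 * ((2 / (κ * w)) ^ s * σ.real (ball P (κ * R * w)))) := by gcongr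
    _ = _ := by ring

noncomputable def rr (κ α : ℝ) (Ω : SE) (X Y z : E) : ℝ :=
  κ * min (gf α (dl Ω X) (max (dist z X) (dl Ω X))) (gf α (dl Ω Y) (max (dist z Y) (dl Ω Y)))

theorem rr_comm (κ α : ℝ) (Ω : SE) (X Y : E) : rr κ α Ω X Y = rr κ α Ω Y X := by
  ext z; rw [rr, rr, min_comm]

theorem rr_le {κ α : ℝ} (hκ : 0 ≤ κ) (hα : 0 ≤ α) (hα1 : α ≤ 1) {X Y : E} (hX : 0 < dl Ω X) (z : E) :
    rr κ α Ω X Y z ≤ κ * max (dist z X) (dl Ω X) :=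
  mul_le_mul_of_nonneg_left ((min_le_left _ _).trans (gf_bd hα hα1 hX (le_max_right _ _)).2) hκ

theorem rr_ge {κ α : ℝ} (hκ : 0 ≤ κ) (hα : 0 ≤ α) (hα1 : α ≤ 1) {X Y : E} (hX : 0 < dl Ω X) (hY : 0 < dl Ω Y) (z : E) :
    κ * min (dl Ω X) (dl Ω Y) ≤ rr κ α Ω X Y z :=
  mul_le_mul_of_nonneg_left (min_le_min (gf_bd hα hα1 hX (le_max_right _ _)).1 (gf_bd hα hα1 hY (le_max_right _ _)).1) hκ

theorem rr_lip {κ α : ℝ} (hκ : 0 ≤ κ) (hκ1 : κ ≤ 1) (hα : 0 ≤ α) (hα1 : α ≤ 1) {X Y : E} (hX : 0 < dl Ω X) (hY : 0 < dl Ω Y) (x y : E) :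
    rr κ α Ω X Y x ≤ rr κ α Ω X Y y + κ * dist x y := by
  have key : ∀ W : E, 0 < dl Ω W → gf α (dl Ω W) (max (dist x W) (dl Ω W)) ≤ gf α (dl Ω W) (max (dist y W) (dl Ω W)) + dist x y := fun W hW => by
    refine gf_lip hα hα1 hW (le_max_right _ _) (le_max_right _ _) dist_nonneg (max_le ?_ ?_)
    · linarith [dist_triangle x y W, le_max_left (dist y W) (dl Ω W)]
    · linarith [le_max_right (dist y W) (dl Ω W), dist_nonneg (x := x) (y := y)]
  unfold rr
  rw [← mul_add]
  refine mul_le_mul_of_nonneg_left ?_ hκ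
  rw [← min_add_add_right]
  exact min_le_min (key X hX) (key Y hY)

theorem rr_hd (hn : 1 ≤ n) (hP : IsMixedPair M Cσ d cd Ω σ) {κ α : ℝ} (hκ : 0 < κ) (hκ1 : κ ≤ 1 / 100) (hα : 0 ≤ α) (hα1 : α ≤ 1) {X Y : E}
    (hX : X ∈ Ω) (hY : Y ∈ Ω) (h : ∀ W, (W = X ∨ W = Y) → ∀ P ∈ frontier Ω, (κ * gf α (dl Ω W) (max (dist P W) (dl Ω W))) ^ nm ≤
        a * σ.real (ball P (κ * gf α (dl Ω W) (max (dist P W) (dl Ω W))))) : Hd Ω σ a (rr κ α Ω X Y) := by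
  have hf := fr_ne hn hP.bounded hP.nonempty
  have hX0 := dl_pos hP.nta.isOpen hf hX
  have hY0 := dl_pos hP.nta.isOpen hf hY
  refine ⟨fun x => ?_, fun x y => ?_, fun x hx => ?_, fun P hPf => ?_⟩
  · exact (mul_pos hκ (lt_min hX0 hY0)).trans_le (rr_ge hκ.le hα hα1 hX0 hY0 x)
  · have := rr_lip hκ.le lz hα hα1 hX0 hY0 x y
    nlinarith [dist_nonneg (x := x) (y := y)]
  · have h1 := rr_le hκ.le hα hα1 (Y := Y) hX0 x
    have h2 : max (dist x X) (dl Ω X) ≤ diam Ω := max_le (fr_dist hP (subset_closure hx) (subset_closure hX)) (dl_le_diam hP.bounded hf (subset_closure hX))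
    have h3 := diam_pos' hn hP
    nlinarith
  · unfold rr
    rcases min_choice (gf α (dl Ω X) (max (dist P X) (dl Ω X))) (gf α (dl Ω Y) (max (dist P Y) (dl Ω Y))) with e | e <;> rw [e]
    · exact h X (Or.inl rfl) P hPf
    · exact h Y (Or.inr rfl) P hPf
end

section

theorem unitv (hn : 1 ≤ n) : ∃ e : E, ‖e‖ = 1 := ⟨EuclideanSpace.single ⟨0, hn⟩ 1, by simp⟩

theorem cl_near (hn : 1 ≤ n) (hP : IsMixedPair M Cσ d cd Ω σ) {x y : E} (hx : x ∈ Ω) (h : dist y x ≤ dl Ω x / 11) :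
    y ∈ Ω ∧ Cl Ω x y := by
  have hf := fr_ne hn hP.bounded hP.nonempty
  have h0 := dl_pos hP.nta.isOpen hf hx
  have hD := dl_le_diam hP.bounded hf (subset_closure hx)
  have m1 : dist (midpoint ℝ x y) x = dist y x / 2 := by rw [dist_midpoint_left, dist_comm x y]; simp; ring
  have m2 : dist (midpoint ℝ x y) y = dist y x / 2 := by rw [dist_midpoint_right, dist_comm x y]; simp; ring
  have hy : y ∈ Ω := dl_ball hx (by rw [mem_ball]; linarith)
  have hm : midpoint ℝ x y ∈ Ω := dl_ball hx (by rw [mem_ball]; linarith)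
  exact ⟨hy, (Relation.ReflTransGen.single ⟨hx, hm, by rw [dist_comm]; linarith⟩).tail ⟨hm, hy, by linarith⟩⟩

theorem cand (hn : 1 ≤ n) (hP : IsMixedPair M Cσ d cd Ω σ) {A : E} (hA : A ∈ Ω) (X Y : E) : ∃ A' ∈ Ω, dist A' A ≤ dl Ω A / 15 ∧
    dl Ω A' / 32 ≤ dist A' X ∧ dl Ω A' / 32 ≤ dist A' Y ∧ Cl Ω A A' := by
  obtain ⟨e, he⟩ := unitv hn
  have h0 := dl_pos hP.nta.isOpen (fr_ne hn hP.bounded hP.nonempty) hA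
  by_contra hc
  push Not at hc
  have key : ∀ s : ℝ, |s| ≤ dl Ω A / 15 → dist (A + s • e) X < dl Ω A * (1 / 30) ∨ dist (A + s • e) Y < dl Ω A * (1 / 30) := fun s hs => by
    have d1 : dist (A + s • e) A = |s| := by rw [dist_eq_norm, add_sub_cancel_left, norm_smul, he, mul_one, norm_eq_abs]
    obtain ⟨hm, hcl⟩ := cl_near hn hP hA (y := A + s • e) (by rw [d1]; linarith)
    have h1 := hc _ hm (by rw [d1]; exact hs)
    have h2 := dl_lip Ω (A + s • e) A
    rw [d1] at h2
    by_contra hcc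
    push Not at hcc
    exact h1 lz lz hcl
  have dd : ∀ s t : ℝ, dist (A + s • e) (A + t • e) = |s - t| := fun s t => by
    rw [dist_add_left, dist_eq_norm, ← sub_smul, norm_smul, he, mul_one, norm_eq_abs]
  have two : ∀ s t : ℝ, dl Ω A / 15 ≤ |s - t| → ∀ Z : E, dist (A + s • e) Z < dl Ω A * (1 / 30) → dist (A + t • e) Z < dl Ω A * (1 / 30) → False :=
    fun s t h Z h1 h2 => by linarith [dist_triangle_right (A + s • e) (A + t • e) Z, dd s t]
  have a1 : dl Ω A / 15 ≤ |dl Ω A / 15 - 0| := by rw [sub_zero]; exact le_abs_self _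
  have a2 : dl Ω A / 15 ≤ |-(dl Ω A / 15) - 0| := by rw [sub_zero, abs_neg]; exact le_abs_self _
  have a3 : dl Ω A / 15 ≤ |dl Ω A / 15 - -(dl Ω A / 15)| := by rw [abs_of_pos lz]; linarith
  rcases key (dl Ω A / 15) (abs_of_pos lz).le with h1 | h1 <;> rcases key (-(dl Ω A / 15)) (by rw [abs_neg, abs_of_pos lz]) with h2 | h2 <;>
    rcases key 0 (by rw [abs_zero]; linarith) with h3 | h3
  all_goals first | exact two _ _ a1 _ h1 h3 | exact two _ _ a2 _ h2 h3 | exact two _ _ a3 _ h1 h2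
end

theorem gro_B {ρ ϑ c : ℝ} {X W z : E} (hρ : 0 < ρ) (hz : z ≠ W) (hϑ : 0 < ϑ) (hϑ1 : ϑ ≤ 1) (hc : 0 < c) (hc1 : c ≤ 1) :
    2 * √(ρ ^ 2 + ‖z - X‖ ^ 2) / min (ϑ * rp ρ X W z) (c * ρ) * Bw ρ X W z ≤ 4 / (ϑ * c) := by
  obtain ⟨b0, b1, b2, b3⟩ := Bw_prop (X := X) hρ hz
  have hr := rp_pos (X := X) hρ hz
  obtain ⟨s, hs⟩ : ∃ s, s = √(ρ ^ 2 + ‖z - X‖ ^ 2) := ⟨_, rfl⟩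
  have hs0 : 0 < s := by rw [hs]; exact Real.sqrt_pos.2 pz
  have hss : s ^ 2 = ρ ^ 2 + ‖z - X‖ ^ 2 := by rw [hs]; exact Real.sq_sqrt pz
  rw [← hs]
  rw [← hss, le_div_iff₀ pz] at b2
  have e0 : 0 < min (ϑ * rp ρ X W z) (c * ρ) := lt_min pz pz
  have hρs : ρ ≤ s := by
    refine le_of_sq_le_sq ?_ hs0.le
    rw [hss]; nlinarith [sq_nonneg ‖z - X‖]
  have k1 : s * Bw ρ X W z ≤ ρ := by
    have : s * (s * Bw ρ X W z) ≤ s * ρ := by nlinarith only [b2, hρs, hρ]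
    exact le_of_mul_le_mul_left this hs0
  have k2 : s * Bw ρ X W z ≤ 2 * rp ρ X W z := by
    refine le_of_sq_le_sq ?_ pz
    nlinarith only [mul_le_mul_of_nonneg_right b2 b0.le, b3, hr]
  rw [div_mul_eq_mul_div, div_le_div_iff₀ e0 pz]
  rcases min_choice (ϑ * rp ρ X W z) (c * ρ) with e | e <;> rw [e]
  · have : ϑ * c * (s * Bw ρ X W z) ≤ ϑ * 1 * (2 * rp ρ X W z) := by gcongr
    nlinarith only [this]
  · have : ϑ * c * (s * Bw ρ X W z) ≤ 1 * c * (ρ) := by gcongr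
    nlinarith only [this, mul_pos hc hρ]

variable (n) in
set_option maxHeartbeats 1600000 in
theorem piece (hn : 3 ≤ n) (M Cσ d cd α : ℝ) (hα : 0 < α) (hα1 : α ≤ 1 / 2) : ∃ β κ0 C : ℝ, 0 < β ∧ 0 < κ0 ∧ κ0 ≤ 1 / 100 ∧ 0 < C ∧
    ∀ (Ω : SE) σ, IsMixedPair M Cσ d cd Ω σ → ∀ a, 0 < a → ∀ GR, IsRobinGreen Ω σ a GR → ∀ X ∈ Ω, ∀ Y ∈ Ω, X ≠ Y →
      Cl Ω X Y → ∀ κ, 0 < κ → κ ≤ κ0 → Hd Ω σ a (rr κ α Ω X Y) → ∀ (j : ℕ) (S : SE), MeasurableSet S → S ⊆ Ω →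
      (∀ z ∈ S, dl Ω z ≤ 3 * rr κ α Ω X Y z ∧ 2 ^ j * dl Ω X / 2 ≤ dist z X ∧ dist z X ≤ 2 ^ j * dl Ω X ∧ dist z X ≤ dist z Y) →
      ∫⁻ z in S, ofReal (GR z X * GR z Y * (max (dl Ω z) (rr κ α Ω X Y z) ^ 2)⁻¹) ≤
        ofReal (C * ((3 * κ * (1 / 2 ^ j) ^ α) ^ β) ^ 2 * GR X Y) := by
  by_cases hM : 1 < M
  swap
  · refine ⟨1, 1 / 100, 1, one_pos, by norm_num, le_rfl, one_pos, fun Ω σ hP => absurd hP.nta.M_gt_one hM⟩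
  obtain ⟨g, Cg, hCg, grow⟩ := grow n oz M
  obtain ⟨β, ϑ, Ca, hβ, -, hϑ, hϑ1, hCa, agmon⟩ := agmon n hn M Cσ d cd g
  obtain ⟨Cp, hCp, prod3⟩ := prod3 n hn M Cσ d cd
  obtain ⟨c, hc⟩ : ∃ c : ℝ, c = 1 / (250 * M) := ⟨_, rfl⟩
  have hM0 : 0 < M := by linarith
  have hc0 : 0 < c := by rw [hc]; positivity
  have hcM : c * M = 1 / 250 := by rw [hc]; field_simp
  have hc1 : c ≤ 1 / 250 := by nlinarith
  obtain ⟨K, hK⟩ : ∃ K : ℝ, K = Cg * (4 / (ϑ * c)) ^ g := ⟨_, rfl⟩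
  have hK0 : 0 < K := by rw [hK]; positivity
  refine ⟨β, min (1 / 100) (min (ϑ / 2) (c / 3)), Ca * K ^ 2 * (c⁻¹) ^ nm * Cp, hβ, by positivity, min_le_left _ _, by positivity, ?_⟩
  intro Ω σ hP a ha GR hG X hX Y hY hXY hcl κ hκ hκ0 hH j S hSm hSΩ hS
  have hκ1 : κ ≤ 1 / 100 := hκ0.trans (min_le_left _ _)
  have hκ2 : κ ≤ ϑ / 2 := hκ0.trans ((min_le_right _ _).trans (min_le_left _ _))
  have hκ3 : κ ≤ c / 3 := hκ0.trans ((min_le_right _ _).trans (min_le_right _ _))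
  have hf := fr_ne oz hP.bounded hP.nonempty
  have ho := hP.nta.isOpen
  have hX0 := dl_pos ho hf hX
  have hY0 := dl_pos ho hf hY
  have hD := diam_pos' oz hP
  have hα1' : α ≤ 1 := by linarith
  rcases S.eq_empty_or_nonempty with rfl | ⟨z0, hz0⟩
  · simp
  obtain ⟨ρ, hρ⟩ : ∃ ρ, ρ = 2 ^ j * dl Ω X := ⟨_, rfl⟩
  have hρ0 : 0 < ρ := by rw [hρ]; positivity
  have hρX : dl Ω X ≤ ρ := by rw [hρ]; exact le_mul_of_one_le_left hX0.le (one_le_pow₀ one_le_two)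
  rw [← hρ] at hS
  have hρD : ρ ≤ 2 * diam Ω := by
    have := (hS z0 hz0).2.1
    have := fr_dist hP (subset_closure (hSΩ hz0)) (subset_closure hX)
    linarith
  obtain ⟨A0, hA0, hA1, hA2⟩ := seqA hP.nta hf (subset_closure hX) (t := ρ / 200) pz lz
  obtain ⟨A, hA, hA3, hAX, hAY, hA4⟩ := cand oz hP hA0 X Y
  have hA00 : 0 ≤ dl Ω A := infDist_nonneg
  replace hAX : dl Ω A / 40 ≤ dist A X := by linarith
  replace hAY : dl Ω A / 40 ≤ dist A Y := by linarith
  have hclXA : Cl Ω X A := (Relation.ReflTransGen.single ⟨hX, hA0, by rw [dist_comm]; linarith⟩).trans hA4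
  have hA0' := dl_pos ho hf hA0
  have hAp := dl_pos ho hf hA
  have hcA : c * ρ ≤ dl Ω A := by
    have h1 := dl_lip Ω A0 A
    rw [dist_comm] at h1
    rw [div_le_iff₀ hM0] at hA2
    have h3 : dl Ω A0 * (14 / 15) ≤ dl Ω A := by linarith
    have h4 : ρ * (1 / 200) * (14 / 15) ≤ dl Ω A * M := by nlinarith only [h3, hA2, hM0]
    have h5 : c * ρ * M ≤ dl Ω A * M := by
      have : c * ρ * M = c * M * ρ := by ring
      rw [this, hcM]; linarith
    exact le_of_mul_le_mul_right h5 hM0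
  have hdAX : dist A X ≤ ρ := by
    have h1 := dl_lip Ω A0 X
    have := dist_triangle A A0 X
    linarith
  have hAX' : A ≠ X := fun e => by rw [e, dist_self] at hAX; linarith
  have hAY' : A ≠ Y := fun e => by rw [e, dist_self] at hAY; linarith
  have hrX : ∀ z, rr κ α Ω X Y z ≤ κ * max (dist z X) (dl Ω X) := fun z => rr_le hκ.le hα.le hα1' hX0 z
  have hrY : ∀ z, rr κ α Ω X Y z ≤ κ * max (dist z Y) (dl Ω Y) := fun z => by rw [rr_comm]; exact rr_le hκ.le hα.le hα1' hY0 z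
  have hsq : ∀ z, ρ ≤ √(ρ ^ 2 + ‖z - X‖ ^ 2) ∧ dist z X ≤ √(ρ ^ 2 + ‖z - X‖ ^ 2) := fun z => by
    refine ⟨Real.le_sqrt_of_sq_le (by nlinarith [sq_nonneg ‖z - X‖]), Real.le_sqrt_of_sq_le ?_⟩
    rw [dist_eq_norm]; nlinarith
  have main : ∀ W, (W = X ∨ W = Y) → ∫⁻ z in S, ofReal (GR z W ^ 2 * (max (dl Ω z) (rr κ α Ω X Y z) ^ 2)⁻¹) ≤
      ofReal (Ca * ((3 * κ * (1 / 2 ^ j) ^ α) ^ β) ^ 2 * ((K * GR A W) ^ 2 * ρ ^ nm)) := by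
    intro W hW
    have hWΩ : W ∈ Ω := by rcases hW with rfl | rfl <;> assumption
    have hW0 : 0 < dl Ω W := dl_pos ho hf hWΩ
    have hrW : ∀ z, rr κ α Ω X Y z ≤ κ * max (dist z W) (dl Ω W) := by rcases hW with rfl | rfl <;> assumption
    have hAW : A ≠ W := by rcases hW with rfl | rfl <;> assumption
    have hclW : Cl Ω A W := by
      rcases hW with rfl | rfl
      · exact hclXA.sy
      · exact hclXA.sy.trans hcl
    have hu := Pl.robin ho hP.bounded hG hWΩ
    have hw : Rw Ω σ a W (fun x => GR x W) := hG.weak W hWΩ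
    refine agmon Ω σ hP a ha _ hH (κ * min (dl Ω X) (dl Ω Y)) pz (fun z => rr_ge hκ.le hα.le hα1' hX0 hY0 z) W (fun x => GR x W) hu hw X ρ hρ0
      (fun z hz hd => ?_) (K * GR A W) (fun z hz hd hr => ?_) (3 * κ * (1 / 2 ^ j) ^ α) pz S hSm hSΩ (fun z hz => ?_)
    · unfold rp
      rw [mul_min_of_nonneg _ _ hϑ.le]
      refine le_min ((hrX z).trans ?_) ((hrW z).trans ?_)
      · have h1 : max (dist z X) (dl Ω X) ≤ √(ρ ^ 2 + ‖z - X‖ ^ 2) := max_le (hsq z).2 (hρX.trans (hsq z).1)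
        have h2 : 0 ≤ √(ρ ^ 2 + ‖z - X‖ ^ 2) := Real.sqrt_nonneg _
        nlinarith only [h1, h2, hκ, hκ2]
      · have h1 : max (dist z W) (dl Ω W) ≤ 2 * dist z W := max_le lz lz
        have h2 : 0 ≤ dist z W := dist_nonneg
        nlinarith only [h1, h2, hκ, hκ2]
    · have hzW : z ≠ W := fun e => by rw [e, dist_self] at hd; linarith
      by_cases hc : Cl Ω z A
      · obtain ⟨b0, -, -, -⟩ := Bw_prop (X := X) hρ0 hzW
        have hrp := rp_pos (X := X) hρ0 hzW
        obtain ⟨ε, hε⟩ : ∃ ε, ε = min (ϑ * rp ρ X W z) (c * ρ) := ⟨_, rfl⟩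
        have hε0 : 0 < ε := by rw [hε]; positivity
        have hs := hsq z
        have hεc : ε ≤ c * ρ := hε.le.trans (min_le_right _ _)
        have hg := grow Ω hP.bounded hf hP.nta W 1 _ hu.wk zero_le_one hu.nn' z hz A hA hc hzW (Or.inr (by
            have := dl_lip Ω z W
            rw [dist_comm W z]; linarith)) ε (2 * √(ρ ^ 2 + ‖z - X‖ ^ 2) / ε) hε0 (hε.le.trans ((min_le_left _ _).trans hr.le)) (hεc.trans hcA)
            (by rw [one_le_div hε0]; nlinarith only [hs.1, hεc, hc1, hρ0]) (by
              rw [div_mul_cancel₀ _ hε0.ne']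
              have := dist_triangle z X A
              rw [dist_comm X A] at this
              linarith [hs.1, hs.2]) A (mem_ball_self lz) hAW
        have hB := gro_B (X := X) hρ0 hzW hϑ lz hc0 lz
        rw [← hε] at hB
        have hGA : 0 ≤ GR A W := hu.nn' A hA hAW
        calc GR z W * Bw ρ X W z ^ g ≤ Cg * (2 * √(ρ ^ 2 + ‖z - X‖ ^ 2) / ε) ^ g * GR A W * Bw ρ X W z ^ g := by gcongr
          _ = Cg * (2 * √(ρ ^ 2 + ‖z - X‖ ^ 2) / ε * Bw ρ X W z) ^ g * GR A W := by rw [mul_pow]; ring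
          _ ≤ Cg * (4 / (ϑ * c)) ^ g * GR A W := by gcongr
          _ = _ := by rw [hK]
      · have : GR z W = 0 := vanish oz hP ha hu hw hz fun h => hc (h.trans hclW.sy)
        rw [this, zero_mul]
        exact mul_nonneg hK0.le (hu.nn' A hA hAW)
    · obtain ⟨s1, s2, s3, s4⟩ := hS z hz
      refine ⟨s3, ?_, ?_, ?_⟩
      · rcases hW with rfl | rfl <;> linarith
      · by_contra hcon
        push Not at hcon
        have h1 := hrW z
        rw [max_eq_right lz] at h1
        have h2 := dl_lip Ω W z
        rw [dist_comm] at h2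
        nlinarith only [s1, h1, h2, hcon, hκ1, hW0]
      · have h1 : gf α (dl Ω X) (max (dist z X) (dl Ω X)) ≤ gf α (dl Ω X) ρ + 0 :=
          gf_lip hα.le hα1' hX0 (le_max_right _ _) hρX le_rfl (by rw [add_zero]; exact max_le s3 hρX)
        have h2 : gf α (dl Ω X) ρ = (1 / 2 ^ j) ^ α * ρ := by
          have : dl Ω X / ρ = 1 / 2 ^ j := by rw [hρ]; field_simp
          rw [gf, this, mul_comm]
        have h3 : rr κ α Ω X Y z ≤ κ * ((1 / 2 ^ j) ^ α * ρ) := by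
          refine mul_le_mul_of_nonneg_left ((min_le_left _ _).trans ?_) hκ.le
          rw [← h2]; linarith
        have h4 : 0 < rr κ α Ω X Y z := hH.pos z
        refine max_le ?_ ?_ <;> nlinarith only [h3, h4, s1]
  have hmX := main X (Or.inl rfl)
  have hmY := main Y (Or.inr rfl)
  have huX := Pl.robin ho hP.bounded hG hX
  have huY := Pl.robin ho hP.bounded hG hY
  have huA := Pl.robin ho hP.bounded hG hA
  have hp := prod3 Ω σ hP a ha _ hH A Y (fun x => GR x A) (fun x => GR x Y) huA (hG.weak A hA) huY (hG.weak Y hY) (by rw [dist_comm]; exact hAY)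
    (fun z hz => by
      rw [mem_ball] at hz
      have h1 : max (dist z X) (dl Ω X) ≤ ρ + dl Ω A := max_le (by linarith [dist_triangle z A X]) lz
      have h2 := hrX z
      have h3 : κ * max (dist z X) (dl Ω X) ≤ c / 3 * (ρ + dl Ω A) := mul_le_mul hκ3 h1 (hX0.le.trans (le_max_right _ _)) pz
      nlinarith only [h2, h3, hcA, hc1, hAp]) X (subset_closure hX) (by rw [dist_comm]; linarith) hXY
  beta_reduce at hp
  rw [hG.symm X hX A hA hAX'.symm] at hp
  have hGX : 0 ≤ GR A X := huX.nn' A hA hAX'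
  have hGY : 0 ≤ GR A Y := huY.nn' A hA hAY'
  obtain ⟨m, hm⟩ : ∃ m : E → ℝ, m = fun z => max (dl Ω z) (rr κ α Ω X Y z) := ⟨_, rfl⟩
  have hmp : ∀ z, 0 < m z := fun z => by rw [hm]; exact (hH.pos z).trans_le (le_max_right _ _)
  have hmc : Continuous m := by rw [hm]; exact (continuous_infDist_pt _).max (lip_meas hH.lip)
  have hmz : ∀ z, max (dl Ω z) (rr κ α Ω X Y z) = m z := fun z => by rw [hm]
  simp only [hmz] at hmX hmY ⊢
  have hneX : ∀ z ∈ S, z ≠ X := fun z hz e => by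
    have := (hS z hz).2.1
    rw [e, dist_self] at this; linarith
  have hneY : ∀ z ∈ S, z ≠ Y := fun z hz e => by
    have h1 := (hS z hz).2.2.2
    have := (hS z hz).2.1
    rw [e, dist_self] at h1
    rw [e] at this; linarith
  have meas : ∀ W u, Pl Ω W u → AEMeasurable (fun z => ofReal (u z * (m z)⁻¹)) (volume.restrict S) := fun W u hu =>
    ((((hu.ms oz).mono_measure (Measure.restrict_mono hSΩ le_rfl)).aemeasurable).mul
      (hmc.inv₀ fun z => (hmp z).ne').aemeasurable).ennreal_ofReal
  have hc := cs2 (volume.restrict S) (meas X _ huX) (meas Y _ huY)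
  obtain ⟨μ, hμ⟩ : ∃ μ : ℝ, μ = ((3 * κ * (1 / 2 ^ j) ^ α) ^ β) ^ 2 := ⟨_, rfl⟩
  have hμ0 : 0 ≤ μ := by rw [hμ]; positivity
  rw [← hμ] at hmX hmY ⊢
  have sq : ∀ W, (∀ z ∈ S, 0 ≤ GR z W) → ∫⁻ z in S, ofReal (GR z W * (m z)⁻¹) ^ 2 = ∫⁻ z in S, ofReal (GR z W ^ 2 * (m z ^ 2)⁻¹) :=
    fun W h => setLIntegral_congr_fun hSm fun z hz => by
      beta_reduce
      rw [← ofReal_pow (mul_nonneg (h z hz) (inv_pos.2 (hmp z)).le), mul_pow, inv_pow]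
  have pr : ∫⁻ z in S, ofReal (GR z X * (m z)⁻¹) * ofReal (GR z Y * (m z)⁻¹) =
      ∫⁻ z in S, ofReal (GR z X * GR z Y * (m z ^ 2)⁻¹) := setLIntegral_congr_fun hSm fun z hz => by
    beta_reduce
    rw [← ofReal_mul (mul_nonneg (huX.nn' z (hSΩ hz) (hneX z hz)) (inv_pos.2 (hmp z)).le)]
    congr 1; rw [pow_two, mul_inv]; ring
  rw [pr, sq X fun z hz => huX.nn' z (hSΩ hz) (hneX z hz), sq Y fun z hz => huY.nn' z (hSΩ hz) (hneY z hz)] at hc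
  have h1 := hc.trans (mul_le_mul' hmX hmY)
  rw [← ofReal_mul pz] at h1
  have e1 : Ca * μ * ((K * GR A X) ^ 2 * ρ ^ nm) * (Ca * μ * ((K * GR A Y) ^ 2 * ρ ^ nm)) =
      (Ca * μ * K ^ 2 * (GR A X * (GR A Y * ρ ^ nm))) ^ 2 := by ring
  rw [e1, ofReal_pow pz] at h1
  refine ((ENNReal.pow_le_pow_left_iff two_ne_zero).1 h1).trans (ofReal_le_ofReal ?_)
  have h2 : ρ ^ nm ≤ (c⁻¹) ^ nm * dl Ω A ^ nm := by
    rw [← mul_pow]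
    refine pow_le_pow_left₀ hρ0.le ?_ _
    rw [inv_mul_eq_div, le_div_iff₀ hc0]; linarith
  calc Ca * μ * K ^ 2 * (GR A X * (GR A Y * ρ ^ nm)) ≤ Ca * μ * K ^ 2 * (GR A X * (GR A Y * ((c⁻¹) ^ nm * dl Ω A ^ nm))) := by gcongr
    _ = Ca * μ * K ^ 2 * (c⁻¹) ^ nm * (GR A X * (GR A Y * dl Ω A ^ nm)) := by ring
    _ ≤ Ca * μ * K ^ 2 * (c⁻¹) ^ nm * (Cp * GR X Y) := by gcongr
    _ = _ := by ring

section

theorem cmul {ζ f : E → ℝ} (h1 : CD ζ) (h2 : tsupport ζ ⊆ Ω) (hf : ∀ x ∈ Ω, ContDiffAt ℝ 1 f x) : ContDiff ℝ 1 (fun z => ζ z * f z) :=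
  contDiff_iff_contDiffAt.2 fun x => by
    by_cases hx : x ∈ tsupport ζ
    · exact (h1.contDiffAt.of_le (by exact_mod_cast le_top)).mul (hf x (h2 hx))
    · have : (fun z => ζ z * f z) =ᶠ[𝓝 x] fun _ => 0 := by
        filter_upwards [notMem_tsupport_iff_eventuallyEq.1 hx] with z hz
        rw [hz]; simp
      exact contDiffAt_const.congr_of_eventuallyEq this

theorem zeta (ho : IsOpen Ω) (hb : Bornology.IsBounded Ω) (hf : (frontier Ω).Nonempty) {L : ℝ}
    (hL : ∀ x, |deriv smoothTransition x| ≤ L) {r : E → ℝ} (hl : ∀ x y, r x ≤ r y + dist x y) {r0 : ℝ} (h0 : 0 < r0) (hr : ∀ z, r0 ≤ r z) :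
    ∃ ζ : E → ℝ, CD ζ ∧ HasCompactSupport ζ ∧ tsupport ζ ⊆ Ω ∧ (∀ x, 0 ≤ ζ x ∧ ζ x ≤ 1) ∧
      (∀ x ∈ Ω, 3 * r x < dl Ω x → ζ =ᶠ[𝓝 x] fun _ => 1) ∧ ∀ x ∈ Ω, gradient ζ x ≠ 0 → r x ≤ 2 * dl Ω x ∧ dl Ω x ≤ 3 * r x ∧ ‖gradient ζ x‖ * r x ≤ 7 * L := by
  have hL0 : 0 ≤ L := (abs_nonneg _).trans (hL 0)
  have hs : frontier Ω ⊆ Ωᶜ := fun z hz h => by rw [ho.frontier_eq] at hz; exact hz.2 h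
  have hne := hf.mono hs
  obtain ⟨g, g0, g1, g2⟩ := lip_smooth (n := n) (f := fun x => infDist x Ωᶜ) (K := 1) zero_le_one
    (fun x y => by rw [one_mul]; exact infDist_le_infDist_add_dist) (τ := r0 / 8) pz
  obtain ⟨q, q0, q1, q2⟩ := lip_smooth (n := n) (f := r) (K := 1) zero_le_one (fun x y => by rw [one_mul]; exact hl x y) (τ := r0 / 8) pz
  have hc : Continuous fun x : E => infDist x Ωᶜ := continuous_infDist_pt _
  have hrc : Continuous r := lip_meas hl
  have qb : ∀ z, 7 / 8 * r z ≤ q z ∧ q z ≤ 9 / 8 * r z := fun z => by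
    have := abs_le.1 (q1 z)
    have := hr z
    exact ⟨by linarith, by linarith⟩
  have gb : ∀ z, infDist z Ωᶜ - r z / 8 ≤ g z ∧ g z ≤ infDist z Ωᶜ + r z / 8 := fun z => by
    have := abs_le.1 (g1 z)
    have := hr z
    exact ⟨by linarith, by linarith⟩
  have rp' : ∀ z, 0 < r z := fun z => h0.trans_le (hr z)
  have qp : ∀ z, 0 < q z := fun z => by linarith [(qb z).1, rp' z]
  have hg' : CD fun z => g z / q z - 1 := (g0.div q0 fun z => (qp z).ne').sub contDiff_const
  obtain ⟨ζ, hζ⟩ : ∃ ζ : E → ℝ, ζ = fun z => smoothTransition (g z / q z - 1) := ⟨_, rfl⟩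
  have z0 : ∀ z, infDist z Ωᶜ ≤ r z / 2 → ζ z = 0 := fun z hz => by
    rw [hζ]
    refine smoothTransition.zero_of_nonpos ?_
    rw [sub_nonpos, div_le_one (qp z)]
    linarith [(qb z).1, (gb z).2, rp' z]
  have z1 : ∀ z, 3 * r z ≤ infDist z Ωᶜ → ζ z = 1 := fun z hz => by
    rw [hζ]
    refine smoothTransition.one_of_one_le ?_
    rw [le_sub_iff_add_le, le_div_iff₀ (qp z)]
    linarith [(qb z).2, (gb z).1, rp' z]
  have ts : tsupport ζ ⊆ {z | r0 / 2 ≤ infDist z Ωᶜ} := by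
    refine closure_minimal (fun z hz => ?_) (isClosed_le continuous_const hc)
    by_contra h
    rw [mem_setOf_eq, not_le] at h
    exact hz (z0 z (by linarith [hr z]))
  have tΩ : {z | r0 / 2 ≤ infDist z Ωᶜ} ⊆ Ω := fun z hz => by
    by_contra h
    rw [mem_setOf_eq, infDist_zero_of_mem (show z ∈ Ωᶜ from h)] at hz
    linarith
  refine ⟨ζ, by rw [hζ]; exact smoothTransition.contDiff.comp hg', ?_, ts.trans tΩ, fun x => by
    rw [hζ]; exact ⟨smoothTransition.nonneg _, smoothTransition.le_one _⟩, fun x hx h => ?_, fun x hx hgr => ?_⟩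
  · exact (hb.subset (ts.trans tΩ)).isCompact_closure.of_isClosed_subset (isClosed_tsupport _) subset_closure
  · rw [← dl_compl ho hf hx] at h
    filter_upwards [(hc.sub (continuous_const.mul hrc)).tendsto x |>.eventually (lt_mem_nhds (sub_pos.2 h))] with z hz
    exact z1 z (sub_pos.1 hz).le
  · have a1 : r x ≤ 2 * dl Ω x := by
      rw [← dl_compl ho hf hx]
      by_contra h
      push Not at h
      have : ζ =ᶠ[𝓝 x] fun _ => 0 := by
        filter_upwards [(hrc.sub (continuous_const.mul hc)).tendsto x |>.eventually (lt_mem_nhds (sub_pos.2 h))] with z hz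
        have hz' : 2 * infDist z Ωᶜ < r z := sub_pos.1 hz
        exact z0 z (by linarith only [hz'])
      exact hgr (by rw [this.gradient_eq]; simp)
    have a2 : dl Ω x ≤ 3 * r x := by
      rw [← dl_compl ho hf hx]
      by_contra h
      push Not at h
      have : ζ =ᶠ[𝓝 x] fun _ => 1 := by
        filter_upwards [(hc.sub (continuous_const.mul hrc)).tendsto x |>.eventually (lt_mem_nhds (sub_pos.2 h))] with z hz
        exact z1 z (sub_pos.1 hz).le
      exact hgr (by rw [this.gradient_eq]; simp)
    refine ⟨a1, a2, ?_⟩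
    have hgd := (g0.differentiable sz x)
    have hqd := (q0.differentiable sz x)
    have hd := st_fderiv (hg'.differentiable sz x) hL
    rw [fderiv_sub_const] at hd
    rw [grad_norm, hζ]
    have hr := rp' x
    have hdiv : ‖fderiv ℝ (fun z => g z / q z) x‖ * r x ≤ 7 := by
      have e := (hgd.hasFDerivAt.mul ((hasDerivAt_inv (qp x).ne').comp_hasFDerivAt x hqd.hasFDerivAt)).fderiv
      have e2 : (fun z => g z / q z) = fun z => g z * (q z)⁻¹ := by ext z; rw [div_eq_mul_inv]
      rw [e2]
      have : ‖fderiv ℝ (fun z => g z * (q z)⁻¹) x‖ ≤ |g x| * (((q x) ^ 2)⁻¹ * 1) + (q x)⁻¹ * 1 := by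
        rw [show (fun z => g z * (q z)⁻¹) = g * fun z => (q z)⁻¹ from rfl]
        refine (le_of_eq (congrArg norm e)).trans ?_
        refine (norm_add_le _ _).trans ?_
        rw [norm_smul, norm_smul, norm_smul, norm_eq_abs, norm_eq_abs, norm_eq_abs, abs_neg]
        have t1 : |((q x) ^ 2)⁻¹| = ((q x) ^ 2)⁻¹ := abs_of_pos (by have := qp x; positivity)
        have t2 : |(q x)⁻¹| = (q x)⁻¹ := abs_of_pos (by have := qp x; positivity)
        rw [t1, Function.comp_apply, t2]
        have := g2 x
        have := q2 x
        have := qp x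
        gcongr
      refine (mul_le_mul_of_nonneg_right this hr.le).trans ?_
      have i1 : (q x)⁻¹ * r x ≤ 8 / 7 := by
        rw [inv_mul_le_iff₀ (qp x)]; linarith [(qb x).1]
      have i0 : 0 ≤ (q x)⁻¹ * r x := by have := qp x; positivity
      have i2 : |g x| ≤ 25 / 8 * r x := by
        rw [← dl_compl ho hf hx] at a1 a2
        rw [abs_le]; constructor <;> linarith [(gb x).1, (gb x).2]
      calc (|g x| * (((q x) ^ 2)⁻¹ * 1) + (q x)⁻¹ * 1) * r x ≤ (25 / 8 * r x * (((q x) ^ 2)⁻¹ * 1) + (q x)⁻¹ * 1) * r x := by gcongr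
        _ = 25 / 8 * ((q x)⁻¹ * r x) ^ 2 + (q x)⁻¹ * r x := by rw [mul_pow, inv_pow]; ring
        _ ≤ 25 / 8 * (8 / 7) ^ 2 + 8 / 7 := by gcongr
        _ ≤ 7 := by norm_num
    calc _ ≤ L * ‖fderiv ℝ (fun z => g z / q z) x‖ * r x := mul_le_mul_of_nonneg_right hd hr.le
      _ = L * (‖fderiv ℝ (fun z => g z / q z) x‖ * r x) := by ring
      _ ≤ L * 7 := by gcongr
      _ = _ := by ring

set_option maxHeartbeats 800000 in
theorem repr1 (hn : 3 ≤ n) {X : E} {w H ζ : E → ℝ} (hw : Pl Ω X w) (hH : ∀ x ∈ Ω, ContDiffAt ℝ (⊤ : ℕ∞) H x) (hHw : Wk Ω Y 0 H)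
    (z1 : CD ζ) (zc : HasCompactSupport ζ) (zs : tsupport ζ ⊆ Ω) (zX : ζ =ᶠ[𝓝 X] fun _ => 1) :
    IntegrableOn (fun z => H z * ⟪gradient w z, gradient ζ z⟫ - w z * ⟪gradient H z, gradient ζ z⟫) Ω ∧
    H X = ∫ z in Ω, (H z * ⟪gradient w z, gradient ζ z⟫ - w z * ⟪gradient H z, gradient ζ z⟫) := by
  have ho := hw.wk.op
  have hH1 : ∀ x ∈ Ω, ContDiffAt ℝ 1 H x := fun x hx => (hH x hx).of_le (by exact_mod_cast le_top)
  obtain ⟨ρ, hρ, hρζ⟩ := Metric.eventually_nhds_iff_ball.1 zX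
  have zg0 : ∀ z ∈ ball X ρ, gradient ζ z = 0 := fun z hz => by
    have : ζ =ᶠ[𝓝 z] fun _ => 1 := by filter_upwards [isOpen_ball.mem_nhds hz] with y hy using hρζ y hy
    rw [this.gradient_eq]; simp
  obtain ⟨U, hU0, hU⟩ := hw.ubd hρ
  obtain ⟨Bz, hBz⟩ := zc.exists_bound_of_continuous z1.continuous
  obtain ⟨Bg', hBg⟩ := (zc.fderiv (𝕜 := ℝ)).exists_bound_of_continuous (z1.continuous_fderiv sz)
  have hHc : ContinuousOn (fun x => fderiv ℝ H x) Ω := fun x hx =>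
    ((hH1 x hx).continuousAt_fderiv one_ne_zero).continuousWithinAt
  obtain ⟨BH', hBH⟩ := IsCompact.exists_bound_of_continuousOn zc (hHc.mono zs)
  obtain ⟨Bh', hBh⟩ := IsCompact.exists_bound_of_continuousOn zc (fun x hx => ((hH1 x (zs hx)).continuousAt.continuousWithinAt : ContinuousWithinAt H _ x))
  obtain ⟨B, hB0, hB1, hB2, hB3, hB4⟩ : ∃ B : ℝ, 0 ≤ B ∧ Bz ≤ B ∧ Bg' ≤ B ∧ BH' ≤ B ∧ Bh' ≤ B :=
    ⟨|Bz| + |Bg'| + |BH'| + |Bh'|, by positivity, by linarith [le_abs_self Bz, abs_nonneg Bg', abs_nonneg BH', abs_nonneg Bh'],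
      by linarith [le_abs_self Bg', abs_nonneg Bz, abs_nonneg BH', abs_nonneg Bh'], by linarith [le_abs_self BH', abs_nonneg Bz, abs_nonneg Bg', abs_nonneg Bh'],
      by linarith [le_abs_self Bh', abs_nonneg Bz, abs_nonneg Bg', abs_nonneg BH']⟩
  have hζB : ∀ z, |ζ z| ≤ B := fun z => (hBz z).trans hB1
  have hgB : ∀ z, ‖gradient ζ z‖ ≤ B := fun z => by rw [grad_norm]; exact (hBg z).trans hB2
  have hHB : ∀ z ∈ tsupport ζ, ‖gradient H z‖ ≤ B := fun z hz => by rw [grad_norm]; exact (hBH z hz).trans hB3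
  have hhB : ∀ z ∈ tsupport ζ, |H z| ≤ B := fun z hz => (hBh z hz).trans hB4
  have zz : ∀ z ∉ tsupport ζ, ζ z = 0 := fun z hz => image_eq_zero_of_notMem_tsupport hz
  have hfinv : volume Ω ≠ ⊤ := hw.bd.measure_lt_top.ne
  have hdom : IntegrableOn (fun z => B * B * ‖gradient w z‖ + U * (B * B)) Ω :=
    (hw.wk.l1.const_mul _).add (integrableOn_const hfinv)
  have wms : AEStronglyMeasurable w (volume.restrict Ω) := hw.ms oz
  have Hms : AEStronglyMeasurable H (volume.restrict Ω) :=
    ContinuousOn.aestronglyMeasurable (fun x hx => (hH1 x hx).continuousAt.continuousWithinAt) ho.measurableSet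
  have zms : AEStronglyMeasurable ζ (volume.restrict Ω) := z1.continuous.aestronglyMeasurable
  have gm : ∀ f g : E → ℝ, AEStronglyMeasurable (fun z => ⟪gradient f z, gradient g z⟫) (volume.restrict Ω) := fun f g =>
    ((grad_meas f).inner (grad_meas g)).aestronglyMeasurable
  have b1 : ∀ (s : ℝ) (F : E) z, |s| ≤ 1 → F = s • gradient w z → |ζ z * ⟪gradient H z, F⟫| ≤ B * B * ‖gradient w z‖ := fun s F z hs e => by
    by_cases hz : z ∈ tsupport ζ
    · rw [abs_mul, e, inner_smul_right, abs_mul]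
      have h1 := abs_real_inner_le_norm (gradient H z) (gradient w z)
      have h2 := hHB z hz
      have h3 := hζB z
      calc |ζ z| * (|s| * |⟪gradient H z, gradient w z⟫|) ≤ B * (1 * (B * ‖gradient w z‖)) := by
            gcongr; exact h1.trans (by gcongr)
        _ = _ := by ring
    · rw [zz z hz, zero_mul, abs_zero]; positivity
  have b2 : ∀ (t : ℝ), ∀ z ∈ Ω, z ≠ X → |t| ≤ |w z| → |t * ⟪gradient H z, gradient ζ z⟫| ≤ U * (B * B) := fun t z hzΩ hzX ht => by
    by_cases hz : z ∈ tsupport ζ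
    · by_cases hb : z ∈ ball X ρ
      · rw [zg0 z hb, inner_zero_right, mul_zero, abs_zero]; positivity
      · rw [abs_mul]
        have h1 := abs_real_inner_le_norm (gradient H z) (gradient ζ z)
        have h2 := hHB z hz
        have h3 := hgB z
        have h4 := ht.trans (hU z ⟨subset_closure hzΩ, hb⟩)
        gcongr
        exact h1.trans (by gcongr)
    · rw [grad_tsupp hz, inner_zero_right, mul_zero, abs_zero]; positivity
  have b3 : ∀ z, |H z * ⟪gradient w z, gradient ζ z⟫| ≤ B * B * ‖gradient w z‖ := fun z => by
    by_cases hz : z ∈ tsupport ζ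
    · rw [abs_mul]
      have h1 := abs_real_inner_le_norm (gradient w z) (gradient ζ z)
      have h2 := hhB z hz
      have h3 := hgB z
      calc _ ≤ B * (‖gradient w z‖ * B) := by gcongr; exact h1.trans (by gcongr)
        _ = _ := by ring
    · rw [grad_tsupp hz, inner_zero_right, mul_zero, abs_zero]; positivity
  have aeX : ∀ᵐ z ∂volume.restrict Ω, z ∈ Ω ∧ z ≠ X := (ae_restrict_mem ho.measurableSet).and (ae_restrict_of_ae (ae_neY oz X))
  have UB : 0 ≤ U * (B * B) := by positivity
  have i3 : IntegrableOn (fun z => H z * ⟪gradient w z, gradient ζ z⟫) Ω := hdom.mono' (Hms.mul (gm w ζ)) (Filter.Eventually.of_forall fun z => by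
    rw [norm_eq_abs]; linarith [b3 z])
  have i2 : IntegrableOn (fun z => w z * ⟪gradient H z, gradient ζ z⟫) Ω := hdom.mono' (wms.mul (gm H ζ)) (aeX.mono fun z hz => by
    rw [norm_eq_abs]; linarith [b2 (w z) z hz.1 hz.2 le_rfl, mul_nonneg (mul_nonneg hB0 hB0) (norm_nonneg (gradient w z))])
  have i1 : IntegrableOn (fun z => ζ z * ⟪gradient H z, gradient w z⟫) Ω := hdom.mono' (zms.mul (gm H w)) (Filter.Eventually.of_forall fun z => by
    rw [norm_eq_abs]; linarith [b1 1 (gradient w z) z sz sz])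
  refine ⟨i3.sub i2, ?_⟩
  have t1 : ∫ z in Ω, (ζ z * ⟪gradient H z, gradient w z⟫ + H z * ⟪gradient w z, gradient ζ z⟫) = H X := by
    have := hw.wk.c1t (cmul z1 zs hH1) (zc.mul_right) ((tsupport_mul_subset_left).trans zs)
    rw [one_mul, zX.self_of_nhds, one_mul] at this
    rw [← this]
    refine setIntegral_congr_fun ho.measurableSet fun z hz => ?_
    beta_reduce
    rw [grad_mul (z1.differentiable sz z) ((hH1 z hz).differentiableAt sz), inner_add_right, inner_smul_right, inner_smul_right,
      real_inner_comm (gradient w z) (gradient H z)]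
  have t2 : ∫ z in Ω, (ζ z * ⟪gradient H z, gradient w z⟫ + w z * ⟪gradient H z, gradient ζ z⟫) = 0 := by
    have tr : ∀ k : ℕ, ∃ φ : E → ℝ, (∀ z, z ≠ X → φ z = fm (k + 1) (w z)) ∧ (∀ x ∈ Ω, ContDiffAt ℝ 1 φ x) ∧
        (∀ z ∈ Ω, z ≠ X → gradient φ z = (max (2 * ((k : ℝ) + 1) - w z) 0 / (2 * (k + 1))) • gradient w z) := fun k => by
      obtain ⟨φ, -, -, -, -, h1, h2, -, h3, -⟩ := trunc hn hw (m := (k : ℝ) + 1) pz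
      exact ⟨φ, h1, h2, h3⟩
    choose φ p1 p2 p3 using tr
    have zero : ∀ k, ∫ z in Ω, (ζ z * ⟪gradient H z, gradient (φ k) z⟫ + φ k z * ⟪gradient H z, gradient ζ z⟫) = 0 := fun k => by
      have := hHw.c1t (cmul z1 zs (p2 k)) (zc.mul_right) ((tsupport_mul_subset_left).trans zs)
      rw [zero_mul] at this
      rw [← this]
      refine setIntegral_congr_fun ho.measurableSet fun z hz => ?_
      beta_reduce
      rw [grad_mul (z1.differentiable sz z) ((p2 k z hz).differentiableAt sz), inner_add_right, inner_smul_right, inner_smul_right]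
    have lim := tendsto_integral_of_dominated_convergence (μ := volume.restrict Ω)
      (F := fun k z => ζ z * ⟪gradient H z, gradient (φ k) z⟫ + φ k z * ⟪gradient H z, gradient ζ z⟫)
      (f := fun z => ζ z * ⟪gradient H z, gradient w z⟫ + w z * ⟪gradient H z, gradient ζ z⟫) _
      (fun k => (zms.mul (gm H (φ k))).add ((ContinuousOn.aestronglyMeasurable (fun x hx => (p2 k x hx).continuousAt.continuousWithinAt) ho.measurableSet).mul (gm H ζ)))
      hdom (fun k => aeX.mono fun z hz => by
        have hk : (0 : ℝ) < k + 1 := by positivity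
        have hwz := hw.nn' z hz.1 hz.2
        have h1 := fm_d hk hwz
        have h2 := fm_le hk hwz
        have a1 := b1 _ _ z (by rw [abs_of_nonneg h1.1]; exact h1.2) (p3 k z hz.1 hz.2)
        have a2 := b2 (φ k z) z hz.1 hz.2 (by rw [p1 k z hz.2, abs_of_nonneg h2.1, abs_of_nonneg hwz]; exact h2.2.1)
        rw [norm_eq_abs]
        exact (abs_add_le _ _).trans (add_le_add a1 a2)) (aeX.mono fun z hz => by
        have hwz := hw.nn' z hz.1 hz.2
        have hev : ∀ᶠ k : ℕ in Filter.atTop, w z ≤ 2 * ((k : ℝ) + 1) := by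
          filter_upwards [Filter.eventually_ge_atTop ⌈w z⌉₊] with k hk
          have := Nat.ceil_le.1 hk
          linarith [(Nat.cast_nonneg k : (0 : ℝ) ≤ k)]
        have hlim := tendsto_one_div_add_atTop_nhds_zero_nat (𝕜 := ℝ)
        have l1 : Filter.Tendsto (fun k : ℕ => 1 - w z / 2 * (1 / ((k : ℝ) + 1))) Filter.atTop (𝓝 1) := by
          simpa using (hlim.const_mul (w z / 2)).const_sub 1
        have l2 : Filter.Tendsto (fun k : ℕ => w z - w z ^ 2 / 4 * (1 / ((k : ℝ) + 1))) Filter.atTop (𝓝 (w z)) := by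
          simpa using (hlim.const_mul (w z ^ 2 / 4)).const_sub (w z)
        have l3 := ((l1.mul_const (ζ z * ⟪gradient H z, gradient w z⟫)).add (l2.mul_const ⟪gradient H z, gradient ζ z⟫))
        rw [one_mul] at l3
        refine l3.congr' ?_
        filter_upwards [hev] with k hk
        have hk0 : (0 : ℝ) < k + 1 := by positivity
        rw [p3 k z hz.1 hz.2, p1 k z hz.2, fm, max_eq_left lz, inner_smul_right]
        field_simp
        ring)
    simp only [zero] at lim
    exact tendsto_nhds_unique lim tendsto_const_nhds
  rw [integral_add i1 i3] at t1
  rw [integral_add i1 i2] at t2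
  rw [integral_sub i3 i2]
  linarith
end

section

theorem pick_k {β κ0 η : ℝ} (hβ : 0 < β) (hκ0 : 0 < κ0) (hη : 0 < η) : ∃ κ, 0 < κ ∧ κ ≤ κ0 ∧ ((3 * κ) ^ β) ^ 2 ≤ η := by
  refine ⟨min κ0 ((√η) ^ β⁻¹ / 3), by positivity, min_le_left _ _, ?_⟩
  have h1 : 3 * min κ0 ((√η) ^ β⁻¹ / 3) ≤ (√η) ^ β⁻¹ := by
    have := min_le_right κ0 ((√η) ^ β⁻¹ / 3)
    linarith
  have h2 := Real.rpow_le_rpow pz h1 hβ.le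
  rw [Real.rpow_inv_rpow (Real.sqrt_nonneg _) hβ.ne'] at h2
  calc _ ≤ (√η) ^ 2 := by gcongr
    _ = η := Real.sq_sqrt hη.le

theorem geo {C κ α β q G : ℝ} (hC : 0 ≤ C) (hκ : 0 < κ) (hG : 0 ≤ G) (hq : q = (((1 / 2 : ℝ) ^ α) ^ β) ^ 2) (hq1 : q < 1) :
    ∑' j : ℕ, ofReal (C * ((3 * κ * (1 / 2 ^ j) ^ α) ^ β) ^ 2 * G) = ofReal (C * ((3 * κ) ^ β) ^ 2 * G * (1 - q)⁻¹) := by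
  have e : ∀ j : ℕ, C * ((3 * κ * (1 / 2 ^ j) ^ α) ^ β) ^ 2 * G = C * ((3 * κ) ^ β) ^ 2 * G * q ^ j := fun j => by
    have : ((1 : ℝ) / 2 ^ j) ^ α = ((1 / 2 : ℝ) ^ α) ^ j := by
      rw [show (1 : ℝ) / 2 ^ j = (1 / 2) ^ j by rw [div_pow, one_pow], ← rpow_natCast, ← rpow_natCast, ← Real.rpow_mul nz,
        ← Real.rpow_mul nz, mul_comm]
    have h2 : (((1 / 2 : ℝ) ^ α) ^ j) ^ β = (((1 / 2 : ℝ) ^ α) ^ β) ^ j := by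
      have ht : (0 : ℝ) ≤ (1 / 2 : ℝ) ^ α := by positivity
      generalize (1 / 2 : ℝ) ^ α = t at ht
      rw [← rpow_natCast, ← rpow_natCast, ← Real.rpow_mul ht, ← Real.rpow_mul ht, mul_comm]
    rw [this, Real.mul_rpow pz pz, h2, hq]; ring
  have hq0 : 0 ≤ q := by rw [hq]; positivity
  simp_rw [e]
  rw [← ofReal_tsum_of_nonneg (fun j => by positivity) ((summable_geometric_of_lt_one hq0 hq1).mul_left _), tsum_mul_left,
    tsum_geometric_of_lt_one hq0 hq1]

variable (n) in
set_option maxHeartbeats 1000000 in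
theorem core (hn : 3 ≤ n) (M Cσ d cd : ℝ) : ∃ L : ℝ, 1 ≤ L ∧ ∀ (Ω : SE) σ, IsMixedPair M Cσ d cd Ω σ → ∀ a, 0 < a →
    ∀ GR GD, IsRobinGreen Ω σ a GR → IsDirichletGreen Ω GD → ∀ X ∈ Ω, ∀ Y ∈ Ω, X ≠ Y → Dp Ω σ a L X → Dp Ω σ a L Y → GR X Y ≤ 2 * GD X Y := by
  obtain ⟨α, hα, hα1, deep⟩ := deep n hn M Cσ d cd
  obtain ⟨β, κ0, C, hβ, hκ0, hκ01, hC, piece⟩ := piece n hn M Cσ d cd α hα hα1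
  obtain ⟨Cg, hCg, gbd⟩ := grad_bd n oz
  obtain ⟨Ls, hLs, st⟩ := st_bd
  obtain ⟨q, hq⟩ : ∃ q, q = (((1 / 2 : ℝ) ^ α) ^ β) ^ 2 := ⟨_, rfl⟩
  have hq1 : q < 1 := by
    rw [hq]
    have h1 : (1 / 2 : ℝ) ^ α < 1 := Real.rpow_lt_one nz nz hα
    have h2 : ((1 / 2 : ℝ) ^ α) ^ β < 1 := Real.rpow_lt_one pz h1 hβ
    exact pow_lt_one₀ pz h2 two_ne_zero
  obtain ⟨K, hK⟩ : ∃ K, K = 168 * Cg * Ls := ⟨_, rfl⟩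
  have hK0 : 0 < K := by rw [hK]; positivity
  have hq2 : 0 < 1 - q := by linarith
  obtain ⟨κ, hκ, hκκ, hκη⟩ := pick_k (η := (1 - q) / (4 * K * C)) hβ hκ0 pz
  have hκ1 : κ ≤ 1 / 100 := hκκ.trans hκ01
  obtain ⟨L, hL, deep⟩ := deep κ hκ lz
  refine ⟨L, hL, fun Ω σ hP a ha GR GD hR hD X hX Y hY hXY dX dY => ?_⟩
  have ho := hP.nta.isOpen
  have hb := hP.bounded
  have hf := fr_ne oz hb hP.nonempty
  have hu := Pl.robin ho hb hR hY
  have hv := Pl.diri ho hb hD hY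
  have hw := Pl.robin ho hb hR hX
  have hG0 : 0 ≤ GR X Y := hu.nn' X hX hXY
  have hv0 := hv.nn' X hX hXY
  by_cases hc : Cl Ω X Y
  swap
  · have : GR X Y = 0 := vanish oz hP ha hu (hR.weak Y hY) hX hc
    rw [this]; exact mul_nonneg two_pos.le hv0
  have hX0 := dl_pos ho hf hX
  have hY0 := dl_pos ho hf hY
  have hα2 : α ≤ 1 := by linarith
  have hd : Hd Ω σ a (rr κ α Ω X Y) := rr_hd oz hP hκ hκ1 hα.le hα2 hX hY (fun W hW P hPf => by
    rcases hW with rfl | rfl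
    · exact deep Ω σ hP a ha W hX dX P hPf
    · exact deep Ω σ hP a ha W hY dY P hPf)
  have pX := piece Ω σ hP a ha GR hR X hX Y hY hXY hc κ hκ hκκ hd
  have pY := piece Ω σ hP a ha GR hR Y hY X hX hXY.symm (Cl.sy hc) κ hκ hκκ (by rw [rr_comm]; exact hd)
  rw [rr_comm κ α Ω Y X, ← hR.symm X hX Y hY hXY] at pY
  have rle1 := rr_le hκ.le hα.le hα2 (Y := Y) hX0
  have rle2 := rr_le hκ.le hα.le hα2 (Y := X) hY0
  rw [rr_comm κ α Ω Y X] at rle2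
  have rge := rr_ge hκ.le hα.le hα2 hX0 hY0
  obtain ⟨r, hr⟩ : ∃ r, r = rr κ α Ω X Y := ⟨_, rfl⟩
  rw [← hr] at hd pX pY rle1 rle2 rge
  have hrc : Continuous r := lip_meas hd.lip
  have r0 : 0 < κ * min (dl Ω X) (dl Ω Y) := mul_pos hκ (lt_min hX0 hY0)
  have rp : ∀ z, 0 < r z := fun z => r0.trans_le (rge z)
  obtain ⟨ζ, z1, zc, zs, -, zt, zg⟩ := zeta ho hb hf st hd.lip r0 rge
  obtain ⟨H, -, H1, H2, H3⟩ := hfun oz hu hv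
  have zX : ζ =ᶠ[𝓝 X] fun _ => 1 := zt X hX (by
    have := rle1 X
    rw [dist_self, max_eq_right hX0.le] at this
    have h2 : κ * dl Ω X ≤ 1 / 100 * dl Ω X := by gcongr
    linarith)
  obtain ⟨hi, hrep⟩ := repr1 hn hw H1 (H2 Y) z1 zc zs zX
  have dist_c : ∀ W : E, 0 < dl Ω W → ∀ z, dl Ω z ≤ 3 * r z → r z ≤ κ * max (dist z W) (dl Ω W) → 3 / 4 * dl Ω W ≤ dist z W ∧ dl Ω z ≤ dist z W := fun W hW z h1 h2 => by
    have h3 : κ * max (dist z W) (dl Ω W) ≤ 1 / 100 * max (dist z W) (dl Ω W) := by gcongr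
    have h4 := dl_lip Ω W z
    rw [dist_comm] at h4
    have h5 : 0 ≤ dist z W := dist_nonneg
    rcases max_cases (dist z W) (dl Ω W) with ⟨h6, -⟩ | ⟨h6, -⟩ <;> rw [h6] at h3 h2 <;> constructor <;> linarith only [h1, h2, h3, h4, h5, hW]
  have dyad : ∀ W : E, 0 < dl Ω W → ∀ z, 3 / 4 * dl Ω W ≤ dist z W → ∃ j : ℕ, 2 ^ j * dl Ω W / 2 ≤ dist z W ∧ dist z W ≤ 2 ^ j * dl Ω W := fun W hW z h => by
    obtain ⟨j, j1, j2⟩ := exists_nat_pow_near (x := 2 * dist z W / dl Ω W) (y := 2) (by rw [le_div_iff₀ hW]; linarith) one_lt_two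
    rw [le_div_iff₀ hW] at j1
    rw [div_lt_iff₀ hW, pow_succ] at j2
    exact ⟨j, by linarith, by linarith⟩
  obtain ⟨S, hS⟩ : ∃ S : E → E → ℕ → SE, S = fun W V j => Ω ∩ {z | dl Ω z ≤ 3 * r z ∧ 2 ^ j * dl Ω W / 2 ≤ dist z W ∧ dist z W ≤ 2 ^ j * dl Ω W ∧ dist z W ≤ dist z V} := ⟨_, rfl⟩
  have hSm : ∀ W V j, MeasurableSet (S W V j) := fun W V j => by
    rw [hS]
    have c1 : Continuous fun z : E => dl Ω z := continuous_infDist_pt _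
    have c2 : ∀ W : E, Continuous fun z : E => dist z W := fun W => continuous_id.dist continuous_const
    refine ho.measurableSet.inter (IsClosed.measurableSet ?_)
    exact (isClosed_le c1 (continuous_const.mul hrc)).inter ((isClosed_le continuous_const (c2 W)).inter ((isClosed_le (c2 W) continuous_const).inter (isClosed_le (c2 W) (c2 V))))
  obtain ⟨F, hF⟩ : ∃ F : E → ℝ≥0∞, F = fun z => ofReal (GR z X * GR z Y * (max (dl Ω z) (r z) ^ 2)⁻¹) := ⟨_, rfl⟩
  have qX : ∀ j, ∫⁻ z in S X Y j, F z ≤ ofReal (C * ((3 * κ * (1 / 2 ^ j) ^ α) ^ β) ^ 2 * GR X Y) := fun j => by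
    rw [hF]
    refine pX j _ (hSm X Y j) (by rw [hS]; exact inter_subset_left) fun z hz => ?_
    rw [hS] at hz; exact hz.2
  have qY : ∀ j, ∫⁻ z in S Y X j, F z ≤ ofReal (C * ((3 * κ * (1 / 2 ^ j) ^ α) ^ β) ^ 2 * GR X Y) := fun j => by
    rw [hF]
    have := pY j _ (hSm Y X j) (by rw [hS]; exact inter_subset_left) fun z hz => by rw [hS] at hz; exact hz.2
    simpa only [mul_comm (GR _ Y)] using this
  obtain ⟨T, hT⟩ : ∃ T, T = (⋃ j, S X Y j) ∪ ⋃ j, S Y X j := ⟨_, rfl⟩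
  have hTm : MeasurableSet T := by rw [hT]; exact (MeasurableSet.iUnion (hSm X Y)).union (MeasurableSet.iUnion (hSm Y X))
  have mem : ∀ z ∈ Ω, gradient ζ z ≠ 0 → z ∈ T := fun z hz hg => by
    obtain ⟨-, g2, -⟩ := zg z hz hg
    have dx := (dist_c X hX0 z g2 (rle1 z)).1
    have dy := (dist_c Y hY0 z g2 (rle2 z)).1
    rw [hT, hS]
    rcases le_total (dist z X) (dist z Y) with h | h
    · obtain ⟨j, j1, j2⟩ := dyad X hX0 z dx
      exact Or.inl (mem_iUnion.2 ⟨j, hz, g2, j1, j2, h⟩)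
    · obtain ⟨j, j1, j2⟩ := dyad Y hY0 z dy
      exact Or.inr (mem_iUnion.2 ⟨j, hz, g2, j1, j2, h⟩)
  have hvu : ∀ z ∈ Ω, z ≠ Y → GD z Y ≤ GR z Y := fun z hz hzY => green_le oz hu hv (hD.boundary_zero Y hY) (subset_closure hz) hzY
  have Hnn : ∀ z ∈ Ω, z ≠ Y → 0 ≤ H z := fun z hz hzY => by rw [H3 z hzY]; linarith [hvu z hz hzY]
  have Hle : ∀ z ∈ Ω, z ≠ Y → H z ≤ GR z Y := fun z hz hzY => by
    rw [H3 z hzY]; have := hv.nn' z hz hzY; linarith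
  have bound : ∀ z ∈ Ω, ‖H z * ⟪gradient (fun x => GR x X) z, gradient ζ z⟫ - GR z X * ⟪gradient H z, gradient ζ z⟫‖ₑ ≤ T.indicator (fun z => ofReal K * F z) z := fun z hz => by
    by_cases hg : gradient ζ z = 0
    · rw [hg]; simp
    rw [indicator_of_mem (mem z hz hg), hF, ← ofReal_mul hK0.le, ← ofReal_norm_eq_enorm]
    refine ofReal_le_ofReal ?_
    obtain ⟨g1, g2, g3⟩ := zg z hz hg
    obtain ⟨dx, dx2⟩ := dist_c X hX0 z g2 (rle1 z)
    obtain ⟨dy, dy2⟩ := dist_c Y hY0 z g2 (rle2 z)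
    have hzX : z ≠ X := fun e => by rw [e, dist_self] at dx; linarith
    have hzY : z ≠ Y := fun e => by rw [e, dist_self] at dy; linarith
    have hz0 := dl_pos ho hf hz
    have hcb : closedBall z (dl Ω z / 2) ⊆ Ω := dl_cball hz (by rw [dist_self]; linarith)
    have e1 := gbd Ω X 1 _ hw.wk zero_le_one hw.nn' z (dl Ω z / 2) hzX pz (Or.inr (by rw [dist_comm]; linarith)) hcb
    have e2 := gbd Ω Y 0 _ (H2 Y) le_rfl Hnn z (dl Ω z / 2) hzY pz (Or.inl rfl) hcb
    have w0 : 0 ≤ GR z X := hw.nn' z hz hzX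
    have h0 := Hnn z hz hzY
    have h1 := Hle z hz hzY
    have hrz := rp z
    obtain ⟨m, hm⟩ : ∃ m, m = max (dl Ω z) (r z) := ⟨_, rfl⟩
    have m1 : m ≤ 3 * r z := by rw [hm]; exact max_le g2 lz
    have m2 : m ≤ 2 * dl Ω z := by rw [hm]; exact max_le lz g1
    have m0 : 0 < m := by rw [hm]; exact hz0.trans_le (le_max_left _ _)
    rw [← hm, ← div_eq_mul_inv, ← mul_div_assoc, le_div_iff₀ pz, norm_eq_abs]
    have i1 := abs_real_inner_le_norm (gradient (fun x => GR x X) z) (gradient ζ z)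
    have i2 := abs_real_inner_le_norm (gradient H z) (gradient ζ z)
    have j1 := norm_nonneg (gradient ζ z)
    have j2 := norm_nonneg (gradient H z)
    have j3 := norm_nonneg (gradient (fun x => GR x X) z)
    calc _ ≤ (H z * (‖gradient (fun x => GR x X) z‖ * ‖gradient ζ z‖) + GR z X * (‖gradient H z‖ * ‖gradient ζ z‖)) * m ^ 2 := by
          gcongr
          refine (abs_sub _ _).trans ?_
          rw [abs_mul, abs_mul, abs_of_nonneg h0, abs_of_nonneg w0]
          gcongr
      _ = (H z * ‖gradient (fun x => GR x X) z‖ + GR z X * ‖gradient H z‖) * ‖gradient ζ z‖ * (m * m) := by ring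
      _ ≤ (H z * ‖gradient (fun x => GR x X) z‖ + GR z X * ‖gradient H z‖) * ‖gradient ζ z‖ * ((2 * dl Ω z) * (3 * r z)) := by gcongr
      _ = 12 * (H z * (dl Ω z / 2 * ‖gradient (fun x => GR x X) z‖) + GR z X * (dl Ω z / 2 * ‖gradient H z‖)) * (‖gradient ζ z‖ * r z) := by ring
      _ ≤ 12 * (H z * (Cg * GR z X) + GR z X * (Cg * H z)) * (7 * Ls) := by gcongr
      _ = K * (GR z X * H z) := by rw [hK]; ring
      _ ≤ K * (GR z X * GR z Y) := by gcongr
  have main : ofReal (H X) ≤ ofReal (1 / 2 * GR X Y) := by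
    calc ofReal (H X) = ofReal ‖H X‖ := by rw [norm_of_nonneg (Hnn X hX hXY)]
      _ = ‖H X‖ₑ := ofReal_norm_eq_enorm _
      _ ≤ ∫⁻ z in Ω, ‖H z * ⟪gradient (fun x => GR x X) z, gradient ζ z⟫ - GR z X * ⟪gradient H z, gradient ζ z⟫‖ₑ := by
          rw [hrep]; exact enorm_integral_le_lintegral_enorm _
      _ ≤ ∫⁻ z in Ω, T.indicator (fun z => ofReal K * F z) z := setLIntegral_mono' ho.measurableSet bound
      _ ≤ ∫⁻ z, T.indicator (fun z => ofReal K * F z) z := lintegral_mono' Measure.restrict_le_self le_rfl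
      _ = ∫⁻ z in T, ofReal K * F z := lintegral_indicator hTm _
      _ = ofReal K * ∫⁻ z in T, F z := lintegral_const_mul' _ _ ofReal_ne_top
      _ ≤ ofReal K * ((∑' j, ∫⁻ z in S X Y j, F z) + ∑' j, ∫⁻ z in S Y X j, F z) := by
          refine mul_le_mul' le_rfl ?_
          rw [hT]
          exact (lintegral_union_le _ _ _).trans (add_le_add (lintegral_iUnion_le _ _) (lintegral_iUnion_le _ _))
      _ ≤ ofReal K * ((∑' j : ℕ, ofReal (C * ((3 * κ * (1 / 2 ^ j) ^ α) ^ β) ^ 2 * GR X Y)) + ∑' j : ℕ, ofReal (C * ((3 * κ * (1 / 2 ^ j) ^ α) ^ β) ^ 2 * GR X Y)) :=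
          mul_le_mul' le_rfl (add_le_add (ENNReal.tsum_le_tsum qX) (ENNReal.tsum_le_tsum qY))
      _ = ofReal (2 * K * (C * ((3 * κ) ^ β) ^ 2 * GR X Y * (1 - q)⁻¹)) := by
          rw [geo hC.le hκ hG0 hq hq1, ← ofReal_add pz pz, ← ofReal_mul hK0.le]; congr 1; ring
      _ ≤ ofReal (2 * K * (C * ((1 - q) / (4 * K * C)) * GR X Y * (1 - q)⁻¹)) := ofReal_le_ofReal (by gcongr)
      _ = _ := by congr 1; field_simp; norm_num
  rw [ofReal_le_ofReal_iff pz, H3 X hXY] at main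
  linarith
end

section

theorem Dp.mono {L L' : ℝ} {W : E} (h : L' ≤ L) : Dp Ω σ a L W → Dp Ω σ a L' W := fun ⟨Q, h1, h2, h3⟩ =>
  ⟨Q, h1, h2, (mul_le_mul_of_nonneg_right h (pow_nonneg infDist_nonneg _)).trans h3⟩

theorem pw_bd (p B : ℝ) : ∃ K : ℝ, 1 ≤ K ∧ (0 < p → B ≤ K ^ p ∧ ∀ x, 0 ≤ x → x ^ p ≤ B → x ≤ K) := by
  by_cases hp : 0 < p
  swap
  · exact ⟨1, le_rfl, fun h => absurd h hp⟩
  have h1 : 1 ≤ max B 1 := le_max_right _ _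
  refine ⟨(max B 1) ^ p⁻¹, Real.one_le_rpow h1 pz, fun _ => ⟨?_, fun x hx h => ?_⟩⟩
  · rw [Real.rpow_inv_rpow pz hp.ne']; exact le_max_left _ _
  · rw [← Real.rpow_rpow_inv hx hp.ne']
    exact Real.rpow_le_rpow pz (h.trans (le_max_left _ _)) pz

variable (n) in
theorem lowv (hn : 3 ≤ n) (M : ℝ) : ∃ (g : ℕ) (C : ℝ), 0 < C ∧ ∀ (Cσ d cd : ℝ) (Ω : SE) (σ : ME), IsMixedPair M Cσ d cd Ω σ →
    ∀ Y v, Pl Ω Y v → ∀ z ∈ Ω, z ≠ Y → Cl Ω Y z → ∀ ε t, 0 < ε → ε ≤ dl Ω Y → ε ≤ dl Ω z → 1 ≤ t → dist Y z ≤ t * ε → dl Ω Y ≤ t * ε →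
      (dl Ω Y ^ nm)⁻¹ ≤ C * t ^ g * v z := by
  obtain ⟨c, hc, low⟩ := pl_low n oz
  obtain ⟨g, Cg, hCg, grow⟩ := grow n oz M
  refine ⟨g, c⁻¹ * (Cg * 4 ^ g), by positivity, fun Cσ d cd Ω σ hP Y v hv z hz hzY hcl ε t hε e1 e2 ht h1 h2 => ?_⟩
  have hf := fr_ne oz hP.bounded hP.nonempty
  have hY0 := dl_pos hP.nta.isOpen hf hv.mem
  obtain ⟨e, he⟩ := unitv (n := n) oz
  obtain ⟨x, hx⟩ : ∃ x, x = Y + (dl Ω Y / 20) • e := ⟨_, rfl⟩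
  have dx : dist x Y = dl Ω Y / 20 := by
    rw [hx, dist_eq_norm, add_sub_cancel_left, norm_smul, he, mul_one, norm_of_nonneg pz]
  have hxY : x ≠ Y := dist_pos.1 (by rw [dx]; positivity)
  obtain ⟨hxΩ, hxc⟩ := cl_near oz hP hv.mem (y := x) (by rw [dx]; linarith)
  have l1 := dl_lip Ω x Y
  have l2 := dl_lip Ω Y x
  rw [dist_comm Y x] at l2
  rw [dx] at l1 l2
  have k1 := low Ω Y v hv x (dl Ω Y / 2) hxY (by rw [dx]; linarith) (dl_cball hv.mem (by rw [dx]; linarith))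
  have k2 := grow Ω hP.bounded hf hP.nta Y 1 v hv.wk zero_le_one hv.nn' x hxΩ z hz ((Cl.sy hxc).trans hcl) hxY (Or.inr (by rw [dist_comm, dx]; linarith))
    (ε / 2) (4 * t) pz lz lz lz (by
      have := dist_triangle x Y z
      rw [dx] at this
      linarith) z (mem_ball_self (by have := dl_pos hP.nta.isOpen hf hz; positivity)) hzY
  rw [dx] at k1
  have k3 : (dl Ω Y ^ nm)⁻¹ ≤ ((dl Ω Y / 20) ^ nm)⁻¹ := by gcongr; linarith
  calc (dl Ω Y ^ nm)⁻¹ = c⁻¹ * (c * (dl Ω Y ^ nm)⁻¹) := by field_simp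
    _ ≤ c⁻¹ * (Cg * (4 * t) ^ g * v z) := by
      refine mul_le_mul_of_nonneg_left ?_ pz
      exact (mul_le_mul_of_nonneg_left k3 hc.le).trans (k1.trans k2)
    _ = _ := by rw [mul_pow]; ring

theorem fr_ball (hn : 1 ≤ n) (hP : IsMixedPair M Cσ d cd Ω σ) {Q : E} (hQ : Q ∈ frontier Ω) {s : ℝ} (hs : 0 < s) (k : ℕ) (h : 2 * diam Ω ≤ 2 ^ k * s) :
    σ.real (frontier Ω) ≤ Cσ ^ k * σ.real (ball Q s) := by
  refine le_trans (sig_mono hP fun P hPf => ?_) (sig_shift hn hP hQ hs k (s' := 2 * diam Ω) (by rw [dist_self, zero_add]; exact h))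
  have := fr_dist hP (frontier_subset_closure hPf.2) (frontier_subset_closure hQ)
  rw [mem_ball]; linarith [diam_pos' hn hP]

variable (n) in
theorem thick (hn : 3 ≤ n) (M Cσ d cd L0 B : ℝ) (hL : 0 < L0) : ∃ c : ℝ, 0 < c ∧ ∀ (Ω : SE) σ, IsMixedPair M Cσ d cd Ω σ →
    ∀ a, 0 < a → ∀ Y ∈ Ω, Dp Ω σ a L0 Y → a * σ.real (frontier Ω) ≤ B * diam Ω ^ nm → c * diam Ω ≤ dl Ω Y := by
  obtain ⟨K, hK, hp⟩ := pw_bd (d - nm) (B / (L0 * (min cd 1 / (2 * 1) ^ d)))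
  refine ⟨K⁻¹, by positivity, fun Ω σ hP a ha Y hY ⟨Q, hQ, hQd, hQ2⟩ hB => ?_⟩
  have hpp : 0 < d - nm := by have := hP.d_gt; linarith
  have hf := fr_ne oz hP.bounded hP.nonempty
  have h0 := dl_pos hP.nta.isOpen hf hY
  have hD := diam_pos' oz hP
  have hc := hP.cd_pos
  have hle := dl_le_diam hP.bounded hf (subset_closure hY)
  have s1 := sig_low oz hP hQ h0 le_rfl hle (by rw [one_mul])
  have s2 : σ.real (ball Q (diam Ω)) ≤ σ.real (frontier Ω) := sig_mono hP inter_subset_right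
  obtain ⟨c1, hc1⟩ : ∃ c1, c1 = min cd 1 / (2 * 1) ^ d := ⟨_, rfl⟩
  have hc0 : 0 < c1 := by rw [hc1]; have : 0 < min cd 1 := lt_min hc one_pos; positivity
  rw [← hc1] at s1 hp
  obtain ⟨x, hx⟩ : ∃ x, x = diam Ω / dl Ω Y := ⟨_, rfl⟩
  have hx0 : 0 < x := by rw [hx]; positivity
  have hDx : diam Ω = x * dl Ω Y := by rw [hx]; field_simp
  have key : x ^ (d - ((n : ℝ) - 2)) ≤ B / (L0 * c1) := by
    rw [Real.rpow_sub hx0, show (n : ℝ) - 2 = ((n - 2 : ℕ) : ℝ) by rw [Nat.cast_sub oz]; norm_num, rpow_natCast, div_le_div_iff₀ pz pz]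
    have hz : 0 < dl Ω Y ^ nm := by positivity
    refine le_of_mul_le_mul_right ?_ hz
    calc x ^ d * (L0 * c1) * dl Ω Y ^ nm = (c1 * x ^ d) * (L0 * dl Ω Y ^ nm) := by ring
      _ ≤ (c1 * x ^ d) * (a * σ.real (ball Q (dl Ω Y))) := by gcongr
      _ = a * (c1 * x ^ d * σ.real (ball Q (dl Ω Y))) := by ring
      _ ≤ a * σ.real (frontier Ω) := by rw [hx]; exact mul_le_mul_of_nonneg_left (s1.trans s2) ha.le
      _ ≤ B * diam Ω ^ nm := hB
      _ = _ := by rw [hDx, mul_pow]; ring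
  have := (hp hpp).2 x hx0.le key
  rw [hDx, inv_mul_le_iff₀ pz]
  gcongr

variable (n) in
theorem thin (hn : 3 ≤ n) (M Cσ d cd L B : ℝ) (hL : 0 < L) : ∃ B' : ℝ, ∀ (Ω : SE) σ, IsMixedPair M Cσ d cd Ω σ →
    ∀ a, 0 < a → ∀ X ∈ Ω, ¬ Dp Ω σ a L X → diam Ω ≤ B * dl Ω X → a * σ.real (frontier Ω) ≤ B' * diam Ω ^ nm := by
  obtain ⟨k, hk⟩ := pow_two_big (2 * B)
  refine ⟨Cσ ^ k * L, fun Ω σ hP a ha X hX hN hD => ?_⟩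
  have hf := fr_ne oz hP.bounded hP.nonempty
  have h0 := dl_pos hP.nta.isOpen hf hX
  obtain ⟨Q, hQ, hQd⟩ := near_pt hf X
  have h1 := fr_ball oz hP hQ h0 k (by nlinarith only [hk, hD, h0])
  have h2 : a * σ.real (ball Q (dl Ω X)) ≤ L * dl Ω X ^ nm := by
    by_contra h; push Not at h
    exact hN ⟨Q, hQ, hQd, h.le⟩
  have hC := hP.Cσ_pos
  have hle := dl_le_diam hP.bounded hf (subset_closure hX)
  calc a * σ.real (frontier Ω) ≤ a * (Cσ ^ k * σ.real (ball Q (dl Ω X))) := by gcongr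
    _ = Cσ ^ k * (a * σ.real (ball Q (dl Ω X))) := by ring
    _ ≤ Cσ ^ k * (L * diam Ω ^ nm) := by
      refine mul_le_mul_of_nonneg_left (h2.trans ?_) pz
      gcongr
    _ = _ := by ring

variable (n) in
theorem flat (hn : 3 ≤ n) (M Cσ d cd c : ℝ) (hc : 0 < c) : ∃ C : ℝ, 0 < C ∧ ∀ (Ω : SE) σ, IsMixedPair M Cσ d cd Ω σ → ∀ a, 0 < a →
    diam Ω ^ nm ≤ a * σ.real (frontier Ω) → ∀ GR GD, IsRobinGreen Ω σ a GR → IsDirichletGreen Ω GD → ∀ X ∈ Ω, ∀ Y ∈ Ω, X ≠ Y → c * diam Ω ≤ dl Ω X →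
    c * diam Ω ≤ dl Ω Y → dl Ω X / 400 ≤ dist X Y → GR X Y ≤ C * GD X Y := by
  obtain ⟨c', hc'⟩ : ∃ c', c' = min c (1 / 100) := ⟨_, rfl⟩
  have hc0 : 0 < c' := by rw [hc']; exact lt_min hc nz
  have hc1 : c' ≤ c := by rw [hc']; exact min_le_left _ _
  have hc2 : c' ≤ 1 / 100 := by rw [hc']; exact min_le_right _ _
  obtain ⟨k, hk⟩ := pow_two_big (2 / c')
  rw [div_le_iff₀ hc0] at hk
  obtain ⟨C1, hC1, pole⟩ := pole n hn M Cσ d cd (max 1 (Cσ ^ k)) (le_max_left _ _)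
  obtain ⟨g, C2, hC2, low⟩ := lowv n hn M
  refine ⟨C1 * (c ^ nm)⁻¹ * (C2 * (1 / c) ^ g), by positivity, fun Ω σ hP a ha hA GR GD hR hD X hX Y hY hXY hcX hcY hdist => ?_⟩
  have ho := hP.nta.isOpen
  have hb := hP.bounded
  have hf := fr_ne oz hb hP.nonempty
  have hD0 := diam_pos' oz hP
  have hu := Pl.robin ho hb hR hY
  have hv := Pl.diri ho hb hD hY
  have hv0 : 0 ≤ GD X Y := hv.nn' X hX hXY
  by_cases hcl : Cl Ω X Y
  swap
  · have : GR X Y = 0 := vanish oz hP ha hu (hR.weak Y hY) hX hcl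
    rw [this]; positivity
  have hle := dl_le_diam hb hf (subset_closure hX)
  have hle' := dl_le_diam hb hf (subset_closure hY)
  have h1c : c ≤ 1 := by by_contra h; push Not at h; nlinarith only [h, hcX, hle, hD0]
  have hd : Hd Ω σ (max 1 (Cσ ^ k) * a) (fun _ => c' * diam Ω) := by
    refine ⟨fun _ => by positivity, fun x y => le_add_of_nonneg_right dist_nonneg, fun x _ => by nlinarith only [hc2, hD0], fun P hPf => ?_⟩
    have h1 := fr_ball oz hP hPf (s := c' * diam Ω) pz k (by nlinarith only [hk, hD0])
    calc (c' * diam Ω) ^ nm ≤ diam Ω ^ nm := by gcongr; nlinarith only [hc2, hD0]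
      _ ≤ a * (Cσ ^ k * σ.real (ball P (c' * diam Ω))) := hA.trans (by gcongr)
      _ = Cσ ^ k * a * σ.real (ball P (c' * diam Ω)) := by ring
      _ ≤ _ := by gcongr; exact le_max_right _ _
  have hX0 := dl_pos ho hf hX
  have p1 := pole Ω σ hP a ha _ hd Y _ hu (hR.weak Y hY) X hX hXY hdist (fun z _ => by
    have : c' * diam Ω ≤ c * diam Ω := by gcongr
    linarith)
  have p2 := low Cσ d cd Ω σ hP Y _ hv X hX hXY (Cl.sy hcl) (c * diam Ω) (1 / c) pz hcY hcX (by rw [le_div_iff₀ hc]; linarith)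
    (by rw [← mul_assoc, one_div_mul_cancel hc.ne', one_mul]; exact fr_dist hP (subset_closure hY) (subset_closure hX))
    (by rw [← mul_assoc, one_div_mul_cancel hc.ne', one_mul]; exact hle')
  have hu0 : 0 ≤ GR X Y := hu.nn' X hX hXY
  have q1 : GR X Y * (c ^ nm * diam Ω ^ nm) ≤ C1 := by
    rw [← mul_pow]; refine le_trans ?_ p1; gcongr
  have hY0 := dl_pos ho hf hY
  have q2 : (diam Ω ^ nm)⁻¹ ≤ C2 * (1 / c) ^ g * GD X Y := le_trans (by gcongr) p2
  calc GR X Y ≤ C1 * (c ^ nm)⁻¹ * (diam Ω ^ nm)⁻¹ := by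
        rw [mul_assoc, ← mul_inv, ← div_eq_mul_inv, le_div_iff₀ pz]; exact q1
    _ ≤ C1 * (c ^ nm)⁻¹ * (C2 * (1 / c) ^ g * GD X Y) := by gcongr
    _ = _ := by ring
end

section

variable (n) in
theorem pick (hn : 3 ≤ n) (M Cσ d cd L0 L : ℝ) (hL0 : 0 < L0) (hL : 0 < L) : ∃ B : ℝ, 1 ≤ B ∧ ∀ (Ω : SE) σ,
    IsMixedPair M Cσ d cd Ω σ → ∀ a, 0 < a → ∀ X ∈ Ω, Dp Ω σ a L0 X → ∀ V W : E, (¬ Dp Ω σ a L X ∧ diam Ω ≤ B * dl Ω X) ∨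
    ∃ X' ∈ Ω, Cl Ω X X' ∧ Dp Ω σ a L X' ∧ dist X X' ≤ B * dl Ω X ∧ dl Ω X ≤ dl Ω X' ∧ dl Ω X' ≤ B * dl Ω X ∧
      (X' = X ∨ dl Ω X' / 32 ≤ dist X' V ∧ dl Ω X' / 32 ≤ dist X' W) := by
  obtain ⟨k, hk⟩ := pow_two_big (18 * M)
  obtain ⟨K1, hK1, hp⟩ := pw_bd (d - nm) (L * 4 ^ nm * Cσ ^ k / (L0 * (min cd 1 / (2 * 1) ^ d)))
  obtain ⟨K, hK⟩ : ∃ K, K = max K1 (2 * M) := ⟨_, rfl⟩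
  have hKK : K1 ≤ K := by rw [hK]; exact le_max_left _ _
  have hKM : 2 * M ≤ K := by rw [hK]; exact le_max_right _ _
  refine ⟨100 * K, by linarith, fun Ω σ hP a ha X hX ⟨Q, hQ, hQd, hQ2⟩ V W => ?_⟩
  have hf := fr_ne oz hP.bounded hP.nonempty
  have h0 := dl_pos hP.nta.isOpen hf hX
  have hK0 : 1 ≤ K := hK1.trans hKK
  have hKd : dl Ω X ≤ K * dl Ω X := le_mul_of_one_le_left h0.le hK0
  by_cases hN : Dp Ω σ a L X
  · exact Or.inr ⟨X, hX, Relation.ReflTransGen.refl, hN, by rw [dist_self]; positivity, le_rfl, by linarith, Or.inl rfl⟩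
  by_cases hD : diam Ω ≤ 100 * K * dl Ω X
  · exact Or.inl ⟨hN, hD⟩
  push Not at hD
  right
  have hM := hP.nta.M_gt_one
  obtain ⟨A, hA, dA, lA⟩ := seqA hP.nta hf (subset_closure hX) (t := K * dl Ω X) pz lz
  obtain ⟨A', hA', dA', sV, sW, cA⟩ := cand oz hP hA V W
  have l1 := dl_lip Ω A X
  have l2 := dl_lip Ω A A'
  have l3 := dl_lip Ω A' A
  rw [dist_comm A A'] at l2
  have t1 := dist_triangle A' A X
  rw [div_le_iff₀ lz] at lA
  have lA2 : K * dl Ω X ≤ 2 * M * dl Ω A' := by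
    have q : dl Ω A ≤ 2 * dl Ω A' := by linarith
    have := mul_le_mul_of_nonneg_left q (by linarith : 0 ≤ M)
    linarith only [lA, this]
  have lA1 : dl Ω X ≤ dl Ω A' := by
    have : 2 * M * dl Ω X ≤ 2 * M * dl Ω A' := le_trans (by gcongr) lA2
    exact le_of_mul_le_mul_left this lz
  refine ⟨A', hA', (Relation.ReflTransGen.single ⟨hX, hA, by rw [dist_comm]; linarith⟩ : Cl Ω X A).trans cA, ?_, by rw [dist_comm]; linarith, lA1, by linarith, Or.inr ⟨sV, sW⟩⟩
  obtain ⟨Q', hQ', hQ'd⟩ := near_pt hf A'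
  refine ⟨Q', hQ', hQ'd, ?_⟩
  have t2 := dist_triangle Q' A' Q
  have t3 := dist_triangle A' X Q
  rw [dist_comm Q' A'] at t2
  have h0' : 0 < dl Ω A' := h0.trans_le lA1
  have s1 := sig_shift oz hP hQ' h0' k (Q' := Q) (s' := K * dl Ω X) (by
    have : 18 * M * dl Ω A' ≤ 2 ^ k * dl Ω A' := by gcongr
    linarith)
  have s2 := sig_low oz hP hQ h0 le_rfl hKd lz
  obtain ⟨c1, hc1⟩ : ∃ c1, c1 = min cd 1 / (2 * 1) ^ d := ⟨_, rfl⟩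
  have hc0 : 0 < c1 := by rw [hc1]; have : 0 < min cd 1 := lt_min hP.cd_pos one_pos; positivity
  rw [← hc1, mul_div_cancel_right₀ _ h0.ne'] at s2
  rw [← hc1] at hp
  have hpp : 0 < d - nm := by have := hP.d_gt; linarith
  have e1 := (hp hpp).1.trans (Real.rpow_le_rpow lz hKK hpp.le)
  rw [Real.rpow_sub lz, show (n : ℝ) - 2 = ((n - 2 : ℕ) : ℝ) by rw [Nat.cast_sub oz]; norm_num, rpow_natCast,
    div_le_div_iff₀ pz pz] at e1
  have hC := hP.Cσ_pos
  refine le_of_mul_le_mul_left ?_ (pow_pos hC k)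
  calc Cσ ^ k * (L * dl Ω A' ^ nm) ≤ Cσ ^ k * (L * (4 * (K * dl Ω X)) ^ nm) := by gcongr; linarith
    _ = (L * 4 ^ nm * Cσ ^ k * K ^ nm) * dl Ω X ^ nm := by rw [mul_pow, mul_pow]; ring
    _ ≤ (K ^ d * (L0 * c1)) * dl Ω X ^ nm := by gcongr
    _ = c1 * K ^ d * (L0 * dl Ω X ^ nm) := by ring
    _ ≤ c1 * K ^ d * (a * σ.real (ball Q (dl Ω X))) := by gcongr
    _ = a * (c1 * K ^ d * σ.real (ball Q (dl Ω X))) := by ring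
    _ ≤ a * (Cσ ^ k * σ.real (ball Q' (dl Ω A'))) := mul_le_mul_of_nonneg_left (s2.trans s1) ha.le
    _ = _ := by ring

variable (n) in
theorem poleY (hn : 3 ≤ n) (M Cσ d cd : ℝ) : ∃ L C : ℝ, 1 ≤ L ∧ 0 < C ∧ ∀ (Ω : SE) σ,
    IsMixedPair M Cσ d cd Ω σ → ∀ a, 0 < a → ∀ GR, IsRobinGreen Ω σ a GR → ∀ Y ∈ Ω, Dp Ω σ a L Y → ∀ z ∈ Ω, dist z Y = dl Ω Y / 40 →
      GR z Y * dl Ω z ^ nm ≤ C := by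
  obtain ⟨α, hα, hα1, deep⟩ := deep n hn M Cσ d cd
  obtain ⟨L, hL, deep⟩ := deep (1 / 100) nz nz
  obtain ⟨C, hC, pole⟩ := pole n hn M Cσ d cd 1 le_rfl
  refine ⟨L, C, hL, hC, fun Ω σ hP a ha GR hR Y hY hdp z hz hd => ?_⟩
  have hf := fr_ne oz hP.bounded hP.nonempty
  have h0 := dl_pos hP.nta.isOpen hf hY
  have hh : Hd Ω σ (1 * a) (rr (1 / 100) α Ω Y Y) := by
    rw [one_mul]
    exact rr_hd oz hP nz le_rfl hα.le lz hY hY (fun W hW P hPf => by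
      have : W = Y := hW.elim id id
      rw [this]; exact deep Ω σ hP a ha Y hY hdp P hPf)
  have l1 := dl_lip Ω z Y
  have l2 := dl_lip Ω Y z
  rw [dist_comm Y z] at l2
  refine pole Ω σ hP a ha _ hh Y _ (Pl.robin hP.nta.isOpen hP.bounded hR hY) (hR.weak Y hY) z hz (dist_pos.1 (by rw [hd]; positivity)) lz fun y hy => ?_
  have h1 := rr_le (κ := 1 / 100) nz hα.le lz (Y := Y) h0 y
  have h2 : max (dist y Y) (dl Ω Y) ≤ dl Ω Y + dl Ω Y := max_le (by
    have := dist_triangle y z Y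
    rw [mem_ball] at hy
    linarith) lz
  linarith

variable (n) in
theorem compY (hn : 3 ≤ n) (M Cσ d cd : ℝ) : ∃ L : ℝ, 1 ≤ L ∧ ∀ B, 1 ≤ B → ∃ C : ℝ, 1 ≤ C ∧ ∀ (Ω : SE) σ,
    IsMixedPair M Cσ d cd Ω σ → ∀ a, 0 < a → ∀ GR GD, IsRobinGreen Ω σ a GR → IsDirichletGreen Ω GD → ∀ Y ∈ Ω, ∀ Y' ∈ Ω, Dp Ω σ a L Y' → Cl Ω Y Y' →
    dist Y Y' ≤ B * dl Ω Y → dl Ω Y ≤ dl Ω Y' → dl Ω Y' ≤ B * dl Ω Y → dl Ω Y' / 35 ≤ dist Y Y' → ∀ x ∈ Ω, x ≠ Y → dl Ω Y' / 35 ≤ dist x Y' →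
    GD x Y' ≤ C * GD x Y := by
  obtain ⟨L, C1, hL, hC1, pole⟩ := poleY n hn M Cσ d cd
  obtain ⟨g, C2, hC2, low⟩ := lowv n hn M
  refine ⟨L, hL, fun B hB => ⟨max 1 (C1 * 2 ^ nm * (C2 * (4 * B) ^ g)), le_max_left _ _, fun Ω σ hP a ha GR GD hR hD Y hY Y' hY' hdp hcl d1 d2 d3 d4 x hx hxY d5 => ?_⟩⟩
  obtain ⟨C, hC⟩ : ∃ C, C = max 1 (C1 * 2 ^ nm * (C2 * (4 * B) ^ g)) := ⟨_, rfl⟩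
  have hCp : 0 < C := by rw [hC]; exact one_pos.trans_le (le_max_left _ _)
  rw [← hC]
  have ho := hP.nta.isOpen
  have hb := hP.bounded
  have hf := fr_ne oz hb hP.nonempty
  have h0 := dl_pos ho hf hY
  have h0' := dl_pos ho hf hY'
  have hv := Pl.diri ho hb hD hY
  have hv' := Pl.diri ho hb hD hY'
  have hu' := Pl.robin ho hb hR hY'
  have := maxw hn hv hv' (c := C⁻¹) (t := dl Ω Y' / 40) pz pz lz (fun P hPf => by
    rw [hD.boundary_zero Y hY P hPf, hD.boundary_zero Y' hY' P hPf, mul_zero]) (fun z _ hzd => by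
    obtain ⟨hz, hzc⟩ := cl_near oz hP hY' (y := z) lz
    have hzY : z ≠ Y := fun e => by rw [e] at hzd; linarith
    have hzY' : z ≠ Y' := dist_pos.1 (by rw [hzd]; positivity)
    have l2 := dl_lip Ω Y' z
    rw [dist_comm Y' z, hzd] at l2
    have t1 := dist_triangle Y Y' z
    rw [dist_comm Y' z, hzd] at t1
    have p1 := pole Ω σ hP a ha GR hR Y' hY' hdp z hz hzd
    have p2 := low Cσ d cd Ω σ hP Y _ hv z hz hzY (hcl.trans hzc) (dl Ω Y / 2) (4 * B) pz lz lz lz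
      (by nlinarith only [t1, d1, d3, h0, hB]) (by nlinarith only [h0, hB])
    have p3 : GD z Y' ≤ GR z Y' := green_le oz hu' hv' (hD.boundary_zero Y' hY') (subset_closure hz) hzY'
    have p4 : 0 ≤ GR z Y' := hu'.nn' z hz hzY'
    have p5 : 0 ≤ GD z Y := hv.nn' z hz hzY
    rw [inv_mul_le_iff₀ hCp]
    refine p3.trans ?_
    calc GR z Y' ≤ C1 * (dl Ω z ^ nm)⁻¹ := by rw [← div_eq_mul_inv, le_div_iff₀ (pow_pos (dl_pos ho hf hz) _)]; exact p1
      _ ≤ C1 * ((dl Ω Y / 2) ^ nm)⁻¹ := by gcongr; linarith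
      _ = C1 * 2 ^ nm * (dl Ω Y ^ nm)⁻¹ := by rw [div_pow, inv_div]; ring
      _ ≤ C1 * 2 ^ nm * (C2 * (4 * B) ^ g * GD z Y) := by gcongr
      _ = C1 * 2 ^ nm * (C2 * (4 * B) ^ g) * GD z Y := by ring
      _ ≤ C * GD z Y := by gcongr; rw [hC]; exact le_max_right _ _) x (subset_closure hx) lz hxY
  rwa [inv_mul_le_iff₀ hCp] at this

variable (n) in
theorem far (hn : 3 ≤ n) (M Cσ d cd L0 : ℝ) (hL0 : 0 < L0) : ∃ C : ℝ, 0 < C ∧ ∀ (Ω : SE) σ, IsMixedPair M Cσ d cd Ω σ → ∀ a, 0 < a →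
    diam Ω ^ nm ≤ a * σ.real (frontier Ω) → ∀ GR GD, IsRobinGreen Ω σ a GR → IsDirichletGreen Ω GD → ∀ X ∈ Ω, ∀ Y ∈ Ω, X ≠ Y → Dp Ω σ a L0 X → Dp Ω σ a L0 Y →
    dl Ω Y / 30 ≤ dist X Y → GR X Y ≤ C * GD X Y := by
  obtain ⟨g, Cg, hCg, grow⟩ := grow n oz M
  obtain ⟨L1, hL1, core⟩ := core n hn M Cσ d cd
  obtain ⟨L2, hL2, comp⟩ := compY n hn M Cσ d cd
  obtain ⟨L, hL⟩ : ∃ L, L = max L1 L2 := ⟨_, rfl⟩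
  have hLL1 : L1 ≤ L := by rw [hL]; exact le_max_left _ _
  have hLL2 : L2 ≤ L := by rw [hL]; exact le_max_right _ _
  have hLp : 0 < L := by linarith
  obtain ⟨B, hB, pick⟩ := pick n hn M Cσ d cd L0 L hL0 hLp
  obtain ⟨C5, hC5, comp⟩ := comp B hB
  obtain ⟨B', thin⟩ := thin n hn M Cσ d cd L B hLp
  obtain ⟨c, hc, thick⟩ := thick n hn M Cσ d cd L0 B' hL0
  obtain ⟨C6, hC6, flat⟩ := flat n hn M Cσ d cd c hc
  obtain ⟨C7, hC7⟩ : ∃ C7, C7 = Cg * B ^ g := ⟨_, rfl⟩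
  have hC70 : 0 < C7 := by rw [hC7]; positivity
  obtain ⟨C8, hC8⟩ : ∃ C8, C8 = C7 * (C7 * (2 * (C5 * C7))) := ⟨_, rfl⟩
  refine ⟨max C6 C8, lt_max_of_lt_left hC6, fun Ω σ hP a ha hA GR GD hR hD X hX Y hY hXY dX dY hd => ?_⟩
  have ho := hP.nta.isOpen
  have hb := hP.bounded
  have hf := fr_ne oz hb hP.nonempty
  have hX0 := dl_pos ho hf hX
  have hY0 := dl_pos ho hf hY
  have hv := Pl.diri ho hb hD hY
  have hu := Pl.robin ho hb hR hY
  have hv0 : 0 ≤ GD X Y := hv.nn' X hX hXY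
  have l1 := dl_lip Ω X Y
  have flat' : ∀ W ∈ Ω, ¬ Dp Ω σ a L W → diam Ω ≤ B * dl Ω W → GR X Y ≤ max C6 C8 * GD X Y := fun W hW h1 h2 => by
    have h3 := thin Ω σ hP a ha W hW h1 h2
    refine (flat Ω σ hP a ha hA GR GD hR hD X hX Y hY hXY (thick Ω σ hP a ha X hX dX h3) (thick Ω σ hP a ha Y hY dY h3) lz).trans ?_
    gcongr; exact le_max_left _ _
  rcases pick Ω σ hP a ha X hX dX Y Y with ⟨h1, h2⟩ | ⟨X', hX', cX, eX, x1, x2, x3, x4⟩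
  · exact flat' X hX h1 h2
  rcases pick Ω σ hP a ha Y hY dY X' Y with ⟨h1, h2⟩ | ⟨Y', hY', cY, eY, y1, y2, y3, y4⟩
  · exact flat' Y hY h1 h2
  by_cases hcl : Cl Ω X Y
  swap
  · have : GR X Y = 0 := vanish oz hP ha hu (hR.weak Y hY) hX hcl
    rw [this]; exact mul_nonneg (le_max_of_le_left hC6.le) hv0
  have hX'0 : 0 < dl Ω X' := hX0.trans_le x2
  have hY'0 : 0 < dl Ω Y' := hY0.trans_le y2
  have hXY' : dl Ω X / 40 ≤ dist X Y := by linarith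
  have a1 : dl Ω X' / 34 ≤ dist X' Y ∧ dl Ω Y / 34 ≤ dist X' Y := by
    rcases x4 with rfl | ⟨h, -⟩
    · exact ⟨by linarith, by linarith⟩
    · have := dl_lip Ω Y X'
      rw [dist_comm] at this
      exact ⟨by linarith, by linarith⟩
  have nX'Y : X' ≠ Y := dist_pos.1 lz
  have a2 : dl Ω Y' / 35 ≤ dist X' Y' := by
    rcases y4 with h | ⟨h, -⟩
    · rw [h]; linarith
    · rw [dist_comm]; linarith
  have nX'Y' : X' ≠ Y' := dist_pos.1 lz
  have tr : ∀ (Z : E) (w : E → ℝ), Pl Ω Z w → ∀ x ∈ Ω, ∀ y ∈ Ω, Cl Ω x y → x ≠ Z → y ≠ Z → dl Ω x / 40 ≤ dist x Z → ∀ ε, 0 < ε → ε ≤ dl Ω x → ε ≤ dl Ω y → dist x y ≤ B * ε → w x ≤ C7 * w y :=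
    fun Z w hw x hx y hy hxy h1 h2 h3 ε hε e1 e2 e3 => by
      rw [hC7]
      exact grow Ω hb hf hP.nta Z 1 w hw.wk zero_le_one hw.nn' x hx y hy hxy h1 (Or.inr (by rw [dist_comm]; exact h3)) ε B hε e1 e2 hB e3 y (mem_ball_self lz) h2
  have s1 : GR X Y ≤ C7 * GR X' Y := tr Y _ hu X hX X' hX' cX hXY nX'Y hXY' (dl Ω X) hX0 le_rfl x2 x1
  have s2 : GR Y X' ≤ C7 * GR Y' X' := tr X' _ (Pl.robin ho hb hR hX') Y hY Y' hY' cY nX'Y.symm nX'Y'.symm (by rw [dist_comm]; linarith) (dl Ω Y) hY0 le_rfl y2 y1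
  have s3 := core Ω σ hP a ha GR GD hR hD X' hX' Y' hY' nX'Y' (eX.mono hLL1) (eY.mono hLL1)
  have s5 : GD X' Y ≤ C7 * GD X Y := tr Y _ hv X' hX' X hX (Cl.sy cX) nX'Y hXY lz (dl Ω X) hX0 x2 le_rfl (by rw [dist_comm]; exact x1)
  have s4 : GD X' Y' ≤ C5 * GD X' Y := by
    rcases y4 with h | ⟨-, h⟩
    · rw [h]; exact le_mul_of_one_le_left (hv.nn' X' hX' nX'Y) hC5
    · exact comp Ω σ hP a ha GR GD hR hD Y hY Y' hY' (eY.mono hLL2) cY y1 y2 y3 (by rw [dist_comm]; linarith) X' hX' nX'Y a2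
  rw [← hR.symm X' hX' Y hY nX'Y, ← hR.symm X' hX' Y' hY' nX'Y'] at s2
  calc GR X Y ≤ C7 * (C7 * (2 * (C5 * (C7 * GD X Y)))) := by
        refine s1.trans (mul_le_mul_of_nonneg_left (s2.trans (mul_le_mul_of_nonneg_left (s3.trans (mul_le_mul_of_nonneg_left (s4.trans ?_) two_pos.le)) hC70.le)) hC70.le)
        exact mul_le_mul_of_nonneg_left s5 lz
    _ = C8 * GD X Y := by rw [hC8]; ring
    _ ≤ _ := by gcongr; exact le_max_right _ _

variable (n) in
theorem full (hn : 3 ≤ n) (M Cσ d cd L0 : ℝ) (hL0 : 0 < L0) : ∃ C : ℝ, 0 < C ∧ ∀ (Ω : SE) σ, IsMixedPair M Cσ d cd Ω σ → ∀ a, 0 < a →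
    diam Ω ^ nm ≤ a * σ.real (frontier Ω) → ∀ GR GD, IsRobinGreen Ω σ a GR → IsDirichletGreen Ω GD → ∀ X ∈ Ω, ∀ Y ∈ Ω, X ≠ Y → Dp Ω σ a L0 X → Dp Ω σ a L0 Y →
    GR X Y ≤ C * GD X Y := by
  obtain ⟨g, Cg, hCg, grow⟩ := grow n oz M
  obtain ⟨L1, hL1⟩ : ∃ L1, L1 = L0 / (2 ^ nm * max 1 Cσ ^ 2) := ⟨_, rfl⟩
  have hm1 : 1 ≤ max 1 Cσ := le_max_left _ _
  have h2n : (1 : ℝ) ≤ 2 ^ nm := one_le_pow₀ nz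
  have hq1 : (1 : ℝ) ≤ 2 ^ nm * max 1 Cσ ^ 2 := one_le_mul_of_one_le_of_one_le h2n (one_le_pow₀ hm1)
  have hL10 : 0 < L1 := by rw [hL1]; positivity
  have hL11 : L1 ≤ L0 := by rw [hL1]; exact div_le_self hL0.le hq1
  obtain ⟨C, hC, far⟩ := far n hn M Cσ d cd L1 hL10
  obtain ⟨C7, hC7⟩ : ∃ C7, C7 = Cg * 2 ^ g := ⟨_, rfl⟩
  have hC70 : 0 < C7 := by rw [hC7]; positivity
  refine ⟨1 + C + C7 * (C * C7), by positivity, fun Ω σ hP a ha hA GR GD hR hD X hX Y hY hXY dX dY => ?_⟩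
  have ho := hP.nta.isOpen
  have hb := hP.bounded
  have hf := fr_ne oz hb hP.nonempty
  have hX0 := dl_pos ho hf hX
  have hY0 := dl_pos ho hf hY
  have hv := Pl.diri ho hb hD hY
  have hu := Pl.robin ho hb hR hY
  have hv0 : 0 ≤ GD X Y := hv.nn' X hX hXY
  have hp1 : 0 ≤ C * GD X Y := by positivity
  have hp2 : 0 ≤ C7 * (C * C7) * GD X Y := by positivity
  by_cases hd : dl Ω Y / 30 ≤ dist X Y
  · have := far Ω σ hP a ha hA GR GD hR hD X hX Y hY hXY (dX.mono hL11) (dY.mono hL11) hd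
    linarith
  push Not at hd
  obtain ⟨e, he⟩ := unitv (n := n) oz
  obtain ⟨z, hz⟩ : ∃ z, z = Y + (dl Ω Y / 30) • e := ⟨_, rfl⟩
  have dz : dist z Y = dl Ω Y / 30 := by
    rw [hz, dist_eq_norm, add_sub_cancel_left, norm_smul, he, mul_one, norm_of_nonneg pz]
  have hzY : z ≠ Y := dist_pos.1 (by rw [dz]; positivity)
  obtain ⟨hzΩ, hzc⟩ := cl_near oz hP hY (y := z) (by rw [dz]; linarith)
  obtain ⟨-, hXc⟩ := cl_near oz hP hY (y := X) lz
  have l1 := dl_lip Ω z Y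
  have l2 := dl_lip Ω Y z
  have l3 := dl_lip Ω Y X
  rw [dist_comm Y z, dz] at l2
  rw [dist_comm Y X] at l3
  rw [dz] at l1
  have t1 := dist_triangle X Y z
  rw [dist_comm Y z, dz] at t1
  have hz0 := dl_pos ho hf hzΩ
  have dpz : Dp Ω σ a L1 z := by
    obtain ⟨Q, hQ, hQd, hQ2⟩ := dY
    obtain ⟨Q', hQ', hQ'd⟩ := near_pt hf z
    refine ⟨Q', hQ', hQ'd, ?_⟩
    have t2 := dist_triangle Q' z Q
    have t3 := dist_triangle z Y Q
    rw [dist_comm Q' z] at t2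
    have s1 := sig_shift oz hP hQ' hz0 2 (Q' := Q) (s' := dl Ω Y) lz
    rw [hL1, div_mul_eq_mul_div, div_le_iff₀ pz]
    have hC0 := hP.Cσ_pos
    calc L0 * dl Ω z ^ nm ≤ L0 * (2 * dl Ω Y) ^ nm := by gcongr; linarith
      _ = 2 ^ nm * (L0 * dl Ω Y ^ nm) := by rw [mul_pow]; ring
      _ ≤ 2 ^ nm * (a * (Cσ ^ 2 * σ.real (ball Q' (dl Ω z)))) := mul_le_mul_of_nonneg_left (hQ2.trans (mul_le_mul_of_nonneg_left s1 ha.le)) pz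
      _ ≤ 2 ^ nm * (a * (max 1 Cσ ^ 2 * σ.real (ball Q' (dl Ω z)))) := by gcongr; exact le_max_right _ _
      _ = _ := by ring
  obtain ⟨H, -, H1, H2, H3⟩ := hfun oz hu hv
  have Hnn : ∀ z ∈ Ω, z ≠ Y → 0 ≤ H z := fun z hz hzY => by
    rw [H3 z hzY, sub_nonneg]; exact green_le oz hu hv (hD.boundary_zero Y hY) (subset_closure hz) hzY
  have s1 := grow Ω hb hf hP.nta Y 0 H (H2 Y) le_rfl Hnn X hX z hzΩ ((Cl.sy hXc).trans hzc) hXY (Or.inl rfl) (dl Ω Y / 2) 2 pz lz lz one_le_two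
    lz z (mem_ball_self pz) hzY
  have s2 := far Ω σ hP a ha hA GR GD hR hD z hzΩ Y hY hzY dpz (dY.mono hL11) dz.ge
  have s3 := grow Ω hb hf hP.nta Y 1 _ hv.wk zero_le_one hv.nn' z hzΩ X hX ((Cl.sy hzc).trans hXc) hzY (Or.inr (by rw [dist_comm, dz]; linarith)) (dl Ω Y / 2) 2
    pz lz lz one_le_two (by rw [dist_comm]; linarith) X (mem_ball_self pz) hXY
  rw [← hC7, H3 X hXY, H3 z hzY] at s1
  rw [← hC7] at s3
  have hvz : 0 ≤ GD z Y := hv.nn' z hzΩ hzY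
  have s4 : C7 * (GR z Y - GD z Y) ≤ C7 * (C * (C7 * GD X Y)) := by
    refine mul_le_mul_of_nonneg_left ?_ hC70.le
    have := mul_le_mul_of_nonneg_left s3 hC.le
    linarith
  have : C7 * (C * (C7 * GD X Y)) = C7 * (C * C7) * GD X Y := by ring
  linarith
end

end main

/-- Dirichlet-regime comparison: if both `X` and `Y` are at (quantified) depth at
least that of the Neumann-to-Dirichlet transition scale, then `G_D(X,Y) ≤ G_R(X,Y) ≤ C·G_D(X,Y)`,
with `C` depending only on `C₀` and the geometric constants (not on `a`). -/
theorem stmt_2 (n : ℕ) (hn : 3 ≤ n) (M Cσ d cd C₀ : ℝ) (hC₀ : 1 ≤ C₀) :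
    ∃ C : ℝ, 1 < C ∧
      ∀ (Ω : Set (EuclideanSpace ℝ (Fin n))) (σ : MeasureTheory.Measure (EuclideanSpace ℝ (Fin n))),
        IsMixedPair M Cσ d cd Ω σ →
        ∀ a : ℝ, 0 < a →
          Metric.diam Ω ^ ((n : ℝ) - 2) ≤ a * (σ (frontier Ω)).toReal →
          ∀ GR GD : EuclideanSpace ℝ (Fin n) → EuclideanSpace ℝ (Fin n) → ℝ,
            IsRobinGreen Ω σ a GR → IsDirichletGreen Ω GD →
            ∀ X ∈ Ω, ∀ Y ∈ Ω, X ≠ Y →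
              ∀ QX ∈ frontier Ω, ∀ QY ∈ frontier Ω,
                dist QX X = Metric.infDist X (frontier Ω) →
                dist QY Y = Metric.infDist Y (frontier Ω) →
                a⁻¹ ≤ C₀ * Metric.infDist X (frontier Ω) ^ ((2 : ℝ) - n) *
                    (σ (Metric.ball QX (Metric.infDist X (frontier Ω)))).toReal →
                a⁻¹ ≤ C₀ * Metric.infDist Y (frontier Ω) ^ ((2 : ℝ) - n) *
                    (σ (Metric.ball QY (Metric.infDist Y (frontier Ω)))).toReal →
                GD X Y ≤ GR X Y ∧ GR X Y ≤ C * GD X Y := by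
  have h0 : 0 < C₀ := by linarith
  obtain ⟨C, hC, h⟩ := full n hn M Cσ d cd C₀⁻¹ (by positivity)
  refine ⟨C + 1, by linarith, fun Ω σ hP a ha hdi GR GD hR hD X hX Y hY hXY QX hQX QY hQY dX dY sX sY => ?_⟩
  have hcast : ((n - 2 : ℕ) : ℝ) = (n : ℝ) - 2 := by rw [Nat.cast_sub (by omega)]; norm_num
  have hf := fr_ne (by omega) hP.bounded hP.nonempty
  have key : ∀ Z ∈ Ω, ∀ Q ∈ frontier Ω, dist Q Z = infDist Z (frontier Ω) →
      a⁻¹ ≤ C₀ * infDist Z (frontier Ω) ^ ((2 : ℝ) - n) *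
        (σ (ball Q (infDist Z (frontier Ω)))).toReal → Dp Ω σ a C₀⁻¹ Z := by
    intro Z hZ Q hQ dZ sZ
    have hp : 0 < infDist Z (frontier Ω) := dl_pos hP.nta.isOpen hf hZ
    refine ⟨Q, hQ, by rw [dist_comm]; exact dZ, ?_⟩
    rw [show (2 : ℝ) - n = -((n - 2 : ℕ) : ℝ) by rw [hcast]; ring, Real.rpow_neg hp.le,
      Real.rpow_natCast, inv_le_iff_one_le_mul₀ ha] at sZ
    change C₀⁻¹ * infDist Z (frontier Ω) ^ (n - 2) ≤ a * (σ (ball Q (infDist Z (frontier Ω)))).toReal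
    have hq : 0 < infDist Z (frontier Ω) ^ (n - 2) := pow_pos hp _
    rw [inv_mul_le_iff₀ h0]
    calc infDist Z (frontier Ω) ^ (n - 2) = infDist Z (frontier Ω) ^ (n - 2) * 1 := by ring
      _ ≤ infDist Z (frontier Ω) ^ (n - 2) * (C₀ * (infDist Z (frontier Ω) ^ (n - 2))⁻¹ *
          (σ (ball Q (infDist Z (frontier Ω)))).toReal * a) := mul_le_mul_of_nonneg_left sZ hq.le
      _ = _ := by field_simp
  have ho := hP.nta.isOpen
  have hb := hP.bounded
  have hGD : 0 ≤ GD X Y := hD.nonneg Y hY X ⟨subset_closure hX, hXY⟩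
  refine ⟨green_le (by omega) (Pl.robin ho hb hR hY) (Pl.diri ho hb hD hY) (hD.boundary_zero Y hY)
    (subset_closure hX) hXY, ?_⟩
  rw [← hcast, Real.rpow_natCast] at hdi
  have := h Ω σ hP a ha hdi GR GD hR hD X hX Y hY hXY (key X hX QX hQX dX sX) (key Y hY QY hQY dY sY)
  linarith
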